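/- Let Ω ⊆ ℂ^{n+m} be a pseudoconvex domain with fibration p(z,w) = w over D = p(Ω), ψ plurisubharmonic on Ω, and ξ(·) : D → ℓ₁^{(n)} holomorphic with the locally uniformly bounded property. Then log K^{ψ_w}_{ξ(w),Ω_w}(z) is plurisubharmonic in (z,w) on Ω, where Ω_w = p^{-1}(w) ∩ Ω and ψ_w = ψ|_{Ω_w}. -/

import Mathlib

open MeasureTheory Filter Topology Complex
open scoped ENNReal
noncomputable section

/-- The total degree `|α|` of a multi-index. -/
def mdeg {n : ℕ} (α : Fin n → ℕ) : ℕ := ∑ i, α i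

/-- The factorial `α!` of a multi-index. -/
def mfact {n : ℕ} (α : Fin n → ℕ) : ℕ := ∏ i, Nat.factorial (α i)

/-- Partial derivative in the `i`-th coordinate direction. -/
def pderivC {n : ℕ} (i : Fin n) (f : (Fin n → ℂ) → ℂ) : (Fin n → ℂ) → ℂ :=
  fun z => deriv (fun t : ℂ => f (Function.update z i t)) (z i)

/-- Iterated partial derivative `∂^{|α|} f / ∂z^α`. -/
def multiDeriv {n : ℕ} (α : Fin n → ℕ) (f : (Fin n → ℂ) → ℂ) : (Fin n → ℂ) → ℂ :=
  (List.finRange n).foldr (fun i g => (pderivC i)^[α i] g) f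

/-- Membership in `ℓ₁^{(n)}`: `∑_α |ξ_α| ρ^{|α|} < ∞` for every `ρ > 0`. -/
def MemL1 {n : ℕ} (ξ : (Fin n → ℕ) → ℂ) : Prop :=
  ∀ ρ : ℝ, 0 < ρ → Summable fun α : Fin n → ℕ => ‖ξ α‖ * ρ ^ mdeg α

/-- The action `(ξ·f)(z) = ∑_α ξ_α f^{(α)}(z)/α!`. -/
def xiAct {n : ℕ} (ξ : (Fin n → ℕ) → ℂ) (f : (Fin n → ℂ) → ℂ) (z : Fin n → ℂ) : ℂ :=
  ∑' α : Fin n → ℕ, ξ α * multiDeriv α f z / (mfact α : ℂ)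

/-- Plurisubharmonicity of an `EReal`-valued function on a set: upper semicontinuity
together with the sub-mean value inequality on every complex circle whose closed disc
is contained in the set (expressed via integrable real-valued majorants). -/
def PlurisubharmonicOn {E : Type*} [NormedAddCommGroup E] [NormedSpace ℂ E]
    (f : E → EReal) (s : Set E) : Prop :=
  UpperSemicontinuousOn f s ∧
  ∀ z ∈ s, ∀ v : E, (∀ t : ℂ, ‖t‖ ≤ 1 → z + t • v ∈ s) →
    ∀ g : ℝ → ℝ, IntervalIntegrable g volume 0 (2 * Real.pi) →
      (∀ θ : ℝ, f (z + Complex.exp (θ * Complex.I) • v) ≤ (g θ : EReal)) →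
      f z ≤ (((2 * Real.pi)⁻¹ * ∫ θ in (0:ℝ)..(2 * Real.pi), g θ : ℝ) : EReal)

/-- The weighted `L²` integral `∫_D |f|² e^{-ψ}`. -/
def wL2 {n : ℕ} (D : Set (Fin n → ℂ)) (ψ : (Fin n → ℂ) → ℝ) (f : (Fin n → ℂ) → ℂ) : ℝ≥0∞ :=
  ∫⁻ z in D, ENNReal.ofReal (‖f z‖ ^ 2 * Real.exp (-ψ z))

/-- Membership in the weighted Bergman space `A²(D, e^{-ψ})`. -/
def MemA2 {n : ℕ} (D : Set (Fin n → ℂ)) (ψ : (Fin n → ℂ) → ℝ) (f : (Fin n → ℂ) → ℂ) : Prop :=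
  DifferentiableOn ℂ f D ∧ wL2 D ψ f < ⊤

/-- The weighted `ξ`-Bergman kernel `K^ψ_{ξ,D}(z)`. -/
def xiBergman {n : ℕ} (ξ : (Fin n → ℕ) → ℂ) (D : Set (Fin n → ℂ))
    (ψ : (Fin n → ℂ) → ℝ) (z : Fin n → ℂ) : ℝ≥0∞ :=
  ⨆ f : {f // MemA2 D ψ f}, ENNReal.ofReal (‖xiAct ξ f.1 z‖ ^ 2) / wL2 D ψ f.1

/-- The locally uniformly bounded property for a functional-valued function on `D`. -/
def LocUnifBdd {n m : ℕ} (ξ : (Fin m → ℂ) → (Fin n → ℕ) → ℂ) (D : Set (Fin m → ℂ)) : Prop :=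
  ∀ w ∈ D, ∀ ρ : ℝ, 0 < ρ → ∃ V ∈ 𝓝 w, ∃ C : ℝ,
    ∀ w' ∈ V ∩ D, (∑' α : Fin n → ℕ, ENNReal.ofReal (‖ξ w' α‖ * ρ ^ mdeg α)) ≤ ENNReal.ofReal C

/-- Pseudoconvexity of an open set: existence of a continuous plurisubharmonic
exhaustion function. -/
def Pseudoconvex {E : Type*} [NormedAddCommGroup E] [NormedSpace ℂ E] (Ω : Set E) : Prop :=
  IsOpen Ω ∧ ∃ u : E → ℝ, ContinuousOn u Ω ∧
    PlurisubharmonicOn (fun x => (u x : EReal)) Ω ∧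
    ∀ c : ℝ, ∃ K : Set E, IsCompact K ∧ K ⊆ Ω ∧ {x ∈ Ω | u x ≤ c} ⊆ K

/-- The fiberwise `ξ(w)`-Bergman kernel `K^{ψ_w}_{ξ(w),Ω_w}(z)` of the fibration
`p(z,w) = w` of `Ω`. -/
def fiberKernel {n m : ℕ} (ξ : (Fin m → ℂ) → (Fin n → ℕ) → ℂ)
    (Ω : Set ((Fin n → ℂ) × (Fin m → ℂ))) (ψ : (Fin n → ℂ) × (Fin m → ℂ) → ℝ)
    (p : (Fin n → ℂ) × (Fin m → ℂ)) : ℝ≥0∞ :=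
  xiBergman (ξ p.2) {z | (z, p.2) ∈ Ω} (fun z => ψ (z, p.2)) p.1

section Background
open scoped ComplexConjugate
open Function (update uncurry iterate_succ_apply' update_of_ne update_self update_eq_self)
open Real (circleAverage two_pi_pos sq_sqrt exp_le_exp exp_pos exp_nonneg log_pow exp_log norm_eq_abs norm_of_nonneg)
open Real renaming log → rlog
open Finset (sum_insert induction_on sum_eq_single mem_insert_of_mem sum_mul_sum mem_univ mem_insert_self
  single_le_sum sum_le_card_nsmul)
open Set (indicator union_subset mem_image_of_mem Icc indicator_nonneg)
open ENNReal (ofReal_toReal ofReal_le_ofReal_iff ofReal_sum_of_nonneg)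
open ENNReal renaming ofReal_mul → eofReal_mul, ofReal_pow → eofReal_pow, ofReal_add → eofReal_add
open intervalIntegral (integral_of_le)

local notation:max "ℂ^" n:max => Fin n → ℂ
local notation:max "ℂ∘" Φ:max => fun y => (Φ y : ℂ)
local notation:max "wL2₀" D:max ψ:max => wL2 (Set.ofPred fun z => (z, (0 : ℂ)) ∈ D) (fun z => ψ (z, 0))
open Metric
open scoped Real
open Finset (sum_congr mul_sum sum_mul sum_neg_distrib sum_le_sum sum_add_distrib sum_nonneg sum_sub_distrib)
open Set (indicator_of_mem indicator_of_notMem Ioc inter_subset_left)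
open ENNReal (ofReal_le_ofReal ofReal_ne_top mul_ne_top)
open ENNReal renaming ofReal → eofReal
variable {W : Type*} [NormedAddCommGroup W] [NormedSpace ℂ W]

instance [FiniteDimensional ℂ W] : ProperSpace W := FiniteDimensional.proper ℂ W

/-- The Wirtinger derivative `∂_v f`. -/
def dz (v : W) (f : W → ℂ) (x : W) : ℂ :=
  (1 / 2) * (fderiv ℝ f x v - I * fderiv ℝ f x (I • v))

/-- The conjugate Wirtinger derivative `∂̄_v f`. -/
def dbar (v : W) (f : W → ℂ) (x : W) : ℂ :=
  (1 / 2) * (fderiv ℝ f x v + I * fderiv ℝ f x (I • v))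

/-- The Levi form of a real function at `x` in the direction `v`. -/
def levi (Φ : W → ℝ) (x v : W) : ℝ :=
  (1 / 4) * (fderiv ℝ (fderiv ℝ Φ) x v v + fderiv ℝ (fderiv ℝ Φ) x (I • v) (I • v))

lemma dz_add {v : W} {f g : W → ℂ} {x : W} (hf : DifferentiableAt ℝ f x)
    (hg : DifferentiableAt ℝ g x) : dz v (fun y => f y + g y) x = dz v f x + dz v g x := by
  simp only [dz, fderiv_fun_add hf hg, _root_.add_apply]; ring

lemma dbar_sub {v : W} {f g : W → ℂ} {x : W} (hf : DifferentiableAt ℝ f x)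
    (hg : DifferentiableAt ℝ g x) : dbar v (fun y => f y - g y) x = dbar v f x - dbar v g x := by
  simp only [dbar, fderiv_fun_sub hf hg, _root_.sub_apply]; ring

lemma dz_mul {v : W} {f g : W → ℂ} {x : W} (hf : DifferentiableAt ℝ f x)
    (hg : DifferentiableAt ℝ g x) :
    dz v (fun y => f y * g y) x = f x * dz v g x + g x * dz v f x := by
  simp only [dz, fderiv_fun_mul hf hg, _root_.add_apply,
    _root_.smul_apply, smul_eq_mul]; ring

lemma dbar_mul {v : W} {f g : W → ℂ} {x : W} (hf : DifferentiableAt ℝ f x)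
    (hg : DifferentiableAt ℝ g x) :
    dbar v (fun y => f y * g y) x = f x * dbar v g x + g x * dbar v f x := by
  simp only [dbar, fderiv_fun_mul hf hg, _root_.add_apply,
    _root_.smul_apply, smul_eq_mul]; ring

lemma fderiv_conj (f : W → ℂ) (x v : W) :
    fderiv ℝ (fun y => conj (f y)) x v = conj (fderiv ℝ f x v) := by
  have : (fun y => conj (f y)) = conjCLE ∘ f := by ext; simp
  rw [this, ContinuousLinearEquiv.comp_fderiv]; simp

lemma dbar_conj (v : W) (f : W → ℂ) (x : W) :
    dbar v (fun y => conj (f y)) x = conj (dz v f x) := by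
  simp only [dbar, dz, fderiv_conj, map_mul, map_sub, conj_I, map_div₀, map_one,
    conj_ofNat]
  ring

lemma dz_conj (v : W) (f : W → ℂ) (x : W) :
    dz v (fun y => conj (f y)) x = conj (dbar v f x) := by
  simp only [dbar, dz, fderiv_conj, map_mul, map_add, conj_I, map_div₀, map_one,
    conj_ofNat]
  ring

lemma fderiv_ofReal {Φ : W → ℝ} {x : W} (h : DifferentiableAt ℝ Φ x) (v : W) :
    fderiv ℝ ℂ∘Φ x v = (fderiv ℝ Φ x v : ℂ) := by
  have := (ofRealCLM.hasFDerivAt (x := Φ x)).comp x h.hasFDerivAt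
  have h2 : HasFDerivAt ℂ∘Φ (ofRealCLM.comp (fderiv ℝ Φ x)) x := this
  rw [h2.fderiv]; simp

lemma conj_dz_ofReal (Φ : W → ℝ) (v x : W) :
    conj (dz v ℂ∘Φ x) = dbar v ℂ∘Φ x := by
  rw [← dbar_conj]; simp

lemma dz_exp_neg {Φ : W → ℝ} {x : W} (h : DifferentiableAt ℝ Φ x) (v : W) :
    dz v (fun y => ((rexp (-Φ y) : ℝ) : ℂ)) x
      = - (rexp (-Φ x) : ℝ) * dz v ℂ∘Φ x := by
  have h' : DifferentiableAt ℝ (fun y => rexp (-Φ y)) x := h.fun_neg.exp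
  simp only [dz]
  rw [fderiv_ofReal h, fderiv_ofReal h, fderiv_ofReal h', fderiv_ofReal h',
    fderiv_exp h.fun_neg, fderiv_fun_neg]
  simp only [_root_.smul_apply, _root_.neg_apply, smul_eq_mul]
  push_cast
  ring

lemma dbar_exp_neg {Φ : W → ℝ} {x : W} (h : DifferentiableAt ℝ Φ x) (v : W) :
    dbar v (fun y => ((rexp (-Φ y) : ℝ) : ℂ)) x
      = - (rexp (-Φ x) : ℝ) * dbar v ℂ∘Φ x := by
  have := congrArg conj (dz_exp_neg h v)
  rw [conj_dz_ofReal, map_mul, conj_dz_ofReal, map_neg, conj_ofReal] at this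
  exact this

lemma contDiffOn_dz {n : ℕ} {f : W → ℂ} {U : Set W} (hU : IsOpen U)
    (hf : ContDiffOn ℝ (n + 1 : ℕ) f U) (v : W) : ContDiffOn ℝ n (dz v f) U := by
  have h : ContDiffOn ℝ n (fderiv ℝ f) U :=
    hf.fderiv_of_isOpen hU (by norm_cast)
  unfold dz
  exact contDiffOn_const.mul ((h.clm_apply contDiffOn_const).sub
    (contDiffOn_const.mul (h.clm_apply contDiffOn_const)))

lemma contDiffOn_dbar {n : ℕ} {f : W → ℂ} {U : Set W} (hU : IsOpen U)
    (hf : ContDiffOn ℝ (n + 1 : ℕ) f U) (v : W) : ContDiffOn ℝ n (dbar v f) U := by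
  have h : ContDiffOn ℝ n (fderiv ℝ f) U :=
    hf.fderiv_of_isOpen hU (by norm_cast)
  unfold dbar
  exact contDiffOn_const.mul ((h.clm_apply contDiffOn_const).add
    (contDiffOn_const.mul (h.clm_apply contDiffOn_const)))

lemma contDiff_dz {n : ℕ} {f : W → ℂ} (hf : ContDiff ℝ (n + 1 : ℕ) f) (v : W) :
    ContDiff ℝ n (dz v f) :=
  contDiffOn_univ.1 (contDiffOn_dz isOpen_univ (contDiffOn_univ.2 hf) v)

lemma contDiff_dbar {n : ℕ} {f : W → ℂ} (hf : ContDiff ℝ (n + 1 : ℕ) f) (v : W) :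
    ContDiff ℝ n (dbar v f) :=
  contDiffOn_univ.1 (contDiffOn_dbar isOpen_univ (contDiffOn_univ.2 hf) v)

lemma tsupport_dz_subset (v : W) (f : W → ℂ) : tsupport (dz v f) ⊆ tsupport f := by
  refine closure_minimal (fun x hx => ?_) (isClosed_tsupport f)
  by_contra h
  have h0 : fderiv ℝ f x = 0 := by
    by_contra h1
    exact h (support_fderiv_subset ℝ h1)
  exact hx (by simp [dz, h0])

lemma tsupport_dbar_subset (v : W) (f : W → ℂ) : tsupport (dbar v f) ⊆ tsupport f := by
  refine closure_minimal (fun x hx => ?_) (isClosed_tsupport f)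
  by_contra h
  have h0 : fderiv ℝ f x = 0 := by
    by_contra h1
    exact h (support_fderiv_subset ℝ h1)
  exact hx (by simp [dbar, h0])

lemma hasCompactSupport_dz {f : W → ℂ} (h : HasCompactSupport f) (v : W) :
    HasCompactSupport (dz v f) := h.mono' ((subset_tsupport _).trans (tsupport_dz_subset v f))

lemma hasCompactSupport_dbar {f : W → ℂ} (h : HasCompactSupport f) (v : W) :
    HasCompactSupport (dbar v f) := h.mono' ((subset_tsupport _).trans (tsupport_dbar_subset v f))

lemma fderiv_dz {f : W → ℂ} {x : W} (hf : ContDiffAt ℝ 2 f x) (v u : W) :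
    fderiv ℝ (dz v f) x u
      = (1 / 2) * (fderiv ℝ (fderiv ℝ f) x u v - I * fderiv ℝ (fderiv ℝ f) x u (I • v)) := by
  have hd : DifferentiableAt ℝ (fderiv ℝ f) x :=
    (hf.fderiv_right (m := 1) (by norm_num)).differentiableAt (by norm_num)
  have h1 := fun w : W => (hd.hasFDerivAt.clm_apply (hasFDerivAt_const w x))
  have h2 := ((h1 v).sub ((h1 (I • v)).const_mul I)).const_mul (1 / 2 : ℂ)
  have h3 : HasFDerivAt (dz v f) _ x := h2
  rw [h3.fderiv]
  simp

lemma fderiv_dbar {f : W → ℂ} {x : W} (hf : ContDiffAt ℝ 2 f x) (v u : W) :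
    fderiv ℝ (dbar v f) x u
      = (1 / 2) * (fderiv ℝ (fderiv ℝ f) x u v + I * fderiv ℝ (fderiv ℝ f) x u (I • v)) := by
  have hd : DifferentiableAt ℝ (fderiv ℝ f) x :=
    (hf.fderiv_right (m := 1) (by norm_num)).differentiableAt (by norm_num)
  have h1 := fun w : W => (hd.hasFDerivAt.clm_apply (hasFDerivAt_const w x))
  have h2 := ((h1 v).add ((h1 (I • v)).const_mul I)).const_mul (1 / 2 : ℂ)
  have h3 : HasFDerivAt (dbar v f) _ x := h2
  rw [h3.fderiv]
  simp
  ring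

lemma dbar_dz_comm {f : W → ℂ} {x : W} (hf : ContDiffAt ℝ 2 f x) (u v : W) :
    dbar u (dz v f) x = dz v (dbar u f) x := by
  have hs : IsSymmSndFDerivAt ℝ f x := hf.isSymmSndFDerivAt (by simp)
  simp only [dbar.eq_1 u (dz v f), dz.eq_1 v (dbar u f), fderiv_dz hf, fderiv_dbar hf]
  rw [hs.eq v u, hs.eq v (I • u), hs.eq (I • v) u, hs.eq (I • v) (I • u)]
  ring

lemma dbar_dbar_comm {f : W → ℂ} {x : W} (hf : ContDiffAt ℝ 2 f x) (u v : W) :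
    dbar u (dbar v f) x = dbar v (dbar u f) x := by
  have hs : IsSymmSndFDerivAt ℝ f x := hf.isSymmSndFDerivAt (by simp)
  simp only [dbar.eq_1 u (dbar v f), dbar.eq_1 v (dbar u f), fderiv_dbar hf]
  rw [hs.eq v u, hs.eq v (I • u), hs.eq (I • v) u, hs.eq (I • v) (I • u)]
  ring

lemma fderiv_fderiv_ofReal {Φ : W → ℝ} {x : W} (h : ContDiffAt ℝ 2 Φ x) (u v : W) :
    fderiv ℝ (fderiv ℝ ℂ∘Φ) x u v = (fderiv ℝ (fderiv ℝ Φ) x u v : ℂ) := by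
  have hd : DifferentiableAt ℝ (fderiv ℝ Φ) x :=
    (h.fderiv_right (m := 1) (by norm_num)).differentiableAt (by norm_num)
  have hc : ContDiffAt ℝ 2 ℂ∘Φ x :=
    ofRealCLM.contDiff.contDiffAt.comp x h
  have hdc : DifferentiableAt ℝ (fderiv ℝ ℂ∘Φ) x :=
    (hc.fderiv_right (m := 1) (by norm_num)).differentiableAt (by norm_num)
  have h1 := (hdc.hasFDerivAt.clm_apply (hasFDerivAt_const v x)).fderiv
  have h2 := (hd.hasFDerivAt.clm_apply (hasFDerivAt_const v x))
  have h4 := fderiv_ofReal h2.differentiableAt u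
  have h5 : (fun y => fderiv ℝ ℂ∘Φ y v)
      =ᶠ[𝓝 x] (fun y => ((fderiv ℝ Φ y v : ℝ) : ℂ)) := by
    have hev : ∀ᶠ y in 𝓝 x, ContDiffAt ℝ 2 Φ y := h.eventually (by simp)
    filter_upwards [hev] with y hy
    exact fderiv_ofReal (hy.differentiableAt (by norm_num)) v
  rw [← h5.fderiv_eq, h1, h2.fderiv] at h4
  simpa using h4

/-- The sesquilinear form attached to a real bilinear form. -/
def sesq (Q : W →L[ℝ] W →L[ℝ] ℝ) (u v : W) : ℂ :=
  (1 / 4) * ((Q v u : ℂ) + Q (I • v) (I • u) + I * (Q (I • v) u - Q v (I • u)))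

lemma sesq_smul_left (Q : W →L[ℝ] W →L[ℝ] ℝ) (c : ℂ) (u v : W) :
    sesq Q (c • u) v = c * sesq Q u v := by
  have h1 : c • u = c.re • u + c.im • (I • u) := by
    conv_lhs => rw [← re_add_im c, add_smul, mul_smul]
    simp
  have h2 : I • (c • u) = c.re • (I • u) - c.im • u := by
    rw [h1, smul_add, smul_comm I c.re, smul_comm I c.im, smul_smul I I, I_mul_I]
    simp [sub_eq_add_neg]
  unfold sesq
  rw [h2, h1]
  simp only [map_add, map_sub, map_smul, smul_eq_mul]
  conv_rhs => rw [← re_add_im c]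
  push_cast
  linear_combination (c.im * (1 / 4) * (Q v (I • u) - Q (I • v) u) : ℂ) * I_sq

lemma sesq_smul_right (Q : W →L[ℝ] W →L[ℝ] ℝ) (c : ℂ) (u v : W) :
    sesq Q u (c • v) = conj c * sesq Q u v := by
  have h1 : c • v = c.re • v + c.im • (I • v) := by
    conv_lhs => rw [← re_add_im c, add_smul, mul_smul]
    simp
  have h2 : I • (c • v) = c.re • (I • v) - c.im • v := by
    rw [h1, smul_add, smul_comm I c.re, smul_comm I c.im, smul_smul I I, I_mul_I]
    simp [sub_eq_add_neg]
  have h3 : conj c = c.re - c.im * I := by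
    apply ext <;> simp
  unfold sesq
  rw [h2, h1, h3]
  simp only [map_add, map_sub, map_smul, smul_eq_mul, _root_.add_apply,
    _root_.sub_apply, _root_.smul_apply]
  push_cast
  linear_combination (c.im * (1 / 4) * (Q (I • v) u - Q v (I • u)) : ℂ) * I_sq

lemma sesq_add_left (Q : W →L[ℝ] W →L[ℝ] ℝ) (u u' v : W) :
    sesq Q (u + u') v = sesq Q u v + sesq Q u' v := by
  simp only [sesq, smul_add, map_add]; push_cast; ring

lemma sesq_add_right (Q : W →L[ℝ] W →L[ℝ] ℝ) (u v v' : W) :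
    sesq Q u (v + v') = sesq Q u v + sesq Q u v' := by
  simp only [sesq, smul_add, map_add, _root_.add_apply]; push_cast; ring

lemma sesq_sum {κ : Type*} (s : Finset κ) (Q : W →L[ℝ] W →L[ℝ] ℝ) (e : κ → W) (b : κ → ℂ) :
    sesq Q (∑ j ∈ s, b j • e j) (∑ k ∈ s, b k • e k)
      = ∑ j ∈ s, ∑ k ∈ s, b j * conj (b k) * sesq Q (e j) (e k) := by
  classical
  have hl : ∀ v, sesq Q (∑ j ∈ s, b j • e j) v = ∑ j ∈ s, b j * sesq Q (e j) v := by
    intro v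
    induction s using induction_on with
    | empty => simp [sesq]
    | insert a s ha ih => rw [sum_insert ha, sum_insert ha, sesq_add_left, ih,
        sesq_smul_left]
  have hr : ∀ u, sesq Q u (∑ j ∈ s, b j • e j)
      = ∑ j ∈ s, conj (b j) * sesq Q u (e j) := by
    intro u
    clear hl
    induction s using induction_on with
    | empty => simp [sesq]
    | insert a s ha ih => rw [sum_insert ha, sum_insert ha, sesq_add_right, ih,
        sesq_smul_right]
  rw [hl]
  refine sum_congr rfl fun j _ => ?_
  rw [hr, mul_sum]
  exact sum_congr rfl fun k _ => by ring

lemma dbar_dz_ofReal {Φ : W → ℝ} {x : W} (h : ContDiffAt ℝ 2 Φ x) (u v : W) :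
    dbar v (dz u ℂ∘Φ) x = sesq (fderiv ℝ (fderiv ℝ Φ) x) u v := by
  have hc : ContDiffAt ℝ 2 ℂ∘Φ x :=
    ofRealCLM.contDiff.contDiffAt.comp x h
  rw [dbar.eq_1, fderiv_dz hc, fderiv_dz hc]
  simp only [fderiv_fderiv_ofReal h, sesq]
  linear_combination (-(1 / 4) * fderiv ℝ (fderiv ℝ Φ) x (I • v) (I • u) : ℂ) * I_sq

lemma sum_dbar_dz_eq_levi {κ : Type*} [Fintype κ] {Φ : W → ℝ} {x : W} (h : ContDiffAt ℝ 2 Φ x)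
    (e : κ → W) (b : κ → ℂ) :
    ∑ j, ∑ k, b j * conj (b k) * dbar (e k) (dz (e j) ℂ∘Φ) x
      = (levi Φ x (∑ j, b j • e j) : ℂ) := by
  have hs : IsSymmSndFDerivAt ℝ Φ x := h.isSymmSndFDerivAt (by simp)
  simp only [dbar_dz_ofReal h]
  rw [← sesq_sum, sesq, levi, hs.eq (I • _) (∑ j, b j • e j)]
  push_cast
  ring

section HaarMeasure
variable [FiniteDimensional ℂ W] [MeasurableSpace W] [BorelSpace W] {μ : Measure W} [μ.IsAddHaarMeasure]

lemma integral_fderiv_eq_zero_of_compact {f : W → ℂ} (hf : ContDiff ℝ 1 f)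
    (hc : HasCompactSupport f) (v : W) : ∫ x, fderiv ℝ f x v ∂μ = 0 := by
  have hd : Differentiable ℝ f := hf.differentiable (by norm_num)
  have hcont : Continuous fun x => fderiv ℝ f x v :=
    (hf.continuous_fderiv (by norm_num)).clm_apply continuous_const
  have hsupp : HasCompactSupport fun x => fderiv ℝ f x v := hc.fderiv_apply (𝕜 := ℝ) v
  have h := integral_bilinear_fderiv_right_eq_neg_left_of_integrable (μ := μ)
    (B := ContinuousLinearMap.mul ℝ ℂ) (f := fun _ : W => (1 : ℂ)) (g := f) (v := v) (by simp)
    (by simpa using hcont.integrable_of_hasCompactSupport hsupp)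
    (by simpa using hf.continuous.integrable_of_hasCompactSupport hc)
    (by fun_prop) (fun x _ => hd x)
  simpa using h

lemma integral_dbar_eq_zero {f : W → ℂ} (hf : ContDiff ℝ 1 f)
    (hc : HasCompactSupport f) (v : W) : ∫ x, dbar v f x ∂μ = 0 := by
  have hi : ∀ u, Integrable (fun x => fderiv ℝ f x u) μ := fun u =>
    ((hf.continuous_fderiv (by norm_num)).clm_apply
      continuous_const).integrable_of_hasCompactSupport (hc.fderiv_apply (𝕜 := ℝ) u)
  simp only [dbar]
  rw [integral_const_mul, integral_add (hi v) ((hi _).const_mul I), integral_const_mul,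
    integral_fderiv_eq_zero_of_compact hf hc, integral_fderiv_eq_zero_of_compact hf hc]
  simp

/-- The formal weighted adjoint `δ_v b = ∂_v b - (∂_v Φ) b` of `-∂̄_v`. -/
def wdelta (Φ : W → ℝ) (v : W) (b : W → ℂ) (x : W) : ℂ :=
  dz v b x - dz v ℂ∘Φ x * b x

lemma contDiff_one_dz {f : W → ℂ} (hf : ContDiff ℝ 2 f) (v : W) : ContDiff ℝ 1 (dz v f) :=
  contDiff_dz (n := 1) (by exact_mod_cast hf) v

lemma contDiff_one_dbar {f : W → ℂ} (hf : ContDiff ℝ 2 f) (v : W) : ContDiff ℝ 1 (dbar v f) :=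
  contDiff_dbar (n := 1) (by exact_mod_cast hf) v

lemma continuous_dz {f : W → ℂ} (hf : ContDiff ℝ 1 f) (v : W) : Continuous (dz v f) :=
  (contDiff_dz (n := 0) (by exact_mod_cast hf) v).continuous

lemma continuous_dbar {f : W → ℂ} (hf : ContDiff ℝ 1 f) (v : W) : Continuous (dbar v f) :=
  (contDiff_dbar (n := 0) (by exact_mod_cast hf) v).continuous

lemma contDiff_ofReal {n : WithTop ℕ∞} {Φ : W → ℝ} (h : ContDiff ℝ n Φ) :
    ContDiff ℝ n ℂ∘Φ := ofRealCLM.contDiff.comp h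

lemma contDiff_conj {n : WithTop ℕ∞} {f : W → ℂ} (h : ContDiff ℝ n f) :
    ContDiff ℝ n (fun y => conj (f y)) := conjCLE.contDiff.comp h

lemma integral_mul_conj_wdelta {Φ : W → ℝ} {a b : W → ℂ} (hΦ : ContDiff ℝ 1 Φ)
    (ha : ContDiff ℝ 1 a) (hb : ContDiff ℝ 1 b) (hc : HasCompactSupport b) (v : W) :
    ∫ x, a x * conj (wdelta Φ v b x) * (rexp (-Φ x) : ℝ) ∂μ
      = -∫ x, dbar v a x * conj (b x) * (rexp (-Φ x) : ℝ) ∂μ := by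
  have hE : ContDiff ℝ 1 (fun y => ((rexp (-Φ y) : ℝ) : ℂ)) := contDiff_ofReal hΦ.neg.exp
  have hbc := contDiff_conj hb
  have hcc : HasCompactSupport fun y => conj (b y) :=
    hc.comp_left (g := starRingEnd ℂ) (map_zero _)
  have h1 : (1 : WithTop ℕ∞) ≠ 0 := by norm_num
  have h0 := integral_dbar_eq_zero (μ := μ) ((ha.mul hbc).mul hE)
    ((hcc.mul_left (f := a)).mul_right) v
  have key : ∀ x, dbar v (fun y => a y * conj (b y) * ((rexp (-Φ y) : ℝ) : ℂ)) x
      = a x * conj (wdelta Φ v b x) * (rexp (-Φ x) : ℝ)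
        + dbar v a x * conj (b x) * (rexp (-Φ x) : ℝ) := by
    intro x
    rw [dbar_mul ((ha.mul hbc).differentiable h1 x) (hE.differentiable h1 x),
      dbar_mul (ha.differentiable h1 x) (hbc.differentiable h1 x), dbar_conj,
      dbar_exp_neg (hΦ.differentiable h1 x), wdelta, map_sub, map_mul, conj_dz_ofReal]
    ring
  simp only [key] at h0
  rw [integral_add] at h0
  · linear_combination h0
  · refine Continuous.integrable_of_hasCompactSupport ?_ ?_
    · exact (ha.continuous.mul (continuous_conj.comp ((continuous_dz hb v).sub
        ((continuous_dz (contDiff_ofReal hΦ) v).mul hb.continuous)))).mul hE.continuous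
    · refine HasCompactSupport.mul_right (HasCompactSupport.mul_left ?_)
      exact HasCompactSupport.comp_left (g := starRingEnd ℂ) ((hasCompactSupport_dz hc v).sub
        (hc.mul_left)) (map_zero _)
  · exact (((continuous_dbar ha v).mul hbc.continuous).mul
      hE.continuous).integrable_of_hasCompactSupport ((hcc.mul_left).mul_right)

lemma contDiff_wdelta {Φ : W → ℝ} {b : W → ℂ} (hΦ : ContDiff ℝ 2 Φ)
    (hb : ContDiff ℝ 2 b) (v : W) : ContDiff ℝ 1 (wdelta Φ v b) :=
  (contDiff_one_dz hb v).sub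
    ((contDiff_one_dz (contDiff_ofReal hΦ) v).mul (hb.of_le (by norm_num)))

lemma continuous_wdelta {Φ : W → ℝ} {b : W → ℂ} (hΦ : ContDiff ℝ 1 Φ)
    (hb : ContDiff ℝ 1 b) (v : W) : Continuous (wdelta Φ v b) :=
  (continuous_dz hb v).sub ((continuous_dz (contDiff_ofReal hΦ) v).mul hb.continuous)

lemma hasCompactSupport_wdelta (Φ : W → ℝ) {b : W → ℂ} (hc : HasCompactSupport b) (v : W) :
    HasCompactSupport (wdelta Φ v b) := (hasCompactSupport_dz hc v).sub hc.mul_left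

lemma dbar_wdelta {Φ : W → ℝ} {b : W → ℂ} (hΦ : ContDiff ℝ 2 Φ)
    (hb : ContDiff ℝ 2 b) (u v x : W) :
    dbar u (wdelta Φ v b) x
      = wdelta Φ v (dbar u b) x - dbar u (dz v ℂ∘Φ) x * b x := by
  have h1 : (1 : WithTop ℕ∞) ≠ 0 := by norm_num
  have h2 : (2 : WithTop ℕ∞) ≠ 0 := by norm_num
  have hd := (contDiff_one_dz (contDiff_ofReal hΦ) v).differentiable h1 x
  have : wdelta Φ v b = fun y => dz v b y - dz v ℂ∘Φ y * b y := rfl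
  rw [this, dbar_sub ((contDiff_one_dz hb v).differentiable h1 x)
    (hd.fun_mul (hb.differentiable h2 x)), dbar_mul hd (hb.differentiable h2 x),
    dbar_dz_comm hb.contDiffAt, wdelta]
  ring

/-- The Morrey–Kohn–Hörmander inequality on the whole space. -/
lemma morrey_kohn_hormander {κ : Type*} [Fintype κ] (e : κ → W) {Φ : W → ℝ} {c : W → ℝ}
    {β : κ → W → ℂ} (hΦ : ContDiff ℝ 2 Φ) (hβ : ∀ j, ContDiff ℝ 2 (β j))
    (hβc : ∀ j, HasCompactSupport (β j)) (hc : ∀ x, 0 ≤ c x)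
    (hlevi : ∀ x, c x * ∑ j, ‖β j x‖ ^ 2 ≤ levi Φ x (∑ j, β j x • e j)) :
    ∫ x, c x * (∑ j, ‖β j x‖ ^ 2) * rexp (-Φ x) ∂μ
      ≤ ∫ x, ‖∑ j, wdelta Φ (e j) (β j) x‖ ^ 2 * rexp (-Φ x) ∂μ
        + ∫ x, (1 / 2) * (∑ j, ∑ k, ‖dbar (e j) (β k) x - dbar (e k) (β j) x‖ ^ 2)
          * rexp (-Φ x) ∂μ := by
  set E : W → ℝ := fun x => rexp (-Φ x) with hEdef
  have hEc : Continuous E := Real.continuous_exp.comp hΦ.continuous.neg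
  have hEcc : Continuous fun x => (E x : ℂ) := continuous_ofReal.comp hEc
  have hβ1 : ∀ j, ContDiff ℝ 1 (β j) := fun j => (hβ j).of_le (by norm_num)
  have hΦ1 : ContDiff ℝ 1 Φ := hΦ.of_le (by norm_num)
  have hP : ∀ j, ContDiff ℝ 1 (wdelta Φ (e j) (β j)) := fun j => contDiff_wdelta hΦ (hβ j) _
  have hcj : ∀ {f : W → ℂ}, HasCompactSupport f →
      HasCompactSupport fun y => conj (f y) := fun hc =>
    hc.comp_left (g := starRingEnd ℂ) (map_zero _)
  -- integrable pieces
  have hint1 : ∀ j k, Integrable (fun x => wdelta Φ (e j) (β j) x *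
      conj (wdelta Φ (e k) (β k) x) * (E x : ℂ)) μ := fun j k =>
    (((hP j).continuous.mul (continuous_conj.comp (hP k).continuous)).mul
      hEcc).integrable_of_hasCompactSupport
      (((hcj (hasCompactSupport_wdelta Φ (hβc k) _)).mul_left).mul_right)
  have hint2 : ∀ j k, Integrable (fun x => dbar (e k) (dz (e j) ℂ∘Φ) x * β j x *
      conj (β k x) * (E x : ℂ)) μ := fun j k =>
    ((((continuous_dbar (contDiff_one_dz (contDiff_ofReal hΦ) _) _).mul (hβ j).continuous).mul
      (continuous_conj.comp (hβ k).continuous)).mul hEcc).integrable_of_hasCompactSupport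
      (((hcj (hβc k)).mul_left).mul_right)
  have hint3 : ∀ j k, Integrable (fun x => dbar (e k) (β j) x *
      conj (dbar (e j) (β k) x) * (E x : ℂ)) μ := fun j k =>
    (((continuous_dbar (hβ1 j) _).mul (continuous_conj.comp (continuous_dbar (hβ1 k) _))).mul
      hEcc).integrable_of_hasCompactSupport
      (((hcj (hasCompactSupport_dbar (hβc k) _)).mul_left).mul_right)
  have hint4 : ∀ j k, Integrable (fun x => wdelta Φ (e j) (dbar (e k) (β j)) x *
      conj (β k x) * (E x : ℂ)) μ := fun j k =>
    (((continuous_wdelta hΦ1 (contDiff_one_dbar (hβ j) _) _).mul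
      (continuous_conj.comp (hβ k).continuous)).mul hEcc).integrable_of_hasCompactSupport
      (((hcj (hβc k)).mul_left).mul_right)
  -- the identity for each pair of indices
  have hpair : ∀ j k, ∫ x, wdelta Φ (e j) (β j) x *
      conj (wdelta Φ (e k) (β k) x) * (E x : ℂ) ∂μ
      = ∫ x, (dbar (e k) (dz (e j) ℂ∘Φ) x * β j x *
          conj (β k x) * (E x : ℂ)
        + dbar (e k) (β j) x * conj (dbar (e j) (β k) x) * (E x : ℂ)) ∂μ := by
    intro j k
    rw [integral_mul_conj_wdelta hΦ1 (hP j) (hβ1 k) (hβc k) (e k)]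
    have hsecond : ∫ x, wdelta Φ (e j) (dbar (e k) (β j)) x *
        conj (β k x) * (E x : ℂ) ∂μ
        = -∫ x, dbar (e k) (β j) x * conj (dbar (e j) (β k) x) * (E x : ℂ) ∂μ := by
      have := congrArg conj (integral_mul_conj_wdelta (μ := μ) hΦ1 (hβ1 k)
        (contDiff_one_dbar (hβ j) (e k)) (hasCompactSupport_dbar (hβc j) _) (e j))
      rw [map_neg, ← integral_conj, ← integral_conj] at this
      simp only [map_mul, conj_conj, conj_ofReal] at this
      refine Eq.trans (integral_congr_ae (.of_forall fun x => ?_))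
        (this.trans (congrArg _ (integral_congr_ae (.of_forall fun x => ?_))))
      · simp only [hEdef]; ring
      · simp only [hEdef]; ring
    have : ∀ x, dbar (e k) (wdelta Φ (e j) (β j)) x * conj (β k x) * (E x : ℂ)
        = wdelta Φ (e j) (dbar (e k) (β j)) x * conj (β k x) * (E x : ℂ)
        - dbar (e k) (dz (e j) ℂ∘Φ) x * β j x *
          conj (β k x) * (E x : ℂ) := by
      intro x; rw [dbar_wdelta hΦ (hβ j)]; ring
    rw [integral_congr_ae (.of_forall this), integral_sub (hint4 j k) (hint2 j k),
      integral_add (hint2 j k) (hint3 j k), hsecond]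
    ring
  have hsum : ∫ x, (∑ j, ∑ k, wdelta Φ (e j) (β j) x *
      conj (wdelta Φ (e k) (β k) x) * (E x : ℂ)) ∂μ
      = ∫ x, (∑ j, ∑ k, (dbar (e k) (dz (e j) ℂ∘Φ) x * β j x *
          conj (β k x) * (E x : ℂ)
        + dbar (e k) (β j) x * conj (dbar (e j) (β k) x) * (E x : ℂ))) ∂μ := by
    have hint5 := fun j k => (hint2 j k).fun_add (hint3 j k)
    rw [integral_finsetSum _ fun j _ => integrable_finsetSum _ fun k _ => hint1 j k,
      integral_finsetSum _ fun j _ => integrable_finsetSum _ fun k _ => hint5 j k]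
    refine sum_congr rfl fun j _ => ?_
    rw [integral_finsetSum _ fun k _ => hint1 j k, integral_finsetSum _ fun k _ => hint5 j k]
    exact sum_congr rfl fun k _ => hpair j k
  have hR : Integrable (fun x => ∑ j, ∑ k, (dbar (e k) (dz (e j) ℂ∘Φ) x * β j x *
          conj (β k x) * (E x : ℂ)
        + dbar (e k) (β j) x * conj (dbar (e j) (β k) x) * (E x : ℂ))) μ :=
    integrable_finsetSum _ fun j _ => integrable_finsetSum _ fun k _ =>
      (hint2 j k).add (hint3 j k)
  have hleft : ∫ x, ‖∑ j, wdelta Φ (e j) (β j) x‖ ^ 2 * E x ∂μ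
      = (∫ x, (∑ j, ∑ k, (dbar (e k) (dz (e j) ℂ∘Φ) x * β j x *
          conj (β k x) * (E x : ℂ)
        + dbar (e k) (β j) x * conj (dbar (e j) (β k) x) * (E x : ℂ))).re ∂μ) := by
    refine Eq.trans ?_ (integral_re (𝕜 := ℂ) hR).symm
    rw [← hsum]
    have : ∀ x, (∑ j, ∑ k, wdelta Φ (e j) (β j) x *
      conj (wdelta Φ (e k) (β k) x) * (E x : ℂ))
      = ((‖∑ j, wdelta Φ (e j) (β j) x‖ ^ 2 * E x : ℝ) : ℂ) := by
      intro x
      push_cast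
      rw [← mul_conj', map_sum, sum_mul_sum, sum_mul]
      exact sum_congr rfl fun j _ => by rw [sum_mul]
    simp only [this]
    rw [integral_complex_ofReal]
    rfl
  have hQint : Integrable (fun x => (1 / 2) * (∑ j, ∑ k,
      ‖dbar (e j) (β k) x - dbar (e k) (β j) x‖ ^ 2) * E x) μ := by
    simp only [mul_sum, sum_mul]
    refine integrable_finsetSum _ fun j _ => integrable_finsetSum _ fun k _ => ?_
    refine Continuous.integrable_of_hasCompactSupport (((continuous_const.mul
      (((continuous_dbar (hβ1 k) _).sub (continuous_dbar (hβ1 j) _)).norm.pow 2))).mul hEc) ?_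
    refine HasCompactSupport.mul_right (HasCompactSupport.mul_left ?_)
    exact HasCompactSupport.comp_left (g := fun z : ℂ => ‖z‖ ^ 2)
      ((hasCompactSupport_dbar (hβc k) (e j)).sub (hasCompactSupport_dbar (hβc j) (e k))) (by simp)
  have hRre := hR.re
  rw [hleft]
  refine le_trans ?_ (integral_add hRre hQint).le
  refine integral_mono_of_nonneg (.of_forall fun x => ?_) (hRre.add hQint)
    (.of_forall fun x => ?_)
  · have := hc x
    positivity
  simp only
  have hL := sum_dbar_dz_eq_levi (hΦ.contDiffAt (x := x)) e (fun j => β j x)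
  have hsplit : ∑ j, ∑ k, (dbar (e k) (dz (e j) ℂ∘Φ) x * β j x *
          conj (β k x) * (E x : ℂ)
        + dbar (e k) (β j) x * conj (dbar (e j) (β k) x) * (E x : ℂ))
      = ((levi Φ x (∑ j, β j x • e j) : ℂ) + ∑ j, ∑ k,
        dbar (e k) (β j) x * conj (dbar (e j) (β k) x)) * (E x : ℂ) := by
    rw [← hL]
    simp only [add_mul, sum_mul, sum_add_distrib]
    congr 1
    exact sum_congr rfl fun j _ => sum_congr rfl fun k _ => by ring
  have hcross : -((1 / 2) * ∑ j, ∑ k, ‖dbar (e j) (β k) x - dbar (e k) (β j) x‖ ^ 2)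
      ≤ (∑ j, ∑ k, dbar (e k) (β j) x * conj (dbar (e j) (β k) x)).re := by
    rw [mul_sum, ← sum_neg_distrib, re_sum]
    refine sum_le_sum fun j _ => ?_
    rw [mul_sum, ← sum_neg_distrib, re_sum]
    refine sum_le_sum fun k _ => ?_
    have h1 := sq_norm_sub_sq_re
    have : ‖dbar (e j) (β k) x - dbar (e k) (β j) x‖ ^ 2
        = ‖dbar (e j) (β k) x‖ ^ 2 + ‖dbar (e k) (β j) x‖ ^ 2
          - 2 * (dbar (e k) (β j) x * conj (dbar (e j) (β k) x)).re := by
      simp only [← normSq_eq_norm_sq, normSq_apply, sub_re, sub_im,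
        mul_re, conj_re, conj_im]
      ring
    rw [this]
    nlinarith [sq_nonneg ‖dbar (e j) (β k) x‖, sq_nonneg ‖dbar (e k) (β j) x‖]
  have hE0 : 0 ≤ E x := (exp_pos _).le
  change c x * (∑ j, ‖β j x‖ ^ 2) * E x ≤ re _ + _
  rw [hsplit, re_mul_ofReal, add_re, ofReal_re]
  have := mul_le_mul_of_nonneg_right (add_le_add (hlevi x) hcross) hE0
  nlinarith [this]

section Mollification

/-- A smooth circled probability density supported in the ball of radius `ε`. -/
structure IsMollifier (μ : Measure W) (ε : ℝ) (ρ : W → ℝ) : Prop where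
  contDiff : ContDiff ℝ ((⊤ : ℕ∞) : WithTop ℕ∞) ρ
  nonneg : ∀ x, 0 ≤ ρ x
  eq_zero : ∀ x, ε ≤ ‖x‖ → ρ x = 0
  integral_eq : ∫ x, ρ x ∂μ = 1
  circled : ∀ (c : ℂ) (x : W), ‖c‖ = 1 → ρ (c • x) = ρ x

lemma IsMollifier.hasCompactSupport {ε : ℝ} {ρ : W → ℝ} (h : IsMollifier μ ε ρ) :
    HasCompactSupport ρ := by
  refine HasCompactSupport.intro (isCompact_closedBall (0 : W) ε) fun x hx => h.eq_zero x ?_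
  simp at hx; exact hx.le

lemma exists_isMollifier (μ : Measure W) [μ.IsAddHaarMeasure] {ε : ℝ} (hε : 0 < ε) :
    ∃ ρ : W → ℝ, IsMollifier μ ε ρ := by
  let T : W ≃L[ℂ] EuclideanSpace ℂ (Fin (Module.finrank ℂ W)) :=
    ContinuousLinearEquiv.ofFinrankEq (by simp)
  obtain ⟨C, hC, hT⟩ := T.symm.toContinuousLinearMap.bound
  let q : W → ℝ := fun x => ‖T x‖ ^ 2
  have hq : ContDiff ℝ ((⊤ : ℕ∞) : WithTop ℕ∞) q :=
    (contDiff_norm_sq ℂ).comp ((T.toContinuousLinearMap.restrictScalars ℝ).contDiff)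
  have hqx : ∀ x, ‖x‖ ≤ C * ‖T x‖ := fun x => by simpa using hT (T x)
  let r : W → ℝ := fun x => Real.smoothTransition (1 - (C / ε) ^ 2 * q x)
  have hr : ContDiff ℝ ((⊤ : ℕ∞) : WithTop ℕ∞) r :=
    Real.smoothTransition.contDiff.comp (contDiff_const.sub (contDiff_const.mul hq))
  have hr0 : ∀ x, 0 ≤ r x := fun x => Real.smoothTransition.nonneg _
  have hrz : ∀ x, ε ≤ ‖x‖ → r x = 0 := by
    intro x hx
    apply Real.smoothTransition.zero_of_nonpos
    have h1 : 1 ≤ C / ε * ‖T x‖ := by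
      rw [div_mul_eq_mul_div, le_div_iff₀ hε, one_mul]; exact hx.trans (hqx x)
    have h2 : (C / ε) ^ 2 * q x = (C / ε * ‖T x‖) ^ 2 := by simp only [q]; ring
    nlinarith
  have hrc : HasCompactSupport r :=
    HasCompactSupport.intro (isCompact_closedBall (0 : W) ε) fun x hx => hrz x (by
      simp at hx; exact hx.le)
  have hpos : 0 < ∫ x, r x ∂μ := by
    refine hr.continuous.integral_pos_of_hasCompactSupport_nonneg_nonzero hrc hr0 (x := 0) ?_
    have : r 0 = 1 := by
      apply Real.smoothTransition.one_of_one_le; simp [q]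
    rw [this]; norm_num
  refine ⟨fun x => (∫ x, r x ∂μ)⁻¹ * r x, contDiff_const.mul hr,
    fun x => mul_nonneg (inv_nonneg.2 hpos.le) (hr0 x), fun x hx => by simp [hrz x hx], ?_, ?_⟩
  · rw [integral_const_mul, inv_mul_cancel₀ hpos.ne']
  · intro c x hc
    simp [r, q, norm_smul, hc]

variable {F : Type*} [NormedAddCommGroup F] [NormedSpace ℝ F] [CompleteSpace F]

/-- Convolution of `f` with the kernel `ρ`. -/
def moll (μ : Measure W) (ρ : W → ℝ) (f : W → F) (x : W) : F := ∫ y, ρ (x - y) • f y ∂μ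

omit [CompleteSpace F] in
lemma moll_eq_convolution (ρ : W → ℝ) (f : W → F) :
    moll μ ρ f = convolution ρ f (ContinuousLinearMap.lsmul ℝ ℝ) μ := by
  ext x
  rw [convolution_lsmul_swap]; rfl

omit [CompleteSpace F] in
lemma moll_eq_integral_sub (ρ : W → ℝ) (f : W → F) (x : W) :
    moll μ ρ f x = ∫ t, ρ t • f (x - t) ∂μ := by
  rw [moll, ← integral_sub_left_eq_self _ μ x]; simp

lemma contDiff_moll {n : ℕ∞} {ρ : W → ℝ} {f : W → F} (hρ : ContDiff ℝ n ρ)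
    (hρc : HasCompactSupport ρ) (hf : LocallyIntegrable f μ) :
    ContDiff ℝ n (moll μ ρ f) := by
  rw [moll_eq_convolution]
  exact hρc.contDiff_convolution_left _ hρ hf

omit [CompleteSpace F] in
lemma integrable_kernel_smul {ρ : W → ℝ} {f : W → F} (hρ : Continuous ρ)
    (hρc : HasCompactSupport ρ) (hf : LocallyIntegrable f μ) (x : W) :
    Integrable (fun y => ρ (x - y) • f y) μ := by
  refine hf.integrable_smul_left_of_hasCompactSupport (by fun_prop) ?_
  exact hρc.comp_homeomorph (Homeomorph.subLeft x)

omit [FiniteDimensional ℂ W] [MeasurableSpace W] [BorelSpace W] in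
lemma fderiv_comp_const_sub_apply {G : Type*} [NormedAddCommGroup G] [NormedSpace ℝ G] {g : W → G}
    (hg : Differentiable ℝ g) (x y v : W) :
    fderiv ℝ (fun z => g (x - z)) y v = -fderiv ℝ g (x - y) v := by
  have h1 : HasFDerivAt (fun z : W => x - z) (-ContinuousLinearMap.id ℝ W) y := by
    exact (hasFDerivAt_id (𝕜 := ℝ) y).const_sub x
  have h2 := (hg (x - y)).hasFDerivAt.comp y h1
  have h3 : HasFDerivAt (fun z => g (x - z)) _ y := h2
  rw [h3.fderiv]
  simp

lemma fderiv_moll {ρ : W → ℝ} {f : W → F} (hρ : ContDiff ℝ 1 ρ)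
    (hρc : HasCompactSupport ρ) (hf : LocallyIntegrable f μ) (x v : W) :
    fderiv ℝ (moll μ ρ f) x v = ∫ y, (fderiv ℝ ρ (x - y) v) • f y ∂μ := by
  have h := hρc.hasFDerivAt_convolution_left (ContinuousLinearMap.lsmul ℝ ℝ) hρ hf x
  rw [← moll_eq_convolution] at h
  rw [h.fderiv, convolution_eq_swap, ContinuousLinearMap.integral_apply]
  · rfl
  · have hc : HasCompactSupport (fderiv ℝ ρ) := hρc.fderiv (𝕜 := ℝ)
    have := (hc.convolutionExists_left (ContinuousLinearMap.precompL W
      (ContinuousLinearMap.lsmul ℝ ℝ)) (hρ.continuous_fderiv (by norm_num)) hf (μ := μ)) x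
    have h2 := this.integrable_swap
    exact h2

lemma dbar_moll {ρ : W → ℝ} {f : W → ℂ} (hρ : ContDiff ℝ 1 ρ)
    (hρc : HasCompactSupport ρ) (hf : LocallyIntegrable f μ) (x v : W) :
    dbar v (moll μ ρ f) x = -∫ y, f y * dbar v (fun z => (ρ (x - z) : ℂ)) y ∂μ := by
  have hd := hρ.differentiable (by norm_num)
  have hi : ∀ u, Integrable (fun y => (fderiv ℝ ρ (x - y) u) • f y) μ := fun u =>
    integrable_kernel_smul (ρ := fun z => fderiv ℝ ρ z u)
      ((hρ.continuous_fderiv (by norm_num)).clm_apply continuous_const)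
      (hρc.fderiv_apply (𝕜 := ℝ) u) hf x
  rw [dbar, fderiv_moll hρ hρc hf, fderiv_moll hρ hρc hf, ← integral_const_mul,
    ← integral_add (hi v) ((hi _).const_mul I), ← integral_const_mul, ← integral_neg]
  congr 1; ext y
  have hd2 : DifferentiableAt ℝ (fun z => ρ (x - z)) y :=
    (hd.comp (differentiable_id.const_sub x)) y
  rw [dbar, fderiv_ofReal hd2, fderiv_ofReal hd2, fderiv_comp_const_sub_apply hd,
    fderiv_comp_const_sub_apply hd]
  simp only [real_smul]; push_cast; ring

lemma dz_moll {ρ : W → ℝ} {f : W → ℂ} (hρ : ContDiff ℝ 1 ρ)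
    (hρc : HasCompactSupport ρ) (hf : LocallyIntegrable f μ) (x v : W) :
    dz v (moll μ ρ f) x = -∫ y, f y * dz v (fun z => (ρ (x - z) : ℂ)) y ∂μ := by
  have hd := hρ.differentiable (by norm_num)
  have hi : ∀ u, Integrable (fun y => (fderiv ℝ ρ (x - y) u) • f y) μ := fun u =>
    integrable_kernel_smul (ρ := fun z => fderiv ℝ ρ z u)
      ((hρ.continuous_fderiv (by norm_num)).clm_apply continuous_const)
      (hρc.fderiv_apply (𝕜 := ℝ) u) hf x
  rw [dz, fderiv_moll hρ hρc hf, fderiv_moll hρ hρc hf, ← integral_const_mul,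
    ← integral_sub (hi v) ((hi _).const_mul I), ← integral_const_mul, ← integral_neg]
  congr 1; ext y
  have hd2 : DifferentiableAt ℝ (fun z => ρ (x - z)) y :=
    (hd.comp (differentiable_id.const_sub x)) y
  rw [dz, fderiv_ofReal hd2, fderiv_ofReal hd2, fderiv_comp_const_sub_apply hd,
    fderiv_comp_const_sub_apply hd]
  simp only [real_smul]; push_cast; ring

omit [CompleteSpace F] in
lemma hasCompactSupport_moll {ρ : W → ℝ} {f : W → F} (hρc : HasCompactSupport ρ)
    (hf : HasCompactSupport f) : HasCompactSupport (moll μ ρ f) := by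
  rw [moll_eq_convolution]
  exact hρc.convolution _ hf

end Mollification

section LTwo
variable {α : Type*} [MeasurableSpace α] {ν : Measure α}

lemma sq_lintegral_mul_le {f g : α → ℝ≥0∞} (hf : AEMeasurable f ν) (hg : AEMeasurable g ν) :
    (∫⁻ a, f a * g a ∂ν) ^ 2 ≤ (∫⁻ a, f a ^ 2 ∂ν) * ∫⁻ a, g a ^ 2 ∂ν := by
  have h := ENNReal.lintegral_mul_le_Lp_mul_Lq ν (p := 2) (q := 2)
    (by rw [Real.holderConjugate_iff]; norm_num) hf hg
  have hs : ∀ a : ℝ≥0∞, (a ^ (1 / 2 : ℝ)) ^ 2 = a := fun a => by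
    rw [← ENNReal.rpow_natCast, ← ENNReal.rpow_mul]; simp
  have h2 := pow_le_pow_left' h 2
  simpa only [mul_pow, hs, ENNReal.rpow_two, Pi.mul_apply] using h2

lemma sq_lintegral_mul_le_of_lintegral_le_one {f g : α → ℝ≥0∞} (hf : AEMeasurable f ν)
    (hg : AEMeasurable g ν) (h1 : ∫⁻ a, f a ∂ν ≤ 1) :
    (∫⁻ a, f a * g a ∂ν) ^ 2 ≤ ∫⁻ a, f a * g a ^ 2 ∂ν := by
  have h := sq_lintegral_mul_le (ν := ν) (f := fun a => f a ^ (1 / 2 : ℝ))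
    (g := fun a => f a ^ (1 / 2 : ℝ) * g a) (hf.pow_const _) ((hf.pow_const _).mul hg)
  have hs : ∀ a, f a ^ (1 / 2 : ℝ) * f a ^ (1 / 2 : ℝ) = f a := fun a => by
    rw [← ENNReal.rpow_add_of_nonneg _ _ (by norm_num) (by norm_num)]; norm_num
  have hs2 : ∀ a, (f a ^ (1 / 2 : ℝ)) ^ 2 = f a := fun a => by rw [sq, hs]
  simp only [← mul_assoc, hs, mul_pow, hs2] at h
  exact h.trans (mul_le_of_le_one_left' h1)

lemma lintegral_enorm_sq_eq {f : α → ℂ} : ∫⁻ x, ‖f x‖ₑ ^ 2 ∂ν = eLpNorm f 2 ν ^ 2 := by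
  rw [eLpNorm_eq_lintegral_rpow_enorm_toReal (by norm_num) (by norm_num),
    ← ENNReal.rpow_natCast, ← ENNReal.rpow_mul]
  simp

end LTwo

lemma eLpNorm_translate_sub_tendsto {f : W → ℂ} (hf : MemLp f 2 μ) :
    Tendsto (fun t : W => eLpNorm (fun x => f (x - t) - f x) 2 μ) (𝓝 0) (𝓝 0) := by
  have : Fact ((2 : ℝ≥0∞) ≠ ⊤) := ⟨by norm_num⟩
  have hmp : ∀ t : W, MeasurePreserving (fun x => -t + x) μ μ := fun t =>
    measurePreserving_add_left μ (-t)
  have hc : Continuous fun t : W => (DomAddAct.mk (-t)) +ᵥ (hf.toLp f) :=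
    (DomAddAct.continuous_mk.comp continuous_neg).vadd continuous_const
  have h0 := hc.tendsto 0
  rw [tendsto_iff_edist_tendsto_0] at h0
  refine h0.congr fun t => ?_
  rw [DomAddAct.mk_vadd_toLp, DomAddAct.mk_vadd_toLp, Lp.edist_toLp_toLp]
  refine eLpNorm_congr_ae (.of_forall fun x => ?_)
  simp [sub_eq_neg_add]

lemma lintegral_moll_sub_sq_le {ε : ℝ} {ρ : W → ℝ} (hρ : IsMollifier μ ε ρ) {f : W → ℂ}
    (hf : MemLp f 2 μ) {δ : ℝ≥0∞}
    (hδ : ∀ t : W, ‖t‖ < ε → eLpNorm (fun x => f (x - t) - f x) 2 μ ^ 2 ≤ δ) :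
    eLpNorm (fun x => moll μ ρ f x - f x) 2 μ ^ 2 ≤ δ := by
  have hloc : LocallyIntegrable f μ := hf.locallyIntegrable (by norm_num)
  have hρi : Integrable ρ μ := hρ.contDiff.continuous.integrable_of_hasCompactSupport
    hρ.hasCompactSupport
  have hρ1 : ∫⁻ t, eofReal (ρ t) ∂μ = 1 := by
    rw [← ofReal_integral_eq_lintegral_ofReal hρi (.of_forall hρ.nonneg),
      hρ.integral_eq]; simp
  have hmeas : AEMeasurable (fun p : W × W => f (p.1 - p.2) - f p.1) (μ.prod μ) := by
    have h1 := hf.1.aemeasurable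
    have h2 : AEMeasurable (fun p : W × W => f (p.1 - p.2)) (μ.prod μ) :=
      h1.comp_quasiMeasurePreserving (quasiMeasurePreserving_sub μ μ)
    exact h2.sub (h1.comp_quasiMeasurePreserving Measure.quasiMeasurePreserving_fst)
  have hslice : ∀ x, AEMeasurable (fun t => f (x - t) - f x) μ := fun x =>
    (hf.1.aemeasurable.comp_quasiMeasurePreserving
      (quasiMeasurePreserving_sub_left μ x)).sub aemeasurable_const
  have hofr : Measurable fun t => eofReal (ρ t) :=
    ENNReal.measurable_ofReal.comp hρ.contDiff.continuous.measurable
  rw [← lintegral_enorm_sq_eq]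
  have hpt : ∀ x, ‖moll μ ρ f x - f x‖ₑ ^ 2
      ≤ ∫⁻ t, eofReal (ρ t) * ‖f (x - t) - f x‖ₑ ^ 2 ∂μ := by
    intro x
    refine le_trans ?_ (sq_lintegral_mul_le_of_lintegral_le_one hofr.aemeasurable
      (hslice x).enorm hρ1.le)
    refine pow_le_pow_left' ?_ 2
    have h1 : moll μ ρ f x - f x = ∫ t, ρ t • (f (x - t) - f x) ∂μ := by
      have hi1 : Integrable (fun t => ρ t • f (x - t)) μ := by
        have := (integrable_kernel_smul hρ.contDiff.continuous hρ.hasCompactSupport hloc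
          x).comp_sub_left x
        simpa using this
      have hi2 : Integrable (fun t => ρ t • f x) μ := hρi.smul_const _
      simp only [smul_sub]
      rw [integral_sub hi1 hi2, integral_smul_const, hρ.integral_eq, one_smul,
        moll_eq_integral_sub]
    rw [h1]
    refine (enorm_integral_le_lintegral_enorm _).trans (le_of_eq ?_)
    refine lintegral_congr fun t => ?_
    rw [enorm_smul, Real.enorm_eq_ofReal (hρ.nonneg t)]
  refine (lintegral_mono hpt).trans ?_
  rw [lintegral_lintegral_swap]
  · have : ∀ t, ∫⁻ x, eofReal (ρ t) * ‖f (x - t) - f x‖ₑ ^ 2 ∂μ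
        ≤ eofReal (ρ t) * δ := by
      intro t
      rw [lintegral_const_mul' _ _ ofReal_ne_top]
      by_cases ht : ‖t‖ < ε
      · gcongr
        rw [lintegral_enorm_sq_eq]
        exact hδ t ht
      · simp [hρ.eq_zero t (not_lt.1 ht)]
    refine (lintegral_mono this).trans ?_
    rw [lintegral_mul_const _ hofr, hρ1, one_mul]
  · exact ((hofr.comp measurable_snd).aemeasurable.mul (hmeas.enorm.pow_const 2))

lemma exists_moll_approx {f : W → ℂ} (hf : MemLp f 2 μ) {η : ℝ≥0∞} (hη : 0 < η) :
    ∃ ε > 0, ∀ ε' ≤ ε, ∀ ρ : W → ℝ, IsMollifier μ ε' ρ →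
      eLpNorm (fun x => moll μ ρ f x - f x) 2 μ ≤ η := by
  have h := (eLpNorm_translate_sub_tendsto hf).eventually_le_const hη
  obtain ⟨ε, hε, h⟩ := Metric.eventually_nhds_iff.1 h
  refine ⟨ε, hε, fun ε' hε' ρ hρ => ?_⟩
  have := lintegral_moll_sub_sq_le hρ hf (δ := η ^ 2) fun t ht => by
    gcongr
    exact h (by simpa using ht.trans_le hε')
  exact (ENNReal.pow_le_pow_left_iff (by norm_num)).1 this

/-- Along any sequence of mollifiers with shrinking supports, mollifications converge in `L²`. -/
lemma tendsto_eLpNorm_moll_sub {f : W → ℂ} (hf : MemLp f 2 μ) {ε : ℕ → ℝ}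
    (hε : Tendsto ε atTop (𝓝 0)) {ρ : ℕ → W → ℝ} (hρ : ∀ n, IsMollifier μ (ε n) (ρ n)) :
    Tendsto (fun n => eLpNorm (fun x => moll μ (ρ n) f x - f x) 2 μ) atTop (𝓝 0) := by
  rw [ENNReal.tendsto_nhds_zero]
  intro η hη
  obtain ⟨δ, hδ, h⟩ := exists_moll_approx hf hη
  filter_upwards [hε.eventually_le_const hδ] with n hn
  exact h _ hn _ (hρ n)

section LTwoConvergence
variable {α : Type*} [MeasurableSpace α] {ν : Measure α}

lemma MeasureTheory.MemLp.bdd_mul_two {f b : α → ℂ} (hf : MemLp f 2 ν) (hb : AEStronglyMeasurable b ν)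
    {M : ℝ} (hM : ∀ x, ‖b x‖ ≤ M) : MemLp (fun x => b x * f x) 2 ν :=
  hf.of_le_mul (c := M) (hb.mul hf.1) (.of_forall fun x => by
    rw [norm_mul]; gcongr; exact hM x)

lemma integrable_weight_mul_norm_sq {f : α → ℂ} {w : α → ℝ} (hf : MemLp f 2 ν)
    (hw : AEStronglyMeasurable w ν) {M : ℝ} (hM : ∀ x, ‖w x‖ ≤ M) :
    Integrable (fun x => w x * ‖f x‖ ^ 2) ν :=
  ((memLp_two_iff_integrable_sq_norm hf.1).1 hf).bdd_mul hw (.of_forall hM)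

/-- Convergence in `L²`. -/
structure LTwoConv (ν : Measure α) (f : ℕ → α → ℂ) (g : α → ℂ) : Prop where
  memLp : ∀ n, MemLp (f n) 2 ν
  memLp_lim : MemLp g 2 ν
  tendsto : Tendsto (fun n => eLpNorm (fun x => f n x - g x) 2 ν) atTop (𝓝 0)

namespace LTwoConv

lemma add {f f' : ℕ → α → ℂ} {g g' : α → ℂ} (h : LTwoConv ν f g) (h' : LTwoConv ν f' g') :
    LTwoConv ν (fun n x => f n x + f' n x) (fun x => g x + g' x) where
  memLp n := (h.memLp n).add (h'.memLp n)
  memLp_lim := h.memLp_lim.add h'.memLp_lim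
  tendsto := by
    have ht := h.tendsto.add h'.tendsto
    rw [add_zero] at ht
    refine tendsto_of_tendsto_of_tendsto_of_le_of_le tendsto_const_nhds ht
      (fun _ => zero_le) fun n => ?_
    refine le_trans (le_of_eq ?_) (eLpNorm_add_le ((h.memLp n).1.sub h.memLp_lim.1)
      ((h'.memLp n).1.sub h'.memLp_lim.1) (by norm_num))
    congr 1; ext x; simp; ring

lemma bdd_mul {f : ℕ → α → ℂ} {g b : α → ℂ} (h : LTwoConv ν f g)
    (hb : AEStronglyMeasurable b ν) {M : ℝ} (hM : ∀ x, ‖b x‖ ≤ M) :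
    LTwoConv ν (fun n x => b x * f n x) (fun x => b x * g x) where
  memLp n := (h.memLp n).bdd_mul_two hb hM
  memLp_lim := h.memLp_lim.bdd_mul_two hb hM
  tendsto := by
    have ht := ENNReal.Tendsto.const_mul (a := eofReal M) h.tendsto (Or.inr (by simp))
    rw [mul_zero] at ht
    refine tendsto_of_tendsto_of_tendsto_of_le_of_le tendsto_const_nhds ht
      (fun _ => zero_le) fun n => ?_
    refine eLpNorm_le_mul_eLpNorm_of_ae_le_mul (.of_forall fun x => ?_) 2
    simp only [← mul_sub, norm_mul]
    gcongr; exact hM x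

lemma neg {f : ℕ → α → ℂ} {g : α → ℂ} (h : LTwoConv ν f g) :
    LTwoConv ν (fun n x => -f n x) (fun x => -g x) := by
  simpa using h.bdd_mul (b := fun _ => -1) (M := 1) aestronglyMeasurable_const (by simp)

lemma sum {ι : Type*} (s : Finset ι) {f : ι → ℕ → α → ℂ} {g : ι → α → ℂ}
    (h : ∀ i ∈ s, LTwoConv ν (f i) (g i)) :
    LTwoConv ν (fun n x => ∑ i ∈ s, f i n x) (fun x => ∑ i ∈ s, g i x) := by
  classical
  induction s using induction_on with
  | empty => exact ⟨by simp, by simp, by simp⟩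
  | insert a s ha ih =>
    simp only [sum_insert ha]
    exact (h a (by simp)).add (ih fun i hi => h i (by simp [hi]))

lemma tendsto_integral {f : ℕ → α → ℂ} {g : α → ℂ} (h : LTwoConv ν f g) {w : α → ℝ}
    (hw : AEStronglyMeasurable w ν) (hw0 : ∀ x, 0 ≤ w x) {M : ℝ} (hM : ∀ x, w x ≤ M) :
    Tendsto (fun n => ∫ x, w x * ‖f n x‖ ^ 2 ∂ν) atTop (𝓝 (∫ x, w x * ‖g x‖ ^ 2 ∂ν)) := by
  have hb : AEStronglyMeasurable (fun x => ((Real.sqrt (w x) : ℝ) : ℂ)) ν :=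
    (continuous_ofReal.comp Real.continuous_sqrt).comp_aestronglyMeasurable hw
  have h2 := h.bdd_mul hb (M := Real.sqrt M) fun x => by
    simpa [abs_of_nonneg] using Real.sqrt_le_sqrt (hM x)
  have key : ∀ u : α → ℂ, MemLp (fun x => ((Real.sqrt (w x) : ℝ) : ℂ) * u x) 2 ν →
      ∫ x, w x * ‖u x‖ ^ 2 ∂ν
        = ((eLpNorm (fun x => ((Real.sqrt (w x) : ℝ) : ℂ) * u x) 2 ν) ^ 2).toReal := by
    intro u hu
    rw [← lintegral_enorm_sq_eq, ← integral_toReal]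
    · congr 1; ext x
      simp [mul_pow, sq_sqrt (hw0 x), abs_of_nonneg]
    · exact (hu.1.enorm.pow_const 2)
    · exact .of_forall fun x => ENNReal.pow_lt_top enorm_lt_top
  simp only [key _ (h2.memLp _), key _ h2.memLp_lim]
  refine (ENNReal.tendsto_toReal (by simpa using h2.memLp_lim.2.ne)).comp ?_
  have hlim : Tendsto (fun n => eLpNorm (fun x => ((Real.sqrt (w x) : ℝ) : ℂ) * f n x) 2 ν) atTop
      (𝓝 (eLpNorm (fun x => ((Real.sqrt (w x) : ℝ) : ℂ) * g x) 2 ν)) := by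
    have := Lp.tendsto_Lp_iff_tendsto_eLpNorm'' (fi := atTop) _ h2.memLp _ h2.memLp_lim
    have h3 := (this.2 h2.tendsto).enorm
    simpa using h3
  exact (ENNReal.continuous_pow 2).continuousAt.tendsto.comp hlim

end LTwoConv
end LTwoConvergence

lemma exists_cutoff {K U : Set W} (hK : IsCompact K) (hU : IsOpen U) (hKU : K ⊆ U) :
    ∃ χ : W → ℝ, ContDiff ℝ ((⊤ : ℕ∞) : WithTop ℕ∞) χ ∧ HasCompactSupport χ ∧ tsupport χ ⊆ U ∧
      (∀ x, 0 ≤ χ x ∧ χ x ≤ 1) ∧ ∀ᶠ x in 𝓝ˢ K, χ x = 1 := by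
  obtain ⟨L, hL, hKL, hLU⟩ := exists_compact_between hK hU hKU
  obtain ⟨f, h1, h2, h3⟩ := exists_contMDiffMap_one_nhds_of_subset_interior (n := (⊤ : ℕ∞))
    (modelWithCornersSelf ℝ W) hK.isClosed hKL
  have hs : tsupport f ⊆ L := closure_minimal (fun x hx => by
    by_contra h; exact hx (h2 x h)) hL.isClosed
  exact ⟨f, f.contMDiff.contDiff, hL.of_isClosed_subset (isClosed_tsupport _) hs, hs.trans hLU,
    fun x => h3 x, h1⟩

/-- The space of `C²` test functions on `Ω`. -/
def testFn (Ω : Set W) : Submodule ℂ (W → ℂ) where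
  carrier := {ω | ContDiff ℝ 2 ω ∧ HasCompactSupport ω ∧ tsupport ω ⊆ Ω}
  add_mem' := fun {a b} ha hb => ⟨ha.1.add hb.1, ha.2.1.add hb.2.1,
    (tsupport_add _ _).trans (union_subset ha.2.2 hb.2.2)⟩
  zero_mem' := ⟨contDiff_const, HasCompactSupport.zero, by simp⟩
  smul_mem' := fun c a ha => ⟨contDiff_const.smul ha.1, ha.2.1.smul_left,
    (tsupport_smul_subset_right (fun _ => c) a).trans ha.2.2⟩

/-- The distributional equation `∂̄γ = 0`, tested on `X`. -/
def WeakClosed {κ : Type*} (μ : Measure W) (e : κ → W) (γ : κ → W → ℂ)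
    (X : Set W) : Prop := ∀ j k, ∀ ω ∈ testFn X,
  ∫ x, γ k x * dbar (e j) ω x - γ j x * dbar (e k) ω x ∂μ = 0

/-- The weighted distributional equation `∂̄*γ = -kap`, tested on `X`. -/
def WeakAdjoint {κ : Type*} [Fintype κ] (μ : Measure W) (e : κ → W) (Φ : W → ℝ)
    (γ : κ → W → ℂ) (kap : W → ℂ) (X : Set W) : Prop := ∀ ω ∈ testFn X,
  ∫ x, ∑ j, γ j x * (dz (e j) ω x + dz (e j) ℂ∘Φ x * ω x) ∂μ = ∫ x, kap x * ω x ∂μ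

section WeakInequality

/-- Local square integrability on `Ω`. -/
def LocL2 (μ : Measure W) (Ω : Set W) (f : W → ℂ) : Prop :=
  ∀ K ⊆ Ω, IsCompact K → MemLp f 2 (μ.restrict K)

lemma Continuous.exists_norm_le_of_compact {f : W → ℂ} (hf : Continuous f)
    (hc : HasCompactSupport f) : ∃ M, ∀ x, ‖f x‖ ≤ M := by
  obtain ⟨M, hM⟩ := hc.exists_bound_of_continuous hf
  exact ⟨M, hM⟩

lemma LocL2.memLp_mul {Ω : Set W} {f b : W → ℂ} (hf : LocL2 μ Ω f) (hb : Continuous b)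
    (hbc : HasCompactSupport b) (hbΩ : tsupport b ⊆ Ω) : MemLp (fun x => b x * f x) 2 μ := by
  obtain ⟨M, hM⟩ := hb.exists_norm_le_of_compact hbc
  have h1 := (hf _ hbΩ hbc).bdd_mul_two hb.aestronglyMeasurable hM
  rw [← memLp_indicator_iff_restrict (isClosed_tsupport b).measurableSet] at h1
  convert h1 using 1
  ext x
  by_cases hx : x ∈ tsupport b
  · simp [hx]
  · simp [hx, image_eq_zero_of_notMem_tsupport hx]

lemma LocL2.integrable_mul {Ω : Set W} {f b : W → ℂ} (hf : LocL2 μ Ω f) (hb : Continuous b)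
    (hbc : HasCompactSupport b) (hbΩ : tsupport b ⊆ Ω) : Integrable (fun x => f x * b x) μ := by
  have h1 := hf.memLp_mul hb hbc hbΩ
  have h2 : IntegrableOn (fun x => f x * b x) (tsupport b) μ := by
    have : IsFiniteMeasure (μ.restrict (tsupport b)) := ⟨by
      simpa using hbc.isCompact.measure_lt_top⟩
    have := (h1.restrict (tsupport b)).integrable (by norm_num)
    simpa [IntegrableOn, mul_comm] using this
  rwa [integrableOn_iff_integrable_of_support_subset] at h2
  intro x hx
  by_contra h
  exact hx (by simp [image_eq_zero_of_notMem_tsupport h])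

lemma IsMollifier.contDiff_slice {ε : ℝ} {ρ : W → ℝ} (hρ : IsMollifier μ ε ρ) (x : W) {n : ℕ} :
    ContDiff ℝ n (fun y => (ρ (x - y) : ℂ)) :=
  contDiff_ofReal ((hρ.contDiff.of_le (by exact_mod_cast le_top)).comp
    (contDiff_const.sub contDiff_id))

lemma tsupport_moll_subset {ε : ℝ} {ρ : W → ℝ} (hρ : IsMollifier μ ε ρ) {f : W → ℂ} {K : Set W}
    (hf : ∀ x ∉ K, f x = 0) : ∀ x, moll μ ρ f x ≠ 0 → x ∈ thickening ε K := by
  intro x hx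
  by_contra h
  refine hx (integral_eq_zero_of_ae (.of_forall fun y => ?_))
  by_cases hy : y ∈ K
  · have : ε ≤ ‖x - y‖ := by
      by_contra h'
      exact h (mem_thickening_iff.2 ⟨y, hy, by rw [dist_eq_norm]; exact not_le.1 h'⟩)
    simp [hρ.eq_zero _ this]
  · simp [hf y hy]

variable {κ : Type*} [Fintype κ] {e : κ → W} {θ : W → ℝ} {γ : κ → W → ℂ} {kap : W → ℂ}

lemma dbar_moll_sub {Ω : Set W} (hγ : ∀ j, LocL2 μ Ω (γ j)) (hθ : ContDiff ℝ 2 θ)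
    (hθc : HasCompactSupport θ) (hθΩ : tsupport θ ⊆ Ω)
    (hclosed : WeakClosed μ e γ (tsupport θ))
    {ε : ℝ} {ρ : W → ℝ} (hρ : IsMollifier μ ε ρ) (j k : κ) (x : W) :
    dbar (e j) (moll μ ρ fun y => (θ y : ℂ) * γ k y) x
        - dbar (e k) (moll μ ρ fun y => (θ y : ℂ) * γ j y) x
      = moll μ ρ (fun y => dbar (e j) ℂ∘θ y * γ k y
          - dbar (e k) ℂ∘θ y * γ j y) x := by
  set T : W → ℂ := fun y => (θ y : ℂ) with hT
  set R : W → ℂ := fun y => (ρ (x - y) : ℂ) with hR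
  have hTd : ContDiff ℝ 2 T := contDiff_ofReal hθ
  have hRd : ContDiff ℝ 2 R := hρ.contDiff_slice x
  have hTs : tsupport T ⊆ tsupport θ := closure_mono fun y hy => by simpa [T] using hy
  have hTc : HasCompactSupport T := hθc.of_isClosed_subset (isClosed_tsupport _) hTs
  have h2 : (2 : WithTop ℕ∞) ≠ 0 := by norm_num
  have hT1 : ContDiff ℝ 1 T := hTd.of_le (by norm_num)
  have hR1 : ContDiff ℝ 1 R := hRd.of_le (by norm_num)
  have hloc : ∀ j, LocallyIntegrable (fun y => T y * γ j y) μ := fun j =>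
    ((hγ j).memLp_mul hTd.continuous hTc (hTs.trans hθΩ)).locallyIntegrable (by norm_num)
  have hρ1 : ContDiff ℝ 1 ρ := hρ.contDiff.of_le (by exact_mod_cast le_top)
  rw [dbar_moll hρ1 hρ.hasCompactSupport (hloc k), dbar_moll hρ1 hρ.hasCompactSupport (hloc j)]
  have h0 := hclosed j k (fun y => T y * R y) ⟨hTd.mul hRd, hTc.mul_right,
    tsupport_mul_subset_left.trans hTs⟩
  have hA : ∀ a b : κ, Integrable (fun y => T y * γ a y * dbar (e b) R y) μ := fun a b => by
    have := (hγ a).integrable_mul (b := fun y => T y * dbar (e b) R y)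
      (hTd.continuous.mul (continuous_dbar hR1 _)) hTc.mul_right
      (tsupport_mul_subset_left.trans (hTs.trans hθΩ))
    exact this.congr (.of_forall fun y => by simp only; ring)
  have hB : ∀ a b : κ, Integrable (fun y => R y * (dbar (e b) T y * γ a y)) μ := fun a b => by
    have := (hγ a).integrable_mul (b := fun y => dbar (e b) T y * R y)
      ((continuous_dbar hT1 _).mul hRd.continuous) (hasCompactSupport_dbar hTc _).mul_right
      (tsupport_mul_subset_left.trans ((tsupport_dbar_subset _ _).trans (hTs.trans hθΩ)))
    exact this.congr (.of_forall fun y => by simp only; ring)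
  have hm : moll μ ρ (fun y => dbar (e j) T y * γ k y - dbar (e k) T y * γ j y) x
      = ∫ y, R y * (dbar (e j) T y * γ k y) ∂μ - ∫ y, R y * (dbar (e k) T y * γ j y) ∂μ := by
    rw [moll, ← integral_sub (hB _ _) (hB _ _)]
    congr 1; ext y; simp only [R, real_smul]; ring
  rw [hm]
  have h1 : ∫ y, γ k y * dbar (e j) (fun y => T y * R y) y
        - γ j y * dbar (e k) (fun y => T y * R y) y ∂μ
      = (∫ y, T y * γ k y * dbar (e j) R y ∂μ + ∫ y, R y * (dbar (e j) T y * γ k y) ∂μ)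
        - (∫ y, T y * γ j y * dbar (e k) R y ∂μ + ∫ y, R y * (dbar (e k) T y * γ j y) ∂μ) := by
    rw [← integral_add (hA _ _) (hB _ _), ← integral_add (hA _ _) (hB _ _),
      ← integral_sub ((hA _ _).fun_add (hB _ _)) ((hA _ _).fun_add (hB _ _))]
    congr 1; ext y
    rw [dbar_mul (hTd.differentiable h2 y) (hRd.differentiable h2 y),
      dbar_mul (hTd.differentiable h2 y) (hRd.differentiable h2 y)]
    ring
  rw [h1] at h0
  linear_combination -h0

lemma sum_dz_moll {Ω : Set W} {Φ : W → ℝ} (hΦ : ContDiff ℝ 2 Φ) (hγ : ∀ j, LocL2 μ Ω (γ j))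
    (hk : LocL2 μ Ω kap) (hθ : ContDiff ℝ 2 θ)
    (hθc : HasCompactSupport θ) (hθΩ : tsupport θ ⊆ Ω) (hadj : WeakAdjoint μ e Φ γ kap (tsupport θ))
    {ε : ℝ} {ρ : W → ℝ} (hρ : IsMollifier μ ε ρ) (x : W) :
    ∑ j, dz (e j) (moll μ ρ fun y => (θ y : ℂ) * γ j y) x
      = moll μ ρ (fun y => -(θ y * kap y) + ∑ j, (dz (e j) ℂ∘Φ y * (θ y * γ j y)
          + dz (e j) ℂ∘θ y * γ j y)) x := by
  set T : W → ℂ := fun y => (θ y : ℂ) with hT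
  set P : W → ℂ := fun y => (Φ y : ℂ) with hP
  set R : W → ℂ := fun y => (ρ (x - y) : ℂ) with hR
  have hTd : ContDiff ℝ 2 T := contDiff_ofReal hθ
  have hPd : ContDiff ℝ 1 P := (contDiff_ofReal hΦ).of_le (by norm_num)
  have hRd : ContDiff ℝ 2 R := hρ.contDiff_slice x
  have hTs : tsupport T ⊆ tsupport θ := closure_mono fun y hy => by simpa [T] using hy
  have hTc : HasCompactSupport T := hθc.of_isClosed_subset (isClosed_tsupport _) hTs
  have h2 : (2 : WithTop ℕ∞) ≠ 0 := by norm_num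
  have hT1 : ContDiff ℝ 1 T := hTd.of_le (by norm_num)
  have hR1 : ContDiff ℝ 1 R := hRd.of_le (by norm_num)
  have hloc : ∀ j, LocallyIntegrable (fun y => T y * γ j y) μ := fun j =>
    ((hγ j).memLp_mul hTd.continuous hTc (hTs.trans hθΩ)).locallyIntegrable (by norm_num)
  have hρ1 : ContDiff ℝ 1 ρ := hρ.contDiff.of_le (by exact_mod_cast le_top)
  rw [sum_congr rfl fun j _ => dz_moll hρ1 hρ.hasCompactSupport (hloc j) x (e j)]
  have h0 := hadj (fun y => T y * R y) ⟨hTd.mul hRd, hTc.mul_right,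
    tsupport_mul_subset_left.trans hTs⟩
  have hA : ∀ a : κ, Integrable (fun y => T y * γ a y * dz (e a) R y) μ := fun a => by
    have := (hγ a).integrable_mul (b := fun y => T y * dz (e a) R y)
      (hTd.continuous.mul (continuous_dz hR1 _)) hTc.mul_right
      (tsupport_mul_subset_left.trans (hTs.trans hθΩ))
    exact this.congr (.of_forall fun y => by simp only; ring)
  have hB : ∀ a : κ, Integrable (fun y => R y * (dz (e a) P y * (T y * γ a y)
      + dz (e a) T y * γ a y)) μ := fun a => by
    have h1 := (hγ a).integrable_mul (b := fun y => dz (e a) T y * R y)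
      ((continuous_dz hT1 _).mul hRd.continuous) (hasCompactSupport_dz hTc _).mul_right
      (tsupport_mul_subset_left.trans ((tsupport_dz_subset _ _).trans (hTs.trans hθΩ)))
    have h2 := (hγ a).integrable_mul (b := fun y => T y * (dz (e a) P y * R y))
      (hTd.continuous.mul ((continuous_dz hPd _).mul hRd.continuous)) hTc.mul_right
      (tsupport_mul_subset_left.trans (hTs.trans hθΩ))
    exact (h1.add h2).congr (.of_forall fun y => by simp only [Pi.add_apply]; ring)
  have hC : Integrable (fun y => kap y * (T y * R y)) μ :=
    hk.integrable_mul (hTd.continuous.mul hRd.continuous) hTc.mul_right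
      (tsupport_mul_subset_left.trans (hTs.trans hθΩ))
  have hm : moll μ ρ (fun y => -(T y * kap y) + ∑ j, (dz (e j) P y * (T y * γ j y)
        + dz (e j) T y * γ j y)) x
      = -∫ y, kap y * (T y * R y) ∂μ + ∑ j, ∫ y, R y * (dz (e j) P y * (T y * γ j y)
        + dz (e j) T y * γ j y) ∂μ := by
    rw [moll, ← integral_neg, ← integral_finsetSum _ fun j _ => hB j,
      ← integral_add hC.fun_neg (integrable_finsetSum _ fun j _ => hB j)]
    congr 1; ext y; simp only [R, real_smul, mul_add, mul_sum]; ring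
  rw [hm, ← h0, sum_neg_distrib]
  have h1 : ∫ y, ∑ j, γ j y * (dz (e j) (fun y => T y * R y) y + dz (e j) P y * (T y * R y)) ∂μ
      = ∑ j, ∫ y, T y * γ j y * dz (e j) R y ∂μ + ∑ j, ∫ y, R y * (dz (e j) P y * (T y * γ j y)
        + dz (e j) T y * γ j y) ∂μ := by
    rw [← integral_finsetSum _ fun j _ => hB j, ← integral_finsetSum _ fun j _ => hA j,
      ← integral_add (integrable_finsetSum _ fun j _ => hA j)
        (integrable_finsetSum _ fun j _ => hB j)]
    congr 1; ext y
    rw [← sum_add_distrib]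
    refine sum_congr rfl fun j _ => ?_
    rw [dz_mul (hTd.differentiable h2 y) (hRd.differentiable h2 y)]
    ring
  rw [h1]
  ring

lemma ltwoConv_moll {K : Set W} (hK : IsCompact K) {f : W → ℂ} (hf : MemLp f 2 μ)
    (hfK : ∀ x ∉ K, f x = 0) {ε : ℕ → ℝ} (hε : Tendsto ε atTop (𝓝 0)) {ρ : ℕ → W → ℝ}
    (hρ : ∀ n, IsMollifier μ (ε n) (ρ n)) : LTwoConv μ (fun n => moll μ (ρ n) f) f where
  memLp n := by
    have hc := hasCompactSupport_moll (μ := μ) (hρ n).hasCompactSupport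
      (HasCompactSupport.intro hK hfK)
    exact (contDiff_moll (n := 0) ((hρ n).contDiff.of_le (by exact_mod_cast le_top))
      (hρ n).hasCompactSupport
      (hf.locallyIntegrable (by norm_num))).continuous.memLp_of_hasCompactSupport hc
  memLp_lim := hf
  tendsto := tendsto_eLpNorm_moll_sub hf hε hρ

lemma half_sum_sum_sq_le (a b : κ → ℂ) :
    (1 / 2 : ℝ) * ∑ j, ∑ k, ‖a j * b k - a k * b j‖ ^ 2
      ≤ 2 * ((∑ j, ‖a j‖ ^ 2) * ∑ k, ‖b k‖ ^ 2) := by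
  have h : ∀ j k, ‖a j * b k - a k * b j‖ ^ 2
      ≤ 2 * (‖a j‖ ^ 2 * ‖b k‖ ^ 2) + 2 * (‖a k‖ ^ 2 * ‖b j‖ ^ 2) := by
    intro j k
    have h1 := norm_sub_le (a j * b k) (a k * b j)
    rw [norm_mul, norm_mul] at h1
    have h2 := norm_nonneg (a j * b k - a k * b j)
    nlinarith [sq_nonneg (‖a j‖ * ‖b k‖ - ‖a k‖ * ‖b j‖)]
  calc _ ≤ (1 / 2 : ℝ) * ∑ j, ∑ k, (2 * (‖a j‖ ^ 2 * ‖b k‖ ^ 2) + 2 * (‖a k‖ ^ 2 * ‖b j‖ ^ 2)) := by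
        gcongr; exact h _ _
    _ = _ := by
        simp only [sum_add_distrib, ← mul_sum, ← sum_mul]
        ring

lemma norm_neg_add_sum_sq_le (u : ℂ) (a b : κ → ℂ) :
    ‖-u + ∑ j, a j * b j‖ ^ 2 ≤ 2 * ‖u‖ ^ 2 + 2 * ((∑ j, ‖a j‖ ^ 2) * ∑ j, ‖b j‖ ^ 2) := by
  have h1 : ‖∑ j, a j * b j‖ ≤ ∑ j, ‖a j‖ * ‖b j‖ :=
    (norm_sum_le _ _).trans (by simp)
  have h2 := Finset.sum_mul_sq_le_sq_mul_sq Finset.univ (fun j => ‖a j‖) (fun j => ‖b j‖)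
  have h3 := norm_add_le (-u) (∑ j, a j * b j)
  rw [norm_neg] at h3
  have h4 : ‖∑ j, a j * b j‖ ^ 2 ≤ (∑ j, ‖a j‖ * ‖b j‖) ^ 2 := by gcongr
  nlinarith [sq_nonneg (‖u‖ - ‖∑ j, a j * b j‖), norm_nonneg (-u + ∑ j, a j * b j),
    norm_nonneg u, norm_nonneg (∑ j, a j * b j)]

theorem weak_inequality_of_compact {Ω K' : Set W} {Φ c : W → ℝ} (hΦ : ContDiff ℝ 2 Φ)
    (hΦc : HasCompactSupport Φ)
    (hK' : IsCompact K') {ε₀ : ℝ} (hε₀ : 0 < ε₀)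
    (hsub : thickening ε₀ (tsupport θ) ⊆ K') (hc : ContinuousOn c K')
    (hc0 : ∀ x ∈ K', 0 ≤ c x)
    (hlevi : ∀ x ∈ K', ∀ b : κ → ℂ, c x * ∑ j, ‖b j‖ ^ 2 ≤ levi Φ x (∑ j, b j • e j))
    (hγ : ∀ j, LocL2 μ Ω (γ j))
    (hk : LocL2 μ Ω kap) (hθ : ContDiff ℝ 2 θ)
    (hθc : HasCompactSupport θ) (hθΩ : tsupport θ ⊆ Ω)
    (hclosed : WeakClosed μ e γ (tsupport θ)) (hadj : WeakAdjoint μ e Φ γ kap (tsupport θ)) :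
    ∑ j, ∫⁻ x, eofReal ((K'.indicator c x * rexp (-Φ x)) *
        ‖(θ x : ℂ) * γ j x‖ ^ 2) ∂μ
      ≤ ∫⁻ x, eofReal (rexp (-Φ x) * (2 * ‖(θ x : ℂ) * kap x‖ ^ 2)) ∂μ
        + ∫⁻ x, eofReal (rexp (-Φ x) *
          (4 * ∑ j, ∑ k, ‖dz (e j) ℂ∘θ x * γ k x‖ ^ 2)) ∂μ := by
  set T : W → ℂ := fun y => (θ y : ℂ) with hT
  set P : W → ℂ := fun y => (Φ y : ℂ) with hP
  have hTd : ContDiff ℝ 2 T := contDiff_ofReal hθ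
  have hT1 : ContDiff ℝ 1 T := hTd.of_le (by norm_num)
  have hPd : ContDiff ℝ 1 P := (contDiff_ofReal hΦ).of_le (by norm_num)
  have hTs : tsupport T ⊆ tsupport θ := closure_mono fun y hy => by simpa [T] using hy
  have hTc : HasCompactSupport T := hθc.of_isClosed_subset (isClosed_tsupport _) hTs
  have hPc : HasCompactSupport P := hΦc.of_isClosed_subset (isClosed_tsupport _)
    (closure_mono fun y hy => by simpa [P] using hy)
  have hTΩ := hTs.trans hθΩ
  have hT0 : ∀ x ∉ tsupport θ, T x = 0 := fun x hx => by
    simp [T, image_eq_zero_of_notMem_tsupport hx]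
  have hzs : ∀ j, tsupport (dz (e j) T) ⊆ tsupport θ := fun j =>
    (tsupport_dz_subset _ _).trans hTs
  have hbs : ∀ j, tsupport (dbar (e j) T) ⊆ tsupport θ := fun j =>
    (tsupport_dbar_subset _ _).trans hTs
  have hzT : ∀ j k, MemLp (fun y => dz (e j) T y * γ k y) 2 μ := fun j k =>
    (hγ k).memLp_mul (continuous_dz hT1 _) (hasCompactSupport_dz hTc _) ((hzs j).trans hθΩ)
  have hbT : ∀ j k, MemLp (fun y => dbar (e j) T y * γ k y) 2 μ := fun j k =>
    (hγ k).memLp_mul (continuous_dbar hT1 _) (hasCompactSupport_dbar hTc _) ((hbs j).trans hθΩ)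
  have hG : ∀ j, MemLp (fun y => T y * γ j y) 2 μ := fun j =>
    (hγ j).memLp_mul hTd.continuous hTc hTΩ
  have hkT : MemLp (fun y => T y * kap y) 2 μ := hk.memLp_mul hTd.continuous hTc hTΩ
  have hPb : ∀ j, ∃ M, ∀ x, ‖dz (e j) P x‖ ≤ M := fun j =>
    (continuous_dz hPd _).exists_norm_le_of_compact (hasCompactSupport_dz hPc _)
  choose MP hMP using hPb
  have hPG : ∀ j, MemLp (fun y => dz (e j) P y * (T y * γ j y)) 2 μ := fun j =>
    (hG j).bdd_mul_two (continuous_dz hPd _).aestronglyMeasurable (hMP j)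
  let ε : ℕ → ℝ := fun n => ε₀ / (n + 1)
  have hε : Tendsto ε atTop (𝓝 0) := by
    simpa [ε, div_eq_mul_inv] using
      (tendsto_one_div_add_atTop_nhds_zero_nat (𝕜 := ℝ)).const_mul ε₀
  have hε0 : ∀ n, 0 < ε n := fun n => by positivity
  have hεle : ∀ n, ε n ≤ ε₀ := fun n => div_le_self hε₀.le (by simp)
  choose ρ hρ using fun n => exists_isMollifier μ (hε0 n)
  let β : ℕ → κ → W → ℂ := fun n j => moll μ (ρ n) fun y => T y * γ j y
  let D : W → ℂ := fun y => -(T y * kap y) + ∑ j, (dz (e j) P y * (T y * γ j y)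
          + dz (e j) T y * γ j y)
  let B : κ → κ → W → ℂ := fun j k y => dbar (e j) T y * γ k y - dbar (e k) T y * γ j y
  have hD : MemLp D 2 μ := hkT.neg.add (memLp_finsetSum _ fun j _ => (hPG j).add (hzT j j))
  have hB : ∀ j k, MemLp (B j k) 2 μ := fun j k => (hbT j k).sub (hbT k j)
  have hβconv : ∀ j, LTwoConv μ (fun n => β n j) (fun y => T y * γ j y) := fun j =>
    ltwoConv_moll hθc (hG j) (fun x hx => by simp [hT0 x hx]) hε hρ
  have hDconv : LTwoConv μ (fun n => moll μ (ρ n) D) D :=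
    ltwoConv_moll hθc hD (fun x hx => by
      have : ∀ j, dz (e j) T x = 0 := fun j =>
        image_eq_zero_of_notMem_tsupport fun h => hx (hzs j h)
      simp [D, hT0 x hx, this]) hε hρ
  have hBconv : ∀ j k, LTwoConv μ (fun n => moll μ (ρ n) (B j k)) (B j k) := fun j k =>
    ltwoConv_moll hθc (hB j k) (fun x hx => by
      have : ∀ j, dbar (e j) T x = 0 := fun j =>
        image_eq_zero_of_notMem_tsupport fun h => hx (hbs j h)
      simp [B, this]) hε hρ
  have hβsmooth : ∀ n j, ContDiff ℝ 2 (β n j) := fun n j => by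
    exact_mod_cast contDiff_moll (n := 2) ((hρ n).contDiff.of_le (by exact_mod_cast le_top))
      (hρ n).hasCompactSupport ((hG j).locallyIntegrable (by norm_num))
  have hβc : ∀ n j, HasCompactSupport (β n j) := fun n j =>
    hasCompactSupport_moll (hρ n).hasCompactSupport hTc.mul_right
  have hβ0 : ∀ n j, ∀ x ∉ K', β n j x = 0 := fun n j x hx => by
    by_contra h
    exact hx (hsub (thickening_mono (hεle n) _
      (tsupport_moll_subset (hρ n) (fun x hx => by simp [hT0 x hx]) x h)))
  have hmkh := fun n => morrey_kohn_hormander (μ := μ) e (c := K'.indicator c) hΦ (hβsmooth n) (hβc n)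
    (fun x => indicator_nonneg hc0 x) (fun x => by
      by_cases hx : x ∈ K'
      · rw [indicator_of_mem hx]; exact hlevi x hx _
      · simp [hx, hβ0 n _ x hx, levi])
  have hw2 : AEStronglyMeasurable (fun x => rexp (-Φ x)) μ :=
    (Real.continuous_exp.comp hΦ.continuous.neg).aestronglyMeasurable
  obtain ⟨MΦ, hMΦ⟩ := hΦc.exists_bound_of_continuous hΦ.continuous
  have hw2b : ∀ x, rexp (-Φ x) ≤ rexp MΦ := fun x =>
    exp_le_exp.2 ((neg_le_abs _).trans (hMΦ x))
  have hw2b' : ∀ x, ‖rexp (-Φ x)‖ ≤ rexp MΦ := fun x => by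
    rw [norm_of_nonneg (exp_pos _).le]; exact hw2b x
  have hcm : AEStronglyMeasurable (K'.indicator c) μ :=
    (aestronglyMeasurable_indicator_iff hK'.measurableSet).2
      (hc.aestronglyMeasurable_of_isCompact hK' hK'.measurableSet)
  have hci : ∀ x, 0 ≤ K'.indicator c x := fun x => indicator_nonneg hc0 x
  obtain ⟨Mc, hMc⟩ := hK'.exists_bound_of_continuousOn hc
  have hcb : ∀ x, K'.indicator c x ≤ |Mc| := fun x => by
    by_cases hx : x ∈ K'
    · rw [indicator_of_mem hx]
      exact (le_abs_self _).trans ((hMc x hx).trans (le_abs_self _))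
    · simp [hx]
  have hw1 : AEStronglyMeasurable (fun x => K'.indicator c x * rexp (-Φ x)) μ := hcm.mul hw2
  have hw10 : ∀ x, 0 ≤ K'.indicator c x * rexp (-Φ x) := fun x =>
    mul_nonneg (hci x) (exp_pos _).le
  have hw1b : ∀ x, K'.indicator c x * rexp (-Φ x) ≤ |Mc| * rexp MΦ := fun x =>
    mul_le_mul (hcb x) (hw2b x) (exp_pos _).le (abs_nonneg _)
  have hw1b' : ∀ x, ‖K'.indicator c x * rexp (-Φ x)‖ ≤ |Mc| * rexp MΦ := fun x => by
    rw [norm_of_nonneg (hw10 x)]; exact hw1b x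
  have hSconv := hDconv.add
    (LTwoConv.sum Finset.univ fun j _ =>
      ((hβconv j).bdd_mul (continuous_dz hPd (e j)).aestronglyMeasurable (hMP j)).neg)
  have hineq : ∀ n, ∑ j, ∫ x, (K'.indicator c x * rexp (-Φ x)) * ‖β n j x‖ ^ 2 ∂μ
      ≤ ∫ x, rexp (-Φ x) * ‖moll μ (ρ n) D x + ∑ j, -(dz (e j) P x * β n j x)‖ ^ 2 ∂μ
        + (1 / 2) * ∑ j, ∑ k, ∫ x, rexp (-Φ x) * ‖moll μ (ρ n) (B j k) x‖ ^ 2 ∂μ := by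
    intro n
    convert hmkh n using 1
    · rw [← integral_finsetSum _ fun j _ =>
        integrable_weight_mul_norm_sq ((hβconv j).memLp n) hw1 hw1b']
      congr 1; ext x
      rw [← mul_sum]; ring
    · congr 1
      · congr 1; ext x
        have := sum_dz_moll hΦ hγ hk hθ hθc hθΩ hadj (hρ n) x
        simp only [wdelta, sum_sub_distrib, β, D, sum_neg_distrib]
        rw [this, mul_comm, ← sub_eq_add_neg]
      · simp only [← integral_finsetSum Finset.univ fun k _ =>
          integrable_weight_mul_norm_sq ((hBconv _ k).memLp n) hw2 hw2b']
        rw [← integral_finsetSum _ fun j _ => integrable_finsetSum _ fun k _ =>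
          integrable_weight_mul_norm_sq ((hBconv j k).memLp n) hw2 hw2b', ← integral_const_mul]
        congr 1; ext x
        simp only [← mul_sum]
        have : ∀ j k, dbar (e j) (β n k) x - dbar (e k) (β n j) x = moll μ (ρ n) (B j k) x :=
          fun j k => dbar_moll_sub hγ hθ hθc hθΩ hclosed (hρ n) j k x
        simp only [this]; ring
  have hlim := le_of_tendsto_of_tendsto'
    (tendsto_finsetSum _ fun j _ => (hβconv j).tendsto_integral hw1 hw10 hw1b)
    ((hSconv.tendsto_integral hw2 (fun x => (exp_pos _).le) hw2b).add
      ((tendsto_finsetSum _ fun j _ => tendsto_finsetSum _ fun k _ =>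
        (hBconv j k).tendsto_integral hw2 (fun x => (exp_pos _).le) hw2b).const_mul (1 / 2)))
    hineq
  have hS2 := hSconv.memLp_lim
  have i1 := integrable_weight_mul_norm_sq hS2 hw2 hw2b'
  have i2 := fun j k => integrable_weight_mul_norm_sq (hB j k) hw2 hw2b'
  have i3 : Integrable (fun x => rexp (-Φ x) * (2 * ‖T x * kap x‖ ^ 2)) μ := by
    refine ((integrable_weight_mul_norm_sq hkT hw2 hw2b').const_mul 2).congr
      (.of_forall fun x => ?_)
    simp only; ring
  have i4 : Integrable (fun x => rexp (-Φ x) *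
      (4 * ∑ j, ∑ k, ‖dz (e j) T x * γ k x‖ ^ 2)) μ := by
    refine ((integrable_finsetSum Finset.univ fun j _ => integrable_finsetSum Finset.univ fun k _ =>
      integrable_weight_mul_norm_sq (hzT j k) hw2 hw2b').const_mul 4).congr
      (.of_forall fun x => ?_)
    simp only [← mul_sum]; ring
  have i0 := fun j => integrable_weight_mul_norm_sq (hG j) hw1 hw1b'
  have hE0 : ∀ x, 0 ≤ rexp (-Φ x) := fun x => (exp_pos _).le
  rw [← ofReal_integral_eq_lintegral_ofReal i3
      (.of_forall fun x => mul_nonneg (hE0 x) (by positivity)),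
    ← ofReal_integral_eq_lintegral_ofReal i4
      (.of_forall fun x => mul_nonneg (hE0 x) (by positivity)),
    ← eofReal_add (integral_nonneg fun x => by positivity)
      (integral_nonneg fun x => by positivity),
    sum_congr rfl fun j _ => (ofReal_integral_eq_lintegral_ofReal (i0 j)
      (.of_forall fun x => mul_nonneg (hw10 x) (by positivity))).symm,
    ← ofReal_sum_of_nonneg fun j _ => integral_nonneg fun x =>
      mul_nonneg (hw10 x) (by positivity)]
  refine ofReal_le_ofReal (hlim.trans ?_)
  simp only [← integral_finsetSum Finset.univ fun k _ => i2 _ k]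
  rw [← integral_finsetSum _ fun j _ => integrable_finsetSum _ fun k _ => i2 j k,
    ← integral_const_mul, ← integral_add i1 ((integrable_finsetSum _ fun j _ =>
      integrable_finsetSum _ fun k _ => i2 j k).const_mul _), ← integral_add i3 i4]
  refine integral_mono (i1.add ((integrable_finsetSum _ fun j _ =>
      integrable_finsetSum _ fun k _ => i2 j k).const_mul _)) (i3.add i4) fun x => ?_
  simp only [← mul_sum]
  have hS : D x + ∑ j, -(dz (e j) P x * (T x * γ j x))
      = -(T x * kap x) + ∑ j, dz (e j) T x * γ j x := by
    simp only [D, sum_add_distrib, sum_neg_distrib]; ring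
  have hbz : ∀ j, ‖dbar (e j) T x‖ = ‖dz (e j) T x‖ := fun j => by
    rw [hT, ← conj_dz_ofReal, RCLike.norm_conj]
  have e1 := norm_neg_add_sum_sq_le (T x * kap x) (fun j => dz (e j) T x) (fun j => γ j x)
  have e2 := half_sum_sum_sq_le (fun j => dbar (e j) T x) (fun j => γ j x)
  simp only [hbz] at e2
  rw [← hS] at e1
  have e3 : ∑ j, ∑ k, ‖dz (e j) T x * γ k x‖ ^ 2
      = (∑ j, ‖dz (e j) T x‖ ^ 2) * ∑ k, ‖γ k x‖ ^ 2 := by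
    simp only [norm_mul, mul_pow, sum_mul_sum]
  rw [e3]
  have hE := exp_pos (-Φ x)
  simp only [B]
  nlinarith [mul_le_mul_of_nonneg_left (add_le_add e1 e2) hE.le]

theorem weak_inequality {Ω : Set W} (hΩ : IsOpen Ω) {Φ c : W → ℝ} (hΦ : ContDiffOn ℝ 2 Φ Ω)
    (hc : ContinuousOn c Ω) (hc0 : ∀ x ∈ Ω, 0 ≤ c x)
    (hlevi : ∀ x ∈ Ω, ∀ b : κ → ℂ, c x * ∑ j, ‖b j‖ ^ 2 ≤ levi Φ x (∑ j, b j • e j))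
    (hγ : ∀ j, LocL2 μ Ω (γ j)) (hk : LocL2 μ Ω kap) (hθ : ContDiff ℝ 2 θ)
    (hθc : HasCompactSupport θ) (hθΩ : tsupport θ ⊆ Ω)
    (hclosed : WeakClosed μ e γ Ω) (hadj : WeakAdjoint μ e Φ γ kap Ω) :
    ∑ j, ∫⁻ x in Ω, eofReal (c x * rexp (-Φ x) * (θ x ^ 2 * ‖γ j x‖ ^ 2)) ∂μ
      ≤ 2 * ∫⁻ x in Ω, eofReal (rexp (-Φ x) * (θ x ^ 2 * ‖kap x‖ ^ 2)) ∂μ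
        + 4 * ∫⁻ x in Ω, eofReal (rexp (-Φ x) *
          ((∑ j, ‖dz (e j) ℂ∘θ x‖ ^ 2) * ∑ j, ‖γ j x‖ ^ 2)) ∂μ := by
  obtain ⟨ε, hε, hεΩ⟩ := hθc.isCompact.exists_cthickening_subset_open hΩ hθΩ
  have hK' : IsCompact (cthickening ε (tsupport θ)) := hθc.isCompact.cthickening
  set K' := cthickening ε (tsupport θ) with hK'def
  have hθK' : tsupport θ ⊆ K' := self_subset_cthickening _
  obtain ⟨χ, hχ, hχc, hχΩ, hχ01, hχ1⟩ := exists_cutoff hK' hΩ hεΩ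
  have hχ2 : ContDiff ℝ 2 χ := hχ.of_le (WithTop.coe_le_coe.2 (le_top : (2 : ℕ∞) ≤ ⊤))
  have hΦ' : ContDiff ℝ 2 fun x => χ x * Φ x := by
    rw [contDiff_iff_contDiffAt]
    intro x
    by_cases hx : x ∈ tsupport χ
    · exact hχ2.contDiffAt.mul (hΦ.contDiffAt (hΩ.mem_nhds (hχΩ hx)))
    · refine (contDiffAt_const (c := (0 : ℝ))).congr_of_eventuallyEq ?_
      filter_upwards [(isClosed_tsupport χ).isOpen_compl.mem_nhds hx] with y hy
      simp [image_eq_zero_of_notMem_tsupport hy]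
  have heq : ∀ x ∈ K', (fun x => χ x * Φ x) =ᶠ[𝓝 x] Φ := fun x hx => by
    filter_upwards [(eventually_nhdsSet_iff_forall.1 hχ1) x hx] with y hy
    simp [hy]
  have hlev : ∀ x ∈ K', ∀ v, levi (fun x => χ x * Φ x) x v = levi Φ x v := fun x hx v => by
    rw [levi, levi, (heq x hx).fderiv.fderiv_eq]
  have hdz : ∀ x ∈ K', ∀ v, dz v (fun y => ((χ y * Φ y : ℝ) : ℂ)) x
      = dz v ℂ∘Φ x := fun x hx v => by
    have : (fun y => ((χ y * Φ y : ℝ) : ℂ)) =ᶠ[𝓝 x] fun y => (Φ y : ℂ) := by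
      filter_upwards [heq x hx] with y hy using by rw [hy]
    rw [dz, dz, this.fderiv_eq]
  have hT0 : ∀ x ∉ tsupport θ, θ x = 0 := fun x hx => image_eq_zero_of_notMem_tsupport hx
  have hz0 : ∀ j, ∀ x ∉ tsupport θ, dz (e j) ℂ∘θ x = 0 := fun j x hx => by
    refine image_eq_zero_of_notMem_tsupport fun h => hx ?_
    exact closure_mono (fun y hy => by simpa using hy) (tsupport_dz_subset _ _ h)
  have key := weak_inequality_of_compact (μ := μ) (e := e) (c := c) hΦ' hχc.mul_right hK' hε
    (thickening_subset_cthickening _ _) (hc.mono hεΩ) (fun x hx => hc0 x (hεΩ hx))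
    (fun x hx b => by rw [hlev x hx]; exact hlevi x (hεΩ hx) b) hγ hk hθ hθc hθΩ
    (fun j k ω hω => hclosed j k ω ⟨hω.1, hω.2.1, hω.2.2.trans hθΩ⟩) (fun ω hω => by
      rw [← hadj ω ⟨hω.1, hω.2.1, hω.2.2.trans hθΩ⟩]
      congr 1; ext x
      refine sum_congr rfl fun j _ => ?_
      by_cases hx : x ∈ tsupport θ
      · rw [hdz x (hθK' hx)]
      · simp [image_eq_zero_of_notMem_tsupport fun h => hx (hω.2.2 h)])
  have hexp : ∀ x ∈ tsupport θ, χ x * Φ x = Φ x := fun x hx => (heq x (hθK' hx)).self_of_nhds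
  have hind : ∀ f : W → ℝ≥0∞, (∀ x ∉ tsupport θ, f x = 0) → ∫⁻ x in Ω, f x ∂μ = ∫⁻ x, f x ∂μ := by
    intro f hf
    rw [← lintegral_indicator hΩ.measurableSet]
    refine lintegral_congr fun x => ?_
    by_cases hx : x ∈ Ω
    · simp [hx]
    · simp [hx, hf x fun h => hx (hθΩ h)]
  rw [← lintegral_const_mul' _ _ (by norm_num), ← lintegral_const_mul' _ _ (by norm_num),
    hind _ fun x hx => by simp [hT0 x hx], hind _ fun x hx => by simp [hz0 _ x hx],
    sum_congr rfl fun j _ => hind _ fun x hx => by simp [hT0 x hx]]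
  refine le_trans (le_of_eq ?_) (key.trans (le_of_eq ?_))
  · refine sum_congr rfl fun j _ => lintegral_congr fun x => ?_
    by_cases hx : x ∈ tsupport θ
    · rw [indicator_of_mem (hθK' hx), hexp x hx, norm_mul, mul_pow]
      simp
    · simp [hT0 x hx]
  · congr 1
    · refine lintegral_congr fun x => ?_
      by_cases hx : x ∈ tsupport θ
      · rw [hexp x hx, norm_mul, mul_pow, ← ENNReal.ofReal_ofNat 2,
          ← eofReal_mul (by norm_num)]
        congr 1
        simp only [norm_real, norm_eq_abs, sq_abs]; ring
      · simp [hT0 x hx]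
    · refine lintegral_congr fun x => ?_
      by_cases hx : x ∈ tsupport θ
      · rw [hexp x hx, ← ENNReal.ofReal_ofNat 4, ← eofReal_mul (by norm_num)]
        simp only [norm_mul, mul_pow, sum_mul_sum]; ring_nf
      · simp [hz0 _ x hx]

end WeakInequality

/-- Riesz representation for functionals dominated by a linear map into a Hilbert space. -/
lemma exists_inner_eq_of_norm_le {X H : Type*} [AddCommGroup X] [Module ℂ X]
    [NormedAddCommGroup H] [InnerProductSpace ℂ H] [CompleteSpace H] (S : X →ₗ[ℂ] H)
    (L : X →ₗ[ℂ] ℂ) {C : ℝ} (hC : 0 ≤ C) (h : ∀ x, ‖L x‖ ≤ C * ‖S x‖) :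
    ∃ g : H, ‖g‖ ≤ C ∧ ∀ x, L x = inner ℂ g (S x) := by
  have hker : LinearMap.ker S ≤ LinearMap.ker L := fun x hx => by
    have := h x
    rw [LinearMap.mem_ker.1 hx, norm_zero, mul_zero] at this
    exact LinearMap.mem_ker.2 (norm_le_zero_iff.1 this)
  let f : LinearMap.range S →ₗ[ℂ] ℂ :=
    ((LinearMap.ker S).liftQ L hker).comp S.quotKerEquivRange.symm.toLinearMap
  have hf : ∀ x, f ⟨S x, LinearMap.mem_range_self S x⟩ = L x := fun x => by
    have : S.quotKerEquivRange.symm ⟨S x, LinearMap.mem_range_self S x⟩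
        = (LinearMap.ker S).mkQ x := S.quotKerEquivRange_symm_apply_image x _
    simp [f, this]
  let F : StrongDual ℂ (LinearMap.range S) := f.mkContinuous C (by
    rintro ⟨_, x, rfl⟩
    rw [hf x]; exact h x)
  obtain ⟨G, hG, hGn⟩ := exists_extension_norm_eq (LinearMap.range S) F
  refine ⟨(InnerProductSpace.toDual ℂ H).symm G, ?_, fun x => ?_⟩
  · rw [LinearIsometryEquiv.norm_map, hGn]
    exact f.mkContinuous_norm_le hC _
  · rw [InnerProductSpace.toDual_symm_apply, ← hf x]
    exact (hG ⟨S x, LinearMap.mem_range_self S x⟩).symm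

lemma le_four_mul_of_le_half_succ {I : ℕ → ℝ≥0∞} {K G : ℝ≥0∞} (hG : G ≠ ⊤) {k₁ p : ℕ}
    (h1 : ∀ k, k₁ ≤ k → I k ≤ 2 * K + I (k + 1) / 2)
    (h2 : ∀ k : ℕ, I k ≤ (1 + k) ^ p * G) {k : ℕ} (hk : k₁ ≤ k) : I k ≤ 4 * K := by
  have hj : ∀ j k, k₁ ≤ k → I k ≤ 4 * K + I (k + j) * (1 / 2) ^ j := by
    intro j
    induction j with
    | zero => intro k _; simp
    | succ j ih =>
      intro k hk
      calc I k ≤ 2 * K + I (k + 1) / 2 := h1 k hk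
        _ ≤ 2 * K + (4 * K + I (k + 1 + j) * (1 / 2) ^ j) / 2 := by
          gcongr; exact ih (k + 1) (by omega)
        _ = (2 * K + 4 * K / 2) + I (k + 1 + j) * (1 / 2) ^ j / 2 := by
          rw [ENNReal.add_div, ← add_assoc]
        _ = 4 * K + I (k + (j + 1)) * (1 / 2) ^ (j + 1) := by
          have e1 : 4 * K / 2 = 2 * K := by
            rw [show (4 : ℝ≥0∞) * K = 2 * K * 2 by ring,
              ENNReal.mul_div_cancel_right (by norm_num) (by norm_num)]
          rw [e1, ← add_mul, show (2 : ℝ≥0∞) + 2 = 4 by norm_num,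
            show k + 1 + j = k + (j + 1) by ring, pow_succ, mul_div_assoc]
          congr 2
          rw [div_eq_mul_inv, one_div]
  have hlim : Tendsto (fun j : ℕ => 4 * K + eofReal ((1 + (k + j : ℕ) : ℝ) ^ p
      * (1 / 2) ^ j) * G) atTop (𝓝 (4 * K + eofReal 0 * G)) := by
    refine tendsto_const_nhds.add (ENNReal.Tendsto.mul_const (ENNReal.tendsto_ofReal ?_)
      (Or.inr hG))
    have h0 := tendsto_pow_const_mul_const_pow_of_abs_lt_one p (r := (1 / 2 : ℝ))
      (by rw [abs_of_pos] <;> norm_num)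
    have h3 := (h0.comp (tendsto_add_atTop_nat (1 + k))).const_mul (2 ^ (1 + k) : ℝ)
    rw [mul_zero] at h3
    refine h3.congr fun j => ?_
    simp only [Function.comp, one_div, inv_pow]
    push_cast
    rw [pow_add 2 j (1 + k)]
    field_simp
    ring
  rw [ENNReal.ofReal_zero, zero_mul, add_zero] at hlim
  refine ge_of_tendsto' hlim fun j => (hj j k hk).trans ?_
  refine add_le_add le_rfl ?_
  rw [eofReal_mul (by positivity), eofReal_pow (by positivity),
    eofReal_pow (by positivity), mul_right_comm]
  refine mul_le_mul' ((h2 _).trans (le_of_eq ?_)) (le_of_eq ?_)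
  · rw [eofReal_add (by norm_num) (by positivity), ENNReal.ofReal_natCast]; simp
  · rw [ENNReal.ofReal_div_of_pos (by norm_num)]; simp

lemma contDiff_mul_of_tsupport_subset {𝔸 : Type*} [NormedRing 𝔸] [NormedAlgebra ℝ 𝔸] {Ω : Set W}
    (hΩ : IsOpen Ω) {n : WithTop ℕ∞} {ω f : W → 𝔸} (hω : ContDiff ℝ n ω) (hωΩ : tsupport ω ⊆ Ω)
    (hf : ContDiffOn ℝ n f Ω) : ContDiff ℝ n fun x => ω x * f x := by
  rw [contDiff_iff_contDiffAt]
  intro x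
  by_cases hx : x ∈ tsupport ω
  · exact hω.contDiffAt.mul (hf.contDiffAt (hΩ.mem_nhds (hωΩ hx)))
  · refine (contDiffAt_const (c := (0 : 𝔸))).congr_of_eventuallyEq ?_
    filter_upwards [(isClosed_tsupport ω).isOpen_compl.mem_nhds hx] with y hy
    simp [image_eq_zero_of_notMem_tsupport hy]

lemma continuous_mul_of_tsupport_subset {Ω : Set W}
    (hΩ : IsOpen Ω) {ω f : W → ℂ} (hω : Continuous ω) (hωΩ : tsupport ω ⊆ Ω)
    (hf : ContinuousOn f Ω) : Continuous fun x => ω x * f x :=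
  contDiff_zero.1 (contDiff_mul_of_tsupport_subset hΩ (contDiff_zero.2 hω) hωΩ
    (contDiffOn_zero.2 hf))

lemma conj_mem_testFn {Ω : Set W} {ω : W → ℂ} (h : ω ∈ testFn Ω) :
    (fun x => conj (ω x)) ∈ testFn Ω := by
  have hs : tsupport (fun x => conj (ω x)) ⊆ tsupport ω :=
    closure_mono fun y hy => by simpa using hy
  exact ⟨conjCLE.contDiff.comp h.1, h.2.1.of_isClosed_subset (isClosed_tsupport _) hs, hs.trans h.2.2⟩

lemma mul_mem_testFn {Ω : Set W} (hΩ : IsOpen Ω) {ω f : W → ℂ} (h : ω ∈ testFn Ω)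
    (hf : ContDiffOn ℝ 2 f Ω) : (fun x => ω x * f x) ∈ testFn Ω :=
  ⟨contDiff_mul_of_tsupport_subset hΩ h.1 h.2.2 hf, h.2.1.mul_right,
    tsupport_mul_subset_left.trans h.2.2⟩

lemma dz_comp_ofReal {W : Type*} [NormedAddCommGroup W] [NormedSpace ℂ W] {Φ : W → ℝ} {τ : ℝ → ℝ}
    {x : W} (h : DifferentiableAt ℝ Φ x) (hτ : DifferentiableAt ℝ τ (Φ x)) (v : W) :
    dz v (fun y => (τ (Φ y) : ℂ)) x = ((deriv τ (Φ x) : ℝ) : ℂ) * dz v ℂ∘Φ x := by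
  have hc : HasFDerivAt (fun y => τ (Φ y)) (deriv τ (Φ x) • fderiv ℝ Φ x) x :=
    hτ.hasDerivAt.comp_hasFDerivAt x h.hasFDerivAt
  simp only [dz, fderiv_ofReal h, fderiv_ofReal hc.differentiableAt, hc.fderiv,
    _root_.smul_apply, smul_eq_mul]
  push_cast
  ring

/-- A smooth cutoff on the line, equal to `1` on `(-∞, 0]` and `0` on `[1, ∞)`. -/
lemma exists_line_cutoff : ∃ τ : ℝ → ℝ, ∃ A : ℝ, ContDiff ℝ 2 τ ∧ 0 ≤ A ∧ (∀ x, 0 ≤ τ x ∧ τ x ≤ 1) ∧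
    (∀ x ≤ 0, τ x = 1) ∧ (∀ x, 1 ≤ x → τ x = 0) ∧ (∀ x, |deriv τ x| ≤ A) ∧
    (∀ x < 0, deriv τ x = 0) ∧ ∀ x, 1 < x → deriv τ x = 0 := by
  let τ : ℝ → ℝ := fun x => 1 - Real.smoothTransition x
  have hτ : ContDiff ℝ 2 τ := contDiff_const.sub (Real.smoothTransition.contDiff (n := (2 : ℕ∞)))
  have h0 : ∀ x ≤ 0, τ x = 1 := fun x hx => by simp [τ, Real.smoothTransition.zero_of_nonpos hx]
  have h1 : ∀ x, 1 ≤ x → τ x = 0 := fun x hx => by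
    simp [τ, Real.smoothTransition.one_of_one_le hx]
  have d0 : ∀ x < 0, deriv τ x = 0 := fun x hx => by
    have : τ =ᶠ[𝓝 x] fun _ => 1 := by
      filter_upwards [Iio_mem_nhds hx] with y hy using h0 y (le_of_lt hy)
    rw [this.deriv_eq]; simp
  have d1 : ∀ x, 1 < x → deriv τ x = 0 := fun x hx => by
    have : τ =ᶠ[𝓝 x] fun _ => 0 := by
      filter_upwards [Ioi_mem_nhds hx] with y hy using h1 y (le_of_lt hy)
    rw [this.deriv_eq]; simp
  have hcont : Continuous (deriv τ) := hτ.continuous_deriv (by norm_num)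
  obtain ⟨A, hA⟩ := (HasCompactSupport.intro' (f := deriv τ) (K := Icc 0 1) isCompact_Icc
    isClosed_Icc fun x hx => by
      rw [Set.mem_Icc, not_and_or, not_le, not_le] at hx
      exact hx.elim (d0 x) (d1 x)).exists_bound_of_continuous hcont
  refine ⟨τ, A, hτ, (norm_nonneg _).trans (hA 0), fun x => ⟨?_, ?_⟩, h0, h1, hA, d0, d1⟩
  · simpa [τ] using Real.smoothTransition.le_one x
  · simpa [τ] using Real.smoothTransition.nonneg x

section Apriori
variable {κ : Type*} [Fintype κ] {e : κ → W} {γ : κ → W → ℂ} {kap : W → ℂ}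

omit [FiniteDimensional ℂ W] [MeasurableSpace W] [BorelSpace W] in
lemma exists_exhaustion_cutoff {Ω : Set W} (hΩ : IsOpen Ω) {s : W → ℝ} (hs : ContDiffOn ℝ 2 s Ω)
    (hcomp : ∀ a, IsCompact {x ∈ Ω | s x ≤ a}) (e : κ → W) :
    ∃ A : ℝ, 0 ≤ A ∧ ∀ k : ℝ, ∃ θ : W → ℝ, ContDiff ℝ 2 θ ∧ HasCompactSupport θ ∧ tsupport θ ⊆ Ω ∧
      (∀ x, θ x ^ 2 ≤ 1) ∧ (∀ x ∈ Ω, s x ≤ k → θ x = 1) ∧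
      (∀ x ∈ Ω, ∑ j, ‖dz (e j) ℂ∘θ x‖ ^ 2
        ≤ A * ∑ j, ‖dz (e j) ℂ∘s x‖ ^ 2) ∧
      (∀ x ∈ Ω, (s x < k ∨ k + 1 < s x) → ∑ j, ‖dz (e j) ℂ∘θ x‖ ^ 2 = 0) := by
  classical
  obtain ⟨τ, A, hτ, hA, h01, h0, h1, hd, d0, d1⟩ := exists_line_cutoff
  refine ⟨A ^ 2, sq_nonneg A, fun k => ?_⟩
  let θ : W → ℝ := fun x => if x ∈ Ω then τ (s x - k) else 0
  have hsupp : ∀ x ∉ {x ∈ Ω | s x ≤ k + 1}, θ x = 0 := fun x hx => by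
    by_cases h : x ∈ Ω
    · simp only [θ, h, if_true]
      apply h1
      have : ¬ s x ≤ k + 1 := fun h' => hx ⟨h, h'⟩
      linarith
    · simp [θ, h]
  have hev : ∀ x ∈ Ω, θ =ᶠ[𝓝 x] fun y => τ (s y - k) := fun x hx => by
    filter_upwards [hΩ.mem_nhds hx] with y hy
    simp [θ, hy]
  have hts : tsupport θ ⊆ {x ∈ Ω | s x ≤ k + 1} :=
    closure_minimal (fun x hx => by by_contra h; exact hx (hsupp x h)) (hcomp _).isClosed
  have hdz : ∀ x ∈ Ω, ∀ j, dz (e j) ℂ∘θ x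
      = ((deriv τ (s x - k) : ℝ) : ℂ) * dz (e j) ℂ∘s x := fun x hx j => by
    have hsx : DifferentiableAt ℝ s x :=
      ((hs.contDiffAt (hΩ.mem_nhds hx)).differentiableAt (by norm_num))
    have e1 : dz (e j) ℂ∘θ x = dz (e j) (fun y => (τ (s y - k) : ℂ)) x := by
      have : ℂ∘θ =ᶠ[𝓝 x] fun y => (τ (s y - k) : ℂ) := by
        filter_upwards [hev x hx] with y hy; rw [hy]
      simp only [dz, this.fderiv_eq]
    have e2 := dz_comp_ofReal (τ := fun y => τ (y - k)) hsx
      ((hτ.differentiable (by norm_num)).differentiableAt.comp _ (by fun_prop)) (e j)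
    rw [e1, e2, deriv_comp_sub_const]
  refine ⟨θ, ?_, (hcomp (k + 1)).of_isClosed_subset (isClosed_tsupport _) hts,
    hts.trans fun x hx => hx.1, fun x => ?_, fun x hx hk => ?_, fun x hx => ?_, fun x hx hk => ?_⟩
  · rw [contDiff_iff_contDiffAt]
    intro x
    by_cases hx : x ∈ Ω
    · exact (hτ.contDiffAt.comp x ((hs.contDiffAt (hΩ.mem_nhds hx)).sub
        contDiffAt_const)).congr_of_eventuallyEq (hev x hx)
    · refine (contDiffAt_const (c := (0 : ℝ))).congr_of_eventuallyEq ?_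
      filter_upwards [(hcomp (k + 1)).isClosed.isOpen_compl.mem_nhds fun h => hx h.1] with y hy
        using hsupp y hy
  · by_cases hx : x ∈ Ω
    · simp only [θ, hx, if_true]
      have := h01 (s x - k)
      nlinarith
    · simp [θ, hx]
  · simp only [θ, hx, if_true]
    exact h0 _ (by linarith)
  · rw [mul_sum]
    refine sum_le_sum fun j _ => ?_
    rw [hdz x hx, norm_mul, mul_pow, norm_real, norm_eq_abs]
    gcongr
    exact hd _
  · refine Finset.sum_eq_zero fun j _ => ?_
    rw [hdz x hx, hk.elim (fun h => d0 _ (by linarith)) fun h => d1 _ (by linarith)]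
    simp

/-- A weight `Φ` on `Ω` whose complex Hessian dominates `c ≥ δ`, together with an exhaustion `s`
whose gradient is small relative to `c`. -/
structure LeviWeight (e : κ → W) (Ω : Set W) (Φ s c : W → ℝ) (δ M : ℝ) (p : ℕ) : Prop where
  isOpen : IsOpen Ω
  smooth : ContDiffOn ℝ 2 Φ Ω
  smooth' : ContDiffOn ℝ 2 s Ω
  nonneg : ∀ x ∈ Ω, 0 ≤ s x
  compact : ∀ a, IsCompact {x ∈ Ω | s x ≤ a}
  cont : ContinuousOn c Ω
  pos : 0 < δ
  le : ∀ x ∈ Ω, δ ≤ c x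
  levi_le : ∀ x ∈ Ω, ∀ b : κ → ℂ, c x * ∑ j, ‖b j‖ ^ 2 ≤ levi Φ x (∑ j, b j • e j)
  grad : ∀ A : ℝ, ∃ k : ℕ, ∀ x ∈ Ω, k ≤ s x → A * ∑ j, ‖dz (e j) ℂ∘s x‖ ^ 2 ≤ c x
  const_nonneg : 0 ≤ M
  growth : ∀ x ∈ Ω, c x ≤ M * (1 + s x) ^ p

/-- The a priori estimate for the `∂̄`-complex with an exhaustion function of small gradient. -/
theorem apriori_estimate {Ω : Set W} {Φ s c : W → ℝ} {δ M : ℝ} {p : ℕ}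
    (hw : LeviWeight e Ω Φ s c δ M p)
    (hγ : ∀ j, LocL2 μ Ω (γ j)) (hk : LocL2 μ Ω kap)
    (hclosed : WeakClosed μ e γ Ω) (hadj : WeakAdjoint μ e Φ γ kap Ω)
    (hG : ∫⁻ x in Ω, eofReal (rexp (-Φ x) * ∑ j, ‖γ j x‖ ^ 2) ∂μ ≠ ⊤) :
    eofReal δ * ∫⁻ x in Ω, eofReal (rexp (-Φ x) * ∑ j, ‖γ j x‖ ^ 2) ∂μ
      ≤ 4 * ∫⁻ x in Ω, eofReal (rexp (-Φ x) * ‖kap x‖ ^ 2) ∂μ := by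
  obtain ⟨hΩ, hΦ, hs, hs0, hcomp, hc, hδ, hcδ, hlevi, hgrad, hM, hgrowth⟩ := hw
  have hc0 : ∀ x ∈ Ω, 0 ≤ c x := fun x hx => hδ.le.trans (hcδ x hx)
  obtain ⟨A, hA, hcut⟩ := exists_exhaustion_cutoff hΩ hs hcomp e
  obtain ⟨k₁, hk₁⟩ := hgrad (8 * A)
  set Kc : ℕ → Set W := fun k => {x ∈ Ω | s x ≤ k} with hKc
  have hKm : ∀ k, MeasurableSet (Kc k) := fun k => (hcomp k).measurableSet
  have hKΩ : ∀ k, Kc k ⊆ Ω := fun k x hx => hx.1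
  set J : W → ℝ := fun x => rexp (-Φ x) * ∑ j, ‖γ j x‖ ^ 2
  have hJ0 : ∀ x, 0 ≤ J x := fun x => by positivity
  set G := ∫⁻ x in Ω, eofReal (J x) ∂μ
  set K := ∫⁻ x in Ω, eofReal (rexp (-Φ x) * ‖kap x‖ ^ 2) ∂μ
  set Ik : ℕ → ℝ≥0∞ := fun k => ∫⁻ x in Kc k, eofReal (c x * J x) ∂μ with hIk
  have h1 : ∀ k, k₁ ≤ k → Ik k ≤ 2 * K + Ik (k + 1) / 2 := by
    intro k hkk
    obtain ⟨θ, hθ, hθc, hθΩ, hθ1, hθk, hdθ, hdθ0⟩ := hcut k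
    have hw := weak_inequality (μ := μ) hΩ hΦ hc hc0 hlevi hγ hk hθ hθc hθΩ hclosed hadj
    have l1 : Ik k ≤ ∑ j, ∫⁻ x in Ω,
        eofReal (c x * rexp (-Φ x) * (θ x ^ 2 * ‖γ j x‖ ^ 2)) ∂μ := by
      have : Ik k = ∑ j, ∫⁻ x in Kc k,
          eofReal (c x * rexp (-Φ x) * (θ x ^ 2 * ‖γ j x‖ ^ 2)) ∂μ := by
        rw [← lintegral_finsetSum']
        · refine setLIntegral_congr_fun (hKm k) fun x hx => ?_
          rw [← ofReal_sum_of_nonneg fun j _ => by have := hc0 x hx.1; positivity]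
          congr 1
          simp only [J, hθk x hx.1 hx.2, mul_sum]
          exact sum_congr rfl fun j _ => by ring
        · intro j _
          have m1 : AEMeasurable c (μ.restrict (Kc k)) := (hc.mono (hKΩ k)).aemeasurable (hKm k)
          have m2 : AEMeasurable Φ (μ.restrict (Kc k)) :=
            (hΦ.continuousOn.mono (hKΩ k)).aemeasurable (hKm k)
          have m3 : AEMeasurable (γ j) (μ.restrict (Kc k)) :=
            (hγ j _ (hKΩ k) (hcomp k)).1.aemeasurable
          exact ((m1.mul m2.neg.exp).mul
            ((hθ.continuous.measurable.pow_const 2).aemeasurable.mul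
              (m3.norm.pow_const 2))).ennreal_ofReal
      rw [this]
      exact sum_le_sum fun j _ => lintegral_mono_set (hKΩ k)
    have l2 : ∫⁻ x in Ω, eofReal (rexp (-Φ x) * (θ x ^ 2 * ‖kap x‖ ^ 2)) ∂μ ≤ K := by
      refine lintegral_mono fun x => ofReal_le_ofReal ?_
      gcongr
      exact mul_le_of_le_one_left (by positivity) (hθ1 x)
    have l3 : 4 * ∫⁻ x in Ω, eofReal (rexp (-Φ x) *
        ((∑ j, ‖dz (e j) ℂ∘θ x‖ ^ 2) * ∑ j, ‖γ j x‖ ^ 2)) ∂μ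
        ≤ Ik (k + 1) / 2 := by
      rw [ENNReal.le_div_iff_mul_le (by norm_num) (by norm_num), mul_comm, ← mul_assoc,
        ← lintegral_const_mul' _ _ (by norm_num)]
      calc _ ≤ ∫⁻ x in Ω, (Kc (k + 1)).indicator (fun x => eofReal (c x * J x)) x ∂μ := by
            refine setLIntegral_mono' hΩ.measurableSet fun x hx => ?_
            have key : (2 * 4 : ℝ≥0∞) * eofReal (rexp (-Φ x) *
                ((∑ j, ‖dz (e j) ℂ∘θ x‖ ^ 2) * ∑ j, ‖γ j x‖ ^ 2))
                = eofReal ((8 * ∑ j, ‖dz (e j) ℂ∘θ x‖ ^ 2) * J x) := by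
              rw [show (2 * 4 : ℝ≥0∞) = eofReal 8 by norm_num,
                ← eofReal_mul (by norm_num)]
              congr 1; simp only [J]; ring
            rw [key]
            by_cases hx1 : s x < k ∨ (k : ℝ) + 1 < s x
            · rw [hdθ0 x hx hx1]; simp
            · rw [not_or, not_lt, not_lt] at hx1
              rw [indicator_of_mem (show x ∈ Kc (k + 1) from ⟨hx, by push_cast; exact hx1.2⟩)]
              refine ofReal_le_ofReal (mul_le_mul_of_nonneg_right ?_ (hJ0 x))
              refine le_trans ?_ (hk₁ x hx (le_trans (by exact_mod_cast hkk) hx1.1))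
              rw [mul_assoc]
              exact mul_le_mul_of_nonneg_left (hdθ x hx) (by norm_num)
        _ = Ik (k + 1) := by
            rw [setLIntegral_indicator (hKm _), Set.inter_eq_self_of_subset_left (hKΩ _)]
    exact l1.trans (hw.trans (add_le_add (mul_le_mul_right l2 _) l3))
  have h2 : ∀ k : ℕ, Ik k ≤ (1 + k) ^ p * (eofReal M * G) := by
    intro k
    calc Ik k ≤ ∫⁻ x in Kc k, eofReal (M * (1 + k) ^ p) * eofReal (J x) ∂μ := by
          refine setLIntegral_mono' (hKm k) fun x hx => ?_
          rw [← eofReal_mul (by positivity)]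
          refine ofReal_le_ofReal (mul_le_mul_of_nonneg_right ?_ (hJ0 x))
          refine (hgrowth x hx.1).trans (mul_le_mul_of_nonneg_left ?_ hM)
          have := hs0 x hx.1
          exact pow_le_pow_left₀ (by linarith) (by linarith [hx.2]) p
      _ = eofReal (M * (1 + k) ^ p) * ∫⁻ x in Kc k, eofReal (J x) ∂μ :=
          lintegral_const_mul' _ _ ofReal_ne_top
      _ ≤ eofReal (M * (1 + k) ^ p) * G :=
          mul_le_mul_right (lintegral_mono_set (hKΩ k)) _
      _ = _ := by
          rw [eofReal_mul hM, eofReal_pow (by positivity),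
            eofReal_add (by norm_num) (by positivity), ENNReal.ofReal_natCast,
            ENNReal.ofReal_one]
          ring
  have h3 : ∀ k, eofReal δ * ∫⁻ x in Kc k, eofReal (J x) ∂μ ≤ 4 * K := by
    intro k
    have hmono : ∫⁻ x in Kc k, eofReal (J x) ∂μ
        ≤ ∫⁻ x in Kc (max k k₁), eofReal (J x) ∂μ :=
      lintegral_mono_set fun x hx => ⟨hx.1, hx.2.trans (by exact_mod_cast le_max_left _ _)⟩
    refine le_trans ?_ (le_four_mul_of_le_half_succ
      (mul_ne_top ofReal_ne_top hG) h1 h2 (le_max_right k k₁))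
    refine (mul_le_mul_right hmono _).trans ?_
    rw [← lintegral_const_mul' _ _ ofReal_ne_top]
    refine setLIntegral_mono' (hKm _) fun x hx => ?_
    rw [← eofReal_mul hδ.le]
    exact ofReal_le_ofReal (mul_le_mul_of_nonneg_right (hcδ x hx.1) (hJ0 x))
  have hU : ⋃ k, Kc k = Ω := by
    ext x
    simp only [hKc, Set.mem_iUnion, Set.mem_setOf_eq]
    refine ⟨fun ⟨k, h, _⟩ => h, fun h => ?_⟩
    obtain ⟨k, hk⟩ := exists_nat_ge (s x)
    exact ⟨k, h, hk⟩
  have hdir : Directed (· ⊆ ·) Kc := by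
    refine Monotone.directed_le (f := Kc) fun a b hab x hx => ?_
    exact ⟨hx.1, hx.2.trans (by exact_mod_cast hab)⟩
  have hGs : G = ⨆ k, ∫⁻ x in Kc k, eofReal (J x) ∂μ := by
    rw [← setLIntegral_iUnion_of_directed _ hdir, hU]
  rw [hGs, ENNReal.mul_iSup]
  exact iSup_le h3

end Apriori

section LTwoSpace
variable {α : Type*} [MeasurableSpace α] {ν : Measure α}

/-- The class in `L²` of a function, `0` if the function is not in `L²`. -/
def lpOf (ν : Measure α) (f : α → ℂ) : Lp ℂ 2 ν := by
  classical exact if h : MemLp f 2 ν then h.toLp f else 0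

lemma lpOf_coeFn {f : α → ℂ} (h : MemLp f 2 ν) : lpOf ν f =ᵐ[ν] f := by
  rw [lpOf, dif_pos h]; exact h.coeFn_toLp

lemma lpOf_add {f g : α → ℂ} (hf : MemLp f 2 ν) (hg : MemLp g 2 ν) :
    lpOf ν (fun x => f x + g x) = lpOf ν f + lpOf ν g := by
  refine Lp.ext ?_
  filter_upwards [lpOf_coeFn (hf.add hg), lpOf_coeFn hf, lpOf_coeFn hg,
    Lp.coeFn_add (lpOf ν f) (lpOf ν g)] with x h1 h2 h3 h4
  rw [h4, Pi.add_apply, h2, h3]; exact h1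

lemma lpOf_smul {f : α → ℂ} (c : ℂ) (hf : MemLp f 2 ν) :
    lpOf ν (fun x => c * f x) = c • lpOf ν f := by
  refine Lp.ext ?_
  filter_upwards [lpOf_coeFn (hf.const_smul c), lpOf_coeFn hf,
    Lp.coeFn_smul c (lpOf ν f)] with x h1 h2 h4
  rw [h4, Pi.smul_apply, h2]; exact h1

lemma inner_lpOf {f : α → ℂ} (hf : MemLp f 2 ν) (x : Lp ℂ 2 ν) :
    inner ℂ (lpOf ν f) x = ∫ y, conj (f y) * x y ∂ν := by
  rw [L2.inner_def]
  refine integral_congr_ae ?_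
  filter_upwards [lpOf_coeFn hf] with y hy
  rw [hy, RCLike.inner_apply, mul_comm]

lemma ofReal_norm_sq_Lp (f : Lp ℂ 2 ν) :
    eofReal (‖f‖ ^ 2) = ∫⁻ x, eofReal (‖f x‖ ^ 2) ∂ν := by
  have h1 := lintegral_enorm_sq_eq (ν := ν) (f := f)
  have h2 : ∀ x, eofReal (‖f x‖ ^ 2) = ‖f x‖ₑ ^ 2 := fun x => by
    rw [eofReal_pow (norm_nonneg _), ofReal_norm]
  simp only [h2]
  rw [h1, Lp.norm_def, eofReal_pow ENNReal.toReal_nonneg,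
    ofReal_toReal (Lp.memLp f).2.ne]

lemma ofReal_norm_sq_lpOf {f : α → ℂ} (hf : MemLp f 2 ν) :
    eofReal (‖lpOf ν f‖ ^ 2) = ∫⁻ x, eofReal (‖f x‖ ^ 2) ∂ν := by
  rw [ofReal_norm_sq_Lp]
  refine lintegral_congr_ae ?_
  filter_upwards [lpOf_coeFn hf] with y hy
  rw [hy]

/-- Tuples `x` of vectors with `⟪u j i, x k⟫ = ⟪u k i, x j⟫` for all `i, j, k`. -/
def symmTuples {κ ι H : Type*} [Fintype κ] [NormedAddCommGroup H] [InnerProductSpace ℂ H]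
    (u : κ → ι → H) : Submodule ℂ (PiLp 2 fun _ : κ => H) where
  carrier := {x | ∀ j k i, inner ℂ (u j i) (x k) = inner ℂ (u k i) (x j)}
  add_mem' := fun {a b} ha hb j k i => by
    simp only [PiLp.add_apply, inner_add_right, ha j k i, hb j k i]
  zero_mem' := fun j k i => by simp
  smul_mem' := fun c a ha j k i => by
    simp only [PiLp.smul_apply, inner_smul_right, ha j k i]

lemma isClosed_symmTuples {κ ι H : Type*} [Fintype κ] [NormedAddCommGroup H]
    [InnerProductSpace ℂ H] (u : κ → ι → H) :
    IsClosed (symmTuples u : Set (PiLp 2 fun _ : κ => H)) := by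
  have : (symmTuples u : Set (PiLp 2 fun _ : κ => H))
      = ⋂ (j) (k) (i), {x | inner ℂ (u j i) (x k) = inner ℂ (u k i) (x j)} := by
    ext x; simp [symmTuples]
  rw [this]
  refine isClosed_iInter fun j => isClosed_iInter fun k => isClosed_iInter fun i => ?_
  exact isClosed_eq (by fun_prop) (by fun_prop)

end LTwoSpace

section CompactlySupported

/-- Continuous functions with compact support in `Ω`. -/
structure IsCC (Ω : Set W) (f : W → ℂ) : Prop where
  cont : Continuous f
  cpt : HasCompactSupport f
  sub : tsupport f ⊆ Ω

namespace IsCC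
variable {Ω : Set W} {f g : W → ℂ}


lemma eq_zero (h : IsCC Ω f) : ∀ x ∉ Ω, f x = 0 := fun _ hx =>
  image_eq_zero_of_notMem_tsupport fun h' => hx (h.sub h')

lemma mul (h : IsCC Ω f) (hΩ : IsOpen Ω) (hg : ContinuousOn g Ω) : IsCC Ω fun x => f x * g x :=
  ⟨continuous_mul_of_tsupport_subset hΩ h.cont h.sub hg, h.cpt.mul_right,
    tsupport_mul_subset_left.trans h.sub⟩

lemma add (hf : IsCC Ω f) (hg : IsCC Ω g) : IsCC Ω fun x => f x + g x :=
  ⟨hf.cont.add hg.cont, hf.cpt.add hg.cpt,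
    (tsupport_add f g).trans (union_subset hf.sub hg.sub)⟩

lemma conjugate (hf : IsCC Ω f) : IsCC Ω fun x => conj (f x) := by
  have hs : tsupport (fun x => conj (f x)) ⊆ tsupport f :=
    closure_mono fun y hy => by simpa using hy
  exact ⟨continuous_conj.comp hf.cont, hf.cpt.of_isClosed_subset (isClosed_tsupport _) hs,
    hs.trans hf.sub⟩

lemma neg (hf : IsCC Ω f) (hΩ : IsOpen Ω) : IsCC Ω fun x => -f x := by
  simpa using hf.mul hΩ (g := fun _ => -1) continuousOn_const

lemma sum {κ : Type*} {f : κ → W → ℂ} (s : Finset κ) (hf : ∀ j ∈ s, IsCC Ω (f j)) :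
    IsCC Ω fun x => ∑ j ∈ s, f j x := by
  classical
  induction s using induction_on with
  | empty => exact ⟨by simpa using continuous_const, by simp only [Finset.sum_empty]; exact HasCompactSupport.zero,
      by simp⟩
  | insert a s ha ih =>
    simp only [sum_insert ha]
    exact (hf a (mem_insert_self a s)).add
      (ih fun j hj => hf j (mem_insert_of_mem hj))

lemma of_testFn (h : f ∈ testFn Ω) : IsCC Ω f := ⟨h.1.continuous, h.2.1, h.2.2⟩

lemma dz (h : f ∈ testFn Ω) (v : W) : IsCC Ω (dz v f) :=
  ⟨continuous_dz (h.1.of_le (by norm_num)) v,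
    h.2.1.of_isClosed_subset (isClosed_tsupport _) (tsupport_dz_subset v f),
    (tsupport_dz_subset v f).trans h.2.2⟩

lemma dbar (h : f ∈ testFn Ω) (v : W) : IsCC Ω (dbar v f) :=
  ⟨continuous_dbar (h.1.of_le (by norm_num)) v,
    h.2.1.of_isClosed_subset (isClosed_tsupport _) (tsupport_dbar_subset v f),
    (tsupport_dbar_subset v f).trans h.2.2⟩

end IsCC

lemma IsCC.memLp {Ω : Set W} {f : W → ℂ} (h : IsCC Ω f) (s : Set W) : MemLp f 2 (μ.restrict s) :=
  (h.cont.memLp_of_hasCompactSupport h.cpt).restrict s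

lemma IsCC.inner_lpOf_eq {Ω : Set W} {f : W → ℂ} (h : IsCC Ω f) (x : Lp ℂ 2 (μ.restrict Ω)) :
    inner ℂ (lpOf (μ.restrict Ω) f) x = ∫ y, conj (f y) * x y ∂μ := by
  rw [inner_lpOf (h.memLp Ω)]
  exact setIntegral_eq_integral_of_forall_compl_eq_zero fun y hy => by simp [h.eq_zero y hy]

lemma IsCC.inner_lpOf_lpOf {Ω : Set W} (hΩ : MeasurableSet Ω) {f g : W → ℂ} (h : IsCC Ω f)
    (hg : MemLp g 2 (μ.restrict Ω)) :
    inner ℂ (lpOf (μ.restrict Ω) f) (lpOf (μ.restrict Ω) g)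
      = ∫ y, conj (f y) * g y ∂μ := by
  rw [inner_lpOf (h.memLp Ω)]
  have : ∫ y, conj (f y) * lpOf (μ.restrict Ω) g y ∂(μ.restrict Ω)
      = ∫ y, conj (f y) * g y ∂(μ.restrict Ω) := by
    refine integral_congr_ae ?_
    filter_upwards [lpOf_coeFn hg] with y hy
    rw [hy]
  rw [this]
  exact setIntegral_eq_integral_of_forall_compl_eq_zero fun y hy => by simp [h.eq_zero y hy]

lemma locL2_mul {Ω : Set W} {f w : W → ℂ} (hf : MemLp f 2 (μ.restrict Ω))
    (hw : ContinuousOn w Ω) : LocL2 μ Ω fun x => w x * f x := by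
  intro K hK hKc
  obtain ⟨M, hM⟩ := hKc.exists_bound_of_continuousOn (hw.mono hK)
  refine (hf.mono_measure (Measure.restrict_mono hK le_rfl)).of_le_mul (c := M)
    (((hw.mono hK).aestronglyMeasurable hKc.measurableSet).mul
      (hf.1.mono_measure (Measure.restrict_mono hK le_rfl))) ?_
  filter_upwards [ae_restrict_mem hKc.measurableSet] with x hx
  rw [norm_mul]
  gcongr
  exact hM x hx

lemma integral_dz_mul {f g : W → ℂ} (hf : ContDiff ℝ 1 f) (hfc : HasCompactSupport f)
    (hg : ContDiff ℝ 1 g) (v : W) : ∫ x, dz v f x * g x ∂μ = -∫ x, f x * dz v g x ∂μ := by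
  have h1 : (1 : WithTop ℕ∞) ≠ 0 := by norm_num
  have h0 : ∫ x, dz v (fun y => f y * g y) x ∂μ = 0 := by
    have := integral_dbar_eq_zero (μ := μ) (f := fun y => conj (f y * g y))
      (conjCLE.contDiff.comp (hf.mul hg))
      ((hfc.mul_right (f' := g)).comp_left (g := starRingEnd ℂ) (map_zero _)) v
    simp only [dbar_conj] at this
    rw [integral_conj] at this
    simpa using this
  have key : ∀ x, dz v (fun y => f y * g y) x = f x * dz v g x + dz v f x * g x := fun x => by
    rw [dz_mul (hf.differentiable h1 x) (hg.differentiable h1 x)]; ring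
  simp only [key] at h0
  rw [integral_add] at h0
  · linear_combination h0
  · exact (hf.continuous.mul (continuous_dz hg v)).integrable_of_hasCompactSupport hfc.mul_right
  · exact ((continuous_dz hf v).mul hg.continuous).integrable_of_hasCompactSupport
      ((hasCompactSupport_dz hfc v).mul_right)

lemma integral_dbar_mul {f g : W → ℂ} (hf : ContDiff ℝ 1 f) (hfc : HasCompactSupport f)
    (hg : ContDiff ℝ 1 g) (v : W) : ∫ x, dbar v f x * g x ∂μ = -∫ x, f x * dbar v g x ∂μ := by
  have h1 : (1 : WithTop ℕ∞) ≠ 0 := by norm_num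
  have h0 := integral_dbar_eq_zero (μ := μ) (hf.mul hg) (hfc.mul_right (f' := g)) v
  have key : ∀ x, dbar v (fun y => f y * g y) x = f x * dbar v g x + dbar v f x * g x := fun x => by
    rw [dbar_mul (hf.differentiable h1 x) (hg.differentiable h1 x)]; ring
  change ∫ x, dbar v (fun y => f y * g y) x ∂μ = 0 at h0
  simp only [key] at h0
  rw [integral_add] at h0
  · linear_combination h0
  · exact (hf.continuous.mul (continuous_dbar hg v)).integrable_of_hasCompactSupport hfc.mul_right
  · exact ((continuous_dbar hf v).mul hg.continuous).integrable_of_hasCompactSupport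
      ((hasCompactSupport_dbar hfc v).mul_right)

lemma integral_dbar_mul_dbar_comm {f g : W → ℂ} (hf : ContDiff ℝ 2 f) (hfc : HasCompactSupport f)
    (hg : ContDiff ℝ 2 g) (u v : W) :
    ∫ x, dbar u f x * dbar v g x ∂μ = ∫ x, dbar v f x * dbar u g x ∂μ := by
  rw [integral_dbar_mul (hf.of_le (by norm_num)) hfc (contDiff_one_dbar hg v),
    integral_dbar_mul (hf.of_le (by norm_num)) hfc (contDiff_one_dbar hg u)]
  congr 1
  refine integral_congr_ae (.of_forall fun x => ?_)
  simp only [dbar_dbar_comm hg.contDiffAt u v]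

end CompactlySupported

section Hormander
variable {κ : Type*} [Fintype κ] {e : κ → W} {Ω : Set W} {Φ : W → ℝ}

/-- The complex-valued function `exp (c Φ)`. -/
def expW (c : ℝ) (Φ : W → ℝ) (x : W) : ℂ := ((rexp (c * Φ x) : ℝ) : ℂ)

lemma expW_mul (a b : ℝ) (x : W) : expW a Φ x * expW b Φ x = expW (a + b) Φ x := by
  simp only [expW]; rw [← ofReal_mul, ← Real.exp_add]; congr 2; ring

lemma expW_zero (x : W) : expW 0 Φ x = 1 := by simp [expW]

lemma expW_half_mul (x : W) : expW (1 / 2) Φ x * expW (-1 / 2) Φ x = 1 := by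
  rw [expW_mul]; norm_num [expW_zero]

lemma conj_expW (c : ℝ) (x : W) : conj (expW c Φ x) = expW c Φ x :=
  conj_ofReal _

lemma norm_expW_sq (c : ℝ) (x : W) : ‖expW c Φ x‖ ^ 2 = rexp (2 * c * Φ x) := by
  rw [expW, norm_real, norm_eq_abs, abs_of_pos (exp_pos _), ← Real.exp_nat_mul]
  congr 1; push_cast; ring

lemma contDiffOn_expW (c : ℝ) (hΦ : ContDiffOn ℝ 2 Φ Ω) : ContDiffOn ℝ 2 (expW c Φ) Ω :=
  ofRealCLM.contDiff.comp_contDiffOn (contDiffOn_const.mul hΦ).exp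

lemma dz_expW_one {x : W} (h : DifferentiableAt ℝ Φ x) (v : W) :
    dz v (expW 1 Φ) x = expW 1 Φ x * dz v ℂ∘Φ x := by
  have := dz_exp_neg h.fun_neg v
  have e1 : (fun y => ((rexp (- -Φ y) : ℝ) : ℂ)) = expW 1 Φ := by ext y; simp [expW]
  rw [e1] at this
  rw [this]
  have e2 : dz v (fun y => ((-Φ y : ℝ) : ℂ)) x = - dz v ℂ∘Φ x := by
    have e3 : (fun y => ((-Φ y : ℝ) : ℂ)) = fun y => -((Φ y : ℂ)) := by ext; simp
    rw [e3]
    simp only [dz, fderiv_fun_neg, _root_.neg_apply]; ring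
  rw [e2]; simp [expW]

lemma dz_mul_expW (hΩ : IsOpen Ω) (hΦ : ContDiffOn ℝ 2 Φ Ω) {ω : W → ℂ} (hω : ω ∈ testFn Ω)
    (v x : W) : dz v (fun y => ω y * expW 1 Φ y) x
      = (dz v ω x + dz v ℂ∘Φ x * ω x) * expW 1 Φ x := by
  by_cases hx : x ∈ tsupport ω
  · have hn := hΩ.mem_nhds (hω.2.2 hx)
    have d1 : DifferentiableAt ℝ Φ x := (hΦ.contDiffAt hn).differentiableAt (by norm_num)
    have d2 : DifferentiableAt ℝ (expW 1 Φ) x :=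
      ((contDiffOn_expW 1 hΦ).contDiffAt hn).differentiableAt (by norm_num)
    rw [dz_mul (hω.1.differentiable (by norm_num) x) d2, dz_expW_one d1]
    ring
  · rw [image_eq_zero_of_notMem_tsupport hx,
      image_eq_zero_of_notMem_tsupport fun h => hx (tsupport_dz_subset v ω h)]
    have : x ∉ tsupport fun y => ω y * expW 1 Φ y := fun h => hx (tsupport_mul_subset_left h)
    rw [image_eq_zero_of_notMem_tsupport fun h => this (tsupport_dz_subset v _ h)]
    simp

lemma lintegral_weight_expW (x : κ → Lp ℂ 2 (μ.restrict Ω)) :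
    ∫⁻ y in Ω, eofReal (rexp (-Φ y) * ∑ j, ‖expW (1 / 2) Φ y * x j y‖ ^ 2) ∂μ
      = eofReal (‖(WithLp.toLp 2 x : PiLp 2 fun _ : κ => Lp ℂ 2 (μ.restrict Ω))‖ ^ 2) := by
  rw [PiLp.norm_sq_eq_of_L2, ofReal_sum_of_nonneg fun _ _ => by positivity]
  simp only [ofReal_norm_sq_Lp]
  rw [← lintegral_finsetSum' _ fun j _ =>
    ((Lp.aestronglyMeasurable (x j)).norm.aemeasurable.pow_const 2).ennreal_ofReal]
  refine lintegral_congr fun y => ?_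
  rw [← ofReal_sum_of_nonneg fun _ _ => by positivity, mul_sum]
  congr 1
  refine sum_congr rfl fun j _ => ?_
  rw [norm_mul, mul_pow, norm_expW_sq, ← mul_assoc, ← Real.exp_add]
  ring_nf
  simp

/-- The formal adjoint of `∂̄` on the tuple `β`. -/
def adjForm (Φ : W → ℝ) (e : κ → W) (β : κ → testFn Ω) (x : W) : ℂ :=
  -∑ j, wdelta Φ (e j) (β j : W → ℂ) x

lemma isCC_wdelta (hΩ : IsOpen Ω) (hΦ : ContDiffOn ℝ 2 Φ Ω) {ω : W → ℂ} (hω : ω ∈ testFn Ω)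
    (v : W) : IsCC Ω (wdelta Φ v ω) := by
  have h1 : ContinuousOn (dz v fun y => (Φ y : ℂ)) Ω :=
    (contDiffOn_dz (n := 1) hΩ
      (ofRealCLM.contDiff.comp_contDiffOn hΦ) v).continuousOn
  have h2 := (IsCC.dz hω v).add (((IsCC.of_testFn hω).mul hΩ h1).neg hΩ)
  convert h2 using 1
  ext x; simp only [wdelta]; ring

lemma isCC_adjForm (hΩ : IsOpen Ω) (hΦ : ContDiffOn ℝ 2 Φ Ω) (β : κ → testFn Ω) :
    IsCC Ω (adjForm Φ e β) :=
  (IsCC.sum _ fun j _ => isCC_wdelta hΩ hΦ (β j).2 (e j)).neg hΩ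

lemma adjForm_add (β β' : κ → testFn Ω) (x : W) :
    adjForm Φ e (β + β') x = adjForm Φ e β x + adjForm Φ e β' x := by
  simp only [adjForm, wdelta, ← neg_add, ← sum_add_distrib]
  congr 1
  refine sum_congr rfl fun j _ => ?_
  have : dz (e j) ((β + β') j : W → ℂ) x
      = dz (e j) (β j : W → ℂ) x + dz (e j) (β' j : W → ℂ) x :=
    dz_add ((β j).2.1.differentiable (by norm_num) x) ((β' j).2.1.differentiable (by norm_num) x)
  rw [this]
  simp only [Pi.add_apply, Submodule.coe_add]
  ring

lemma adjForm_smul (c : ℂ) (β : κ → testFn Ω) (x : W) :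
    adjForm Φ e (c • β) x = c * adjForm Φ e β x := by
  simp only [adjForm, wdelta, mul_neg, mul_sum]
  congr 1
  refine sum_congr rfl fun j _ => ?_
  have : dz (e j) ((c • β) j : W → ℂ) x = c * dz (e j) (β j : W → ℂ) x := by
    have := dz_mul (v := e j) (f := fun _ => c) (g := (β j : W → ℂ)) (x := x) (by fun_prop)
      ((β j).2.1.differentiable (by norm_num) x)
    have h0 : dz (e j) (fun _ : W => c) x = 0 := by simp [dz]
    rw [h0, mul_zero, add_zero] at this
    exact this
  rw [this]
  simp only [Pi.smul_apply, Submodule.coe_smul, smul_eq_mul]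
  ring

lemma testFn_smooth_cc (hΩ : IsOpen Ω) (hΦ : ContDiffOn ℝ 2 Φ Ω) {f : W → ℂ} (h : IsCC Ω f)
    (c : ℝ) : IsCC Ω fun x => f x * expW c Φ x :=
  h.mul hΩ (contDiffOn_expW c hΦ).continuousOn

theorem dual_estimate {s c : W → ℝ} {δ M : ℝ} {p : ℕ} (hw : LeviWeight e Ω Φ s c δ M p)
    (a : PiLp 2 fun _ : κ => Lp ℂ 2 (μ.restrict Ω))
    (ha : ∀ j k, ∀ ω ∈ testFn Ω,
      inner ℂ (lpOf (μ.restrict Ω) fun x => conj (dbar (e j) ω x) * expW (1 / 2) Φ x)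
        (a k) =
      inner ℂ (lpOf (μ.restrict Ω) fun x => conj (dbar (e k) ω x) * expW (1 / 2) Φ x)
        (a j)) (β : κ → testFn Ω) :
    ‖inner ℂ a (WithLp.toLp 2 fun j => lpOf (μ.restrict Ω) fun x => (β j : W → ℂ) x
        * expW (-1 / 2) Φ x : PiLp 2 fun _ : κ => Lp ℂ 2 (μ.restrict Ω))‖
      ≤ (‖a‖ * Real.sqrt (4 / δ)) *
        ‖lpOf (μ.restrict Ω) fun x => adjForm Φ e β x * expW (-1 / 2) Φ x‖ := by
  have hΩ := hw.isOpen
  have hΦ := hw.smooth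
  have hδ := hw.pos
  have hΩm := hΩ.measurableSet
  set u : κ → testFn Ω → Lp ℂ 2 (μ.restrict Ω) := fun j ω =>
    lpOf (μ.restrict Ω) fun x => conj (dbar (e j) (ω : W → ℂ) x) * expW (1 / 2) Φ x with hu
  have hucc : ∀ j, ∀ ω ∈ testFn Ω,
      IsCC Ω fun x => conj (dbar (e j) ω x) * expW (1 / 2) Φ x :=
    fun j ω hω => testFn_smooth_cc hΩ hΦ (IsCC.dbar hω (e j)).conjugate _
  have hinner : ∀ j (ω : testFn Ω) (x : Lp ℂ 2 (μ.restrict Ω)), inner ℂ (u j ω) x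
      = ∫ y, (expW (1 / 2) Φ y * x y) * dbar (e j) (ω : W → ℂ) y ∂μ := by
    intro j ω x
    rw [(hucc j ω ω.2).inner_lpOf_eq]
    refine integral_congr_ae (.of_forall fun y => ?_)
    simp only [map_mul, conj_conj, conj_expW]; ring
  let N := symmTuples u
  have hNc : IsClosed (N : Set (PiLp 2 fun _ : κ => Lp ℂ 2 (μ.restrict Ω))) := isClosed_symmTuples u
  haveI : CompleteSpace N := hNc.completeSpace_coe
  have haN : a ∈ N := fun j k ω => ha j k ω ω.2
  set b : PiLp 2 fun _ : κ => Lp ℂ 2 (μ.restrict Ω) := WithLp.toLp 2 fun j =>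
    lpOf (μ.restrict Ω) fun x => (β j : W → ℂ) x * expW (-1 / 2) Φ x with hb
  have hbcc : ∀ j, IsCC Ω fun x => (β j : W → ℂ) x * expW (-1 / 2) Φ x :=
    fun j => testFn_smooth_cc hΩ hΦ (IsCC.of_testFn (β j).2) _
  set g := N.starProjection b with hg
  have hgN : g ∈ N := N.starProjection_apply_mem b
  have hproj : ∀ x ∈ N, inner ℂ x g = inner ℂ x b := fun x hx => by
    rw [hg, ← N.inner_starProjection_left_eq_right, N.starProjection_eq_self_iff.2 hx]
  set γ : κ → W → ℂ := fun j x => expW (1 / 2) Φ x * g j x with hγ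
  have hγl : ∀ j, LocL2 μ Ω (γ j) := fun j =>
    locL2_mul (Lp.memLp (g j)) (contDiffOn_expW _ hΦ).continuousOn
  have hkcc : IsCC Ω (adjForm Φ e β) := isCC_adjForm hΩ hΦ β
  have hkl : LocL2 μ Ω (adjForm Φ e β) := fun K _ _ => hkcc.memLp K
  have hap := apriori_estimate (μ := μ) (e := e) (γ := γ) (kap := adjForm Φ e β) hw
    hγl hkl ?_ ?_ ?_
  · have e1 : ∫⁻ x in Ω, eofReal (rexp (-Φ x) * ∑ j, ‖γ j x‖ ^ 2) ∂μ
        = eofReal (‖g‖ ^ 2) := lintegral_weight_expW (fun j => g j)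
    have e2 : ∫⁻ x in Ω, eofReal (rexp (-Φ x) * ‖adjForm Φ e β x‖ ^ 2) ∂μ
        = eofReal
          (‖lpOf (μ.restrict Ω) fun x => adjForm Φ e β x * expW (-1 / 2) Φ x‖ ^ 2) := by
      rw [ofReal_norm_sq_lpOf ((testFn_smooth_cc hΩ hΦ hkcc _).memLp Ω)]
      refine lintegral_congr fun x => ?_
      rw [norm_mul, mul_pow, norm_expW_sq]
      ring_nf
    rw [e1, e2, ← eofReal_mul hδ.le, show (4 : ℝ≥0∞) = eofReal 4 by norm_num,
      ← eofReal_mul (by norm_num), ofReal_le_ofReal_iff (by positivity)] at hap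
    set S := ‖lpOf (μ.restrict Ω) fun x => adjForm Φ e β x * expW (-1 / 2) Φ x‖
    have hgS : ‖g‖ ≤ Real.sqrt (4 / δ) * S := by
      refine le_of_sq_le_sq ?_ (by positivity)
      rw [mul_pow, sq_sqrt (by positivity), div_mul_eq_mul_div, le_div_iff₀ hδ]
      linarith
    rw [← hproj a haN]
    refine (norm_inner_le_norm a g).trans ?_
    rw [mul_assoc]
    exact mul_le_mul_of_nonneg_left hgS (norm_nonneg _)
  · intro j k ω hω
    have i1 := (hγl k).integrable_mul (IsCC.dbar hω (e j)).cont (IsCC.dbar hω (e j)).cpt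
      (IsCC.dbar hω (e j)).sub
    have i2 := (hγl j).integrable_mul (IsCC.dbar hω (e k)).cont (IsCC.dbar hω (e k)).cpt
      (IsCC.dbar hω (e k)).sub
    rw [integral_sub i1 i2, sub_eq_zero]
    have := hgN j k ⟨ω, hω⟩
    rwa [hinner, hinner] at this
  · intro ω hω
    have hωE : (fun y => ω y * expW 1 Φ y) ∈ testFn Ω :=
      mul_mem_testFn hΩ hω (contDiffOn_expW 1 hΦ)
    have hζ := conj_mem_testFn hωE
    set ζ : W → ℂ := fun y => conj (ω y * expW 1 Φ y) with hζd
    have hτcc : ∀ j, IsCC Ω fun x => dbar (e j) ζ x * expW (-1 / 2) Φ x := fun j =>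
      testFn_smooth_cc hΩ hΦ (IsCC.dbar hζ (e j)) _
    let τ : PiLp 2 fun _ : κ => Lp ℂ 2 (μ.restrict Ω) := WithLp.toLp 2 fun j =>
      lpOf (μ.restrict Ω) fun x => dbar (e j) ζ x * expW (-1 / 2) Φ x
    have hτN : τ ∈ N := by
      intro j k η
      have hi : ∀ j k, inner ℂ (u j η) (τ k)
          = ∫ y, dbar (e j) (η : W → ℂ) y * dbar (e k) ζ y ∂μ := fun j k => by
        rw [show τ k = lpOf (μ.restrict Ω) fun x => dbar (e k) ζ x * expW (-1 / 2) Φ x from rfl,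
          (hucc j η η.2).inner_lpOf_lpOf hΩm ((hτcc k).memLp Ω)]
        refine integral_congr_ae (.of_forall fun y => ?_)
        simp only [map_mul, conj_conj, conj_expW]
        linear_combination (dbar (e j) (η : W → ℂ) y * dbar (e k) ζ y) *
          expW_half_mul (Φ := Φ) y
      rw [hi, hi]
      exact integral_dbar_mul_dbar_comm η.2.1 η.2.2.1 hζ.1 _ _
    have hpt : ∀ j x, conj (dbar (e j) ζ x) = (dz (e j) ω x
        + dz (e j) ℂ∘Φ x * ω x) * expW 1 Φ x := fun j x => by
      rw [← dz_mul_expW hΩ hΦ hω, hζd, dbar_conj, conj_conj]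
    have hΦ1 : ∀ j, ContinuousOn (dz (e j) fun y => (Φ y : ℂ)) Ω := fun j =>
      (contDiffOn_dz (n := 1) hΩ
        (ofRealCLM.contDiff.comp_contDiffOn hΦ) (e j)).continuousOn
    have hσcc : ∀ j, IsCC Ω fun x => dz (e j) ω x + dz (e j) ℂ∘Φ x * ω x :=
      fun j => by
        have := (IsCC.dz hω (e j)).add ((IsCC.of_testFn hω).mul hΩ (hΦ1 j))
        simpa only [mul_comm] using this
    have h11 : ∀ x, expW (-1 / 2) Φ x * expW 1 Φ x = expW (1 / 2) Φ x := fun x => by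
      rw [expW_mul]; norm_num
    have hl : ∀ j, inner ℂ (τ j) (g j) = ∫ x, γ j x * (dz (e j) ω x
        + dz (e j) ℂ∘Φ x * ω x) ∂μ := fun j => by
      rw [show τ j = lpOf (μ.restrict Ω) fun x => dbar (e j) ζ x * expW (-1 / 2) Φ x from rfl,
        (hτcc j).inner_lpOf_eq]
      refine integral_congr_ae (.of_forall fun x => ?_)
      simp only [map_mul, hpt, conj_expW, hγ, ← h11 x]
      ring
    have hr : ∀ j, inner ℂ (τ j) (b j) = ∫ x, (dz (e j) ω x
        + dz (e j) ℂ∘Φ x * ω x) * (β j : W → ℂ) x ∂μ := fun j => by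
      rw [show τ j = lpOf (μ.restrict Ω) fun x => dbar (e j) ζ x * expW (-1 / 2) Φ x from rfl,
        show b j = lpOf (μ.restrict Ω) fun x => (β j : W → ℂ) x * expW (-1 / 2) Φ x from rfl,
        (hτcc j).inner_lpOf_lpOf hΩm ((hbcc j).memLp Ω)]
      refine integral_congr_ae (.of_forall fun x => ?_)
      simp only [map_mul, hpt, conj_expW]
      linear_combination (dz (e j) ω x + dz (e j) ℂ∘Φ x * ω x) *
        (β j : W → ℂ) x * (expW (-1 / 2) Φ x * h11 x + expW_half_mul (Φ := Φ) x)
    have hr2 : ∀ j, ∫ x, (dz (e j) ω x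
        + dz (e j) ℂ∘Φ x * ω x) * (β j : W → ℂ) x ∂μ
        = ∫ x, -(wdelta Φ (e j) (β j : W → ℂ) x * ω x) ∂μ := fun j => by
      have i1 : Integrable (fun x => dz (e j) ω x * (β j : W → ℂ) x) μ :=
        ((IsCC.dz hω (e j)).cont.mul (β j).2.1.continuous).integrable_of_hasCompactSupport
          (IsCC.dz hω (e j)).cpt.mul_right
      have i2 : Integrable (fun x => dz (e j) ℂ∘Φ x * ω x * (β j : W → ℂ) x) μ := by
        have h := (IsCC.of_testFn hω).mul hΩ (hΦ1 j)
        have := (h.cont.mul (β j).2.1.continuous).integrable_of_hasCompactSupport (μ := μ)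
          h.cpt.mul_right
        refine this.congr (.of_forall fun x => ?_)
        simp only [Pi.mul_apply]; ring
      have i3 : Integrable (fun x => ω x * dz (e j) (β j : W → ℂ) x) μ :=
        (hω.1.continuous.mul (IsCC.dz (β j).2 (e j)).cont).integrable_of_hasCompactSupport
          hω.2.1.mul_right
      simp only [add_mul]
      rw [integral_add i1 i2, integral_dz_mul (hω.1.of_le (by norm_num)) hω.2.1
        ((β j).2.1.of_le (by norm_num)), ← integral_neg, ← integral_add i3.fun_neg i2]
      refine integral_congr_ae (.of_forall fun x => ?_)
      simp only [wdelta]; ring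
    have hfin := hproj τ hτN
    rw [PiLp.inner_apply, PiLp.inner_apply] at hfin
    rw [integral_finsetSum _ fun j _ =>
      (hγl j).integrable_mul (hσcc j).cont (hσcc j).cpt (hσcc j).sub]
    simp only [← hl]
    rw [hfin]
    simp only [hr, hr2]
    rw [← integral_finsetSum]
    · refine integral_congr_ae (.of_forall fun x => ?_)
      simp only [adjForm, neg_mul, sum_mul, sum_neg_distrib]
    · intro j _
      have h := isCC_wdelta hΩ hΦ (β j).2 (e j)
      exact ((h.cont.mul hω.1.continuous).integrable_of_hasCompactSupport h.cpt.mul_right).neg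
  · have e1 : ∫⁻ x in Ω, eofReal (rexp (-Φ x) * ∑ j, ‖γ j x‖ ^ 2) ∂μ
        = eofReal (‖g‖ ^ 2) := lintegral_weight_expW (fun j => g j)
    rw [e1]; exact ofReal_ne_top

lemma wdelta_mul_expW (hΩ : IsOpen Ω) (hΦ : ContDiffOn ℝ 2 Φ Ω) {ω : W → ℂ} (hω : ω ∈ testFn Ω)
    (v x : W) : wdelta Φ v (fun y => ω y * expW 1 Φ y) x = dz v ω x * expW 1 Φ x := by
  rw [wdelta, dz_mul_expW hΩ hΦ hω]; ring

lemma wdelta_zero (v x : W) : wdelta Φ v (fun _ => 0) x = 0 := by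
  simp [wdelta, dz]

lemma memLp_mul_expW (hΩ : IsOpen Ω) (hΦ : ContDiffOn ℝ 2 Φ Ω) {α : κ → W → ℂ}
    (hα : ∀ j, AEStronglyMeasurable (α j) (μ.restrict Ω))
    (hfin : ∫⁻ x in Ω, eofReal (rexp (-Φ x) * ∑ j, ‖α j x‖ ^ 2) ∂μ ≠ ⊤) (j : κ) :
    MemLp (fun x => α j x * expW (-1 / 2) Φ x) 2 (μ.restrict Ω) := by
  refine ⟨(hα j).mul ((contDiffOn_expW _ hΦ).continuousOn.aestronglyMeasurable
    hΩ.measurableSet), ?_⟩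
  have h1 : eLpNorm (fun x => α j x * expW (-1 / 2) Φ x) 2 (μ.restrict Ω) ^ 2 < ⊤ := by
    rw [← lintegral_enorm_sq_eq]
    refine lt_of_le_of_lt (lintegral_mono fun x => ?_) hfin.lt_top
    rw [← ofReal_norm, ← eofReal_pow (norm_nonneg _)]
    refine ofReal_le_ofReal ?_
    rw [norm_mul, mul_pow, norm_expW_sq, mul_comm]
    have : ‖α j x‖ ^ 2 ≤ ∑ j, ‖α j x‖ ^ 2 :=
      single_le_sum (f := fun j => ‖α j x‖ ^ 2) (fun _ _ => by positivity)
        (mem_univ j)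
    calc _ ≤ rexp (2 * (-1 / 2) * Φ x) * ∑ j, ‖α j x‖ ^ 2 := by gcongr
      _ = _ := by ring_nf
  exact (ENNReal.pow_lt_top_iff.1 h1).resolve_right (by norm_num)

/-- Hörmander's `L²` existence theorem for the `∂̄`-equation, with a smooth weight and a smooth
exhaustion function whose gradient is controlled by the complex Hessian of the weight. -/
theorem hormander [DecidableEq κ] {s c : W → ℝ} {δ M : ℝ} {p : ℕ} (hw : LeviWeight e Ω Φ s c δ M p)
    {α : κ → W → ℂ} (hα : ∀ j, AEStronglyMeasurable (α j) (μ.restrict Ω))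
    (hfin : ∫⁻ x in Ω, eofReal (rexp (-Φ x) * ∑ j, ‖α j x‖ ^ 2) ∂μ ≠ ⊤)
    (hcl : ∀ j k, ∀ ω ∈ testFn Ω, ∫ x, α k x * dbar (e j) ω x ∂μ = ∫ x, α j x * dbar (e k) ω x ∂μ) :
    ∃ g : W → ℂ, AEStronglyMeasurable g (μ.restrict Ω) ∧ LocL2 μ Ω g ∧
      ∫⁻ x in Ω, eofReal (rexp (-Φ x) * ‖g x‖ ^ 2) ∂μ ≤ eofReal (4 / δ) *
        ∫⁻ x in Ω, eofReal (rexp (-Φ x) * ∑ j, ‖α j x‖ ^ 2) ∂μ ∧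
      ∀ j, ∀ ω ∈ testFn Ω, ∫ x, g x * dbar (e j) ω x ∂μ = -∫ x, α j x * ω x ∂μ := by
  have hΩ := hw.isOpen
  have hΦ := hw.smooth
  have hδ := hw.pos
  have hΩm := hΩ.measurableSet
  have hαL := memLp_mul_expW (μ := μ) hΩ hΦ hα hfin
  let a : PiLp 2 fun _ : κ => Lp ℂ 2 (μ.restrict Ω) := WithLp.toLp 2 fun j =>
    lpOf (μ.restrict Ω) fun x => α j x * expW (-1 / 2) Φ x
  have hanorm : ∫⁻ x in Ω, eofReal (rexp (-Φ x) * ∑ j, ‖α j x‖ ^ 2) ∂μ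
      = eofReal (‖a‖ ^ 2) := by
    rw [← lintegral_weight_expW (Φ := Φ)]
    have h1 : ∀ᵐ x ∂(μ.restrict Ω), ∀ j,
        lpOf (μ.restrict Ω) (fun x => α j x * expW (-1 / 2) Φ x) x = α j x * expW (-1 / 2) Φ x :=
      ae_all_iff.2 fun j => lpOf_coeFn (hαL j)
    refine lintegral_congr_ae ?_
    filter_upwards [h1] with x hx
    congr 2
    refine sum_congr rfl fun j _ => ?_
    rw [hx j, mul_left_comm, expW_half_mul, mul_one]
  have hbcc : ∀ (β : testFn Ω), IsCC Ω fun x => (β : W → ℂ) x * expW (-1 / 2) Φ x :=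
    fun β => testFn_smooth_cc hΩ hΦ (IsCC.of_testFn β.2) _
  have hScc : ∀ β : κ → testFn Ω, IsCC Ω fun x => adjForm Φ e β x * expW (-1 / 2) Φ x :=
    fun β => testFn_smooth_cc hΩ hΦ (isCC_adjForm hΩ hΦ β) _
  let B : (κ → testFn Ω) → PiLp 2 fun _ : κ => Lp ℂ 2 (μ.restrict Ω) := fun β =>
    WithLp.toLp 2 fun j => lpOf (μ.restrict Ω) fun x => (β j : W → ℂ) x * expW (-1 / 2) Φ x
  have hBadd : ∀ β β', B (β + β') = B β + B β' := fun β β' => by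
    ext1 j
    have := lpOf_add ((hbcc (β j)).memLp (μ := μ) Ω) ((hbcc (β' j)).memLp Ω)
    simp only [← add_mul] at this
    exact this
  have hBsmul : ∀ (z : ℂ) β, B (z • β) = z • B β := fun z β => by
    ext1 j
    have := lpOf_smul z ((hbcc (β j)).memLp (μ := μ) Ω)
    simp only [← mul_assoc] at this
    exact this
  let L : (κ → testFn Ω) →ₗ[ℂ] ℂ :=
    { toFun := fun β => inner ℂ a (B β)
      map_add' := fun β β' => by rw [hBadd, inner_add_right]
      map_smul' := fun z β => by rw [hBsmul, inner_smul_right]; rfl }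
  let S : (κ → testFn Ω) →ₗ[ℂ] Lp ℂ 2 (μ.restrict Ω) :=
    { toFun := fun β => lpOf (μ.restrict Ω) fun x => adjForm Φ e β x * expW (-1 / 2) Φ x
      map_add' := fun β β' => by
        rw [← lpOf_add ((hScc β).memLp Ω) ((hScc β').memLp Ω)]
        simp only [adjForm_add, add_mul]
      map_smul' := fun z β => by
        rw [RingHom.id_apply, ← lpOf_smul z ((hScc β).memLp Ω)]
        simp only [adjForm_smul, mul_assoc] }
  have ha : ∀ j k, ∀ ω ∈ testFn Ω,
      inner ℂ (lpOf (μ.restrict Ω) fun x => conj (dbar (e j) ω x) * expW (1 / 2) Φ x)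
        (a k) =
      inner ℂ (lpOf (μ.restrict Ω) fun x => conj (dbar (e k) ω x) * expW (1 / 2) Φ x)
        (a j) := by
    intro j k ω hω
    have key : ∀ j k, inner ℂ (lpOf (μ.restrict Ω) fun x =>
        conj (dbar (e j) ω x) * expW (1 / 2) Φ x) (a k)
        = ∫ x, α k x * dbar (e j) ω x ∂μ := fun j k => by
      have hcc : IsCC Ω fun x => conj (dbar (e j) ω x) * expW (1 / 2) Φ x :=
        testFn_smooth_cc hΩ hΦ (IsCC.dbar hω (e j)).conjugate _
      rw [show a k = lpOf (μ.restrict Ω) fun x => α k x * expW (-1 / 2) Φ x from rfl,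
        hcc.inner_lpOf_lpOf hΩm (hαL k)]
      refine integral_congr_ae (.of_forall fun y => ?_)
      simp only [map_mul, conj_conj, conj_expW]
      linear_combination (α k y * dbar (e j) ω y) * expW_half_mul (Φ := Φ) y
    rw [key, key, hcl j k ω hω]
  obtain ⟨g0, hg0, hrep⟩ := exists_inner_eq_of_norm_le S L (C := ‖a‖ * Real.sqrt (4 / δ))
    (by positivity)
    (fun β => dual_estimate hw a ha β)
  refine ⟨fun x => expW (1 / 2) Φ x * g0 x, ?_, ?_, ?_, ?_⟩
  · exact ((contDiffOn_expW _ hΦ).continuousOn.aestronglyMeasurable hΩm).mul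
      (Lp.aestronglyMeasurable g0)
  · exact locL2_mul (Lp.memLp g0) (contDiffOn_expW _ hΦ).continuousOn
  · have e1 : ∫⁻ x in Ω, eofReal (rexp (-Φ x) * ‖expW (1 / 2) Φ x * g0 x‖ ^ 2) ∂μ
        = eofReal (‖g0‖ ^ 2) := by
      rw [ofReal_norm_sq_Lp]
      refine lintegral_congr fun x => ?_
      rw [norm_mul, mul_pow, norm_expW_sq, ← mul_assoc, ← Real.exp_add]
      ring_nf
      simp
    rw [e1, hanorm, ← eofReal_mul (by positivity)]
    refine ofReal_le_ofReal ?_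
    calc ‖g0‖ ^ 2 ≤ (‖a‖ * Real.sqrt (4 / δ)) ^ 2 := by gcongr
      _ = 4 / δ * ‖a‖ ^ 2 := by rw [mul_pow, sq_sqrt (by positivity)]; ring
  · intro j ω hω
    let ζ : testFn Ω := ⟨fun y => conj (ω y) * expW 1 Φ y,
      mul_mem_testFn hΩ (conj_mem_testFn hω) (contDiffOn_expW 1 hΦ)⟩
    have hA : ∀ x, adjForm Φ e (Pi.single j ζ) x
        = -(conj (dbar (e j) ω x) * expW 1 Φ x) := fun x => by
      rw [adjForm, sum_eq_single j]
      · rw [Pi.single_eq_same]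
        have := wdelta_mul_expW hΩ hΦ (conj_mem_testFn hω) (e j) x
        rw [dz_conj] at this
        rw [← this]
      · intro k _ hk
        rw [Pi.single_eq_of_ne hk]
        exact wdelta_zero _ _
      · simp
    have h1 := hrep (Pi.single j ζ)
    have hL : L (Pi.single j ζ) = conj (∫ x, α j x * ω x ∂μ) := by
      change inner ℂ a (B (Pi.single j ζ)) = _
      rw [PiLp.inner_apply, sum_eq_single j]
      · have e1 : B (Pi.single j ζ) j
            = lpOf (μ.restrict Ω) fun x => (ζ : W → ℂ) x * expW (-1 / 2) Φ x := by
          change lpOf (μ.restrict Ω) (fun x => ((Pi.single j ζ : κ → testFn Ω) j : W → ℂ) x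
            * expW (-1 / 2) Φ x) = _
          rw [Pi.single_eq_same]
        rw [e1, ← inner_conj_symm, (show a j = lpOf (μ.restrict Ω)
          fun x => α j x * expW (-1 / 2) Φ x from rfl), (hbcc ζ).inner_lpOf_lpOf hΩm (hαL j)]
        congr 1
        refine integral_congr_ae (.of_forall fun y => ?_)
        have h11 : expW (-1 / 2) Φ y * expW 1 Φ y = expW (1 / 2) Φ y := by
          rw [expW_mul]; norm_num
        simp only [ζ, map_mul, conj_conj, conj_expW]
        linear_combination (α j y * ω y) * (expW (-1 / 2) Φ y * h11 + expW_half_mul (Φ := Φ) y)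
      · intro k _ hk
        have e1 : B (Pi.single j ζ) k = lpOf (μ.restrict Ω) fun x => (0 : ℂ) * (0 : ℂ) := by
          change lpOf (μ.restrict Ω) (fun x => ((Pi.single j ζ : κ → testFn Ω) k : W → ℂ) x
            * expW (-1 / 2) Φ x) = _
          rw [Pi.single_eq_of_ne hk]
          simp
        rw [e1, lpOf_smul 0 (MemLp.zero' : MemLp (fun _ => (0:ℂ)) 2 (μ.restrict Ω)), zero_smul, inner_zero_right]
      · simp
    have hS : inner ℂ g0 (S (Pi.single j ζ))
        = -conj (∫ x, expW (1 / 2) Φ x * g0 x * dbar (e j) ω x ∂μ) := by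
      rw [← inner_conj_symm]
      change conj (inner ℂ (lpOf (μ.restrict Ω) fun x =>
        adjForm Φ e (Pi.single j ζ) x * expW (-1 / 2) Φ x) g0) = _
      rw [(hScc _).inner_lpOf_eq, ← map_neg, ← integral_neg]
      congr 1
      refine integral_congr_ae (.of_forall fun y => ?_)
      have h11 : expW (-1 / 2) Φ y * expW 1 Φ y = expW (1 / 2) Φ y := by
        rw [expW_mul]; norm_num
      simp only [hA, map_mul, map_neg, conj_conj, conj_expW]
      linear_combination (-dbar (e j) ω y * g0 y) * h11
    rw [hL, hS, ← map_neg] at h1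
    rw [← neg_eq_iff_eq_neg]
    exact ((starRingEnd ℂ).injective h1).symm

end Hormander

section MeanValue

lemma measurePreserving_unit_smul {c : ℂ} (hc : ‖c‖ = 1) :
    MeasurePreserving (fun x : W => c • x) μ μ := by
  have hc0 : c ≠ 0 := fun h => by simp [h] at hc
  let f : W →ₗ[ℝ] W := (LinearMap.lsmul ℂ W c).restrictScalars ℝ
  let f' : W →ₗ[ℝ] W := (LinearMap.lsmul ℂ W c⁻¹).restrictScalars ℝ
  have hff : f * f' = 1 := by
    ext x; simp [f, f', smul_smul, hc0]
  have hdet : LinearMap.det f ≠ 0 := fun h => by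
    have := congrArg LinearMap.det hff
    rw [map_mul, h, zero_mul, map_one] at this
    exact zero_ne_one this
  have key := fun s => Measure.addHaar_preimage_linearMap μ hdet s
  have hball : f ⁻¹' ball 0 1 = ball (0 : W) 1 := by
    ext x; simp [f, norm_smul, hc]
  have h1 : eofReal |(LinearMap.det f)⁻¹| = 1 := by
    have := key (ball 0 1)
    rw [hball] at this
    have hpos : μ (ball (0 : W) 1) ≠ 0 := (measure_ball_pos μ 0 one_pos).ne'
    have hfin : μ (ball (0 : W) 1) ≠ ⊤ := measure_ball_lt_top.ne
    nth_rewrite 1 [← one_mul (μ (ball (0 : W) 1))] at this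
    exact ((ENNReal.mul_left_inj hpos hfin).1 this).symm
  refine ⟨(measurable_const_smul c), ?_⟩
  ext s hs
  rw [Measure.map_apply (measurable_const_smul c) hs]
  have := key s
  rw [h1, one_mul] at this
  exact this

variable {F : Type*} [NormedAddCommGroup F] [NormedSpace ℝ F]

lemma moll_eq_unit_smul {ε : ℝ} {ρ : W → ℝ} (hρ : IsMollifier μ ε ρ) (f : W → F) (x : W) {c : ℂ}
    (hc : ‖c‖ = 1) : ∫ y, ρ y • f (x + c • y) ∂μ = moll μ ρ f x := by
  have hn : ‖-c‖ = 1 := by rwa [norm_neg]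
  have hc0 : -c ≠ 0 := fun h => by simp [h] at hn
  rw [moll_eq_integral_sub]
  have := (measurePreserving_unit_smul (μ := μ) hn).integral_comp
    (Homeomorph.smulOfNeZero _ hc0).measurableEmbedding (fun t => ρ t • f (x - t))
  rw [← this]
  refine integral_congr_ae (.of_forall fun y => ?_)
  have h1 : ρ (-(c • y)) = ρ y := by simpa using hρ.circled _ y hn
  simp only [h1, neg_smul, sub_neg_eq_add]

lemma moll_eq_integral_circleAverage [CompleteSpace F] {ε : ℝ} {ρ : W → ℝ} (hρ : IsMollifier μ ε ρ)
    {f : W → F} (hf : StronglyMeasurable f) {C : ℝ} (hC : ∀ x, ‖f x‖ ≤ C) (x : W) :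
    moll μ ρ f x = ∫ y, ρ y • circleAverage (fun t => f (x + t • y)) 0 1 ∂μ := by
  have h2 : (0:ℝ) ≤ 2 * π := by positivity
  have hcm : ∀ θ, ‖circleMap 0 1 θ‖ = 1 := fun θ => by simp
  have hIg : Integrable (uncurry fun (y : W) (θ : ℝ) => ρ y • f (x + circleMap 0 1 θ • y))
      (μ.prod (volume.restrict (Ioc 0 (2 * π)))) := by
    have hb : Integrable (fun z : W × ℝ => (ρ z.1 * C) * 1)
        (μ.prod (volume.restrict (Ioc 0 (2 * π)))) :=
      Integrable.mul_prod (f := fun y => ρ y * C) (g := fun _ : ℝ => (1:ℝ))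
        ((hρ.contDiff.continuous.integrable_of_hasCompactSupport hρ.hasCompactSupport).mul_const C)
        (integrable_const _)
    refine hb.mono' ?_ ?_
    · refine StronglyMeasurable.aestronglyMeasurable ?_
      refine (hρ.contDiff.continuous.stronglyMeasurable.comp_measurable measurable_fst).smul
        (hf.comp_measurable (Continuous.measurable ?_))
      have := continuous_circleMap 0 1
      fun_prop
    · refine .of_forall fun z => ?_
      simp only [uncurry, norm_smul, norm_eq_abs, abs_of_nonneg (hρ.nonneg _), mul_one]
      exact mul_le_mul_of_nonneg_left (hC _) (hρ.nonneg _)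
  have h3 : ∀ y, ρ y • circleAverage (fun t => f (x + t • y)) 0 1
      = (2 * π)⁻¹ • ∫ θ in Ioc 0 (2 * π), ρ y • f (x + circleMap 0 1 θ • y) :=
    fun y => by
      rw [circleAverage, smul_comm, integral_of_le h2, ← integral_smul]
  simp only [h3]
  rw [integral_smul, integral_integral_swap hIg]
  simp only [moll_eq_unit_smul hρ f x (hcm _)]
  rw [← integral_of_le h2, intervalIntegral.integral_const, smul_smul]
  have : (2 * π)⁻¹ * (2 * π - 0) = 1 := by
    have := Real.pi_pos; field_simp; ring
  rw [this, one_smul]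

/-- A function is holomorphic along complex lines at the points of `Ω`. -/
def LineHol (G : W → ℂ) (Ω : Set W) : Prop :=
  ∀ x ∈ Ω, ∀ v : W, DifferentiableAt ℂ (fun t : ℂ => G (x + t • v)) 0

omit [FiniteDimensional ℂ W] [MeasurableSpace W] [BorelSpace W] in
lemma LineHol.of_differentiableOn {G : W → ℂ} {Ω : Set W} (hΩ : IsOpen Ω)
    (h : DifferentiableOn ℂ G Ω) : LineHol G Ω := fun x hx v => by
  have : DifferentiableAt ℂ G (x + (0:ℂ) • v) := by
    simpa using h.differentiableAt (hΩ.mem_nhds hx)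
  exact DifferentiableAt.comp (0:ℂ) this (by fun_prop)

omit [FiniteDimensional ℂ W] [MeasurableSpace W] [BorelSpace W] in
lemma LineHol.differentiableAt {G : W → ℂ} {Ω : Set W} (h : LineHol G Ω) {x v : W} {t : ℂ}
    (ht : x + t • v ∈ Ω) : DifferentiableAt ℂ (fun s : ℂ => G (x + s • v)) t := by
  have h1 := h _ ht v
  have h2 : (fun s : ℂ => G (x + s • v))
      = (fun s : ℂ => G (x + t • v + s • v)) ∘ fun s => s - t := by
    ext s; simp only [Function.comp]; congr 1; module
  rw [h2]
  refine DifferentiableAt.comp t ?_ (by fun_prop)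
  simpa using h1

omit [FiniteDimensional ℂ W] [MeasurableSpace W] [BorelSpace W] in
protected lemma LineHol.circleAverage {G : W → ℂ} {Ω : Set W} (h : LineHol G Ω)
    {x v : W} (hd : ∀ t : ℂ, ‖t‖ ≤ 1 → x + t • v ∈ Ω) :
    circleAverage (fun t => G (x + t • v)) 0 1 = G x := by
  have hd' : ∀ t ∈ closedBall (0:ℂ) 1,
      DifferentiableAt ℂ (fun s : ℂ => G (x + s • v)) t := fun t ht =>
    h.differentiableAt (hd t (by simpa using ht))
  rw [circleAverage_of_differentiable_on]
  · simp
  · have : closure (ball (0:ℂ) |1|) = closedBall 0 1 := by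
      rw [abs_one]; exact closure_ball _ one_ne_zero
    refine DifferentiableOn.diffContOnCl fun t ht => ?_
    rw [this] at ht
    exact (hd' t ht).differentiableWithinAt

/-- Mean value property of holomorphic functions against mollifiers. -/
lemma LineHol.moll_eq {G : W → ℂ} {Ω : Set W} (h : LineHol G Ω)
    {ε : ℝ} {ρ : W → ℝ} (hρ : IsMollifier μ ε ρ) {f : W → ℂ} (hf : StronglyMeasurable f) {C : ℝ}
    (hC : ∀ x, ‖f x‖ ≤ C) {x : W} (hx : ball x ε ⊆ Ω)
    (hfG : ∀ y ∈ ball x ε, f y = G y) : moll μ ρ f x = G x := by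
  rw [moll_eq_integral_circleAverage hρ hf hC]
  have : ∀ y, ρ y • circleAverage (fun t => f (x + t • y)) 0 1 = (ρ y : ℂ) * G x := fun y => by
    by_cases hy : ε ≤ ‖y‖
    · simp [hρ.eq_zero y hy]
    · push Not at hy
      have hb : ∀ t : ℂ, ‖t‖ ≤ 1 → x + t • y ∈ ball x ε := fun t ht => by
        rw [mem_ball, dist_self_add_left, norm_smul]
        exact lt_of_le_of_lt (mul_le_of_le_one_left (norm_nonneg y) ht) hy
      rw [← h.circleAverage fun t ht => hx (hb t ht), real_smul]
      congr 1
      refine Real.circleAverage_congr_sphere fun t ht => ?_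
      exact hfG _ (hb t (by simpa using le_of_eq ht))
  simp only [this]
  rw [integral_mul_const, integral_complex_ofReal, hρ.integral_eq]
  simp

end MeanValue

end HaarMeasure

section Osgood

lemma differentiableAt_of_fderiv_I_smul {G : W → ℂ} {x : W} (hG : DifferentiableAt ℝ G x)
    (h : ∀ v, fderiv ℝ G x (I • v) = I * fderiv ℝ G x v) : DifferentiableAt ℂ G x := by
  rw [differentiableAt_iff_restrictScalars ℝ hG]
  refine ⟨⟨⟨⟨fderiv ℝ G x, map_add _⟩, fun c v => ?_⟩, (fderiv ℝ G x).continuous⟩, ?_⟩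
  · have hc : c • v = c.re • v + c.im • I • v := by
      conv_lhs => rw [← re_add_im c, add_smul, mul_smul]
      simp only [coe_smul]
    change fderiv ℝ G x (c • v) = c • fderiv ℝ G x v
    rw [hc, map_add, map_smul, map_smul, h, real_smul, real_smul, smul_eq_mul]
    conv_rhs => rw [← re_add_im c]
    ring
  · ext; rfl

lemma differentiableAt_of_dbar_eq_zero {κ : Type*} [Fintype κ] {e : κ → W}
    (he : ∀ v, ∃ b : κ → ℂ, v = ∑ j, b j • e j) {G : W → ℂ} {x : W}
    (hG : DifferentiableAt ℝ G x) (h : ∀ j, dbar (e j) G x = 0) : DifferentiableAt ℂ G x := by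
  refine differentiableAt_of_fderiv_I_smul hG fun v => ?_
  have h1 : ∀ j, fderiv ℝ G x (I • e j) = I * fderiv ℝ G x (e j) := fun j => by
    have := h j
    simp only [dbar] at this
    have h2 : fderiv ℝ G x (e j) + I * fderiv ℝ G x (I • e j) = 0 := by simpa using this
    linear_combination (-I) * h2 + (fderiv ℝ G x (I • e j)) * I_sq
  obtain ⟨b, rfl⟩ := he v
  have hc : ∀ (c : ℂ) (v : W), c • v = c.re • v + c.im • I • v := fun c v => by
    conv_lhs => rw [← re_add_im c, add_smul, mul_smul]
    simp only [coe_smul]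
  have h3 : ∀ (c : ℂ) j, fderiv ℝ G x (c • e j) = c * fderiv ℝ G x (e j) := fun c j => by
    rw [hc, map_add, map_smul, map_smul, h1, real_smul, real_smul]
    conv_rhs => rw [← re_add_im c]
    ring
  simp only [Finset.smul_sum, smul_smul, map_sum, h3, mul_sum, mul_assoc]

variable [FiniteDimensional ℂ W] [MeasurableSpace W] [BorelSpace W] {μ : Measure W}
  [μ.IsAddHaarMeasure]

lemma indicator_closedBall_of_continuousOn {G : W → ℂ} {Ω : Set W} (hG : ContinuousOn G Ω)
    {x : W} {r : ℝ} (hr : closedBall x r ⊆ Ω) :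
    StronglyMeasurable ((closedBall x r).indicator G) ∧
      ∃ C, ∀ y, ‖(closedBall x r).indicator G y‖ ≤ C := by
  classical
  constructor
  · refine Measurable.stronglyMeasurable ?_
    rw [← Set.piecewise_eq_indicator]
    exact (hG.mono hr).measurable_piecewise continuousOn_const
      isClosed_closedBall.measurableSet
  · obtain ⟨C, hC⟩ := (isCompact_closedBall x r).exists_bound_of_continuousOn (hG.mono hr)
    refine ⟨max C 0, fun y => ?_⟩
    by_cases hy : y ∈ closedBall x r
    · rw [indicator_of_mem hy]; exact (hC y hy).trans (le_max_left _ _)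
    · rw [indicator_of_notMem hy]; simp

lemma LineHol.moll_indicator {G : W → ℂ} {Ω : Set W} (h : LineHol G Ω) (hG : ContinuousOn G Ω)
    {ε r : ℝ} {ρ : W → ℝ} (hρ : IsMollifier μ ε ρ) {x₀ x : W}
    (hr : closedBall x₀ r ⊆ Ω) (hx : ball x ε ⊆ closedBall x₀ r) :
    moll μ ρ ((closedBall x₀ r).indicator G) x = G x := by
  obtain ⟨h1, C, hC⟩ := indicator_closedBall_of_continuousOn hG hr
  exact h.moll_eq hρ h1 hC (hx.trans hr) fun y hy => indicator_of_mem (hx hy) _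

/-- Osgood's lemma: a continuous function holomorphic along complex lines is holomorphic. -/
theorem LineHol.differentiableOn {G : W → ℂ} {Ω : Set W} (hΩ : IsOpen Ω) (h : LineHol G Ω)
    (hG : ContinuousOn G Ω) : DifferentiableOn ℂ G Ω := by
  letI : MeasurableSpace W := borel W
  haveI : BorelSpace W := ⟨rfl⟩
  let μ : Measure W := Measure.addHaar
  intro x₀ hx₀
  obtain ⟨R, hR, hball⟩ := nhds_basis_closedBall.mem_iff.1 (hΩ.mem_nhds hx₀)
  obtain ⟨ρ, hρ⟩ := exists_isMollifier μ (half_pos hR)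
  obtain ⟨h1, C, hC⟩ := indicator_closedBall_of_continuousOn hG hball
  have heq : moll μ ρ ((closedBall x₀ R).indicator G) =ᶠ[𝓝 x₀] G := by
    filter_upwards [ball_mem_nhds x₀ (half_pos hR)] with x hx
    refine h.moll_indicator hG hρ hball ((ball_subset_ball' ?_).trans
      ball_subset_closedBall)
    rw [mem_ball] at hx; linarith
  have hloc : LocallyIntegrable ((closedBall x₀ R).indicator G) μ := by
    refine (locallyIntegrable_const C).mono h1.aestronglyMeasurable
      (.of_forall fun y => (hC y).trans (le_abs_self C))
  have hd : DifferentiableAt ℝ G x₀ := by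
    have := (contDiff_moll (n := 1) (μ := μ) (hρ.contDiff.of_le (by exact_mod_cast le_top))
      hρ.hasCompactSupport hloc).differentiable (by norm_num) x₀
    exact heq.differentiableAt_iff.1 this
  refine (differentiableAt_of_fderiv_I_smul hd fun v => ?_).differentiableWithinAt
  have h2 := (h x₀ hx₀ v).hasDerivAt.hasFDerivAt.restrictScalars ℝ
  have hd' : HasFDerivAt G (fderiv ℝ G x₀) (x₀ + (0:ℂ) • v) := by simpa using hd.hasFDerivAt
  have h3 := hd'.comp (0:ℂ) (((ContinuousLinearMap.toSpanSingleton ℂ v).restrictScalars ℝ).hasFDerivAt.const_add x₀)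
  have h4 := h2.unique h3
  have e1 := congrArg (fun L => L I) h4
  have e2 := congrArg (fun L => L 1) h4
  simp at e1 e2
  rw [← e1, ← e2]

omit [MeasurableSpace W] [BorelSpace W] in
theorem differentiableOn_of_tendstoLocallyUniformlyOn {ι : Type*} {φ : Filter ι} [φ.NeBot]
    {Fn : ι → W → ℂ} {G : W → ℂ} {Ω : Set W} (hΩ : IsOpen Ω)
    (hF : ∀ᶠ n in φ, DifferentiableOn ℂ (Fn n) Ω) (h : TendstoLocallyUniformlyOn Fn G φ Ω) :
    DifferentiableOn ℂ G Ω := by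
  letI : MeasurableSpace W := borel W
  haveI : BorelSpace W := ⟨rfl⟩
  have hc : ContinuousOn G Ω := h.continuousOn (hF.mono fun n hn => hn.continuousOn).frequently
  refine LineHol.differentiableOn hΩ (fun x hx v => ?_) hc
  have hU : IsOpen ((fun t : ℂ => x + t • v) ⁻¹' Ω) := hΩ.preimage (by fun_prop)
  have h1 := h.comp (fun t : ℂ => x + t • v) (t := (fun t : ℂ => x + t • v) ⁻¹' Ω)
    (fun t ht => ht) (by fun_prop)
  have h2 := h1.differentiableOn (hF.mono fun n hn =>
    hn.comp (by fun_prop) fun t ht => ht) hU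
  exact h2.differentiableAt (hU.mem_nhds (by simpa using hx))

/-- Holomorphic functions are locally bounded by their `L²` norm. -/
lemma exists_enorm_sq_le_lintegral {r : ℝ} (hr : 0 < r) : ∃ C : ℝ≥0∞, C ≠ ⊤ ∧
    ∀ (Ω : Set W) (G : W → ℂ) (x : W), IsOpen Ω → DifferentiableOn ℂ G Ω →
      closedBall x r ⊆ Ω → ‖G x‖ₑ ^ 2 ≤ C * ∫⁻ y in closedBall x r, ‖G y‖ₑ ^ 2 ∂μ := by
  obtain ⟨ρ, hρ⟩ := exists_isMollifier μ hr
  have hm : Measurable fun y => ‖ρ y‖ₑ := hρ.contDiff.continuous.measurable.enorm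
  refine ⟨∫⁻ y, ‖ρ y‖ₑ ^ 2 ∂μ, ?_, fun Ω G x hΩ hG hx => ?_⟩
  · have e : ∫⁻ y, ‖ρ y‖ₑ ^ 2 ∂μ = eLpNorm ℂ∘ρ 2 μ ^ 2 := by
      rw [← lintegral_enorm_sq_eq]
      refine lintegral_congr fun y => ?_
      rw [← ofReal_norm, ← ofReal_norm, norm_real]
    rw [e]
    have : MemLp ℂ∘ρ 2 μ :=
      (continuous_ofReal.comp hρ.contDiff.continuous).memLp_of_hasCompactSupport
        (hρ.hasCompactSupport.comp_left (g := fun x : ℝ => (x : ℂ)) (by simp))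
    exact ENNReal.pow_ne_top this.2.ne
  · have h1 := (LineHol.of_differentiableOn hΩ hG).moll_indicator hG.continuousOn hρ hx
      (ball_subset_closedBall)
    obtain ⟨h2, -⟩ := indicator_closedBall_of_continuousOn hG.continuousOn hx
    set f := (closedBall x r).indicator G with hf
    have e1 : ‖G x‖ₑ ≤ ∫⁻ y, ‖ρ (x - y)‖ₑ * ‖f y‖ₑ ∂μ := by
      rw [← h1, moll]
      refine (enorm_integral_le_lintegral_enorm _).trans (le_of_eq ?_)
      simp only [enorm_smul]
    have e2 : ∫⁻ y, ‖f y‖ₑ ^ 2 ∂μ = ∫⁻ y in closedBall x r, ‖G y‖ₑ ^ 2 ∂μ := by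
      rw [← lintegral_indicator isClosed_closedBall.measurableSet]
      refine lintegral_congr fun y => ?_
      by_cases hy : y ∈ closedBall x r <;> simp [hf, hy]
    calc ‖G x‖ₑ ^ 2 ≤ (∫⁻ y, ‖ρ (x - y)‖ₑ * ‖f y‖ₑ ∂μ) ^ 2 := by gcongr
      _ ≤ (∫⁻ y, ‖ρ (x - y)‖ₑ ^ 2 ∂μ) * ∫⁻ y, ‖f y‖ₑ ^ 2 ∂μ :=
        sq_lintegral_mul_le (hm.comp (measurable_const_sub x)).aemeasurable
          h2.measurable.enorm.aemeasurable
      _ = _ := by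
        rw [e2, lintegral_sub_left_eq_self (fun y => ‖ρ y‖ₑ ^ 2) x]

end Osgood

section WeylLemma
variable [FiniteDimensional ℂ W] [MeasurableSpace W] [BorelSpace W] {μ : Measure W} [μ.IsAddHaarMeasure]
variable {κ : Type*} [Fintype κ] {e : κ → W}

lemma differentiableOn_moll_of_weak (he : ∀ v, ∃ b : κ → ℂ, v = ∑ j, b j • e j) {Ω : Set W}
    {F : W → ℂ} {x₀ : W} {R ε : ℝ} (hR : closedBall x₀ R ⊆ Ω)
    (hF : ∀ j, ∀ ω ∈ testFn Ω, ∫ x, F x * dbar (e j) ω x ∂μ = 0)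
    (hL : LocallyIntegrable ((closedBall x₀ R).indicator F) μ)
    {ρ : W → ℝ} (hρ : IsMollifier μ ε ρ) :
    DifferentiableOn ℂ (moll μ ρ ((closedBall x₀ R).indicator F))
      (ball x₀ (R - ε)) := by
  have hρ1 : ContDiff ℝ 1 ρ := hρ.contDiff.of_le (by exact_mod_cast le_top)
  intro x hx
  rw [mem_ball] at hx
  refine (differentiableAt_of_dbar_eq_zero he ((contDiff_moll (n := 1) hρ1
    hρ.hasCompactSupport hL).differentiable (by norm_num) x) fun j => ?_).differentiableWithinAt
  rw [dbar_moll hρ1 hρ.hasCompactSupport hL, neg_eq_zero]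
  have hsub : tsupport (fun y => (ρ (x - y) : ℂ)) ⊆ closedBall x ε := by
    refine closure_minimal (fun y hy => ?_) isClosed_closedBall
    by_contra h
    rw [mem_closedBall, not_le, dist_comm, dist_eq_norm] at h
    exact hy (by simp [hρ.eq_zero _ h.le])
  have hsub2 : closedBall x ε ⊆ closedBall x₀ R :=
    closedBall_subset_closedBall' (by linarith)
  have hω : (fun y => (ρ (x - y) : ℂ)) ∈ testFn Ω :=
    ⟨hρ.contDiff_slice x (n := 2), (isCompact_closedBall x ε).of_isClosed_subset
      (isClosed_tsupport _) hsub, (hsub.trans hsub2).trans hR⟩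
  rw [← hF j _ hω]
  refine integral_congr_ae (.of_forall fun y => ?_)
  by_cases hy : y ∈ closedBall x₀ R
  · simp [hy]
  · have : dbar (e j) (fun y => (ρ (x - y) : ℂ)) y = 0 :=
      image_eq_zero_of_notMem_tsupport fun h => hy (hsub2 (hsub (tsupport_dbar_subset _ _ h)))
    simp [this]

lemma weyl_local (he : ∀ v, ∃ b : κ → ℂ, v = ∑ j, b j • e j) {Ω : Set W} (hΩ : IsOpen Ω)
    {F : W → ℂ} (hFl : LocL2 μ Ω F) (hF : ∀ j, ∀ ω ∈ testFn Ω, ∫ x, F x * dbar (e j) ω x ∂μ = 0)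
    {x₀ : W} (hx₀ : x₀ ∈ Ω) : ∃ r > 0, ball x₀ r ⊆ Ω ∧ ∃ G : W → ℂ,
      DifferentiableOn ℂ G (ball x₀ r) ∧ F =ᵐ[μ.restrict (ball x₀ r)] G := by
  obtain ⟨R, hR, hball⟩ := nhds_basis_closedBall.mem_iff.1 (hΩ.mem_nhds hx₀)
  set r := R / 3 with hr
  have hr0 : 0 < r := by positivity
  have hm : MeasurableSet (closedBall x₀ R) := isClosed_closedBall.measurableSet
  set f := (closedBall x₀ R).indicator F with hf
  have hfL : MemLp f 2 μ := (memLp_indicator_iff_restrict hm).2 (hFl _ hball (isCompact_closedBall _ _))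
  have hloc : LocallyIntegrable f μ := hfL.locallyIntegrable (by norm_num)
  let ε : ℕ → ℝ := fun n => r / (n + 1)
  have hε : ∀ n, 0 < ε n := fun n => by positivity
  have hεr : ∀ n, ε n ≤ r := fun n => div_le_self hr0.le (by linarith [(Nat.cast_nonneg n : (0:ℝ) ≤ n)])
  have hε0 : Tendsto ε atTop (𝓝 0) := tendsto_const_div_atTop_nhds_zero_nat r |>.comp
    (tendsto_add_atTop_nat 1) |>.congr fun n => by simp [ε]
  choose ρ hρ using fun n => exists_isMollifier μ (hε n)
  have hlim := tendsto_eLpNorm_moll_sub hfL hε0 hρ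
  set Fn : ℕ → W → ℂ := fun n => moll μ (ρ n) f with hFn
  have hcont : ∀ n, Continuous (Fn n) := fun n =>
    (contDiff_moll (n := 1) ((hρ n).contDiff.of_le (by exact_mod_cast le_top))
      (hρ n).hasCompactSupport hloc).continuous
  have hhol : ∀ n, DifferentiableOn ℂ (Fn n) (ball x₀ (R - r)) := fun n =>
    (differentiableOn_moll_of_weak he hball hF hloc (hρ n)).mono
      (ball_subset_ball (by linarith [hεr n]))
  obtain ⟨C, hC, hest⟩ := exists_enorm_sq_le_lintegral (μ := μ) (W := W) (half_pos hr0)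
  have hdiff : ∀ m n, ∀ x ∈ ball x₀ r, ‖Fn m x - Fn n x‖ₑ ^ 2
      ≤ C * (eLpNorm (fun x => Fn m x - f x) 2 μ + eLpNorm (fun x => Fn n x - f x) 2 μ) ^ 2 := by
    intro m n x hx
    refine (hest _ (fun x => Fn m x - Fn n x) x isOpen_ball ((hhol m).sub (hhol n))
      (closedBall_subset_ball' ?_)).trans ?_
    · rw [mem_ball] at hx; linarith
    · refine mul_le_mul_right ((setLIntegral_le_lintegral _ _).trans ?_) _
      rw [lintegral_enorm_sq_eq]
      have hsub : ∀ k, AEStronglyMeasurable (fun x => Fn k x - f x) μ := fun k =>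
        (hcont k).aestronglyMeasurable.sub hfL.1
      have := eLpNorm_sub_le (hsub m) (hsub n) (p := 2) (by norm_num)
      have e1 : ((fun x => Fn m x - f x) - fun x => Fn n x - f x) = fun x => Fn m x - Fn n x := by
        ext x; simp
      rw [e1] at this
      gcongr
  have hbd : Tendsto (fun p : ℕ × ℕ => C * (eLpNorm (fun x => Fn p.1 x - f x) 2 μ
      + eLpNorm (fun x => Fn p.2 x - f x) 2 μ) ^ 2) atTop (𝓝 0) := by
    rw [← prod_atTop_atTop_eq]
    have h1 := (hlim.comp tendsto_fst).add (hlim.comp (tendsto_snd (f := (atTop : Filter ℕ))))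
    have h2 := ENNReal.Tendsto.const_mul (a := C) ((ENNReal.continuous_pow 2).tendsto _ |>.comp h1)
      (Or.inr hC)
    simpa using h2
  have hcau : UniformCauchySeqOn Fn atTop (ball x₀ r) := by
    rw [uniformCauchySeqOn_iff]
    intro η hη
    have h1 := (ENNReal.tendsto_nhds_zero.1 hbd) (eofReal ((η / 2) ^ 2))
      (by rw [gt_iff_lt, ENNReal.ofReal_pos]; positivity)
    obtain ⟨⟨N1, N2⟩, hN⟩ := eventually_atTop.1 h1
    refine ⟨max N1 N2, fun m hm n hn x hx => ?_⟩
    have h2 := (hdiff m n x hx).trans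
      (hN (m, n) ⟨(le_max_left _ _).trans hm, (le_max_right _ _).trans hn⟩)
    rw [← ofReal_norm, ← eofReal_pow (norm_nonneg _),
      ofReal_le_ofReal_iff (by positivity)] at h2
    rw [dist_eq_norm]
    have := le_of_sq_le_sq h2 (by positivity)
    linarith
  have hpt : ∀ x ∈ ball x₀ r, ∃ y, Tendsto (fun n => Fn n x) atTop (𝓝 y) := fun x hx =>
    cauchySeq_tendsto_of_complete (hcau.cauchySeq hx)
  classical
  let G : W → ℂ := fun x => if hx : x ∈ ball x₀ r then (hpt x hx).choose else 0
  have hG : ∀ x ∈ ball x₀ r, Tendsto (fun n => Fn n x) atTop (𝓝 (G x)) := fun x hx => by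
    simp only [G, dif_pos hx]; exact (hpt x hx).choose_spec
  have hunif := hcau.tendstoUniformlyOn_of_tendsto hG
  refine ⟨r, hr0, (ball_subset_closedBall.trans (closedBall_subset_closedBall
    (by linarith))).trans hball, G, ?_, ?_⟩
  · exact differentiableOn_of_tendstoLocallyUniformlyOn isOpen_ball
      (.of_forall fun n => (hhol n).mono (ball_subset_ball (by linarith)))
      hunif.tendstoLocallyUniformlyOn
  · obtain ⟨ns, hns, hae⟩ := (tendstoInMeasure_of_tendsto_eLpNorm (p := 2) (by norm_num)
      (fun n => (hcont n).aestronglyMeasurable) hfL.1 hlim).exists_seq_tendsto_ae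
    rw [EventuallyEq, ae_restrict_iff' isOpen_ball.measurableSet]
    filter_upwards [hae] with x hx hxb
    have h1 : F x = f x := by
      rw [hf, indicator_of_mem]
      exact ball_subset_closedBall (ball_subset_ball (by linarith) hxb)
    rw [h1]
    exact tendsto_nhds_unique hx ((hG x hxb).comp hns.tendsto_atTop)

/-- Weyl's lemma: a weakly holomorphic function is almost everywhere holomorphic. -/
theorem weyl_lemma (he : ∀ v, ∃ b : κ → ℂ, v = ∑ j, b j • e j) {Ω : Set W} (hΩ : IsOpen Ω)
    {F : W → ℂ} (hFl : LocL2 μ Ω F) (hF : ∀ j, ∀ ω ∈ testFn Ω, ∫ x, F x * dbar (e j) ω x ∂μ = 0) :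
    ∃ G : W → ℂ, DifferentiableOn ℂ G Ω ∧ F =ᵐ[μ.restrict Ω] G := by
  choose! r hr hrΩ G hGd hGe using fun x (hx : x ∈ Ω) => weyl_local he hΩ hFl hF hx
  have hpatch : ∀ x ∈ Ω, ∀ y ∈ ball x (r x), G y y = G x y := by
    intro x hx y hy
    have hyΩ := hrΩ x hx hy
    have a1 : F =ᵐ[μ.restrict (ball x (r x) ∩ ball y (r y))] G x :=
      ae_restrict_of_ae_restrict_of_subset inter_subset_left (hGe x hx)
    have a2 : F =ᵐ[μ.restrict (ball x (r x) ∩ ball y (r y))] G y :=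
      ae_restrict_of_ae_restrict_of_subset Set.inter_subset_right (hGe y hyΩ)
    have h1 := a1.symm.trans a2
    exact (Measure.eqOn_open_of_ae_eq h1 (isOpen_ball.inter isOpen_ball)
      ((hGd x hx).continuousOn.mono inter_subset_left)
      ((hGd y hyΩ).continuousOn.mono Set.inter_subset_right)
      ⟨hy, mem_ball_self (hr y hyΩ)⟩).symm
  refine ⟨fun x => G x x, fun x hx => ?_, ?_⟩
  · have h1 : (fun y => G y y) =ᶠ[𝓝 x] G x := by
      filter_upwards [ball_mem_nhds x (hr x hx)] with y hy using hpatch x hx y hy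
    exact (h1.differentiableAt_iff.2 ((hGd x hx).differentiableAt
      (ball_mem_nhds x (hr x hx)))).differentiableWithinAt
  · rw [EventuallyEq, ae_restrict_iff' hΩ.measurableSet, ae_iff]
    refine measure_null_of_locally_null _ fun x hx => ?_
    simp only [Set.mem_setOf_eq, Classical.not_imp] at hx
    refine ⟨{y | ¬(y ∈ Ω → F y = G y y)} ∩ ball x (r x),
      inter_mem self_mem_nhdsWithin (mem_nhdsWithin_of_mem_nhds
        (ball_mem_nhds x (hr x hx.1))), ?_⟩
    have h2 := hGe x hx.1
    rw [EventuallyEq, ae_restrict_iff' isOpen_ball.measurableSet, ae_iff] at h2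
    refine measure_mono_null (fun y hy => ?_) h2
    simp only [Set.mem_setOf_eq, Set.mem_inter_iff, Classical.not_imp] at hy ⊢
    refine ⟨hy.2, fun h => hy.1.2 ?_⟩
    rw [h, hpatch x hx.1 y hy.2]

end WeylLemma

section Psh

/-- Second order Taylor expansion with little-o remainder. -/
lemma taylor_two_bound {f : W → ℝ} (hf : ContDiff ℝ 2 f) (x : W) {ε : ℝ} (hε : 0 < ε) :
    ∃ δ > 0, ∀ h : W, ‖h‖ < δ → |f (x + h) - f x - fderiv ℝ f x h
      - (1 / 2) * fderiv ℝ (fderiv ℝ f) x h h| ≤ ε * ‖h‖ ^ 2 := by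
  have hd : Differentiable ℝ f := hf.differentiable (by norm_num)
  have hd2 : Differentiable ℝ (fderiv ℝ f) :=
    (hf.fderiv_right (m := 1) (by norm_num)).differentiable (by norm_num)
  have hsymm : IsSymmSndFDerivAt ℝ f x := hf.contDiffAt.isSymmSndFDerivAt (by simp)
  set B := fderiv ℝ (fderiv ℝ f) x with hB
  have h1 := (hd2 x).hasFDerivAt.isLittleO.def hε
  rw [Metric.eventually_nhds_iff] at h1
  obtain ⟨δ, hδ, h2⟩ := h1
  refine ⟨δ, hδ, fun h hh => ?_⟩
  let G : W → ℝ := fun k => f (x + k) - fderiv ℝ f x k - (1 / 2) * B k k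
  have hG : ∀ k, HasFDerivAt G (fderiv ℝ f (x + k) - fderiv ℝ f x - B k) k := by
    intro k
    have e1 : HasFDerivAt (fun k => f (x + k)) (fderiv ℝ f (x + k)) k :=
      (hasFDerivAt_comp_add_left x).2 (hd (x + k)).hasFDerivAt
    have e2 : HasFDerivAt (fun k => B k k) (B k + B.flip k) k := by
      have := B.hasFDerivAt.clm_apply (hasFDerivAt_id (𝕜 := ℝ) k)
      refine this.congr_fderiv ?_
      ext w; simp
    refine ((e1.sub (fderiv ℝ f x).hasFDerivAt).sub (e2.const_mul (1 / 2))).congr_fderiv ?_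
    ext w
    have := hsymm k w
    simp only [_root_.sub_apply, _root_.smul_apply, _root_.add_apply, smul_eq_mul,
      ContinuousLinearMap.flip_apply]
    rw [← hB] at this
    rw [← this]; ring
  have key := (convex_closedBall (0:W) ‖h‖).norm_image_sub_le_of_norm_hasFDerivWithin_le
    (f := G) (C := ε * ‖h‖) (𝕜 := ℝ) (x := 0) (y := h)
    (fun k _ => (hG k).hasFDerivWithinAt) (fun k hk => by
      have hk' : ‖k‖ ≤ ‖h‖ := by simpa using hk
      have := h2 (y := x + k) (by simpa using hk'.trans_lt hh)
      simp only [add_sub_cancel_left] at this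
      exact this.trans (by gcongr)) (by simp) (by simp)
  simp only [G, norm_eq_abs, add_zero, map_zero, sub_zero, mul_zero] at key
  rw [show f (x + h) - f x - fderiv ℝ f x h - 1 / 2 * B h h
    = f (x + h) - fderiv ℝ f x h - 1 / 2 * B h h - f x by ring]
  calc _ ≤ _ := key
    _ = _ := by ring

lemma levi_nonneg_of_submean {f : W → ℝ} (hf : ContDiff ℝ 2 f) {x : W} {R : ℝ} (hR : 0 < R)
    (h : ∀ v : W, ‖v‖ ≤ R → f x ≤ circleAverage (fun t => f (x + t • v)) 0 1) (v : W) :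
    0 ≤ levi f x v := by
  refine le_of_forall_pos_le_add fun ε' hε' => ?_
  obtain ⟨ε, hε, hεv⟩ : ∃ ε > 0, ε * ‖v‖ ^ 2 ≤ ε' :=
    ⟨ε' / (‖v‖ ^ 2 + 1), by positivity, by
      rw [div_mul_eq_mul_div, div_le_iff₀ (by positivity)]; nlinarith [sq_nonneg ‖v‖]⟩
  obtain ⟨δ, hδ, hT⟩ := taylor_two_bound hf x hε
  obtain ⟨r, hr, hrv⟩ : ∃ r > 0, r * ‖v‖ < min δ R :=
    ⟨min δ R / (‖v‖ + 1), by positivity, by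
      rw [div_mul_eq_mul_div, div_lt_iff₀ (by positivity)]
      have : 0 < min δ R := by positivity
      nlinarith [norm_nonneg v]⟩
  set L := fderiv ℝ f x
  set B := fderiv ℝ (fderiv ℝ f) x with hB
  have hnr : ‖r • v‖ = r * ‖v‖ := by rw [norm_smul, norm_of_nonneg hr.le]
  have h1 := h (r • v) (by rw [hnr]; exact (hrv.trans_le (min_le_right _ _)).le)
  have hexp : ∀ θ : ℝ, circleMap 0 1 θ • (r • v) = (r * Real.cos θ) • v
      + (r * Real.sin θ) • (I • v) := by
    intro θ
    simp only [circleMap, zero_add, ofReal_one, one_mul, exp_mul_I]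
    rw [add_smul, ← ofReal_cos, ← ofReal_sin, mul_smul, mul_smul, mul_smul]
    rw [← coe_smul r v, ← coe_smul r (Real.cos θ • v), ← coe_smul r (Real.sin θ • (I • v)),
      ← coe_smul (Real.cos θ), ← coe_smul (Real.sin θ)]
    simp only [smul_smul]
    congr 2 <;> ring
  let P : ℝ → ℝ := fun θ => (f x + ε * (r * ‖v‖) ^ 2) + ((r * L v) * Real.cos θ
    + ((r * L (I • v)) * Real.sin θ + ((r ^ 2 / 2 * B v v) * Real.cos θ ^ 2
    + ((r ^ 2 / 2 * (B v (I • v) + B (I • v) v)) * (Real.sin θ * Real.cos θ)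
    + (r ^ 2 / 2 * B (I • v) (I • v)) * Real.sin θ ^ 2))))
  have hP : ∀ θ : ℝ, f (x + circleMap 0 1 θ • (r • v)) ≤ P θ := by
    intro θ
    have hn : ‖circleMap 0 1 θ • (r • v)‖ = r * ‖v‖ := by
      rw [norm_smul, hnr]; simp
    have := (abs_le.1 (hT (circleMap 0 1 θ • (r • v)) (by
      rw [hn]; exact hrv.trans_le (min_le_left _ _)))).2
    rw [hn, hexp] at this
    rw [hexp]
    simp only [map_add, map_smul, _root_.add_apply, _root_.smul_apply, smul_eq_mul] at this
    simp only [P]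
    linarith
  have hc : Continuous f := hf.continuous
  have h2 : circleAverage (fun t => f (x + t • (r • v))) 0 1
      ≤ (2 * π)⁻¹ * ∫ θ in (0:ℝ)..(2 * π), P θ := by
    rw [circleAverage, smul_eq_mul]
    refine mul_le_mul_of_nonneg_left ?_ (by positivity)
    refine intervalIntegral.integral_mono_on (by positivity) ?_ ?_ fun θ _ => hP θ
    · refine Continuous.intervalIntegrable ?_ _ _
      have := continuous_circleMap (0:ℂ) 1
      fun_prop
    · exact Continuous.intervalIntegrable (by fun_prop) _ _
  have h3 : ∫ θ in (0:ℝ)..(2 * π), P θ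
      = 2 * π * (f x + ε * (r * ‖v‖) ^ 2 + r ^ 2 * levi f x v) := by
    have ii : ∀ g : ℝ → ℝ, Continuous g → IntervalIntegrable g volume 0 (2 * π) :=
      fun g hg => hg.intervalIntegrable _ _
    simp only [P]
    repeat rw [intervalIntegral.integral_add (ii _ (by fun_prop)) (ii _ (by fun_prop))]
    simp only [intervalIntegral.integral_const_mul, intervalIntegral.integral_const, integral_cos,
      integral_sin, integral_cos_sq, integral_sin_sq, integral_sin_mul_cos₁]
    simp only [Real.sin_two_pi, Real.cos_two_pi, Real.sin_zero, Real.cos_zero, levi, ← hB, smul_eq_mul]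
    ring
  rw [h3] at h2
  have hpi := Real.pi_pos
  rw [← mul_assoc, inv_mul_cancel₀ (by positivity), one_mul] at h2
  have h4 := h1.trans h2
  have : 0 ≤ r ^ 2 * (levi f x v + ε * ‖v‖ ^ 2) := by nlinarith
  have := nonneg_of_mul_nonneg_right this (by positivity)
  linarith

end Psh

section Psh2

/-- Plurisubharmonicity of a real-valued function. -/
structure RealPsh (f : W → ℝ) (Ω : Set W) : Prop where
  usc : UpperSemicontinuousOn f Ω
  submean : ∀ z ∈ Ω, ∀ v : W, (∀ t : ℂ, ‖t‖ ≤ 1 → z + t • v ∈ Ω) →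
    ∀ g : ℝ → ℝ, IntervalIntegrable g volume 0 (2 * π) →
      (∀ θ : ℝ, f (z + exp (θ * I) • v) ≤ g θ) →
      f z ≤ (2 * π)⁻¹ * ∫ θ in (0:ℝ)..(2 * π), g θ

lemma PlurisubharmonicOn.realPsh {f : W → ℝ} {Ω : Set W}
    (h : PlurisubharmonicOn (fun x => (f x : EReal)) Ω) : RealPsh f Ω where
  usc := fun x hx a ha => by
    simpa using h.1 x hx (a : EReal) (by simpa using ha)
  submean := fun z hz v hv g hg hgf => by
    have := h.2 z hz v hv g hg (fun θ => EReal.coe_le_coe_iff.2 (hgf θ))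
    exact EReal.coe_le_coe_iff.1 this

lemma RealPsh.max_const {f : W → ℝ} {Ω : Set W} (h : RealPsh f Ω) (c : ℝ) :
    RealPsh (fun x => max (f x) c) Ω where
  usc := fun x hx a ha => by
    change max (f x) c < a at ha
    rw [max_lt_iff] at ha
    filter_upwards [h.usc x hx a ha.1] with y hy using max_lt hy ha.2
  submean := fun z hz v hv g hg hgf => by
    refine max_le (h.submean z hz v hv g hg fun θ => (le_max_left _ _).trans (hgf θ)) ?_
    have h1 : ∫ θ in (0:ℝ)..(2 * π), c ≤ ∫ θ in (0:ℝ)..(2 * π), g θ :=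
      intervalIntegral.integral_mono_on (by positivity) (by simp) hg
        fun θ _ => (le_max_right _ _).trans (hgf θ)
    rw [intervalIntegral.integral_const, sub_zero, smul_eq_mul] at h1
    rw [← div_eq_inv_mul, le_div_iff₀ (by positivity)]
    linarith

lemma UpperSemicontinuousOn.measurable_indicator {X : Type*} [TopologicalSpace X]
    [MeasurableSpace X] [BorelSpace X] {f : X → ℝ} {L : Set X} (hL : MeasurableSet L)
    (hf : UpperSemicontinuousOn f L) : Measurable (L.indicator f) := by
  refine measurable_of_Iio fun a => ?_
  obtain ⟨u, hu, hfu⟩ := upperSemicontinuousOn_iff_preimage_Iio.1 hf a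
  have : L.indicator f ⁻¹' Set.Iio a = (L ∩ u) ∪ (Lᶜ ∩ {_x | 0 < a}) := by
    rw [← hfu]
    ext x
    by_cases hx : x ∈ L <;> simp [hx]
  rw [this]
  exact (hL.inter hu.measurableSet).union (hL.compl.inter (MeasurableSet.const _))

variable [FiniteDimensional ℂ W]

/-- Smooth plurisubharmonic regularization near a compact set. -/
theorem RealPsh.exists_smooth {f : W → ℝ} {Ω : Set W} (hΩ : IsOpen Ω) (hf : RealPsh f Ω)
    {k : ℝ} (hk : ∀ x ∈ Ω, k ≤ f x) {K : Set W} (hK : IsCompact K) (hKΩ : K ⊆ Ω) {η : ℝ}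
    (hη : 0 < η) :
    ∃ f' : W → ℝ, ContDiff ℝ (⊤ : ℕ∞) f' ∧ (∀ x ∈ K, f x ≤ f' x) ∧
      (∀ x ∈ K, ∀ a, (∀ y ∈ ball x η, y ∈ Ω → f y ≤ a) → f' x ≤ a) ∧
      ∀ x ∈ K, ∀ v, 0 ≤ levi f' x v := by
  let _ : MeasurableSpace W := borel W
  have : BorelSpace W := ⟨rfl⟩
  let μ : Measure W := Measure.addHaar
  obtain ⟨δ₀, hδ₀, hδΩ⟩ := hK.exists_cthickening_subset_open hΩ hKΩ
  obtain ⟨δ, hδ, hδ1, hδ2⟩ : ∃ δ > 0, δ ≤ η ∧ 3 * δ ≤ δ₀ :=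
    ⟨min η (δ₀ / 3), by positivity, min_le_left _ _, by
      linarith [min_le_right η (δ₀ / 3)]⟩
  obtain ⟨ρ, hρ⟩ := exists_isMollifier μ hδ
  set L := cthickening (3 * δ) K with hL
  have hLc : IsCompact L := hK.cthickening
  have hLΩ : L ⊆ Ω := (cthickening_mono hδ2 K).trans hδΩ
  have hnear : ∀ x ∈ K, ∀ y, ‖y‖ ≤ 3 * δ → x + y ∈ L := fun x hx y hy =>
    mem_cthickening_of_dist_le (x + y) x _ K hx (by simpa [dist_eq_norm] using hy)
  set g := L.indicator f with hg
  have hgm : Measurable g := (hf.usc.mono hLΩ).measurable_indicator hLc.measurableSet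
  obtain ⟨M, hM⟩ := (hf.usc.mono hLΩ).bddAbove_of_isCompact hLc
  have hgb : ∀ x, ‖g x‖ ≤ |M| + |k| := by
    intro x
    by_cases hx : x ∈ L
    · simp only [g, indicator_of_mem hx, norm_eq_abs]
      have h1 := hM (mem_image_of_mem f hx)
      have h2 := hk x (hLΩ hx)
      rw [abs_le]
      constructor <;> linarith [le_abs_self M, neg_abs_le k, abs_nonneg M, abs_nonneg k]
    · simp only [g, indicator_of_notMem hx, norm_zero]; positivity
  have hgloc : LocallyIntegrable g μ := by
    have h1 : IntegrableOn g L μ := Measure.integrableOn_of_bounded hLc.measure_lt_top.ne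
      hgm.aestronglyMeasurable (M := |M| + |k|) (.of_forall hgb)
    have h2 := (integrable_indicator_iff hLc.measurableSet).2 h1
    rw [hg, Set.indicator_indicator, Set.inter_self] at h2
    exact h2.locallyIntegrable
  have hρint : Integrable ρ μ := hρ.contDiff.continuous.integrable_of_hasCompactSupport
    hρ.hasCompactSupport
  have hρg : ∀ h : W → ℝ, Measurable h → (∀ x, ‖h x‖ ≤ |M| + |k|) →
      Integrable (fun y => ρ y • h y) μ := fun h hh hb => by
    simp only [smul_eq_mul]
    exact hρint.mul_bdd hh.aestronglyMeasurable (.of_forall hb)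
  have hρc : ∀ c : ℝ, ∫ y, ρ y • c ∂μ = c := fun c => by
    rw [integral_smul_const, hρ.integral_eq, one_smul]
  have hsub : ∀ x y, x ∈ L → (∀ t : ℂ, ‖t‖ ≤ 1 → x + t • y ∈ L) →
      g x ≤ circleAverage (fun t => g (x + t • y)) 0 1 := by
    intro x y hxL hxy
    simp only [g, indicator_of_mem hxL]
    have h1 := hf.submean x (hLΩ hxL) y (fun t ht => hLΩ (hxy t ht))
      (fun θ => g (x + circleMap 0 1 θ • y)) (by
        rw [intervalIntegrable_iff]
        refine Measure.integrableOn_of_bounded (M := |M| + |k|) measure_Ioc_lt_top.ne ?_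
          (.of_forall fun θ => hgb _)
        refine (hgm.comp ?_).aestronglyMeasurable
        have := continuous_circleMap (0:ℂ) 1
        exact Continuous.measurable (by fun_prop)) (fun θ => by
        have e : circleMap 0 1 θ = exp (θ * I) := by simp [circleMap]
        simp only [e, g]
        rw [indicator_of_mem]
        exact hxy _ (by simp [norm_exp]))
    rw [circleAverage, smul_eq_mul]
    exact h1
  refine ⟨moll μ ρ g, contDiff_moll hρ.contDiff hρ.hasCompactSupport hgloc, ?_, ?_, ?_⟩
  · intro x hx
    rw [moll_eq_integral_circleAverage hρ hgm.stronglyMeasurable hgb]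
    have hxL : x ∈ L := by simpa using hnear x hx 0 (by simpa using hδ.le)
    have hcm : Measurable fun y => circleAverage (fun t => g (x + t • y)) 0 1 := by
      simp only [circleAverage]
      refine Measurable.fun_const_smul ?_ _
      simp only [integral_of_le two_pi_pos.le]
      refine StronglyMeasurable.measurable ?_
      refine StronglyMeasurable.integral_prod_right (f := fun y θ => g (x + circleMap 0 1 θ • y)) ?_
      refine (hgm.comp ?_).stronglyMeasurable
      have := continuous_circleMap (0:ℂ) 1
      exact Continuous.measurable (by fun_prop)
    have hcb : ∀ y, ‖circleAverage (fun t => g (x + t • y)) 0 1‖ ≤ |M| + |k| := by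
      intro y
      rw [circleAverage, norm_smul]
      have := intervalIntegral.norm_integral_le_of_norm_le_const (a := 0) (b := 2 * π)
        (f := fun θ => g (x + circleMap 0 1 θ • y)) (C := |M| + |k|) fun θ _ => hgb _
      rw [sub_zero, abs_of_pos two_pi_pos] at this
      rw [norm_inv, norm_of_nonneg two_pi_pos.le, inv_mul_le_iff₀ two_pi_pos]
      linarith
    calc f x = ∫ y, ρ y • f x ∂μ := (hρc _).symm
      _ ≤ _ := by
        refine integral_mono (hρint.smul_const _) (hρg _ hcm hcb) fun y => ?_
        by_cases hy : δ ≤ ‖y‖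
        · simp [hρ.eq_zero y hy]
        · push Not at hy
          refine smul_le_smul_of_nonneg_left ?_ (hρ.nonneg y)
          have := hsub x y hxL fun t ht => hnear x hx _ (by
            rw [norm_smul]; nlinarith [norm_nonneg y, norm_nonneg t])
          rwa [hg, indicator_of_mem hxL] at this
  · intro x hx a ha
    rw [moll_eq_integral_sub]
    calc _ ≤ ∫ y, ρ y • a ∂μ := by
          refine integral_mono (hρg _ (hgm.comp (measurable_const.sub measurable_id))
            fun _ => hgb _) (hρint.smul_const _) fun y => ?_
          by_cases hy : δ ≤ ‖y‖
          · simp [hρ.eq_zero y hy]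
          · push Not at hy
            refine smul_le_smul_of_nonneg_left ?_ (hρ.nonneg y)
            have hL' : x - y ∈ L := by
              rw [sub_eq_add_neg]; exact hnear x hx _ (by rw [norm_neg]; linarith)
            simp only [g, indicator_of_mem hL']
            exact ha _ (by simpa [dist_eq_norm] using hy.trans_le hδ1) (hLΩ hL')
      _ = a := hρc a
  · intro x hx
    refine levi_nonneg_of_submean (R := δ) ((contDiff_moll (n := ⊤) hρ.contDiff
      hρ.hasCompactSupport hgloc).of_le (WithTop.coe_le_coe.2 (le_top : (2:ℕ∞) ≤ ⊤))) hδ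
      fun v hv => ?_
    have hIg : Integrable (uncurry fun (θ : ℝ) (y : W) =>
        ρ y • g (x + circleMap 0 1 θ • v - y))
        ((volume.restrict (Ioc 0 (2 * π))).prod μ) := by
      have h1 : Integrable (fun p : ℝ × W => (1:ℝ) * ρ p.2)
          ((volume.restrict (Ioc 0 (2 * π))).prod μ) :=
        (integrable_const (1:ℝ)).mul_prod hρint
      have h2 := h1.mul_bdd (c := |M| + |k|)
        (g := fun p : ℝ × W => g (x + circleMap 0 1 p.1 • v - p.2))
        ((hgm.comp (by
          have := continuous_circleMap (0:ℂ) 1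
          exact Continuous.measurable (by fun_prop))).aestronglyMeasurable)
        (.of_forall fun _ => hgb _)
      simpa [Function.uncurry_def] using h2
    have hswap : circleAverage (fun t => moll μ ρ g (x + t • v)) 0 1
        = ∫ y, ρ y • circleAverage (fun t => g ((x - y) + t • v)) 0 1 ∂μ := by
      simp only [circleAverage, moll_eq_integral_sub,
        integral_of_le two_pi_pos.le]
      rw [integral_integral_swap hIg, ← integral_smul]
      congr 1; ext y
      simp only [smul_eq_mul, integral_const_mul]
      rw [mul_left_comm]
      congr 4; ext θ; congr 1; abel
    rw [hswap, moll_eq_integral_sub]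
    refine integral_mono (hρg _ (hgm.comp (measurable_const.sub measurable_id))
      fun _ => hgb _) ?_ fun y => ?_
    · have h3 := hIg.integral_prod_right
      have h4 := h3.const_mul (2 * π)⁻¹
      refine h4.congr (.of_forall fun y => ?_)
      simp only [uncurry, circleAverage, smul_eq_mul, integral_const_mul,
        integral_of_le two_pi_pos.le]
      rw [mul_left_comm]
      congr 4; ext θ; congr 1; abel
    · by_cases hy : δ ≤ ‖y‖
      · simp [hρ.eq_zero y hy]
      · push Not at hy
        refine smul_le_smul_of_nonneg_left ?_ (hρ.nonneg y)
        refine hsub _ _ ?_ fun t ht => ?_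
        · rw [sub_eq_add_neg]; exact hnear x hx _ (by rw [norm_neg]; linarith)
        · rw [sub_eq_add_neg, add_assoc]
          refine hnear x hx _ ((norm_add_le _ _).trans ?_)
          rw [norm_neg, norm_smul]; nlinarith [norm_nonneg v, norm_nonneg t]

end Psh2

section Holomorphic
variable [FiniteDimensional ℂ W]

lemma DifferentiableOn.contDiffOn_real {G : W → ℂ} {Ω : Set W} (hG : DifferentiableOn ℂ G Ω)
    (hΩ : IsOpen Ω) (n : ℕ∞) : ContDiffOn ℝ n G Ω := by
  letI : MeasurableSpace W := borel W
  have : BorelSpace W := ⟨rfl⟩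
  let μ : Measure W := Measure.addHaar
  intro x hx
  obtain ⟨r, hr, hrΩ⟩ := nhds_basis_closedBall.mem_iff.1 (hΩ.mem_nhds hx)
  obtain ⟨ρ, hρ⟩ := exists_isMollifier μ (half_pos hr)
  obtain ⟨h1, C, hC⟩ := indicator_closedBall_of_continuousOn hG.continuousOn hrΩ
  have hloc : LocallyIntegrable ((closedBall x r).indicator G) μ := by
    have h3 : IntegrableOn ((closedBall x r).indicator G) (closedBall x r) μ :=
      Measure.integrableOn_of_bounded measure_closedBall_lt_top.ne
        h1.aestronglyMeasurable (M := C) (.of_forall hC)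
    have h2 := (integrable_indicator_iff measurableSet_closedBall).2 h3
    rw [Set.indicator_indicator, Set.inter_self] at h2
    exact h2.locallyIntegrable
  have h2 : ContDiff ℝ n (moll μ ρ ((closedBall x r).indicator G)) :=
    contDiff_moll (hρ.contDiff.of_le (by exact_mod_cast le_top)) hρ.hasCompactSupport hloc
  refine (h2.contDiffAt.congr_of_eventuallyEq ?_).contDiffWithinAt
  filter_upwards [ball_mem_nhds x (half_pos hr)] with y hy
  refine ((LineHol.of_differentiableOn hΩ hG).moll_indicator hG.continuousOn hρ hrΩ ?_).symm
  intro z hz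
  rw [mem_closedBall]
  rw [mem_ball] at hy hz
  linarith [dist_triangle z y x]

lemma fderiv_real_of_complex {G : W → ℂ} {x : W} (h : DifferentiableAt ℂ G x) (v : W) :
    fderiv ℝ G x v = fderiv ℂ G x v := by
  rw [(h.hasFDerivAt.restrictScalars ℝ).fderiv]; rfl

lemma dbar_eq_zero_of_differentiableAt {G : W → ℂ} {x : W} (h : DifferentiableAt ℂ G x) (v : W) :
    dbar v G x = 0 := by
  rw [dbar, fderiv_real_of_complex h, fderiv_real_of_complex h, map_smul, smul_eq_mul, ← mul_assoc,
    I_mul_I]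
  ring

/-- Directional derivatives of holomorphic functions are holomorphic. -/
lemma DifferentiableOn.fderiv_apply {G : W → ℂ} {Ω : Set W} (hG : DifferentiableOn ℂ G Ω)
    (hΩ : IsOpen Ω) (v : W) : DifferentiableOn ℂ (fun x => fderiv ℂ G x v) Ω := by
  have hc : ContDiffOn ℝ 2 G Ω := hG.contDiffOn_real hΩ 2
  have h1 : ContDiffOn ℝ 1 (fderiv ℝ G) Ω := hc.fderiv_of_isOpen hΩ (by norm_num)
  intro x hx
  have hxn := hΩ.mem_nhds hx
  have h2 : DifferentiableAt ℝ (fderiv ℝ G) x :=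
    (h1.contDiffAt hxn).differentiableAt (by norm_num)
  have hs : IsSymmSndFDerivAt ℝ G x := (hc.contDiffAt hxn).isSymmSndFDerivAt (by simp)
  have hd : ∀ w u, fderiv ℝ (fun y => fderiv ℝ G y w) x u = fderiv ℝ (fderiv ℝ G) x u w := by
    intro w u
    rw [fderiv_clm_apply h2 (differentiableAt_const _)]
    simp
  have hdiff : ∀ w, DifferentiableAt ℝ (fun y => fderiv ℝ G y w) x := fun w =>
    h2.clm_apply (differentiableAt_const _)
  have h3 : DifferentiableAt ℂ (fun y => fderiv ℝ G y v) x := by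
    refine differentiableAt_of_fderiv_I_smul (hdiff v) fun w => ?_
    rw [hd, hs.eq, hd, hs.eq w v]
    have : (fun y => fderiv ℝ G y (I • w)) =ᶠ[𝓝 x] fun y => I * fderiv ℝ G y w := by
      filter_upwards [hxn] with y hy
      have := hG.differentiableAt (hΩ.mem_nhds hy)
      rw [fderiv_real_of_complex this, fderiv_real_of_complex this, map_smul, smul_eq_mul]
    rw [← hd, this.fderiv_eq, fderiv_const_mul (hdiff w), ← hd w v]
    rfl
  refine (h3.congr_of_eventuallyEq ?_).differentiableWithinAt
  filter_upwards [hxn] with y hy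
  rw [fderiv_real_of_complex (hG.differentiableAt (hΩ.mem_nhds hy))]

variable [MeasurableSpace W] [BorelSpace W] {μ : Measure W} [μ.IsAddHaarMeasure]

lemma integral_mul_dbar_of_contDiffOn {Ω : Set W} (hΩ : IsOpen Ω) {P ω : W → ℂ}
    (hP : ContDiffOn ℝ 2 P Ω) (hω : ω ∈ testFn Ω) (v : W) :
    ∫ x, P x * dbar v ω x ∂μ = -∫ x, dbar v P x * ω x ∂μ := by
  have h0 := integral_dbar_eq_zero (μ := μ)
    ((mul_mem_testFn hΩ hω hP).1.of_le (by norm_num)) (mul_mem_testFn hΩ hω hP).2.1 v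
  have hzero : ∀ x ∉ Ω, ω x = 0 ∧ dbar v ω x = 0 := fun x hx =>
    ⟨(IsCC.of_testFn hω).eq_zero x hx, (IsCC.dbar hω v).eq_zero x hx⟩
  have key : ∀ x, dbar v (fun y => ω y * P y) x = dbar v ω x * P x + ω x * dbar v P x := by
    intro x
    by_cases hx : x ∈ Ω
    · rw [dbar_mul (hω.1.differentiable (by norm_num) x)
        ((hP.contDiffAt (hΩ.mem_nhds hx)).differentiableAt (by norm_num))]
      ring
    · rw [(IsCC.dbar (mul_mem_testFn hΩ hω hP) v).eq_zero x hx, (hzero x hx).1, (hzero x hx).2]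
      ring
  have hPd : ContinuousOn (dbar v P) Ω :=
    (contDiffOn_dbar (n := 1) hΩ (by exact_mod_cast hP) v).continuousOn
  have i1 := ((IsCC.dbar hω v).mul hΩ hP.continuousOn)
  have i2 := ((IsCC.of_testFn hω).mul hΩ hPd)
  simp only [key] at h0
  rw [integral_add (i1.cont.integrable_of_hasCompactSupport i1.cpt)
    (i2.cont.integrable_of_hasCompactSupport i2.cpt)] at h0
  simp only [mul_comm (P _), mul_comm (dbar v P _)]
  linear_combination h0

end Holomorphic

/-- A cutoff near the origin of the complex plane, with a bound for `∂̄χ / t`. -/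
structure IsPlaneCutoff (χ : ℂ → ℂ) (ε B : ℝ) : Prop where
  contDiff : ContDiff ℝ 3 χ
  sub : tsupport χ ⊆ ball 0 ε
  norm_le : ∀ τ, ‖χ τ‖ ≤ 1
  one : ∃ ε₁ > 0, ∀ τ ∈ ball (0 : ℂ) ε₁, χ τ = 1
  bound : ∀ τ, ‖dbar 1 χ τ / τ‖ ≤ B

namespace IsPlaneCutoff
variable {χ : ℂ → ℂ} {ε B : ℝ}

lemma dbar_eq_zero_near (hχ : IsPlaneCutoff χ ε B) :
    ∃ ε₁ > 0, ∀ τ ∈ ball (0 : ℂ) ε₁, χ τ = 1 ∧ dbar 1 χ τ = 0 := by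
  obtain ⟨ε₁, h1, h2⟩ := hχ.one
  refine ⟨ε₁, h1, fun τ hτ => ⟨h2 τ hτ, ?_⟩⟩
  have : χ =ᶠ[𝓝 τ] fun _ => 1 := by
    filter_upwards [isOpen_ball.mem_nhds hτ] with σ hσ using h2 σ hσ
  rw [dbar, this.fderiv_eq]
  simp

lemma eq_zero (hχ : IsPlaneCutoff χ ε B) {τ : ℂ} (hτ : ε ≤ ‖τ‖) : χ τ = 0 :=
  image_eq_zero_of_notMem_tsupport fun h => by
    have := hχ.sub h
    rw [mem_ball_zero_iff] at this
    linarith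

lemma contDiff_dbar_div (hχ : ContDiff ℝ 3 χ)
    (h0 : ∃ ε₁ > 0, ∀ τ ∈ ball (0 : ℂ) ε₁, dbar 1 χ τ = 0) :
    ContDiff ℝ 2 fun τ => dbar 1 χ τ / τ := by
  obtain ⟨ε₁, h1, h2⟩ := h0
  rw [contDiff_iff_contDiffAt]
  intro τ
  by_cases hτ : τ = 0
  · subst hτ
    refine (contDiffAt_const (c := (0 : ℂ))).congr_of_eventuallyEq ?_
    filter_upwards [ball_mem_nhds 0 h1] with σ hσ
    rw [h2 σ hσ, zero_div]
  · have h3 : ContDiff ℝ 2 (dbar 1 χ) := by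
      exact_mod_cast contDiff_dbar (n := 2) (f := χ) (by exact_mod_cast hχ) 1
    simp only [div_eq_mul_inv]
    exact h3.contDiffAt.mul (contDiffAt_inv ℝ hτ)

lemma tsupport_dbar_div (hχ : IsPlaneCutoff χ ε B) :
    tsupport (fun τ => dbar 1 χ τ / τ) ⊆ ball 0 ε := by
  refine subset_trans (closure_minimal (fun τ hτ => ?_) (isClosed_tsupport _))
    ((tsupport_dbar_subset 1 χ).trans hχ.sub)
  refine subset_closure (Function.mem_support.2 fun h => hτ ?_)
  simp [h]

lemma eq_zero_dbar_div (hχ : IsPlaneCutoff χ ε B) {τ : ℂ} (hτ : ε ≤ ‖τ‖) : dbar 1 χ τ / τ = 0 :=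
  image_eq_zero_of_notMem_tsupport (f := fun τ => dbar 1 χ τ / τ) fun h => by
    have := hχ.tsupport_dbar_div h
    rw [mem_ball_zero_iff] at this
    linarith

end IsPlaneCutoff

lemma exists_isPlaneCutoff {ε : ℝ} (hε : 0 < ε) :
    ∃ χ B, 0 ≤ B ∧ IsPlaneCutoff χ ε B := by
  obtain ⟨χ, h1, h2, h3, h4, h5⟩ := exists_cutoff (W := ℂ) (K := {0}) (U := ball 0 ε)
    isCompact_singleton isOpen_ball (by simpa using hε)
  let χ' : ℂ → ℂ := fun τ => (χ τ : ℂ)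
  have hsupp : tsupport χ' ⊆ tsupport χ := closure_mono fun τ hτ h => hτ (by simp [χ', h])
  have hc : ContDiff ℝ 3 χ' := ofRealCLM.contDiff.comp
    (h1.of_le (WithTop.coe_le_coe.2 (le_top : (3 : ℕ∞) ≤ ⊤)))
  have hone : ∃ ε₁ > 0, ∀ τ ∈ ball (0 : ℂ) ε₁, χ' τ = 1 := by
    rw [nhdsSet_singleton] at h5
    obtain ⟨ε₁, h6, h7⟩ := eventually_nhds_iff_ball.1 h5
    exact ⟨ε₁, h6, fun τ hτ => by simp [χ', h7 τ hτ]⟩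
  have hone' : ∃ ε₁ > 0, ∀ τ ∈ ball (0 : ℂ) ε₁, dbar 1 χ' τ = 0 := by
    obtain ⟨ε₁, h6, h7⟩ := hone
    refine ⟨ε₁, h6, fun τ hτ => ?_⟩
    have : χ' =ᶠ[𝓝 τ] fun _ => 1 := by
      filter_upwards [isOpen_ball.mem_nhds hτ] with σ hσ using h7 σ hσ
    rw [dbar, this.fderiv_eq]
    simp
  have hk := IsPlaneCutoff.contDiff_dbar_div hc hone'
  have hcs : HasCompactSupport fun τ => dbar 1 χ' τ / τ := by
    refine h2.of_isClosed_subset (isClosed_tsupport _) ?_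
    refine (closure_minimal (fun τ hτ => ?_) (isClosed_tsupport _)).trans
      ((tsupport_dbar_subset 1 χ').trans hsupp)
    refine subset_closure (Function.mem_support.2 fun h => hτ ?_)
    simp [h]
  obtain ⟨B, hB⟩ := hcs.exists_bound_of_continuous hk.continuous
  exact ⟨χ', B, (norm_nonneg _).trans (hB 0), hc, hsupp.trans h3, fun τ => by
    simpa [χ', abs_of_nonneg (h4 τ).1] using (h4 τ).2, hone, hB⟩

section Extension
variable [FiniteDimensional ℂ W]
variable {Ω : Set W} {f : W → ℂ} {t : W →L[ℂ] ℂ} {χ : ℂ → ℂ} {ε B : ℝ}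

lemma contDiffOn_mul_cutoff (hΩ : IsOpen Ω) {k : ℂ → ℂ} (hk : ContDiff ℝ 2 k)
    (hks : tsupport k ⊆ ball 0 ε) (hf : DifferentiableOn ℂ f (Ω ∩ {x | ‖t x‖ < ε})) :
    ContDiffOn ℝ 2 (fun x => f x * k (t x)) Ω := by
  have ho : IsOpen (Ω ∩ {x | ‖t x‖ < ε}) := hΩ.inter (isOpen_lt (by fun_prop) continuous_const)
  intro x hx
  refine ContDiffAt.contDiffWithinAt ?_
  have htc : ContDiff ℝ 2 fun x => k (t x) := hk.comp (t.restrictScalars ℝ).contDiff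
  by_cases h : t x ∈ tsupport k
  · have h1 : x ∈ Ω ∩ {x | ‖t x‖ < ε} := ⟨hx, by simpa using hks h⟩
    exact ((hf.contDiffOn_real ho 2).contDiffAt (ho.mem_nhds h1)).mul htc.contDiffAt
  · refine (contDiffAt_const (c := (0 : ℂ))).congr_of_eventuallyEq ?_
    have h2 : ∀ᶠ y in 𝓝 x, t y ∈ (tsupport k)ᶜ :=
      t.continuous.continuousAt.eventually ((isClosed_tsupport k).isOpen_compl.mem_nhds h)
    filter_upwards [h2] with y hy
    rw [image_eq_zero_of_notMem_tsupport hy, mul_zero]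

lemma dbar_comp_clm {k : ℂ → ℂ} {x : W} (hk : DifferentiableAt ℝ k (t x)) (v : W) :
    dbar v (fun x => k (t x)) x = conj (t v) * dbar 1 k (t x) := by
  have h : HasFDerivAt (fun x => k (t x)) ((fderiv ℝ k (t x)).comp (t.restrictScalars ℝ)) x :=
    hk.hasFDerivAt.comp x (t.restrictScalars ℝ).hasFDerivAt
  have hz : ∀ z : ℂ, fderiv ℝ k (t x) z = z.re * fderiv ℝ k (t x) 1 + z.im * fderiv ℝ k (t x) I := by
    intro z
    conv_lhs => rw [← re_add_im z]
    have : (z.re : ℂ) + z.im * I = z.re • (1 : ℂ) + z.im • I := by simp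
    rw [this, map_add, map_smul, map_smul]; simp
  rw [dbar, dbar, h.fderiv]
  simp only [ContinuousLinearMap.comp_apply, ContinuousLinearMap.coe_restrictScalars', map_smul,
    smul_eq_mul, mul_one]
  rw [hz (t v), hz (I * t v)]
  have : conj (t v) = (t v).re - (t v).im * I := by
    apply ext <;> simp
  rw [this]
  simp only [mul_re, mul_im, I_re, I_im, zero_mul, one_mul, zero_sub, zero_add, ofReal_neg]
  linear_combination ((1/2) * ((t v).im) * fderiv ℝ k (t x) I) * I_mul_I

lemma dbar_mul_cutoff (hΩ : IsOpen Ω) {k : ℂ → ℂ} (hk : ContDiff ℝ 2 k)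
    (hks : tsupport k ⊆ ball 0 ε) (hf : DifferentiableOn ℂ f (Ω ∩ {x | ‖t x‖ < ε}))
    {x : W} (hx : x ∈ Ω) (v : W) :
    dbar v (fun x => f x * k (t x)) x = conj (t v) * (f x * dbar 1 k (t x)) := by
  have ho : IsOpen (Ω ∩ {x | ‖t x‖ < ε}) := hΩ.inter (isOpen_lt (by fun_prop) continuous_const)
  have htc : ContDiff ℝ 2 fun x => k (t x) := hk.comp (t.restrictScalars ℝ).contDiff
  by_cases h : t x ∈ tsupport k
  · have h1 : x ∈ Ω ∩ {x | ‖t x‖ < ε} := ⟨hx, by simpa using hks h⟩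
    have hfx := hf.differentiableAt (ho.mem_nhds h1)
    rw [dbar_mul (hfx.restrictScalars ℝ) (htc.differentiable (by norm_num) x),
      dbar_eq_zero_of_differentiableAt hfx, dbar_comp_clm (hk.differentiable (by norm_num) _)]
    ring
  · have h2 : ∀ᶠ y in 𝓝 x, t y ∈ (tsupport k)ᶜ :=
      t.continuous.continuousAt.eventually ((isClosed_tsupport k).isOpen_compl.mem_nhds h)
    have h3 : (fun x => f x * k (t x)) =ᶠ[𝓝 x] fun _ => 0 := by
      filter_upwards [h2] with y hy
      rw [image_eq_zero_of_notMem_tsupport hy, mul_zero]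
    have h4 : dbar 1 k (t x) = 0 :=
      image_eq_zero_of_notMem_tsupport fun h' => h (tsupport_dbar_subset 1 k h')
    rw [dbar, h3.fderiv_eq, h4]
    simp

variable [MeasurableSpace W] [BorelSpace W] {μ : Measure W} [μ.IsAddHaarMeasure]

lemma ContinuousOn.locL2 {P : W → ℂ} (hP : ContinuousOn P Ω) : LocL2 μ Ω P := by
  intro K hK hKc
  obtain ⟨M, hM⟩ := hKc.exists_bound_of_continuousOn (hP.mono hK)
  have : IsFiniteMeasure (μ.restrict K) := ⟨by simpa using hKc.measure_lt_top⟩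
  refine MemLp.of_bound ((hP.mono hK).aestronglyMeasurable hKc.measurableSet) M ?_
  exact (ae_restrict_iff' hKc.measurableSet).2 (.of_forall hM)

lemma LocL2.continuousOn_mul {P g : W → ℂ} (hg : LocL2 μ Ω g) (hP : ContinuousOn P Ω) :
    LocL2 μ Ω fun x => P x * g x := by
  intro K hK hKc
  obtain ⟨M, hM⟩ := hKc.exists_bound_of_continuousOn (hP.mono hK)
  refine (hg K hK hKc).of_le_mul (c := M)
    (((hP.mono hK).aestronglyMeasurable hKc.measurableSet).mul (hg K hK hKc).1) ?_
  refine (ae_restrict_iff' hKc.measurableSet).2 (.of_forall fun x hx => ?_)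
  rw [norm_mul]
  exact mul_le_mul_of_nonneg_right (hM x hx) (norm_nonneg _)

variable {κ : Type*} [Fintype κ] {e : κ → W} {Φ : W → ℝ}

/-- If `∂̄ g = f ∂̄(χ ∘ t) / t`, then `f χ(t) - t g` is holomorphic and extends `f` from `t = 0`. -/
lemma exists_extension_of_dbar (he : ∀ v, ∃ b : κ → ℂ, v = ∑ j, b j • e j) (hΩ : IsOpen Ω)
    (hχ : IsPlaneCutoff χ ε B) (hε : 0 < ε)
    (hf : DifferentiableOn ℂ f (Ω ∩ {x | ‖t x‖ < ε})) {g : W → ℂ} (hg : LocL2 μ Ω g)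
    (hgd : ∀ j, ∀ ω ∈ testFn Ω, ∫ x, g x * dbar (e j) ω x ∂μ =
      -∫ x, conj (t (e j)) * (f x * (dbar 1 χ (t x) / t x)) * ω x ∂μ) :
    ∃ F : W → ℂ, DifferentiableOn ℂ F Ω ∧
      (fun x => f x * χ (t x) - t x * g x) =ᵐ[μ.restrict Ω] F ∧ ∀ x ∈ Ω, t x = 0 → F x = f x := by
  have hP := contDiffOn_mul_cutoff hΩ (hχ.contDiff.of_le (by norm_num)) hχ.sub hf
  have hloc : LocL2 μ Ω fun x => f x * χ (t x) - t x * g x := fun K hK hKc =>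
    (hP.continuousOn.locL2 K hK hKc).sub (hg.continuousOn_mul t.continuous.continuousOn K hK hKc)
  have hts : ∀ τ, dbar 1 χ τ = τ * (dbar 1 χ τ / τ) := by
    intro τ
    obtain ⟨ε₁, h1, h2⟩ := hχ.dbar_eq_zero_near
    by_cases hτ : τ = 0
    · rw [hτ, (h2 0 (mem_ball_self h1)).2]; simp
    · rw [mul_div_cancel₀ _ hτ]
  have htd : ContDiffOn ℝ 2 (fun x => t x) Ω := (t.restrictScalars ℝ).contDiff.contDiffOn
  obtain ⟨F, hF, hFe⟩ := weyl_lemma (μ := μ) he hΩ hloc fun j ω hω => by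
    have h1 := integral_mul_dbar_of_contDiffOn (μ := μ) hΩ hP hω (e j)
    have h2 := hgd j _ (mul_mem_testFn hΩ hω htd)
    have h3 : ∀ x, dbar (e j) (fun y => ω y * t y) x = t x * dbar (e j) ω x := fun x => by
      rw [dbar_mul (hω.1.differentiable (by norm_num) x)
        (t.differentiableAt.restrictScalars ℝ), dbar_eq_zero_of_differentiableAt t.differentiableAt]
      ring
    have hcω := IsCC.dbar hω (e j)
    have j1 := hcω.mul hΩ hP.continuousOn
    have j2 := hg.integrable_mul (b := fun x => t x * dbar (e j) ω x)
      (t.continuous.mul hcω.cont) (hcω.cpt.mul_left) 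
      ((tsupport_mul_subset_right).trans hcω.sub)
    have e1 : ∫ x, (f x * χ (t x) - t x * g x) * dbar (e j) ω x ∂μ
        = (∫ x, dbar (e j) ω x * (f x * χ (t x)) ∂μ) - ∫ x, g x * (t x * dbar (e j) ω x) ∂μ := by
      rw [← integral_sub (j1.cont.integrable_of_hasCompactSupport j1.cpt) j2]
      refine integral_congr_ae (.of_forall fun x => ?_)
      ring
    simp only [h3] at h2
    rw [e1, h2]
    simp only [mul_comm (dbar (e j) ω _)]
    rw [h1, sub_neg_eq_add, neg_add_eq_zero]
    refine integral_congr_ae (.of_forall fun x => ?_)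
    by_cases hx : x ∈ Ω
    · beta_reduce
      rw [dbar_mul_cutoff hΩ (hχ.contDiff.of_le (by norm_num)) hχ.sub hf hx]
      conv_lhs => rw [hts]
      ring
    · simp [(IsCC.of_testFn hω).eq_zero x hx]
  refine ⟨F, hF, hFe, fun x hx hx0 => ?_⟩
  obtain ⟨ε₁, h1, h2⟩ := hχ.dbar_eq_zero_near
  let Ω₀ := Ω ∩ {x | ‖t x‖ < min ε ε₁}
  have hΩ₀ : IsOpen Ω₀ := hΩ.inter (isOpen_lt (by fun_prop) continuous_const)
  have hsub : Ω₀ ⊆ Ω := inter_subset_left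
  have hb : ∀ y ∈ Ω₀, t y ∈ ball 0 ε₁ := fun y hy =>
    mem_ball_zero_iff.2 (hy.2.trans_le (min_le_right _ _))
  obtain ⟨G, hG, hGe⟩ := weyl_lemma (μ := μ) he hΩ₀
    (fun K hK hKc => hg K (hK.trans hsub) hKc : LocL2 μ Ω₀ g) fun j ω hω => by
    rw [hgd j ω ⟨hω.1, hω.2.1, hω.2.2.trans hsub⟩, neg_eq_zero]
    refine integral_eq_zero_of_ae (.of_forall fun y => ?_)
    by_cases hy : y ∈ Ω₀
    · simp [(h2 _ (hb y hy)).2]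
    · simp [(IsCC.of_testFn hω).eq_zero y hy]
  have hx₀ : x ∈ Ω₀ := ⟨hx, by simp [hx0, hε, h1]⟩
  have h3 : F =ᵐ[μ.restrict Ω₀] fun y => f y - t y * G y := by
    filter_upwards [ae_restrict_of_ae_restrict_of_subset hsub hFe, hGe,
      ae_restrict_mem hΩ₀.measurableSet] with y e1 e2 e3
    rw [← e1, e2, (h2 _ (hb y e3)).1, mul_one]
  have hfc : ContinuousOn f Ω₀ := hf.continuousOn.mono fun y hy =>
    ⟨hy.1, lt_of_lt_of_le (show ‖t y‖ < _ from hy.2) (min_le_left _ _)⟩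
  have := Measure.eqOn_open_of_ae_eq h3 hΩ₀ (hF.continuousOn.mono hsub)
    (hfc.sub (t.continuous.continuousOn.mul hG.continuousOn)) hx₀
  simpa [hx0] using this

/-- A coarse `L²` extension theorem from the hyperplane `t = 0`. -/
theorem extension_coarse (he : ∀ v, ∃ b : κ → ℂ, v = ∑ j, b j • e j)
    {s c : W → ℝ} {δ M : ℝ} {p : ℕ} (hw : LeviWeight e Ω Φ s c δ M p)
    (hte : ∑ j, ‖t (e j)‖ ^ 2 ≤ 1) {R : ℝ} (hR : ∀ x ∈ Ω, ‖t x‖ ≤ R)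
    (hχ : IsPlaneCutoff χ ε B) (hε : 0 < ε)
    (hf : DifferentiableOn ℂ f (Ω ∩ {x | ‖t x‖ < ε}))
    (hI : ∫⁻ x in Ω ∩ {x | ‖t x‖ < ε}, eofReal (rexp (-Φ x) * ‖f x‖ ^ 2) ∂μ ≠ ⊤) :
    ∃ F : W → ℂ, DifferentiableOn ℂ F Ω ∧ (∀ x ∈ Ω, t x = 0 → F x = f x) ∧
      ∫⁻ x in Ω, eofReal (rexp (-Φ x) * ‖F x‖ ^ 2) ∂μ ≤
        eofReal (2 + 2 * R ^ 2 * (4 / δ * B ^ 2)) *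
          ∫⁻ x in Ω ∩ {x | ‖t x‖ < ε}, eofReal (rexp (-Φ x) * ‖f x‖ ^ 2) ∂μ := by
  classical
  have hΩ := hw.isOpen
  have hΦ := hw.smooth
  have hδ := hw.pos
  set I := ∫⁻ x in Ω ∩ {x | ‖t x‖ < ε}, eofReal (rexp (-Φ x) * ‖f x‖ ^ 2) ∂μ with hIdef
  have hTo : IsOpen {x | ‖t x‖ < ε} := isOpen_lt (by fun_prop) continuous_const
  let kap : ℂ → ℂ := fun τ => dbar 1 χ τ / τ
  have hkd : ContDiff ℝ 2 kap := IsPlaneCutoff.contDiff_dbar_div hχ.contDiff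
    (by obtain ⟨ε₁, h1, h2⟩ := hχ.dbar_eq_zero_near; exact ⟨ε₁, h1, fun τ hτ => (h2 τ hτ).2⟩)
  have hks := hχ.tsupport_dbar_div
  have hQ := contDiffOn_mul_cutoff hΩ hkd hks hf
  let α : κ → W → ℂ := fun j x => conj (t (e j)) * (f x * kap (t x))
  have hα : ∀ j, AEStronglyMeasurable (α j) (μ.restrict Ω) := fun j =>
    (hQ.continuousOn.aestronglyMeasurable hΩ.measurableSet).const_mul _
  have hB0 : 0 ≤ B := (norm_nonneg _).trans (hχ.bound 0)
  have hsplit : ∀ h : W → ℝ, (∀ x ∈ Ω, h x ≤ indicator {x | ‖t x‖ < ε} (fun x => ‖f x‖ ^ 2) x) →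
      ∫⁻ x in Ω, eofReal (rexp (-Φ x) * h x) ∂μ ≤ I := by
    intro h hh
    rw [hIdef, Set.inter_comm, ← Measure.restrict_restrict hTo.measurableSet,
      ← lintegral_indicator hTo.measurableSet]
    refine setLIntegral_mono' hΩ.measurableSet fun x hx => ?_
    by_cases h1 : ‖t x‖ < ε
    · rw [indicator_of_mem (show x ∈ {x | ‖t x‖ < ε} from h1)]
      have := hh x hx
      rw [indicator_of_mem (show x ∈ {x | ‖t x‖ < ε} from h1)] at this
      gcongr
    · have := hh x hx
      rw [indicator_of_notMem (show x ∉ {x | ‖t x‖ < ε} from h1)] at this ⊢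
      rw [ENNReal.ofReal_of_nonpos (mul_nonpos_of_nonneg_of_nonpos (exp_nonneg _) this)]
  have hαI : ∫⁻ x in Ω, eofReal (rexp (-Φ x) * ∑ j, ‖α j x‖ ^ 2) ∂μ
      ≤ eofReal (B ^ 2) * I := by
    calc _ ≤ ∫⁻ x in Ω, eofReal (B ^ 2) * eofReal (rexp (-Φ x) *
          indicator {x | ‖t x‖ < ε} (fun x => ‖f x‖ ^ 2) x) ∂μ := by
          refine setLIntegral_mono' hΩ.measurableSet fun x hx => ?_
          rw [← eofReal_mul (by positivity)]
          refine ofReal_le_ofReal ?_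
          have h1 : ∑ j, ‖α j x‖ ^ 2 = (∑ j, ‖t (e j)‖ ^ 2) * (‖f x‖ * ‖kap (t x)‖) ^ 2 := by
            rw [sum_mul]
            refine sum_congr rfl fun j _ => ?_
            simp only [α, norm_mul, RCLike.norm_conj]; ring
          have h2 : ∑ j, ‖α j x‖ ^ 2 ≤
              B ^ 2 * indicator {x | ‖t x‖ < ε} (fun x => ‖f x‖ ^ 2) x := by
            rw [h1]
            by_cases h3 : ‖t x‖ < ε
            · rw [indicator_of_mem (show x ∈ {x | ‖t x‖ < ε} from h3)]
              calc _ ≤ 1 * (‖f x‖ * B) ^ 2 := by gcongr; exact hχ.bound _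
                _ = _ := by ring
            · rw [indicator_of_notMem (show x ∉ {x | ‖t x‖ < ε} from h3)]
              simp only [kap, hχ.eq_zero_dbar_div (not_lt.1 h3)]
              simp
          calc _ ≤ rexp (-Φ x) * (B ^ 2 * _) := by gcongr
            _ = _ := by ring
      _ = eofReal (B ^ 2) * ∫⁻ x in Ω, eofReal (rexp (-Φ x) *
          indicator {x | ‖t x‖ < ε} (fun x => ‖f x‖ ^ 2) x) ∂μ :=
          lintegral_const_mul' _ _ ofReal_ne_top
      _ ≤ _ := by gcongr; exact hsplit _ fun x _ => le_rfl
  obtain ⟨g, hgm, hgl, hgI, hgd⟩ := hormander (μ := μ) hw hα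
    (ne_top_of_le_ne_top (mul_ne_top ofReal_ne_top hI) hαI)
    fun j k ω hω => by
      have hk : ∀ k j, ∫ x, α k x * dbar (e j) ω x ∂μ = -(conj (t (e k)) *
          (conj (t (e j)) * ∫ x, f x * dbar 1 kap (t x) * ω x ∂μ)) := fun k j => by
        have h1 := integral_mul_dbar_of_contDiffOn (μ := μ) hΩ hQ hω (e j)
        have h2 : ∫ x, dbar (e j) (fun x => f x * kap (t x)) x * ω x ∂μ =
            conj (t (e j)) * ∫ x, f x * dbar 1 kap (t x) * ω x ∂μ := by
          rw [← integral_const_mul]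
          refine integral_congr_ae (.of_forall fun x => ?_)
          by_cases hx : x ∈ Ω
          · have := dbar_mul_cutoff hΩ hkd hks hf hx (e j)
            beta_reduce
            rw [this]; ring
          · simp [(IsCC.of_testFn hω).eq_zero x hx]
        rw [← h2, ← mul_neg, ← h1, ← integral_const_mul]
        refine integral_congr_ae (.of_forall fun x => ?_)
        simp only [α]; ring
      rw [hk, hk]
      ring
  obtain ⟨F, hF, hFe, hF0⟩ := exists_extension_of_dbar he hΩ hχ hε hf hgl fun j ω hω => hgd j ω hω
  refine ⟨F, hF, hF0, ?_⟩
  have hR2 : ∀ x ∈ Ω, ‖t x‖ ^ 2 ≤ R ^ 2 := fun x hx => by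
    have := hR x hx
    gcongr
  calc ∫⁻ x in Ω, eofReal (rexp (-Φ x) * ‖F x‖ ^ 2) ∂μ
      ≤ ∫⁻ x in Ω, (eofReal 2 * eofReal (rexp (-Φ x) *
          indicator {x | ‖t x‖ < ε} (fun x => ‖f x‖ ^ 2) x) +
          eofReal (2 * R ^ 2) * eofReal (rexp (-Φ x) * ‖g x‖ ^ 2)) ∂μ := by
        refine lintegral_mono_ae ?_
        filter_upwards [hFe, ae_restrict_mem hΩ.measurableSet] with x h1 h2
        rw [← h1, ← eofReal_mul (by norm_num), ← eofReal_mul (by positivity),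
          ← eofReal_add]
        · refine ofReal_le_ofReal ?_
          have h4 : ‖f x * χ (t x)‖ ^ 2 ≤ indicator {x | ‖t x‖ < ε} (fun x => ‖f x‖ ^ 2) x := by
            by_cases h3 : ‖t x‖ < ε
            · rw [indicator_of_mem (show x ∈ {x | ‖t x‖ < ε} from h3), norm_mul]
              have := hχ.norm_le (t x)
              have := mul_le_mul_of_nonneg_left this (norm_nonneg (f x))
              rw [mul_one] at this
              gcongr
            · rw [indicator_of_notMem (show x ∉ {x | ‖t x‖ < ε} from h3), hχ.eq_zero (not_lt.1 h3)]
              simp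
          have h5 : ‖f x * χ (t x) - t x * g x‖ ^ 2 ≤
              2 * ‖f x * χ (t x)‖ ^ 2 + 2 * (‖t x‖ ^ 2 * ‖g x‖ ^ 2) := by
            have := norm_sub_le (f x * χ (t x)) (t x * g x)
            have h6 := norm_mul (t x) (g x)
            rw [← mul_pow, ← h6]
            calc _ ≤ (‖f x * χ (t x)‖ + ‖t x * g x‖) ^ 2 := by gcongr
              _ ≤ _ := by nlinarith [sq_nonneg (‖f x * χ (t x)‖ - ‖t x * g x‖)]
          have h7 : ‖t x‖ ^ 2 * ‖g x‖ ^ 2 ≤ R ^ 2 * ‖g x‖ ^ 2 := by gcongr ?_ * _; exact hR2 x h2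
          have := exp_nonneg (-Φ x)
          nlinarith
        · have : 0 ≤ indicator {x | ‖t x‖ < ε} (fun x => ‖f x‖ ^ 2) x :=
            indicator_nonneg (fun _ _ => by positivity) x
          positivity
        · positivity
    _ ≤ eofReal 2 * I + eofReal (2 * R ^ 2) *
          (eofReal (4 / δ) * (eofReal (B ^ 2) * I)) := by
        rw [lintegral_add_right', lintegral_const_mul' _ _ ofReal_ne_top,
          lintegral_const_mul' _ _ ofReal_ne_top]
        · gcongr
          · exact hsplit _ fun x _ => le_rfl
          · exact hgI.trans (by gcongr)
        · have h1 : AEStronglyMeasurable (fun x => rexp (-Φ x)) (μ.restrict Ω) :=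
            (Real.continuous_exp.comp_continuousOn hΦ.continuousOn.neg).aestronglyMeasurable
              hΩ.measurableSet
          exact ((h1.mul (hgm.norm.pow 2)).aemeasurable.ennreal_ofReal).const_mul _
    _ = _ := by
        have h4 : 0 ≤ 4 / δ := by positivity
        rw [eofReal_add (by norm_num) (by positivity), eofReal_mul (p := 2 * R ^ 2) (by positivity),
          eofReal_mul h4]
        ring

end Extension

section Levi
variable {W' : Type*} [NormedAddCommGroup W'] [NormedSpace ℂ W']

lemma ContDiffAt.differentiableAt_fderiv {s : W → ℝ} {x : W} (hs : ContDiffAt ℝ 2 s x) :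
    DifferentiableAt ℝ (fderiv ℝ s) x :=
  (hs.fderiv_right (m := 1) (by norm_num)).differentiableAt (by norm_num)

lemma ContDiffAt.eventually_differentiableAt {s : W → ℝ} {x : W} (hs : ContDiffAt ℝ 2 s x) :
    ∀ᶠ y in 𝓝 x, DifferentiableAt ℝ s y :=
  (hs.eventually (by norm_num)).mono fun _ h => h.differentiableAt (by norm_num)

lemma levi_add {f g : W → ℝ} {x : W} (hf : ContDiffAt ℝ 2 f x) (hg : ContDiffAt ℝ 2 g x) (v : W) :
    levi (fun y => f y + g y) x v = levi f x v + levi g x v := by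
  have h1 : fderiv ℝ (fun y => f y + g y) =ᶠ[𝓝 x] fun y => fderiv ℝ f y + fderiv ℝ g y := by
    filter_upwards [hf.eventually_differentiableAt, hg.eventually_differentiableAt] with y h1 h2
    exact fderiv_fun_add h1 h2
  simp only [levi, h1.fderiv_eq,
    fderiv_fun_add hf.differentiableAt_fderiv hg.differentiableAt_fderiv, _root_.add_apply]
  ring

lemma levi_const_mul {f : W → ℝ} {x : W} (hf : ContDiffAt ℝ 2 f x) (a : ℝ) (v : W) :
    levi (fun y => a * f y) x v = a * levi f x v := by
  have h1 : fderiv ℝ (fun y => a * f y) =ᶠ[𝓝 x] fun y => a • fderiv ℝ f y := by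
    filter_upwards [hf.eventually_differentiableAt] with y h1
    exact fderiv_const_mul h1 a
  simp only [levi, h1.fderiv_eq, fderiv_fun_const_smul hf.differentiableAt_fderiv, _root_.smul_apply,
    smul_eq_mul]
  ring

lemma levi_sum {ι : Type*} (S : Finset ι) {f : ι → W → ℝ} {x : W}
    (hf : ∀ i ∈ S, ContDiffAt ℝ 2 (f i) x) (v : W) :
    levi (fun y => ∑ i ∈ S, f i y) x v = ∑ i ∈ S, levi (f i) x v := by
  classical
  induction S using induction_on with
  | empty => simp [levi]
  | insert i S hi ih =>
    simp only [sum_insert hi]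
    rw [levi_add (hf i (mem_insert_self _ _))
      (ContDiffAt.sum fun j hj => hf j (mem_insert_of_mem hj)),
      ih fun j hj => hf j (mem_insert_of_mem hj)]

lemma levi_comp_clm {f : W' → ℝ} (L : W →L[ℂ] W') {x : W} (hf : ContDiffAt ℝ 2 f (L x)) (v : W) :
    levi (fun y => f (L y)) x v = levi f (L x) (L v) := by
  let L' : W →L[ℝ] W' := L.restrictScalars ℝ
  have h1 : fderiv ℝ (fun y => f (L y)) =ᶠ[𝓝 x] fun y => (fderiv ℝ f (L y)).comp L' := by
    filter_upwards [L.continuous.continuousAt.eventually hf.eventually_differentiableAt] with y h1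
    exact (h1.hasFDerivAt.comp y L'.hasFDerivAt).fderiv
  have h2 : HasFDerivAt (fun y => fderiv ℝ f (L y)) ((fderiv ℝ (fderiv ℝ f) (L x)).comp L') x :=
    hf.differentiableAt_fderiv.hasFDerivAt.comp x L'.hasFDerivAt
  have h3 := h2.clm_comp (hasFDerivAt_const L' x)
  simp only [levi, h1.fderiv_eq, h3.fderiv]
  simp [L']

lemma levi_comp_ge {s : W → ℝ} {x : W} (hs : ContDiffAt ℝ 2 s x) {h h' : ℝ → ℝ} {h'' : ℝ}
    (h1 : ∀ᶠ τ in 𝓝 (s x), HasDerivAt h (h' τ) τ) (h2 : HasDerivAt h' h'' (s x)) (h0 : 0 ≤ h'')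
    (v : W) : h' (s x) * levi s x v ≤ levi (fun y => h (s y)) x v := by
  have e1 : fderiv ℝ (fun y => h (s y)) =ᶠ[𝓝 x] fun y => h' (s y) • fderiv ℝ s y := by
    filter_upwards [hs.eventually_differentiableAt,
      hs.continuousAt.eventually h1] with y h1 h2
    exact (h2.comp_hasFDerivAt y h1.hasFDerivAt).fderiv
  have e2 := (h2.comp_hasFDerivAt x (hs.differentiableAt (by norm_num)).hasFDerivAt).smul
    hs.differentiableAt_fderiv.hasFDerivAt
  simp only [levi, e1.fderiv_eq]
  change HasFDerivAt (fun y => h' (s y) • fderiv ℝ s y) _ x at e2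
  rw [e2.fderiv]
  simp only [_root_.add_apply, _root_.smul_apply, ContinuousLinearMap.smulRight_apply,
    smul_eq_mul, Function.comp]
  nlinarith [mul_nonneg h0 (sq_nonneg (fderiv ℝ s x v)),
    mul_nonneg h0 (sq_nonneg (fderiv ℝ s x (I • v)))]

lemma levi_norm_sq (x v : ℂ) : levi (fun τ : ℂ => ‖τ‖ ^ 2) x v = ‖v‖ ^ 2 := by
  have h1 : fderiv ℝ (fun τ : ℂ => ‖τ‖ ^ 2) = fun τ => 2 • innerSL ℝ τ := by
    ext1 τ
    exact (hasStrictFDerivAt_norm_sq τ).hasFDerivAt.fderiv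
  have h2 : HasFDerivAt (fun τ : ℂ => 2 • innerSL ℝ τ) (2 • (innerSL ℝ : ℂ →L[ℝ] ℂ →L[ℝ] ℝ)) x :=
    (2 • (innerSL ℝ : ℂ →L[ℝ] ℂ →L[ℝ] ℝ)).hasFDerivAt
  rw [levi, h1, h2.fderiv]
  have h3 : ∀ u : ℂ, innerSL ℝ u u = ‖u‖ ^ 2 := fun u => real_inner_self_eq_norm_sq u
  simp only [_root_.smul_apply, h3, smul_eq_mul, norm_mul, norm_I, nsmul_eq_mul]
  norm_num
  ring

/-- The squared Hermitian norm on `ℂⁿ × ℂ`. -/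
def sqNorm {n : ℕ} (x : ℂ^n × ℂ) : ℝ := ∑ k, ‖x.1 k‖ ^ 2 + ‖x.2‖ ^ 2

lemma sqNorm_nonneg {n : ℕ} (x : ℂ^n × ℂ) : 0 ≤ sqNorm x := by
  unfold sqNorm; positivity

lemma contDiff_sqNorm {n : ℕ} {m : WithTop ℕ∞} : ContDiff ℝ m (sqNorm (n := n)) := by
  unfold sqNorm
  refine ContDiff.add (ContDiff.sum fun k _ => ContDiff.norm_sq ℝ ?_) (ContDiff.norm_sq ℝ ?_)
  · fun_prop
  · fun_prop

lemma levi_sqNorm {n : ℕ} (x v : ℂ^n × ℂ) : levi sqNorm x v = sqNorm v := by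
  let P : Fin n → (ℂ^n × ℂ) →L[ℂ] ℂ := fun k =>
    (ContinuousLinearMap.proj k).comp (ContinuousLinearMap.fst ℂ ℂ^n ℂ)
  let T : (ℂ^n × ℂ) →L[ℂ] ℂ := ContinuousLinearMap.snd ℂ ℂ^n ℂ
  have hn : ContDiff ℝ 2 fun τ : ℂ => ‖τ‖ ^ 2 := contDiff_norm_sq ℝ
  have hP : ∀ k, ContDiff ℝ 2 fun x => ‖P k x‖ ^ 2 := fun k =>
    hn.comp ((P k).restrictScalars ℝ).contDiff
  have hT : ContDiff ℝ 2 fun x => ‖T x‖ ^ 2 := hn.comp (T.restrictScalars ℝ).contDiff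
  have e : sqNorm (n := n) = fun x => ∑ k, ‖P k x‖ ^ 2 + ‖T x‖ ^ 2 := rfl
  rw [e, levi_add (ContDiff.sum fun k _ => hP k).contDiffAt hT.contDiffAt,
    levi_sum _ fun k _ => (hP k).contDiffAt, levi_comp_clm T hn.contDiffAt, levi_norm_sq]
  congr 1
  refine sum_congr rfl fun k _ => ?_
  rw [levi_comp_clm (P k) hn.contDiffAt, levi_norm_sq]

end Levi

section Exhaustion

lemma ContinuousOn.exists_uniform_near {X : Type*} [PseudoMetricSpace X] [ProperSpace X]
    {u : X → ℝ} {D K : Set X} (hu : ContinuousOn u D) (hD : IsOpen D) (hK : IsCompact K)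
    (hKD : K ⊆ D) {a : ℝ} (ha : 0 < a) :
    ∃ η > 0, ∀ x ∈ K, ∀ y ∈ ball x η, y ∈ D ∧ |u y - u x| ≤ a := by
  obtain ⟨r, hr, hrD⟩ := hK.exists_cthickening_subset_open hD hKD
  have hc : IsCompact (cthickening r K) := hK.cthickening
  have hun := hc.uniformContinuousOn_of_continuous (hu.mono hrD)
  obtain ⟨η, hη, h⟩ := uniformContinuousOn_iff.1 hun a ha
  have hmem : ∀ x ∈ K, ∀ y ∈ ball x r, y ∈ cthickening r K := fun x hx y hy =>
    mem_cthickening_of_dist_le y x r K hx (mem_ball.1 hy).le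
  refine ⟨min η r, lt_min hη hr, fun x hx y hy => ?_⟩
  have hy' := hmem x hx y (ball_subset_ball (min_le_right _ _) hy)
  refine ⟨hrD hy', ?_⟩
  have := h y hy' x (hmem x hx x (mem_ball_self hr))
    ((mem_ball.1 hy).trans_le (min_le_left _ _))
  rw [Real.dist_eq] at this
  exact this.le

variable {n : ℕ} {D L : Set (ℂ^n × ℂ)}

/-- A relatively compact domain with a smooth strictly plurisubharmonic exhaustion. -/
structure StrictExhaustion (D Ω K : Set (ℂ^n × ℂ)) (s : ℂ^n × ℂ → ℝ) (B : ℝ) :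
    Prop where
  isOpen : IsOpen Ω
  sub : Ω ⊆ K
  cpt : IsCompact K
  subD : K ⊆ D
  smooth : ContDiffOn ℝ 2 s Ω
  nonneg : ∀ x ∈ Ω, 0 ≤ s x
  sublevel : ∀ a, IsCompact {x ∈ Ω | s x ≤ a}
  levi_ge : ∀ x ∈ Ω, ∀ v, sqNorm v ≤ levi s x v
  B_nonneg : 0 ≤ B
  grad : ∀ x ∈ Ω, ‖fderiv ℝ s x‖ ≤ B * (1 + s x) ^ 2

/-- A domain with a continuous plurisubharmonic exhaustion function. -/
def HasPshExhaustion (D : Set (ℂ^n × ℂ)) : Prop := IsOpen D ∧ ∃ u, ContinuousOn u D ∧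
  RealPsh u D ∧ ∀ c : ℝ, ∃ K, IsCompact K ∧ K ⊆ D ∧ {x ∈ D | u x ≤ c} ⊆ K

theorem exists_strictExhaustion (hE : HasPshExhaustion D)
    (hL : IsCompact L) (hLD : L ⊆ D) :
    ∃ Ω K s B, L ⊆ Ω ∧ StrictExhaustion D Ω K s B := by
  obtain ⟨hD, u, hu, hpsh, hex⟩ := hE
  have hsub : ∀ c : ℝ, IsCompact {x ∈ D | u x ≤ c} := fun c => by
    obtain ⟨K, h1, h2, h3⟩ := hex c
    have : {x ∈ D | u x ≤ c} = K ∩ {x ∈ D | u x ≤ c} := (Set.inter_eq_right.2 h3).symm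
    rw [this]
    have h4 : K ∩ {x ∈ D | u x ≤ c} = K ∩ u ⁻¹' Set.Iic c := by
      ext x; exact ⟨fun h => ⟨h.1, h.2.2⟩, fun h => ⟨h.1, h2 h.1, h.2⟩⟩
    rw [h4]
    exact h1.of_isClosed_subset ((hu.mono h2).preimage_isClosed_of_isClosed h1.isClosed isClosed_Iic)
      inter_subset_left
  obtain ⟨k, hk⟩ : ∃ k, ∀ x ∈ D, k ≤ u x := by
    obtain ⟨k, hk⟩ := (hsub 0).bddBelow_image (f := u) (hu.mono fun x hx => hx.1)
    refine ⟨min k 0, fun x hx => ?_⟩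
    by_cases h : u x ≤ 0
    · exact (min_le_left _ _).trans (hk ⟨x, ⟨hx, h⟩, rfl⟩)
    · exact (min_le_right _ _).trans (not_le.1 h).le
  obtain ⟨c₀, hc₀⟩ := hL.bddAbove_image (f := u) (hu.mono hLD)
  set c := c₀ + 1 with hc
  set K := {x ∈ D | u x ≤ c + 1} with hKdef
  have hK : IsCompact K := hsub _
  have hKD : K ⊆ D := fun x hx => hx.1
  obtain ⟨η, hη, hηK⟩ := hu.exists_uniform_near hD hK hKD (a := 1 / 2) (by norm_num)
  obtain ⟨u', hu's, hu'1, hu'2, hu'3⟩ := hpsh.exists_smooth hD hk hK hKD hη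
  have hu'2 : ∀ x ∈ K, u' x ≤ u x + 1 / 2 := fun x hx => hu'2 x hx _ fun y hy _ => by
    have := (abs_le.1 (hηK x hx y hy).2).2
    linarith
  have hu'c : ContDiff ℝ 2 u' := hu's.of_le (WithTop.coe_le_coe.2 (le_top : (2 : ℕ∞) ≤ ⊤))
  let Ω : Set (ℂ^n × ℂ) := {x | (x ∈ D ∧ u x < c + 1) ∧ u' x < c}
  have hΩK : Ω ⊆ K := fun x hx => ⟨hx.1.1, hx.1.2.le⟩
  have hΩo : IsOpen Ω := (hu.isOpen_inter_preimage hD isOpen_Iio).inter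
    (isOpen_lt hu's.continuous continuous_const)
  let s : ℂ^n × ℂ → ℝ := fun x => (c - u' x)⁻¹ + sqNorm x
  have hpos : ∀ x ∈ Ω, 0 < c - u' x := fun x hx => sub_pos.2 hx.2
  have hv : ∀ x ∈ Ω, ContDiffAt ℝ 2 (fun x => (c - u' x)⁻¹) x := fun x hx =>
    (contDiffAt_const.sub hu'c.contDiffAt).inv (hpos x hx).ne'
  have hd1 : ContinuousOn (fun x => ‖fderiv ℝ u' x‖) K :=
    ((hu'c.continuous_fderiv (by norm_num)).norm).continuousOn
  have hd2 : ContinuousOn (fun x => ‖fderiv ℝ (sqNorm (n := n)) x‖) K :=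
    (((contDiff_sqNorm (m := 2)).continuous_fderiv (by norm_num)).norm).continuousOn
  obtain ⟨B₁, hB₁⟩ := hK.bddAbove_image hd1
  obtain ⟨B₂, hB₂⟩ := hK.bddAbove_image hd2
  refine ⟨Ω, K, s, |B₁| + |B₂|, fun x hx => ?_, ⟨hΩo, hΩK, hK, hKD, ?_, ?_, ?_, ?_, ?_, ?_⟩⟩
  · have h1 : u x ≤ c₀ := hc₀ ⟨x, hx, rfl⟩
    have h2 : x ∈ K := ⟨hLD hx, by linarith⟩
    exact ⟨⟨hLD hx, by linarith⟩, by linarith [hu'2 x h2]⟩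
  · exact fun x hx => ((hv x hx).add contDiff_sqNorm.contDiffAt).contDiffWithinAt
  · exact fun x hx => add_nonneg (inv_nonneg.2 (hpos x hx).le) (sqNorm_nonneg x)
  · intro a
    have : {x ∈ Ω | s x ≤ a} =
        K ∩ {x | u' x ≤ c ∧ 1 + sqNorm x * (c - u' x) ≤ a * (c - u' x)} := by
      ext x
      constructor
      · rintro ⟨h1, h2⟩
        refine ⟨hΩK h1, h1.2.le, ?_⟩
        have := mul_le_mul_of_nonneg_right h2 (hpos x h1).le
        simp only [s, add_mul, inv_mul_cancel₀ (hpos x h1).ne'] at this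
        exact this
      · rintro ⟨h1, h2, h3⟩
        have h4 : u' x < c := by
          refine lt_of_le_of_ne h2 fun h => ?_
          rw [h, sub_self, mul_zero, mul_zero, add_zero] at h3
          linarith
        have h5 : x ∈ Ω := ⟨⟨h1.1, by linarith [hu'1 x h1]⟩, h4⟩
        refine ⟨h5, le_of_mul_le_mul_right ?_ (hpos x h5)⟩
        simp only [s, add_mul, inv_mul_cancel₀ (hpos x h5).ne']
        exact h3
    rw [this]
    have hcq : Continuous (sqNorm (n := n)) := (contDiff_sqNorm (m := 0)).continuous
    have hcu := hu's.continuous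
    exact hK.inter_right ((isClosed_le hcu continuous_const).inter
      (isClosed_le
      (continuous_const.add (hcq.mul (continuous_const.sub hcu)))
      (continuous_const.mul (continuous_const.sub hcu))))
  · intro x hx v
    have hp := hpos x hx
    rw [levi_add (hv x hx) contDiff_sqNorm.contDiffAt, levi_sqNorm]
    have h1 : ∀ τ : ℝ, τ < c → HasDerivAt (fun τ => (c - τ)⁻¹) ((c - τ)⁻¹ ^ 2) τ := fun τ hτ => by
      have := ((hasDerivAt_id τ).const_sub c).inv (sub_pos.2 hτ).ne'
      refine this.congr_deriv ?_
      simp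
    have h2 : HasDerivAt (fun τ => (c - τ)⁻¹ ^ 2) (2 * (c - u' x)⁻¹ * (c - u' x)⁻¹ ^ 2) (u' x) := by
      have := (h1 _ hx.2).pow 2
      refine this.congr_deriv ?_
      simp
    have h3 := levi_comp_ge (hu'c.contDiffAt (x := x)) (h := fun τ => (c - τ)⁻¹)
      (h' := fun τ => (c - τ)⁻¹ ^ 2) (by
        filter_upwards [isOpen_Iio.mem_nhds hx.2] with τ hτ using h1 τ hτ) h2 (by positivity) v
    have h4 := mul_nonneg (sq_nonneg (c - u' x)⁻¹) (hu'3 x (hΩK hx) v)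
    linarith
  · positivity
  · intro x hx
    have hp := hpos x hx
    have hvd := (hv x hx).differentiableAt (by norm_num)
    have e1 : HasFDerivAt (fun x => (c - u' x)⁻¹) ((c - u' x)⁻¹ ^ 2 • fderiv ℝ u' x) x := by
      have h1 : HasDerivAt (fun τ => (c - τ)⁻¹) ((c - u' x)⁻¹ ^ 2) (u' x) := by
        have := ((hasDerivAt_id (u' x)).const_sub c).inv (sub_pos.2 hx.2).ne'
        refine this.congr_deriv ?_
        simp
      exact h1.comp_hasFDerivAt x (hu'c.differentiable (by norm_num) x).hasFDerivAt
    have e2 : fderiv ℝ s x = (c - u' x)⁻¹ ^ 2 • fderiv ℝ u' x + fderiv ℝ sqNorm x :=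
      (e1.add ((contDiff_sqNorm (m := 2)).differentiable (by norm_num) x).hasFDerivAt).fderiv
    have hs1 : (c - u' x)⁻¹ ≤ s x := le_add_of_nonneg_right (sqNorm_nonneg x)
    have hi : 0 ≤ (c - u' x)⁻¹ := inv_nonneg.2 hp.le
    have b1 : ‖fderiv ℝ u' x‖ ≤ |B₁| := (hB₁ ⟨x, hΩK hx, rfl⟩).trans (le_abs_self _)
    have b2 : ‖fderiv ℝ (sqNorm (n := n)) x‖ ≤ |B₂| := (hB₂ ⟨x, hΩK hx, rfl⟩).trans (le_abs_self _)
    rw [e2]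
    calc _ ≤ (c - u' x)⁻¹ ^ 2 * ‖fderiv ℝ u' x‖ + ‖fderiv ℝ (sqNorm (n := n)) x‖ := by
          refine (norm_add_le _ _).trans (add_le_add ?_ le_rfl)
          rw [norm_smul, norm_of_nonneg (by positivity)]
      _ ≤ (1 + s x) ^ 2 * |B₁| + 1 * |B₂| := by
          rw [one_mul]
          gcongr
          linarith
      _ ≤ (1 + s x) ^ 2 * |B₁| + (1 + s x) ^ 2 * |B₂| := by
          gcongr
          nlinarith
      _ = _ := by ring

end Exhaustion

section PiIntegral
variable {E : Type*} [MeasureSpace E] [SigmaFinite (volume : Measure E)]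

lemma lintegral_pi_cons {N : ℕ} {Q : (Fin (N + 1) → E) → ℝ≥0∞} (hQ : Measurable Q) :
    ∫⁻ Z, Q Z = ∫⁻ z, ∫⁻ Z' : Fin N → E, Q (Fin.cons z Z') := by
  have h := (volume_preserving_piFinSuccAbove (fun _ : Fin (N + 1) => E) 0).symm
  have hm : Measurable fun a : E × (Fin N → E) =>
      Q ((MeasurableEquiv.piFinSuccAbove (fun _ => E) 0).symm a) := hQ.comp h.measurable
  rw [← h.lintegral_comp hQ, Measure.volume_eq_prod, lintegral_prod _ hm.aemeasurable]
  simp [MeasurableEquiv.piFinSuccAbove, Fin.insertNthEquiv]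

lemma lintegral_pi_prod {q : E → ℝ≥0∞} (hq : Measurable q) (N : ℕ) :
    ∫⁻ Z : Fin N → E, ∏ i, q (Z i) = (∫⁻ z, q z) ^ N := by
  induction N with
  | zero =>
    simp only [Finset.univ_eq_empty, Finset.prod_empty, pow_zero, lintegral_const, one_mul]
    rw [volume_pi, Measure.pi_univ]; simp
  | succ N ih =>
    rw [lintegral_pi_cons (by fun_prop)]
    simp only [Fin.prod_univ_succ, Fin.cons_zero, Fin.cons_succ]
    have hm : Measurable fun Z : Fin N → E => ∏ i, q (Z i) := by fun_prop
    simp only [lintegral_const_mul _ hm, ih]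
    rw [lintegral_mul_const _ hq, pow_succ']

end PiIntegral

lemma hasDerivAt_posPow (m : ℕ) (a x : ℝ) :
    HasDerivAt (fun y : ℝ => (max (y - a) 0) ^ (m + 2)) ((m + 2) * (max (x - a) 0) ^ (m + 1)) x := by
  have hp : ∀ x, HasDerivAt (fun y : ℝ => (y - a) ^ (m + 2)) ((m + 2) * (x - a) ^ (m + 1)) x :=
    fun x => by
      have := ((hasDerivAt_id x).sub_const a).pow (m + 2)
      refine this.congr_deriv ?_
      simp
  rcases lt_trichotomy x a with h | h | h
  · rw [max_eq_right (by linarith)]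
    refine ((hasDerivAt_const x (0 : ℝ)).congr_of_eventuallyEq ?_).congr_deriv (by simp)
    filter_upwards [isOpen_Iio.mem_nhds h] with y hy
    rw [max_eq_right (sub_nonpos.2 (le_of_lt hy))]; simp
  · subst h
    rw [sub_self, max_self, ← hasDerivWithinAt_univ, ← Set.Iic_union_Ici (a := x)]
    refine HasDerivWithinAt.union ?_ ?_
    · refine ((hasDerivWithinAt_const x _ (0 : ℝ)).congr (fun y hy => ?_) (by simp)).congr_deriv
        (by simp)
      rw [max_eq_right (sub_nonpos.2 hy)]; simp
    · refine ((hp x).hasDerivWithinAt.congr (fun y hy => ?_) (by simp)).congr_deriv (by simp)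
      rw [max_eq_left (sub_nonneg.2 hy)]
  · rw [max_eq_left (by linarith)]
    refine (hp x).congr_of_eventuallyEq ?_
    filter_upwards [isOpen_Ioi.mem_nhds h] with y hy
    rw [max_eq_left (sub_nonneg.2 (le_of_lt hy))]

lemma contDiff_posPow (m : ℕ) (a : ℝ) :
    ContDiff ℝ 2 fun y : ℝ => (max (y - a) 0) ^ (m + 3) := by
  have e1 : deriv (fun y : ℝ => (max (y - a) 0) ^ (m + 3)) =
      fun x => ((m + 1 : ℕ) + 2 : ℝ) * (max (x - a) 0) ^ (m + 2) :=
    funext fun x => (hasDerivAt_posPow (m + 1) a x).deriv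
  rw [show (2 : WithTop ℕ∞) = 1 + 1 by norm_num, contDiff_succ_iff_deriv]
  refine ⟨fun x => (hasDerivAt_posPow (m + 1) a x).differentiableAt, by simp, ?_⟩
  rw [e1, contDiff_one_iff_deriv]
  have h2 : ∀ x, HasDerivAt (fun x => ((m + 1 : ℕ) + 2 : ℝ) * (max (x - a) 0) ^ (m + 2)) _ x :=
    fun x => (hasDerivAt_posPow m a x).const_mul _
  refine ⟨fun x => (h2 x).differentiableAt, ?_⟩
  rw [funext fun x => (h2 x).deriv]
  fun_prop

section FiberProduct
variable {n : ℕ}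

/-- The `i`-th projection of the `N`-fold fibre product of `ℂⁿ × ℂ` over `ℂ`. -/
def fibProj (N : ℕ) (i : Fin N) : ((Fin N → ℂ^n) × ℂ) →L[ℂ] (ℂ^n × ℂ) :=
  ((ContinuousLinearMap.proj i).comp (ContinuousLinearMap.fst ℂ (Fin N → ℂ^n) ℂ)).prod
    (ContinuousLinearMap.snd ℂ (Fin N → ℂ^n) ℂ)

@[simp] lemma fibProj_apply {N : ℕ} (i : Fin N) (x : (Fin N → ℂ^n) × ℂ) :
    fibProj N i x = (x.1 i, x.2) := rfl

lemma norm_fibProj_le {N : ℕ} (i : Fin N) : ‖fibProj (n := n) N i‖ ≤ 1 :=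
  ContinuousLinearMap.opNorm_le_bound _ zero_le_one fun x => by
    rw [fibProj_apply, one_mul, Prod.norm_def, Prod.norm_def]
    exact max_le_max (norm_le_pi_norm x.1 i) le_rfl

/-- The fibre product of a set over the last coordinate. -/
def fibProd (N : ℕ) (Ω : Set (ℂ^n × ℂ)) : Set ((Fin N → ℂ^n) × ℂ) :=
  {x | ∀ i, (x.1 i, x.2) ∈ Ω}

/-- The standard basis of the fibre product. -/
def fibBasis (N n : ℕ) : (Fin N × Fin n) ⊕ Unit → (Fin N → ℂ^n) × ℂ :=
  Sum.elim (fun p => (Pi.single p.1 (Pi.single p.2 1), 0)) fun _ => (0, 1)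

lemma isOpen_fibProd {N : ℕ} {Ω : Set (ℂ^n × ℂ)} (hΩ : IsOpen Ω) :
    IsOpen (fibProd N Ω) := by
  have : fibProd N Ω = ⋂ i, fibProj N i ⁻¹' Ω := by ext; simp [fibProd]
  rw [this]
  exact isOpen_iInter_of_finite fun i => hΩ.preimage (fibProj N i).continuous

lemma sum_fibBasis {N : ℕ} (b : (Fin N × Fin n) ⊕ Unit → ℂ) :
    ∑ j, b j • fibBasis N n j = (fun i k => b (Sum.inl (i, k)), b (Sum.inr ())) := by
  rw [Fintype.sum_sum_type]
  simp only [fibBasis, Sum.elim_inl, Sum.elim_inr, Finset.univ_unique, Finset.sum_singleton,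
    Fintype.sum_prod_type]
  refine Prod.ext ?_ ?_
  · ext i k
    simp only [Prod.fst_add, Prod.fst_sum, Prod.smul_fst, smul_zero, add_zero, Finset.sum_apply,
      Pi.smul_apply, Pi.single_apply, smul_eq_mul]
    rw [sum_eq_single i, sum_eq_single k]
    · simp
    · intro k' _ hk; simp [hk.symm]
    · simp
    · intro i' _ hi
      refine Finset.sum_eq_zero fun k' _ => ?_
      simp [hi.symm]
    · simp
  · simp [Prod.snd_sum]

lemma fibBasis_span {N : ℕ} (v : (Fin N → ℂ^n) × ℂ) :
    ∃ b : (Fin N × Fin n) ⊕ Unit → ℂ, v = ∑ j, b j • fibBasis N n j :=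
  ⟨Sum.elim (fun p => v.1 p.1 p.2) fun _ => v.2, by rw [sum_fibBasis]; rfl⟩

lemma norm_fibBasis_le {N : ℕ} (j) : ‖fibBasis N n j‖ ≤ 1 := by
  rcases j with ⟨i, k⟩ | j
  · simp only [fibBasis, Sum.elim_inl, Prod.norm_def, norm_zero]
    rw [Pi.norm_single, Pi.norm_single]; simp
  · simp [fibBasis, Prod.norm_def]

lemma sum_sq_le_sqNorm {N : ℕ} (hN : N ≠ 0) (b : (Fin N × Fin n) ⊕ Unit → ℂ) :
    ∑ j, ‖b j‖ ^ 2 ≤ ∑ i, sqNorm (fibProj N i (∑ j, b j • fibBasis N n j)) := by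
  rw [sum_fibBasis, Fintype.sum_sum_type, Fintype.sum_prod_type]
  simp only [fibProj_apply, sqNorm, sum_add_distrib, Finset.univ_unique,
    Finset.sum_singleton, Finset.sum_const, Finset.card_univ, Fintype.card_fin, nsmul_eq_mul]
  have : (1 : ℝ) ≤ N := by exact_mod_cast Nat.one_le_iff_ne_zero.2 hN
  have h2 := sq_nonneg ‖b (Sum.inr ())‖
  change _ + ‖b (Sum.inr ())‖ ^ 2 ≤ _
  nlinarith

lemma norm_dz_ofReal_le {W : Type*} [NormedAddCommGroup W] [NormedSpace ℂ W] {s : W → ℝ} {x : W}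
    (hs : DifferentiableAt ℝ s x) (v : W) :
    ‖dz v ℂ∘s x‖ ≤ ‖fderiv ℝ s x‖ * ‖v‖ := by
  have h : HasFDerivAt ℂ∘s (ofRealCLM.comp (fderiv ℝ s x)) x :=
    ofRealCLM.hasFDerivAt.comp x hs.hasFDerivAt
  rw [dz, h.fderiv]
  simp only [ContinuousLinearMap.comp_apply, ofRealCLM_apply]
  have h1 := (fderiv ℝ s x).le_opNorm v
  have h2 := (fderiv ℝ s x).le_opNorm (I • v)
  rw [norm_smul, norm_I, one_mul] at h2
  have h3 := norm_sub_le (fderiv ℝ s x v : ℂ) (I * fderiv ℝ s x (I • v))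
  rw [norm_mul, norm_I, one_mul, norm_real, norm_real] at h3
  rw [norm_mul]
  have : ‖(1 / 2 : ℂ)‖ = 1 / 2 := by norm_num
  rw [this]
  linarith

/-- The product integral on a fibre product. -/
lemma lintegral_fibProd {q : ℂ^n × ℂ → ℝ≥0∞} (hq : Measurable q) (N : ℕ) :
    ∫⁻ x : (Fin N → ℂ^n) × ℂ, ∏ i, q (fibProj N i x) = ∫⁻ t, (∫⁻ z, q (z, t)) ^ N := by
  have hm : Measurable fun x : (Fin N → ℂ^n) × ℂ => ∏ i, q (fibProj N i x) :=
    Finset.measurable_prod _ fun i _ => hq.comp (fibProj N i).continuous.measurable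
  rw [Measure.volume_eq_prod, lintegral_prod_symm _ hm.aemeasurable]
  refine lintegral_congr fun t => ?_
  exact lintegral_pi_prod (hq.comp measurable_prodMk_right) N

end FiberProduct

lemma isAddHaarMeasure_pi_pi (N n : ℕ) :
    (volume : Measure (Fin N → ℂ^n)).IsAddHaarMeasure :=
  Measure.pi.isAddHaarMeasure fun _ : Fin N => (volume : Measure ℂ^n)

lemma isAddHaarMeasure_pi_pi_prod (N n : ℕ) :
    (volume : Measure ((Fin N → ℂ^n) × ℂ)).IsAddHaarMeasure := by
  have := isAddHaarMeasure_pi_pi N n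
  exact Measure.prod.instIsAddHaarMeasure (volume : Measure (Fin N → ℂ^n)) _

lemma ContinuousOn.measurable_indicator {X : Type*} [TopologicalSpace X] [MeasurableSpace X]
    [OpensMeasurableSpace X] {Y : Type*} [TopologicalSpace Y] [MeasurableSpace Y] [BorelSpace Y]
    [Zero Y] {g : X → Y} {E : Set X} (hg : ContinuousOn g E) (hE : MeasurableSet E) :
    Measurable (E.indicator g) := by
  classical
  rw [← Set.piecewise_eq_indicator]
  exact hg.measurable_piecewise continuousOn_const hE

lemma DifferentiableOn.prod_of_forall {W : Type*} [NormedAddCommGroup W] [NormedSpace ℂ W]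
    {ι : Type*} (S : Finset ι) {g : ι → W → ℂ} {Ω : Set W}
    (hg : ∀ i ∈ S, DifferentiableOn ℂ (g i) Ω) :
    DifferentiableOn ℂ (fun x => ∏ i ∈ S, g i x) Ω := by
  classical
  induction S using induction_on with
  | empty => simp [differentiableOn_const]
  | insert a S ha ih =>
    simp only [Finset.prod_insert ha]
    exact (hg a (mem_insert_self _ _)).fun_mul
      (ih fun i hi => hg i (mem_insert_of_mem hi))

section FiberExtension
variable {n : ℕ} {D Ω K : Set (ℂ^n × ℂ)} {s φ : ℂ^n × ℂ → ℝ} {B : ℝ}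

/-- The sum of a function over the factors of a fibre product. -/
def fibSum (N : ℕ) (s : ℂ^n × ℂ → ℝ) (x : (Fin N → ℂ^n) × ℂ) : ℝ :=
  ∑ i, s (fibProj N i x)

lemma ContDiffOn.fibSum (hs : ContDiffOn ℝ 2 s Ω) (N : ℕ) :
    ContDiffOn ℝ 2 (fibSum N s) (fibProd N Ω) := by
  refine ContDiffOn.sum fun i _ => hs.comp
    ((fibProj N i).restrictScalars ℝ).contDiff.contDiffOn fun x hx => hx i

lemma levi_fibSum {N : ℕ} {x : (Fin N → ℂ^n) × ℂ}
    (hs : ∀ i, ContDiffAt ℝ 2 s (fibProj N i x)) (v : (Fin N → ℂ^n) × ℂ) :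
    levi (fibSum N s) x v = ∑ i, levi s (fibProj N i x) (fibProj N i v) := by
  have h1 := levi_sum Finset.univ (f := fun i y => s (fibProj N i y)) (fun i _ => (hs i).comp x
    ((fibProj N i).restrictScalars ℝ).contDiff.contDiffAt) v
  refine h1.trans ?_
  exact sum_congr rfl fun i _ => levi_comp_clm (fibProj N i) (hs i) v

namespace StrictExhaustion
variable (h : StrictExhaustion D Ω K s B)
include h

lemma contDiffAt {x} (hx : x ∈ Ω) : ContDiffAt ℝ 2 s x :=
  h.smooth.contDiffAt (h.isOpen.mem_nhds hx)

lemma fibSum_nonneg {N : ℕ} {x} (hx : x ∈ fibProd N Ω) : 0 ≤ fibSum N s x :=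
  sum_nonneg fun i _ => h.nonneg _ (hx i)

lemma le_fibSum {N : ℕ} {x} (hx : x ∈ fibProd N Ω) (i : Fin N) :
    s (fibProj N i x) ≤ fibSum N s x :=
  single_le_sum (f := fun i => s (fibProj N i x)) (fun i _ => h.nonneg _ (hx i))
    (mem_univ i)

lemma isCompact_fibSum_le {N : ℕ} (hN : N ≠ 0) (a : ℝ) :
    IsCompact {x ∈ fibProd N Ω | fibSum N s x ≤ a} := by
  set Ka := {x ∈ Ω | s x ≤ a} with hKa
  have hK : IsCompact Ka := h.sublevel a
  set C : Set ((Fin N → ℂ^n) × ℂ) := ⋂ i, fibProj N i ⁻¹' Ka with hC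
  have hCc : IsClosed C := isClosed_iInter fun i => hK.isClosed.preimage (fibProj N i).continuous
  have hCΩ : C ⊆ fibProd N Ω := fun x hx i => (Set.mem_iInter.1 hx i).1
  have hCcpt : IsCompact C := by
    refine ((isCompact_univ_pi fun _ : Fin N => hK.image continuous_fst).prod
      (hK.image continuous_snd)).of_isClosed_subset hCc fun x hx => ?_
    have hx' := Set.mem_iInter.1 hx
    refine ⟨fun i _ => ⟨_, hx' i, rfl⟩, ⟨_, hx' ⟨0, Nat.pos_of_ne_zero hN⟩, rfl⟩⟩
  have e : {x ∈ fibProd N Ω | fibSum N s x ≤ a} = C ∩ fibSum N s ⁻¹' Set.Iic a := by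
    ext x
    refine ⟨fun hx => ⟨Set.mem_iInter.2 fun i => ⟨hx.1 i, (h.le_fibSum hx.1 i).trans hx.2⟩, hx.2⟩,
      fun hx => ⟨hCΩ hx.1, hx.2⟩⟩
  rw [e]
  exact hCcpt.of_isClosed_subset
    (((h.smooth.fibSum N).continuousOn.mono hCΩ).preimage_isClosed_of_isClosed hCc isClosed_Iic)
    inter_subset_left

lemma norm_fderiv_fibSum_le {N : ℕ} {x} (hx : x ∈ fibProd N Ω) :
    ‖fderiv ℝ (fibSum N s) x‖ ≤ N * (B * (1 + fibSum N s x) ^ 2) := by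
  have hd : ∀ i, HasFDerivAt (fun y => s (fibProj N i y))
      ((fderiv ℝ s (fibProj N i x)).comp ((fibProj N i).restrictScalars ℝ)) x := fun i =>
    ((h.contDiffAt (hx i)).differentiableAt (by norm_num)).hasFDerivAt.comp x
      ((fibProj N i).restrictScalars ℝ).hasFDerivAt
  have hs : HasFDerivAt (fibSum N s) (∑ i, (fderiv ℝ s (fibProj N i x)).comp
      ((fibProj N i).restrictScalars ℝ)) x := HasFDerivAt.fun_sum fun i _ => hd i
  rw [hs.fderiv]
  refine (norm_sum_le _ _).trans ?_
  refine (sum_le_card_nsmul _ _ (B * (1 + fibSum N s x) ^ 2) fun i _ => ?_).trans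
    (by simp)
  refine (ContinuousLinearMap.opNorm_comp_le _ _).trans ?_
  have h1 : ‖(fibProj (n := n) N i).restrictScalars ℝ‖ ≤ 1 := by
    rw [ContinuousLinearMap.norm_restrictScalars]; exact norm_fibProj_le i
  have h2 := h.grad _ (hx i)
  have h3 : B * (1 + s (fibProj N i x)) ^ 2 ≤ B * (1 + fibSum N s x) ^ 2 := by
    have := h.le_fibSum hx i
    have := h.nonneg _ (hx i)
    have := h.B_nonneg
    gcongr
  calc _ ≤ ‖fderiv ℝ s (fibProj N i x)‖ * 1 := by gcongr
    _ ≤ _ := by rw [mul_one]; exact h2.trans h3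

end StrictExhaustion

lemma mul_pow_four_le_posPow {A k0 S : ℝ} (hA : 0 ≤ A) (h1 : 2 * k0 + 1 ≤ S) (hS : 0 ≤ S)
    (h2 : 10 * A ≤ S) : A * (1 + S) ^ 4 ≤ 7 * (max (S - k0) 0) ^ 6 := by
  have h3 : (1 + S) / 2 ≤ max (S - k0) 0 := le_max_of_le_left (by linarith)
  have h4 : ((1 + S) / 2) ^ 6 ≤ (max (S - k0) 0) ^ 6 := by gcongr
  have h5 : A ≤ 7 / 64 * (1 + S) ^ 2 := by nlinarith
  have h6 : 0 ≤ (1 + S) ^ 4 := by positivity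
  have h7 := mul_le_mul_of_nonneg_right h5 h6
  nlinarith

/-- Extension of the tensor powers of a function on the central fibre, with bounds on the
norm that are geometric in the tensor power. -/
theorem StrictExhaustion.exists_extension (h : StrictExhaustion D Ω K s B)
    (hφ : ContDiff ℝ 2 φ) {δ : ℝ} (hδ : 0 < δ) (hlevi : ∀ x ∈ Ω, ∀ v, δ * sqNorm v ≤ levi φ x v)
    {R : ℝ} (hR : ∀ x ∈ Ω, ‖x.2‖ ≤ R) {f : ℂ^n → ℂ}
    (hf : DifferentiableOn ℂ f {z | (z, (0 : ℂ)) ∈ D}) {ε : ℝ} (hε : 0 < ε)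
    (hεD : ∀ x ∈ Ω, ‖x.2‖ < ε → (x.1, (0 : ℂ)) ∈ D) {M : ℝ≥0∞} (hM : M ≠ ⊤)
    (hfM : ∀ τ : ℂ, ‖τ‖ < ε →
      ∫⁻ z in {z | (z, τ) ∈ Ω}, eofReal (rexp (-φ (z, τ)) * ‖f z‖ ^ 2) ≤ M)
    {k1 : ℝ} (hk1 : 0 ≤ k1) :
    ∃ C : ℝ≥0∞, C ≠ ⊤ ∧ ∀ N : ℕ, N ≠ 0 → ∃ F : (Fin N → ℂ^n) × ℂ → ℂ,
      DifferentiableOn ℂ F (fibProd N Ω) ∧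
      (∀ Z, (Z, (0 : ℂ)) ∈ fibProd N Ω → F (Z, 0) = ∏ i, f (Z i)) ∧
      ∫⁻ x in fibProd N {x ∈ Ω | s x < k1},
        eofReal (rexp (-fibSum N φ x) * ‖F x‖ ^ 2) ≤ C * M ^ N := by
  obtain ⟨χ, B', hB', hχ⟩ := exists_isPlaneCutoff hε
  refine ⟨eofReal (2 + 2 * R ^ 2 * (4 / δ * B' ^ 2)) * volume (ball (0 : ℂ) ε),
    mul_ne_top ofReal_ne_top measure_ball_lt_top.ne, fun N hN => ?_⟩
  set S := fibSum N s with hS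
  set k0 : ℝ := N * k1 with hk0
  have hk00 : 0 ≤ k0 := by positivity
  set Φ : (Fin N → ℂ^n) × ℂ → ℝ := fun x => fibSum N φ x + (max (S x - k0) 0) ^ 7 with hΦdef
  set c : (Fin N → ℂ^n) × ℂ → ℝ := fun x => δ + 7 * (max (S x - k0) 0) ^ 6 with hcdef
  have hΩN : IsOpen (fibProd N Ω) := isOpen_fibProd h.isOpen
  have hSs : ContDiffOn ℝ 2 S (fibProd N Ω) := h.smooth.fibSum N
  have hφN : ContDiffOn ℝ 2 (fibSum N φ) (fibProd N Ω) := hφ.contDiffOn.fibSum N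
  have hpow : ContDiffOn ℝ 2 (fun x => (max (S x - k0) 0) ^ 7) (fibProd N Ω) :=
    (contDiff_posPow 4 k0).comp_contDiffOn hSs
  have hΦs : ContDiffOn ℝ 2 Φ (fibProd N Ω) := hφN.add hpow
  have hcc : ContinuousOn c (fibProd N Ω) := by
    have := hSs.continuousOn
    fun_prop
  have hlv : ∀ x ∈ fibProd N Ω, ∀ b : (Fin N × Fin n) ⊕ Unit → ℂ,
      c x * ∑ j, ‖b j‖ ^ 2 ≤ levi Φ x (∑ j, b j • fibBasis N n j) := by
    intro x hx b
    set v := ∑ j, b j • fibBasis N n j with hv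
    have hnx := hΩN.mem_nhds hx
    have e1 : levi Φ x v = levi (fibSum N φ) x v + levi (fun x => (max (S x - k0) 0) ^ 7) x v :=
      levi_add (hφN.contDiffAt hnx) (hpow.contDiffAt hnx) v
    have e2 : δ * ∑ i, sqNorm (fibProj N i v) ≤ levi (fibSum N φ) x v := by
      rw [levi_fibSum (fun i => hφ.contDiffAt), mul_sum]
      exact sum_le_sum fun i _ => hlevi _ (hx i) _
    have e3 : ∑ i, sqNorm (fibProj N i v) ≤ levi S x v := by
      rw [hS, levi_fibSum fun i => h.contDiffAt (hx i)]
      exact sum_le_sum fun i _ => h.levi_ge _ (hx i) _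
    have e4 : 7 * (max (S x - k0) 0) ^ 6 * levi S x v ≤
        levi (fun x => (max (S x - k0) 0) ^ 7) x v := by
      have d1 : ∀ y : ℝ, HasDerivAt (fun y : ℝ => (max (y - k0) 0) ^ 7)
          (7 * (max (y - k0) 0) ^ 6) y := fun y => by
        have := hasDerivAt_posPow 5 k0 y
        norm_num at this
        exact this
      have d2 : HasDerivAt (fun y : ℝ => 7 * (max (y - k0) 0) ^ 6)
          (7 * (6 * (max (S x - k0) 0) ^ 5)) (S x) := by
        have := (hasDerivAt_posPow 4 k0 (S x)).const_mul 7
        norm_num at this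
        exact this
      exact levi_comp_ge (hSs.contDiffAt hnx) (.of_forall d1) d2 (by positivity) v
    have e5 := sum_sq_le_sqNorm hN b
    rw [← hv] at e5
    have e6 : 0 ≤ 7 * (max (S x - k0) 0) ^ 6 := by positivity
    rw [e1]
    calc c x * ∑ j, ‖b j‖ ^ 2 ≤ c x * ∑ i, sqNorm (fibProj N i v) := by
          apply mul_le_mul_of_nonneg_left e5; simp only [hcdef]; positivity
      _ = δ * ∑ i, sqNorm (fibProj N i v) + 7 * (max (S x - k0) 0) ^ 6 *
          ∑ i, sqNorm (fibProj N i v) := by simp only [hcdef]; ring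
      _ ≤ _ := add_le_add e2 ((mul_le_mul_of_nonneg_left e3 e6).trans e4)
  have hgr : ∀ A : ℝ, ∃ k : ℕ, ∀ x ∈ fibProd N Ω, k ≤ S x →
      A * ∑ j, ‖dz (fibBasis N n j) ℂ∘S x‖ ^ 2 ≤ c x := by
    intro A
    set m : ℝ := ((Fintype.card ((Fin N × Fin n) ⊕ Unit) : ℕ) : ℝ) with hm
    set A' : ℝ := |A| * (m * (N * B) ^ 2) with hA'
    have hA'0 : 0 ≤ A' := by positivity
    obtain ⟨k, hk⟩ := exists_nat_ge (2 * k0 + 1 + 10 * A')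
    refine ⟨k, fun x hx hkx => ?_⟩
    have hS0 := h.fibSum_nonneg hx
    have g1 : ∀ j, ‖dz (fibBasis N n j) ℂ∘S x‖ ^ 2 ≤
        (N * (B * (1 + S x) ^ 2)) ^ 2 := fun j => by
      have hb := h.B_nonneg
      have := norm_dz_ofReal_le ((hSs.contDiffAt (hΩN.mem_nhds hx)).differentiableAt
        (by norm_num)) (fibBasis N n j)
      have h3 := h.norm_fderiv_fibSum_le hx
      have h4 := norm_fibBasis_le (n := n) (N := N) j
      gcongr
      calc _ ≤ _ := this
        _ ≤ ‖fderiv ℝ S x‖ * 1 := by gcongr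
        _ ≤ _ := by rw [mul_one]; exact h3
    have g2 : ∑ j, ‖dz (fibBasis N n j) ℂ∘S x‖ ^ 2 ≤
        m * (N * (B * (1 + S x) ^ 2)) ^ 2 := by
      refine (sum_le_card_nsmul _ _ _ fun j _ => g1 j).trans ?_
      rw [nsmul_eq_mul, hm, Finset.card_univ]
    calc A * ∑ j, ‖dz (fibBasis N n j) ℂ∘S x‖ ^ 2
        ≤ |A| * (m * (N * (B * (1 + S x) ^ 2)) ^ 2) :=
          mul_le_mul (le_abs_self A) g2 (sum_nonneg fun _ _ => by positivity) (abs_nonneg _)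
      _ = A' * (1 + S x) ^ 4 := by rw [hA']; ring
      _ ≤ 7 * (max (S x - k0) 0) ^ 6 :=
          mul_pow_four_le_posPow hA'0 (by linarith) hS0 (by linarith)
      _ ≤ c x := by simp only [hcdef]; linarith
  have hgrow : ∀ x ∈ fibProd N Ω, c x ≤ (δ + 7) * (1 + S x) ^ 6 := by
    intro x hx
    have hS0 : 0 ≤ S x := h.fibSum_nonneg hx
    have h1 : max (S x - k0) 0 ≤ 1 + S x := max_le (by linarith) (by linarith)
    have h2 : (max (S x - k0) 0) ^ 6 ≤ (1 + S x) ^ 6 := by gcongr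
    have h3 : 1 ≤ (1 + S x) ^ 6 := one_le_pow₀ (by linarith)
    simp only [hcdef]
    nlinarith
  set t : ((Fin N → ℂ^n) × ℂ) →L[ℂ] ℂ := ContinuousLinearMap.snd ℂ (Fin N → ℂ^n) ℂ
  have ht : ∀ x, t x = x.2 := fun x => rfl
  have hte : ∑ j, ‖t (fibBasis N n j)‖ ^ 2 ≤ 1 := by
    rw [Fintype.sum_sum_type]
    simp [ht, fibBasis]
  have i0 : Fin N := ⟨0, Nat.pos_of_ne_zero hN⟩
  have hRN : ∀ x ∈ fibProd N Ω, ‖t x‖ ≤ R := fun x hx => hR _ (hx i0)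
  have hfN : DifferentiableOn ℂ (fun x : (Fin N → ℂ^n) × ℂ => ∏ i, f (x.1 i))
      (fibProd N Ω ∩ {x | ‖t x‖ < ε}) := by
    refine DifferentiableOn.prod_of_forall _ fun i _ => ?_
    refine hf.comp (g := f) (f := fun x : (Fin N → ℂ^n) × ℂ => x.1 i)
      (by fun_prop) fun x hx => hεD _ (hx.1 i) hx.2
  set E : Set (ℂ^n × ℂ) := Ω ∩ {x | ‖x.2‖ < ε} with hE
  have hEo : IsOpen E := h.isOpen.inter (isOpen_lt (by fun_prop) continuous_const)
  set q : ℂ^n × ℂ → ℝ≥0∞ :=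
    E.indicator fun x => eofReal (rexp (-φ x) * ‖f x.1‖ ^ 2) with hq
  have hqm : Measurable q := by
    refine ContinuousOn.measurable_indicator ?_ hEo.measurableSet
    have h1 : ContinuousOn (fun x : ℂ^n × ℂ => f x.1) E :=
      hf.continuousOn.comp continuous_fst.continuousOn fun x hx => hεD _ hx.1 hx.2
    have h2 := hφ.continuous
    exact ENNReal.continuous_ofReal.comp_continuousOn
      ((by fun_prop : Continuous fun x => rexp (-φ x)).continuousOn.mul (h1.norm.pow 2))
  have hI : ∫⁻ x in fibProd N Ω ∩ {x | ‖t x‖ < ε},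
      eofReal (rexp (-Φ x) * ‖∏ i, f (x.1 i)‖ ^ 2) ≤
      volume (ball (0 : ℂ) ε) * M ^ N := by
    have hmeas : MeasurableSet (fibProd N Ω ∩ {x | ‖t x‖ < ε}) :=
      (hΩN.inter (isOpen_lt (by fun_prop) continuous_const)).measurableSet
    calc _ ≤ ∫⁻ x : (Fin N → ℂ^n) × ℂ, ∏ i, q (fibProj N i x) := by
          rw [← lintegral_indicator hmeas]
          refine lintegral_mono fun x => ?_
          by_cases hx : x ∈ fibProd N Ω ∩ {x | ‖t x‖ < ε}
          swap
          · rw [indicator_of_notMem hx]; exact bot_le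
          rw [indicator_of_mem hx]
          have : ∀ i, q (fibProj N i x) =
              eofReal (rexp (-φ (fibProj N i x)) * ‖f (x.1 i)‖ ^ 2) := fun i => by
            rw [hq, indicator_of_mem (show fibProj N i x ∈ E from ⟨hx.1 i, hx.2⟩)]; rfl
          simp only [this]
          rw [← ENNReal.ofReal_prod_of_nonneg fun i _ => by positivity, Finset.prod_mul_distrib,
            ← Real.exp_sum, norm_prod, Finset.prod_pow, sum_neg_distrib]
          gcongr
          simp only [hΦdef, fibSum]
          have : 0 ≤ (max (S x - k0) 0) ^ 7 := by positivity
          linarith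
      _ = ∫⁻ τ, (∫⁻ z, q (z, τ)) ^ N := lintegral_fibProd hqm N
      _ ≤ ∫⁻ τ, (ball (0 : ℂ) ε).indicator (fun _ => M ^ N) τ := by
          refine lintegral_mono fun τ => ?_
          by_cases hτ : ‖τ‖ < ε
          · rw [indicator_of_mem (by simpa using hτ)]
            gcongr
            refine le_trans (le_of_eq ?_) (hfM τ hτ)
            have hmm : MeasurableSet {z | (z, τ) ∈ Ω} :=
              (h.isOpen.preimage (by fun_prop : Continuous fun z : ℂ^n => (z, τ))).measurableSet
            rw [← lintegral_indicator hmm]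
            refine lintegral_congr fun z => ?_
            by_cases hz : (z, τ) ∈ Ω
            · rw [hq, indicator_of_mem (show (z, τ) ∈ E from ⟨hz, hτ⟩),
                indicator_of_mem (show z ∈ {z | (z, τ) ∈ Ω} from hz)]
            · rw [hq, indicator_of_notMem (fun hh : (z, τ) ∈ E => hz hh.1),
                indicator_of_notMem (show z ∉ {z | (z, τ) ∈ Ω} from hz)]
          · rw [indicator_of_notMem (by simpa using hτ)]
            have : ∀ z, q (z, τ) = 0 := fun z => indicator_of_notMem (fun hz => hτ hz.2) _
            simp [this, hN]
      _ = _ := by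
          rw [lintegral_indicator measurableSet_ball, setLIntegral_const, mul_comm]
  have hItop := hI.trans_lt (ENNReal.mul_lt_top measure_ball_lt_top
    (ENNReal.pow_lt_top hM.lt_top))
  have := isAddHaarMeasure_pi_pi_prod N n
  obtain ⟨F, hF1, hF2, hF3⟩ := extension_coarse (μ := volume) (e := fibBasis N n) (t := t)
    fibBasis_span ⟨hΩN, hΦs, hSs,
    fun x hx => h.fibSum_nonneg hx, h.isCompact_fibSum_le hN, hcc, hδ,
    fun x _ => by simp only [hcdef]; linarith [pow_nonneg (le_max_right (S x - k0) 0) 6],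
    hlv, hgr, (by linarith : 0 ≤ δ + 7), hgrow⟩ hte hRN hχ hε hfN hItop.ne
  refine ⟨F, hF1, fun Z hZ => hF2 _ hZ rfl, ?_⟩
  have hsub : fibProd N {x ∈ Ω | s x < k1} ⊆ fibProd N Ω := fun x hx i => (hx i).1
  have hmeas1 : MeasurableSet (fibProd N {x ∈ Ω | s x < k1}) := by
    refine (isOpen_fibProd ?_).measurableSet
    exact h.smooth.continuousOn.isOpen_inter_preimage h.isOpen isOpen_Iio
  calc _ = ∫⁻ x in fibProd N {x ∈ Ω | s x < k1},
        eofReal (rexp (-Φ x) * ‖F x‖ ^ 2) := by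
        refine setLIntegral_congr_fun hmeas1 fun x hx => ?_
        have : S x ≤ k0 := by
          rw [hS, hk0]
          refine (sum_le_card_nsmul _ _ k1 fun i _ => (hx i).2.le).trans (by simp)
        simp only [hΦdef, max_eq_right (sub_nonpos.2 this)]
        simp
    _ ≤ ∫⁻ x in fibProd N Ω, eofReal (rexp (-Φ x) * ‖F x‖ ^ 2) :=
        lintegral_mono_set hsub
    _ ≤ _ := hF3
    _ ≤ _ := by rw [mul_assoc (eofReal _)]; exact mul_le_mul_right hI _

/-- Extension of tensor powers from the central fibre of a pseudoconvex domain, on a relatively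
compact subdomain and for a smooth approximation of a plurisubharmonic weight. -/
theorem exists_approx_extension (hE : HasPshExhaustion D)
    {ψ : ℂ^n × ℂ → ℝ} (hψ : RealPsh ψ D) {f : ℂ^n → ℂ}
    (hf : DifferentiableOn ℂ f {z | (z, (0 : ℂ)) ∈ D})
    (hfψ : wL2₀ D ψ f ≠ ⊤)
    {L : Set (ℂ^n × ℂ)} (hL : IsCompact L) (hLD : L ⊆ D) (k : ℝ) {η : ℝ} (hη : 0 < η) :
    ∃ (D' : Set (ℂ^n × ℂ)) (φ : ℂ^n × ℂ → ℝ), IsOpen D' ∧ L ⊆ D' ∧ D' ⊆ D ∧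
      Continuous φ ∧
      (∀ x ∈ D', ∀ a, (∀ y ∈ ball x η, y ∈ D → max (ψ y) (-k) ≤ a) → φ x ≤ a + η) ∧
      ∃ C : ℝ≥0∞, C ≠ ⊤ ∧ ∀ N : ℕ, N ≠ 0 → ∃ F : (Fin N → ℂ^n) × ℂ → ℂ,
        DifferentiableOn ℂ F (fibProd N D') ∧
        (∀ Z, (Z, (0 : ℂ)) ∈ fibProd N D' → F (Z, 0) = ∏ i, f (Z i)) ∧
        ∫⁻ x in fibProd N D', eofReal (rexp (-fibSum N φ x) * ‖F x‖ ^ 2) ≤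
          C * (eofReal (rexp η) *
            wL2₀ D ψ f) ^ N := by
  have hD := hE.1
  obtain ⟨Ω, K, s, B, hLΩ, h⟩ := exists_strictExhaustion hE hL hLD
  obtain ⟨k1, hk1, hsk⟩ : ∃ k1 : ℝ, 0 ≤ k1 ∧ ∀ x ∈ L, s x < k1 := by
    obtain ⟨b, hb⟩ := hL.bddAbove_image (h.smooth.continuousOn.mono hLΩ)
    refine ⟨max 0 (b + 1), le_max_left _ _, fun x hx => lt_of_lt_of_le ?_ (le_max_right _ _)⟩
    have := hb ⟨x, hx, rfl⟩
    linarith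
  obtain ⟨r, hr, hrD⟩ := h.cpt.exists_cthickening_subset_open hD h.subD
  set K' := cthickening r K with hK'
  have hK'c : IsCompact K' := h.cpt.cthickening
  have hΩK' : Ω ⊆ K' := h.sub.trans (self_subset_cthickening K)
  obtain ⟨ψ', hψ's, hψ'1, hψ'2, hψ'3⟩ := (hψ.max_const (-k)).exists_smooth hD
    (k := -k) (fun x _ => le_max_right _ _) hK'c hrD hη
  obtain ⟨S0, hS0⟩ := hK'c.bddAbove_image (f := sqNorm) (contDiff_sqNorm (m := 0)).continuous.continuousOn
  have hS0' : ∀ x ∈ K', sqNorm x ≤ max S0 0 := fun x hx => (hS0 ⟨x, hx, rfl⟩).trans (le_max_left _ _)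
  obtain ⟨R, hR⟩ := hK'c.isBounded.exists_norm_le
  set δ := η / (max S0 0 + 1) with hδdef
  have hm0 : 0 ≤ max S0 0 := le_max_right _ _
  have hδ : 0 < δ := by positivity
  set φ : ℂ^n × ℂ → ℝ := fun x => ψ' x + δ * sqNorm x with hφdef
  have hψ's2 : ContDiff ℝ 2 ψ' := hψ's.of_le (WithTop.coe_le_coe.2 (le_top : ((2 : ℕ) : ℕ∞) ≤ ⊤))
  have hφs : ContDiff ℝ 2 φ := hψ's2.add (contDiff_const.mul contDiff_sqNorm)
  have hφlow : ∀ x ∈ K', ψ x ≤ φ x := fun x hx => by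
    have := hψ'1 x hx
    have h2 := mul_nonneg hδ.le (sqNorm_nonneg x)
    simp only [hφdef]
    linarith [le_max_left (ψ x) (-k)]
  have hφup : ∀ x ∈ K', φ x ≤ ψ' x + η := fun x hx => by
    have h2 : δ * sqNorm x ≤ δ * (max S0 0 + 1) :=
      mul_le_mul_of_nonneg_left (by linarith [hS0' x hx]) hδ.le
    have h3 : δ * (max S0 0 + 1) = η := by rw [hδdef]; field_simp
    simp only [hφdef]
    linarith
  have hφlevi : ∀ x ∈ Ω, ∀ v, δ * sqNorm v ≤ levi φ x v := fun x hx v => by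
    have e1 : levi φ x v = levi ψ' x v + levi (fun x => δ * sqNorm x) x v :=
      levi_add hψ's2.contDiffAt (contDiff_const.mul contDiff_sqNorm).contDiffAt v
    rw [e1, levi_const_mul contDiff_sqNorm.contDiffAt δ v, levi_sqNorm]
    linarith [hψ'3 x (hΩK' hx) v]
  have hunif := hK'c.uniformContinuousOn_of_continuous hφs.continuous.continuousOn
  obtain ⟨ε₁, hε₁, hε₁'⟩ := uniformContinuousOn_iff.1 hunif η hη
  set ε := min ε₁ r with hεdef
  have hε : 0 < ε := lt_min hε₁ hr
  have hdist : ∀ (z : ℂ^n) (τ : ℂ), dist (z, τ) (z, (0 : ℂ)) = ‖τ‖ := fun z τ => by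
    rw [Prod.dist_eq]; simp
  have hin : ∀ x ∈ Ω, ‖x.2‖ < ε → (x.1, (0 : ℂ)) ∈ K' := fun x hx hxε => by
    refine mem_cthickening_of_dist_le _ x _ _ (h.sub hx) ?_
    rw [dist_comm]
    exact (hdist x.1 x.2).le.trans (hxε.le.trans (min_le_right _ _))
  obtain ⟨C, hC, hCF⟩ := h.exists_extension hφs hδ hφlevi (R := R)
    (fun x hx => (norm_snd_le x).trans (hR x (hΩK' hx))) hf hε
    (fun x hx hxε => hrD (hin x hx hxε))
    (M := eofReal (rexp η) * wL2₀ D ψ f)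
    (mul_ne_top ofReal_ne_top hfψ) (fun τ hτ => by
      have hmτ : MeasurableSet {z | (z, τ) ∈ Ω} :=
        (h.isOpen.preimage (by fun_prop : Continuous fun z : ℂ^n => (z, τ))).measurableSet
      rw [wL2, ← lintegral_const_mul' _ _ ofReal_ne_top]
      refine (setLIntegral_mono' hmτ fun z hz => ?_).trans
        (lintegral_mono_set fun z hz => hrD (hin (z, τ) hz hτ))
      rw [← eofReal_mul (exp_pos _).le]
      refine ofReal_le_ofReal ?_
      have hz0 := hin (z, τ) hz hτ
      have h1 := hφlow _ hz0
      have h2 := hε₁' (z, τ) (hΩK' hz) (z, 0) hz0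
        ((hdist z τ).le.trans_lt (hτ.trans_le (min_le_left _ _)))
      rw [Real.dist_eq] at h2
      have h3 := (abs_lt.1 h2).1
      have h4 : rexp (-φ (z, τ)) ≤ rexp η * rexp (-ψ (z, 0)) := by
        rw [← Real.exp_add]
        refine exp_le_exp.2 ?_
        simp only at h1
        linarith
      calc _ ≤ rexp η * rexp (-ψ (z, 0)) * ‖f z‖ ^ 2 := by gcongr
        _ = _ := by ring) hk1
  refine ⟨{x ∈ Ω | s x < k1}, φ,
    h.smooth.continuousOn.isOpen_inter_preimage h.isOpen isOpen_Iio,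
    fun x hx => ⟨hLΩ hx, hsk x hx⟩, fun x hx => h.subD (h.sub hx.1), hφs.continuous,
    fun x hx a ha => ?_, C, hC, fun N hN => ?_⟩
  · have := hψ'2 x (hΩK' hx.1) a ha
    linarith [hφup x (hΩK' hx.1)]
  · obtain ⟨F, hF1, hF2, hF3⟩ := hCF N hN
    exact ⟨F, hF1.mono fun x hx i => (hx i).1, fun Z hZ => hF2 Z fun i => (hZ i).1, hF3⟩

end FiberExtension

section Tensor
variable {n : ℕ} {I : Type*} [Fintype I]

lemma lintegral_wL2 (D : Set ℂ^n) (φ : ℂ^n → ℝ) (h : ℂ^n → ℂ) :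
    wL2 D φ h = ∫⁻ z in D, eofReal (rexp (-φ z) * ‖h z‖ ^ 2) := by
  simp only [wL2, mul_comm]

lemma isOpen_forall_mem {N : ℕ} {D : Set ℂ^n} (hD : IsOpen D) :
    IsOpen {Z : Fin N → ℂ^n | ∀ i, Z i ∈ D} := by
  have : {Z : Fin N → ℂ^n | ∀ i, Z i ∈ D} = ⋂ i, (fun Z => Z i) ⁻¹' D := by ext; simp
  rw [this]
  exact isOpen_iInter_of_finite fun i => hD.preimage (continuous_apply i)

lemma differentiable_finCons_left {N : ℕ} (Z : Fin N → ℂ^n) :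
    Differentiable ℂ fun z : ℂ^n => (Fin.cons z Z : Fin (N + 1) → ℂ^n) := by
  rw [differentiable_pi]
  intro i
  refine Fin.cases ?_ (fun i => ?_) i
  · simpa using differentiable_id
  · simp

lemma differentiable_finCons_right {N : ℕ} (z : ℂ^n) :
    Differentiable ℂ fun Z : Fin N → ℂ^n => (Fin.cons z Z : Fin (N + 1) → ℂ^n) := by
  rw [differentiable_pi]
  intro i
  refine Fin.cases ?_ (fun i => ?_) i
  · simp
  · simp only [Fin.cons_succ]; exact differentiable_apply i

/-- A norm bound for a finite combination of point evaluations on a weighted Bergman space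
passes to its tensor powers. -/
theorem tensor_bound {D : Set ℂ^n} (hD : IsOpen D) {φ : ℂ^n → ℝ}
    (hφ : Continuous φ) {κ : I → ℂ} {y : I → ℂ^n} (hy : ∀ i, y i ∈ D) {K : ℝ≥0∞}
    (hK : ∀ h, DifferentiableOn ℂ h D →
      eofReal (‖∑ i, κ i * h (y i)‖ ^ 2) ≤ K * wL2 D φ h) (N : ℕ)
    {F : (Fin N → ℂ^n) → ℂ} (hF : DifferentiableOn ℂ F {Z | ∀ i, Z i ∈ D}) :
    eofReal (‖∑ p : Fin N → I, (∏ a, κ (p a)) * F (fun a => y (p a))‖ ^ 2) ≤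
      K ^ N * ∫⁻ Z in {Z | ∀ i, Z i ∈ D},
        eofReal (rexp (-∑ i, φ (Z i)) * ‖F Z‖ ^ 2) := by
  induction N with
  | zero =>
    have e : ∀ Z : Fin 0 → ℂ^n, F Z = F (fun a => a.elim0) := fun Z =>
      congrArg F (Subsingleton.elim _ _)
    simp only [e, Finset.univ_eq_empty, Finset.sum_empty, Finset.prod_empty, one_mul, pow_zero,
      neg_zero, Real.exp_zero, IsEmpty.forall_iff, Set.setOf_true, Measure.restrict_univ,
      lintegral_const, Fintype.sum_unique]
    rw [volume_pi, Measure.pi_univ]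
    simp
  | succ N ih =>
    set S : Set (Fin N → ℂ^n) := {Z | ∀ i, Z i ∈ D} with hS
    set S' : Set (Fin (N + 1) → ℂ^n) := {Z | ∀ i, Z i ∈ D} with hS'
    have hSo : IsOpen S := isOpen_forall_mem hD
    have hSo' : IsOpen S' := isOpen_forall_mem hD
    have hcons : ∀ z ∈ D, ∀ Z ∈ S, (Fin.cons z Z : Fin (N + 1) → ℂ^n) ∈ S' :=
      fun z hz Z hZ i => by
        refine Fin.cases ?_ (fun i => ?_) i
        · simpa using hz
        · simpa using hZ i
    set F' : (Fin N → ℂ^n) → ℂ := fun Z => ∑ i, κ i * F (Fin.cons (y i) Z) with hF'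
    have hF'd : DifferentiableOn ℂ F' S :=
      DifferentiableOn.fun_sum fun i _ => (hF.comp (differentiable_finCons_right (y i)).differentiableOn
        fun Z hZ => hcons _ (hy i) _ hZ).const_mul _
    have e1 : ∑ p : Fin (N + 1) → I, (∏ a, κ (p a)) * F (fun a => y (p a)) =
        ∑ p : Fin N → I, (∏ a, κ (p a)) * F' (fun a => y (p a)) := by
      rw [← (Fin.consEquiv fun _ : Fin (N + 1) => I).sum_comp, Fintype.sum_prod_type,
        Finset.sum_comm]
      refine sum_congr rfl fun p _ => ?_
      rw [hF', mul_sum]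
      refine sum_congr rfl fun i _ => ?_
      have : (fun a => y ((Fin.cons i p : Fin (N + 1) → I) a)) =
          (Fin.cons (y i) fun a => y (p a) : Fin (N + 1) → ℂ^n) :=
        Fin.comp_cons y i p
      simp only [Fin.consEquiv_apply, this, Fin.prod_univ_succ, Fin.cons_zero, Fin.cons_succ]
      ring
    set q : (Fin (N + 1) → ℂ^n) → ℝ≥0∞ := S'.indicator fun Z =>
      eofReal (rexp (-∑ i, φ (Z i)) * ‖F Z‖ ^ 2) with hq
    have hqm : Measurable q := by
      refine ContinuousOn.measurable_indicator ?_ hSo'.measurableSet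
      refine ENNReal.continuous_ofReal.comp_continuousOn ?_
      exact (by fun_prop : Continuous fun Z : Fin (N + 1) → ℂ^n =>
        rexp (-∑ i, φ (Z i))).continuousOn.mul (hF.continuousOn.norm.pow 2)
    rw [e1, ← lintegral_indicator hSo'.measurableSet, lintegral_pi_cons hqm]
    refine (ih hF'd).trans ?_
    have hmc : Measurable fun x : ℂ^n × (Fin N → ℂ^n) => q (Fin.cons x.1 x.2) :=
      hqm.comp (by
        rw [measurable_pi_iff]
        intro i
        refine Fin.cases ?_ (fun i => ?_) i
        · simpa using measurable_fst
        · simp only [Fin.cons_succ]; fun_prop)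
    rw [lintegral_lintegral_swap hmc.aemeasurable, pow_succ, mul_assoc,
      ← lintegral_const_mul _ hmc.lintegral_prod_left']
    refine mul_le_mul_right ?_ _
    rw [← lintegral_indicator hSo.measurableSet]
    refine lintegral_mono fun Z => ?_
    by_cases hZ : Z ∈ S
    swap
    · rw [indicator_of_notMem hZ]; exact bot_le
    rw [indicator_of_mem hZ, eofReal_mul (exp_nonneg _)]
    have h1 := hK _ (hF.comp (differentiable_finCons_left Z).differentiableOn
      fun z hz => hcons z hz Z hZ)
    refine (mul_le_mul_right h1 _).trans (le_of_eq ?_)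
    rw [mul_left_comm]
    congr 1
    rw [lintegral_wL2, ← lintegral_const_mul' _ _ ofReal_ne_top,
      ← lintegral_indicator hD.measurableSet]
    refine lintegral_congr fun z => ?_
    by_cases hz : z ∈ D
    · rw [indicator_of_mem hz, hq, indicator_of_mem (hcons z hz Z hZ),
        ← eofReal_mul (exp_nonneg _), ← mul_assoc, ← Real.exp_add, Fin.sum_univ_succ]
      simp only [Fin.cons_zero, Fin.cons_succ, Function.comp]
      ring_nf
    · rw [indicator_of_notMem hz, hq, indicator_of_notMem]
      exact fun h => hz (by simpa using h 0)

end Tensor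

section Jensen

/-- Jensen's inequality for holomorphic functions on a closed disc. -/
lemma log_norm_le_circleAverage {H : ℂ → ℂ} {r : ℝ} (hr : 0 < r)
    (hH : AnalyticOnNhd ℂ H (closedBall 0 r)) (h0 : H 0 ≠ 0) :
    rlog ‖H 0‖ ≤ circleAverage (fun z => rlog ‖H z‖) 0 r := by
  have hH' : AnalyticOnNhd ℂ H (closedBall 0 |r|) := by rwa [abs_of_pos hr]
  rw [AnalyticOnNhd.circleAverage_log_norm hr.ne' hH' h0]
  have : 0 ≤ ∑ᶠ u : ℂ, ((MeromorphicOn.divisor H (closedBall 0 |r|)) u : ℝ) *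
      rlog (r * ‖(0 : ℂ) - u‖⁻¹) := by
    refine finsum_nonneg fun u => ?_
    by_cases hu : u ∈ closedBall (0 : ℂ) |r|
    · refine mul_nonneg ?_ ?_
      · exact_mod_cast MeromorphicOn.AnalyticOnNhd.divisor_nonneg hH' u
      · rw [zero_sub, norm_neg]
        rcases eq_or_ne u 0 with rfl | h
        · simp
        · refine Real.log_nonneg ?_
          rw [← div_eq_mul_inv, one_le_div (norm_pos_iff.2 h)]
          simpa [abs_of_pos hr] using hu
    · rw [Function.locallyFinsuppWithin.apply_eq_zero_of_notMem _ hu]; simp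
  linarith

lemma ae_ne_zero_circle {H : ℂ → ℂ} {r : ℝ} (hr : 0 < r)
    (hH : AnalyticOnNhd ℂ H (closedBall 0 r)) (h0 : H 0 ≠ 0) :
    ∀ᵐ θ : ℝ, H (circleMap 0 r θ) ≠ 0 := by
  have h1 := hH.preimage_zero_mem_codiscreteWithin h0 (mem_closedBall_self hr.le)
    ((convex_closedBall (0 : ℂ) r).isConnected ⟨0, mem_closedBall_self hr.le⟩)
  have h2 : H ⁻¹' {0}ᶜ ∈ codiscreteWithin (sphere (0 : ℂ) |r|) := by
    rw [abs_of_pos hr]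
    exact Filter.codiscreteWithin.mono sphere_subset_closedBall h1
  have h3 := circleMap_preimage_codiscrete hr.ne' h2
  have h4 := ae_restrict_le_codiscreteWithin (μ := (volume : Measure ℝ)) MeasurableSet.univ h3
  rw [Measure.restrict_univ] at h4
  exact h4

/-- In every annulus of positive width there is a circle on which the integral of a function is
controlled by the integral over the plane. -/
lemma exists_radius_lintegral_le {G : ℂ → ℝ≥0∞} (hG : Measurable G) {A : ℝ≥0∞} (hA0 : A ≠ 0)
    (hA : A ≠ ⊤) (hGA : ∫⁻ t, G t ≤ A) {η : ℝ} (hη : 0 < η) (hη1 : η ≤ 1 / 2) :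
    ∃ r ∈ Icc (1 - η) 1, ∫⁻ θ in Ioc 0 (2 * π), G (circleMap 0 r θ) ≤
      eofReal (4 / η) * A := by
  by_contra hcon
  push Not at hcon
  have e1 : ∀ r : ℝ, ∫⁻ θ in Set.Ioo (-π) π, G (-circleMap 0 r θ) =
      ∫⁻ θ in Ioc 0 (2 * π), G (circleMap 0 r θ) := by
    intro r
    rw [← setLIntegral_congr Ioo_ae_eq_Ioc, ← lintegral_indicator measurableSet_Ioo,
      ← lintegral_indicator measurableSet_Ioo, 
      ← lintegral_add_right_eq_self
        ((Set.Ioo 0 (2 * π)).indicator fun θ => G (circleMap 0 r θ)) π]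
    refine lintegral_congr fun θ => ?_
    have e : -circleMap 0 r θ = circleMap 0 r (θ + π) := by
      simp [circleMap, add_mul, exp_add]
    by_cases h : θ ∈ Set.Ioo (-π) π
    · rw [indicator_of_mem h, indicator_of_mem, e]
      constructor <;> linarith [h.1, h.2]
    · rw [indicator_of_notMem h, indicator_of_notMem]
      exact fun h' => h ⟨by linarith [h'.1], by linarith [h'.2]⟩
  have e2 : ∫⁻ t, G t = ∫⁻ r in Set.Ioi (0 : ℝ), eofReal r *
      ∫⁻ θ in Ioc 0 (2 * π), G (circleMap 0 r θ) := by
    have hneg := (Measure.measurePreserving_neg (volume : Measure ℂ)).lintegral_comp hG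
    rw [← hneg, ← Complex.lintegral_comp_polarCoord_symm, polarCoord_target,
      Measure.volume_eq_prod, ← Measure.prod_restrict, lintegral_prod]
    · refine lintegral_congr fun r => ?_
      simp only [smul_eq_mul]
      rw [lintegral_const_mul' _ _ ofReal_ne_top, ← e1]
      congr 1
      refine lintegral_congr fun θ => ?_
      rw [Complex.polarCoord_symm_apply, circleMap, zero_add, exp_mul_I]
      push_cast; rfl
    · refine Measurable.aemeasurable ?_
      refine Measurable.smul (f := fun p : ℝ × ℝ => eofReal p.1) (by fun_prop) (hG.comp ?_)
      exact (measurableEquivRealProd.symm.measurable.comp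
        (continuous_polarCoord_symm.measurable)).neg
  have h3 : 2 * A ≤ ∫⁻ t, G t := by
    rw [e2]
    calc 2 * A = ∫⁻ r in Icc (1 - η) 1, eofReal (1 / 2) * (eofReal (4 / η) * A) := by
          rw [setLIntegral_const, Real.volume_Icc, ← mul_assoc, mul_right_comm,
            ← eofReal_mul (by norm_num), ← eofReal_mul (by positivity)]
          congr 1
          rw [show 1 / 2 * (4 / η) * (1 - (1 - η)) = 2 by field_simp; ring]
          simp
      _ ≤ ∫⁻ r in Icc (1 - η) 1, eofReal r *
          ∫⁻ θ in Ioc 0 (2 * π), G (circleMap 0 r θ) := by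
          refine setLIntegral_mono' measurableSet_Icc fun r hr => ?_
          refine mul_le_mul' (ofReal_le_ofReal (by linarith [hr.1])) (hcon r hr).le
      _ ≤ _ := lintegral_mono_set fun r hr => lt_of_lt_of_le (by linarith) hr.1
  have h4 := h3.trans hGA
  have h5 : A < 2 * A := by
    rw [two_mul]; exact ENNReal.lt_add_right hA hA0
  exact absurd h4 (not_le.2 h5)

end Jensen

section BergmanFunctional
variable {n : ℕ}

/-- The squared norm of a functional on the weighted Bergman space `A²(D, e^{-ψ})`. -/
def bergmanSq (D : Set ℂ^n) (ψ : ℂ^n → ℝ)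
    (l : (ℂ^n → ℂ) → ℂ) : ℝ≥0∞ :=
  ⨆ f : {f // MemA2 D ψ f}, eofReal (‖l f.1‖ ^ 2) / wL2 D ψ f.1

lemma ofReal_sq_le_mul_wL2 {D : Set ℂ^n} {ψ : ℂ^n → ℝ}
    {l : (ℂ^n → ℂ) → ℂ} {K : ℝ≥0∞} (hK : bergmanSq D ψ l ≤ K) (h0 : K ≠ 0) (hT : K ≠ ⊤)
    {h : ℂ^n → ℂ} (hh : DifferentiableOn ℂ h D) :
    eofReal (‖l h‖ ^ 2) ≤ K * wL2 D ψ h := by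
  rcases eq_or_ne (wL2 D ψ h) ⊤ with h1 | h1
  · rw [h1, ENNReal.mul_top h0]; exact le_top
  · have h2 : eofReal (‖l h‖ ^ 2) / wL2 D ψ h ≤ K :=
      (le_iSup (fun f : {f // MemA2 D ψ f} => eofReal (‖l f.1‖ ^ 2) / wL2 D ψ f.1)
        ⟨h, hh, h1.lt_top⟩).trans hK
    exact (ENNReal.div_le_iff_le_mul (Or.inr hT) (Or.inl h1)).1 h2

/-- The logarithm of an extended nonnegative number, shifted by `k` and truncated below at `0`. -/
def truncLog (k : ℝ) (K : ℝ≥0∞) : ℝ≥0∞ := (ENNReal.log K + (k : EReal)).toENNReal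

lemma truncLog_mono (k : ℝ) : Monotone (truncLog k) := fun _ _ h =>
  EReal.toENNReal_le_toENNReal (add_le_add_left (ENNReal.log_monotone h) _)

lemma truncLog_top (k : ℝ) : truncLog k ⊤ = ⊤ := by simp [truncLog]

lemma truncLog_ofReal_exp (k x : ℝ) :
    truncLog k (eofReal (rexp x)) = eofReal (x + k) := by
  rw [truncLog, ENNReal.log_ofReal, if_neg (not_le.2 (exp_pos x)), Real.log_exp,
    ← EReal.coe_add, EReal.toENNReal_of_ne_top (EReal.coe_ne_top _), EReal.toReal_coe]

lemma ofReal_add_le_truncLog {k x : ℝ} {K : ℝ≥0∞}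
    (h : eofReal (rexp x) ≤ max K (eofReal (rexp (-k)))) :
    eofReal (x + k) ≤ truncLog k K := by
  rcases le_max_iff.1 h with h | h
  · rw [← truncLog_ofReal_exp]; exact truncLog_mono k h
  · rw [ofReal_le_ofReal_iff (exp_nonneg _), exp_le_exp] at h
    rw [ENNReal.ofReal_of_nonpos (by linarith)]
    exact bot_le

lemma ofReal_exp_le_of_sq_le_pow_mul {N : ℕ} (hN : N ≠ 0) {K : ℝ≥0∞} {b γ a : ℝ} (hb : 0 < b)
    (hγ : 0 ≤ γ) (ha : 0 < a) (h : eofReal b ≤ K ^ N * eofReal γ) :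
    eofReal (rexp ((rlog b - γ / a + 1 - rlog a) / N)) ≤ K := by
  rw [← ENNReal.pow_le_pow_left_iff hN, ← eofReal_pow (exp_nonneg _), ← Real.exp_nat_mul,
    mul_div_cancel₀ _ (by exact_mod_cast hN)]
  rcases hγ.eq_or_lt with rfl | hγ
  · simp [hb.not_ge] at h
  have h1 : eofReal (b / γ) ≤ K ^ N := by
    rw [ENNReal.ofReal_div_of_pos hγ]
    exact ENNReal.div_le_of_le_mul h
  refine le_trans (ofReal_le_ofReal ?_) h1
  have h2 : rexp (rlog b - γ / a + 1 - rlog a) = b * rexp (1 - γ / a) / a := by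
    rw [show rlog b - γ / a + 1 - rlog a = rlog b + (1 - γ / a) - rlog a by ring,
      Real.exp_sub, Real.exp_add, exp_log hb, exp_log ha]
  rw [h2, div_le_div_iff₀ ha hγ]
  have h3 : γ / a * rexp (1 - γ / a) ≤ 1 := by
    have := Real.add_one_le_exp (γ / a - 1)
    rw [show 1 - γ / a = -(γ / a - 1) by ring, Real.exp_neg, ← div_eq_mul_inv,
      div_le_one (exp_pos _)]
    linarith
  calc b * rexp (1 - γ / a) * γ = b * a * (γ / a * rexp (1 - γ / a)) := by field_simp
    _ ≤ b * a * 1 := by gcongr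
    _ = b * a := mul_one _

variable {D : Set (ℂ^n × ℂ)}

/-- Sub-mean value inequality on some circle of radius close to one, for the logarithm of the norm
of a holomorphically varying combination of point evaluations, on a relatively compact subdomain
and for a continuous approximation of the weight. -/
theorem exists_circle_bound (hE : HasPshExhaustion D)
    {ψ : ℂ^n × ℂ → ℝ} (hψ : RealPsh ψ D) {f : ℂ^n → ℂ}
    (hf : DifferentiableOn ℂ f {z | (z, (0 : ℂ)) ∈ D})
    (hfψ : wL2₀ D ψ f ≠ ⊤)
    (hf0 : wL2₀ D ψ f ≠ 0)
    {I : Type*} [Fintype I] {y : I → ℂ^n} {κ : I → ℂ → ℂ} {T : Set ℂ} (hT : IsOpen T)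
    (hT1 : closedBall 0 1 ⊆ T) (hκ : ∀ i, DifferentiableOn ℂ (κ i) T)
    (hy : ∀ i, ∀ t : ℂ, ‖t‖ ≤ 1 → (y i, t) ∈ D) (hne : ∑ i, κ i 0 * f (y i) ≠ 0)
    {L : Set (ℂ^n × ℂ)} (hL : IsCompact L) (hLD : L ⊆ D) (k k' : ℝ) {η : ℝ} (hη : 0 < η)
    (hη1 : η ≤ 1 / 2) :
    ∃ (D' : Set (ℂ^n × ℂ)) (φ : ℂ^n × ℂ → ℝ) (r : ℝ), IsOpen D' ∧ L ⊆ D' ∧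
      D' ⊆ D ∧ Continuous φ ∧
      (∀ x ∈ D', ∀ a, (∀ y ∈ ball x η, y ∈ D → max (ψ y) (-k) ≤ a) → φ x ≤ a + η) ∧
      r ∈ Icc (1 - η) 1 ∧
      eofReal (2 * π * (rlog (‖∑ i, κ i 0 * f (y i)‖ ^ 2) -
        rlog (wL2₀ D ψ f).toReal - 2 * η + k')) ≤
      ∫⁻ θ in Ioc 0 (2 * π), truncLog k'
        (bergmanSq {z | (z, circleMap 0 r θ) ∈ D'} (fun z => φ (z, circleMap 0 r θ))
          fun h => ∑ i, κ i (circleMap 0 r θ) * h (y i)) := by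
  set L' : Set (ℂ^n × ℂ) := L ∪ ⋃ i, {y i} ×ˢ closedBall 0 1 with hL'
  have hL'c : IsCompact L' :=
    hL.union (isCompact_iUnion fun i => isCompact_singleton.prod (isCompact_closedBall _ _))
  have hL'D : L' ⊆ D := by
    refine union_subset hLD (Set.iUnion_subset fun i => ?_)
    rintro ⟨z, t⟩ ⟨hz, ht⟩
    obtain rfl : z = y i := hz
    exact hy i t (by simpa using ht)
  obtain ⟨D', φ, hD', hLD', hD'D, hφ, happ, C, hC, hF⟩ :=
    exists_approx_extension hE hψ hf hfψ hL'c hL'D k hη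
  have hyD' : ∀ i, ∀ t : ℂ, ‖t‖ ≤ 1 → (y i, t) ∈ D' := fun i t ht =>
    hLD' (Or.inr (Set.mem_iUnion.2 ⟨i, rfl, by simpa using ht⟩))
  set M := wL2₀ D ψ f with hM
  set m := M.toReal with hm
  have hm0 : 0 < m := ENNReal.toReal_pos hf0 hfψ
  have hMm : M = eofReal m := (ofReal_toReal hfψ).symm
  set c := max C.toReal 1 with hc
  have hc0 : 0 < c := lt_of_lt_of_le one_pos (le_max_right _ _)
  have hCc : C ≤ eofReal c := by
    rw [← ofReal_toReal hC]; exact ofReal_le_ofReal (le_max_left _ _)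
  set b := 4 / η * c / (2 * π) with hb
  have hb0 : 0 < b := by positivity
  obtain ⟨N, hN⟩ : ∃ N : ℕ, rlog b ≤ N * η ∧ N ≠ 0 := by
    obtain ⟨N, hN⟩ := exists_nat_ge (rlog b / η)
    refine ⟨N + 1, ?_, N.succ_ne_zero⟩
    rw [div_le_iff₀ hη] at hN
    push_cast
    nlinarith
  obtain ⟨hNb, hN0⟩ := hN
  obtain ⟨F, hFd, hF0, hFi⟩ := hF N hN0
  set A : ℝ := c * (rexp η * m) ^ N with hA
  have hA0 : 0 < A := by positivity
  set a : ℝ := 4 / η * A / (2 * π) with ha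
  have ha0 : 0 < a := by positivity
  have hlog : rlog a ≤ N * (rlog m + 2 * η) := by
    have : a = b * (rexp η * m) ^ N := by rw [ha, hA, hb]; ring
    rw [this, Real.log_mul hb0.ne' (by positivity), log_pow,
      Real.log_mul (Real.exp_ne_zero _) hm0.ne', Real.log_exp]
    nlinarith
  set q : (Fin N → ℂ^n) × ℂ → ℝ≥0∞ := (fibProd N D').indicator fun x =>
    eofReal (rexp (-fibSum N φ x) * ‖F x‖ ^ 2) with hq
  have hfo : IsOpen (fibProd N D') := isOpen_fibProd hD'
  have hqm : Measurable q := by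
    refine ContinuousOn.measurable_indicator ?_ hfo.measurableSet
    refine ENNReal.continuous_ofReal.comp_continuousOn ?_
    refine ContinuousOn.mul (Continuous.continuousOn ?_) (hFd.continuousOn.norm.pow 2)
    refine Real.continuous_exp.comp (Continuous.neg ?_)
    exact continuous_finsetSum _ fun i _ => hφ.comp (fibProj N i).continuous
  set G : ℂ → ℝ≥0∞ := fun t => ∫⁻ Z, q (Z, t) with hG
  have hGm : Measurable G := hqm.lintegral_prod_left'
  have hGA : ∫⁻ t, G t ≤ eofReal A := by
    rw [hG, ← lintegral_prod_symm _ hqm.aemeasurable, ← Measure.volume_eq_prod, hq,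
      lintegral_indicator hfo.measurableSet]
    refine hFi.trans ?_
    rw [hA, eofReal_mul hc0.le, eofReal_pow (by positivity),
      eofReal_mul (exp_nonneg _), ← hMm]
    exact mul_le_mul_left hCc _
  obtain ⟨r, hr, hrG⟩ := exists_radius_lintegral_le hGm (by simpa using hA0) ofReal_ne_top
    hGA hη hη1
  have hr0 : 0 < r := by linarith [hr.1]
  refine ⟨D', φ, r, hD', Set.subset_union_left.trans hLD', hD'D, hφ, happ, hr, ?_⟩
  have hnr : ∀ θ, ‖circleMap 0 r θ‖ ≤ 1 := fun θ => by
    rw [norm_circleMap_zero, abs_of_pos hr0]; exact hr.2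
  set T' : Set ℂ := T ∩ {t | ∀ i, (y i, t) ∈ D'} with hT'
  have hT'o : IsOpen T' := by
    refine hT.inter ?_
    rw [Set.setOf_forall]
    exact isOpen_iInter_of_finite fun i => hD'.preimage (by fun_prop)
  set H : ℂ → ℂ := fun t => ∑ p : Fin N → I, (∏ j, κ (p j) t) * F (fun j => y (p j), t) with hH
  have hHd : DifferentiableOn ℂ H T' := by
    refine DifferentiableOn.fun_sum fun p _ => DifferentiableOn.fun_mul ?_ ?_
    · exact DifferentiableOn.prod_of_forall _ fun j _ => (hκ (p j)).mono inter_subset_left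
    · refine hFd.comp (Differentiable.differentiableOn (by fun_prop)) fun t ht j => ht.2 (p j)
  have hHa : AnalyticOnNhd ℂ H (closedBall 0 r) :=
    (hHd.analyticOnNhd hT'o).mono fun t ht => by
      have ht1 : ‖t‖ ≤ 1 := le_trans (by simpa using ht) hr.2
      exact ⟨hT1 (by simpa using ht1), fun i => hyD' i t ht1⟩
  have hH0 : H 0 = (∑ i, κ i 0 * f (y i)) ^ N := by
    rw [hH, Fintype.sum_pow]
    refine sum_congr rfl fun p _ => ?_
    rw [hF0 _ fun j => hyD' (p j) 0 (by simp), Finset.prod_mul_distrib]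
  have hH0' : H 0 ≠ 0 := by rw [hH0]; exact pow_ne_zero _ hne
  have hjen := log_norm_le_circleAverage hr0 hHa hH0'
  have hIg : IntervalIntegrable (fun θ => rlog ‖H (circleMap 0 r θ)‖) volume 0 (2 * π) := by
    refine MeromorphicOn.circleIntegrable_log_norm (c := 0) (R := r) (f := H) ?_
    exact fun z hz => (hHa z (sphere_subset_closedBall
      (by rwa [abs_of_pos hr0] at hz))).meromorphicAt
  set μ : Measure ℝ := volume.restrict (Ioc 0 (2 * π)) with hμ
  set g : ℝ → ℝ≥0∞ := fun θ => G (circleMap 0 r θ) with hg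
  have hgm : Measurable g := hGm.comp (by fun_prop)
  have hgT : ∫⁻ θ, g θ ∂μ ≠ ⊤ := ne_top_of_le_ne_top
    (mul_ne_top ofReal_ne_top ofReal_ne_top) hrG
  have hgi : Integrable (fun θ => (g θ).toReal) μ :=
    integrable_toReal_of_lintegral_ne_top hgm.aemeasurable hgT
  have hgI : ∫ θ, (g θ).toReal ∂μ ≤ 2 * π * a := by
    rw [integral_toReal hgm.aemeasurable (ae_lt_top hgm hgT)]
    refine ENNReal.toReal_le_of_le_ofReal (by positivity) (hrG.trans (le_of_eq ?_))
    rw [← eofReal_mul (by positivity), ha]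
    congr 1
    field_simp
  have hLi : Integrable (fun θ => rlog ‖H (circleMap 0 r θ)‖) μ :=
    (intervalIntegrable_iff_integrableOn_Ioc_of_le (by positivity)).1 hIg
  have hLI : 2 * π * (N * rlog ‖∑ i, κ i 0 * f (y i)‖) ≤
      ∫ θ, rlog ‖H (circleMap 0 r θ)‖ ∂μ := by
    rw [hH0, norm_pow, log_pow, Real.circleAverage_def,
      integral_of_le (by positivity), smul_eq_mul,
      inv_mul_eq_div, le_div_iff₀ (by positivity)] at hjen
    linarith
  have hμ1 : μ.real Set.univ = 2 * π := by
    rw [hμ, measureReal_restrict_apply_univ, Real.volume_real_Ioc_of_le (by positivity)]; ring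
  have hN1 : (0 : ℝ) < N := by exact_mod_cast Nat.pos_of_ne_zero hN0
  set w : ℝ → ℝ := fun θ =>
    (2 * rlog ‖H (circleMap 0 r θ)‖ - (g θ).toReal / a + 1 - rlog a) / N + k' with hw
  have hwi : Integrable w μ := by
    refine Integrable.add (Integrable.div_const ?_ _) (integrable_const _)
    exact (((hLi.const_mul 2).sub (hgi.div_const a)).add (integrable_const _)).sub
      (integrable_const _)
  have hwI : 2 * π * (rlog (‖∑ i, κ i 0 * f (y i)‖ ^ 2) - rlog m - 2 * η + k') ≤
      ∫ θ, w θ ∂μ := by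
    have e : ∫ θ, w θ ∂μ = (2 * ∫ θ, rlog ‖H (circleMap 0 r θ)‖ ∂μ) / N -
        (∫ θ, (g θ).toReal ∂μ) / a / N + 2 * π * ((1 - rlog a) / N + k') := by
      have e1 : w = fun θ => (2 * rlog ‖H (circleMap 0 r θ)‖) / N - (g θ).toReal / a / N +
          ((1 - rlog a) / N + k') := by
        funext θ; rw [hw]; ring
      have i1 : Integrable (fun θ => (2 * rlog ‖H (circleMap 0 r θ)‖) / N) μ :=
        (hLi.const_mul 2).div_const _
      have i2 : Integrable (fun θ => (g θ).toReal / a / N) μ := (hgi.div_const _).div_const _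
      have i3 : Integrable (fun θ => (2 * rlog ‖H (circleMap 0 r θ)‖) / N -
        (g θ).toReal / a / N) μ := i1.sub i2
      rw [e1, integral_add i3 (integrable_const _), integral_sub i1 i2, integral_const, hμ1,
        integral_div, integral_const_mul, integral_div, integral_div, smul_eq_mul]
    rw [e, log_pow]
    have h1 : (2 * (2 * π * (N * rlog ‖∑ i, κ i 0 * f (y i)‖))) / N ≤
        (2 * ∫ θ, rlog ‖H (circleMap 0 r θ)‖ ∂μ) / N := by gcongr
    have h2 : (∫ θ, (g θ).toReal ∂μ) / a / N ≤ 2 * π / N := by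
      gcongr
      rwa [div_le_iff₀ ha0]
    have h3 : rlog a / N ≤ rlog m + 2 * η := by
      rw [div_le_iff₀ hN1]; linarith
    have h4 : (2 * (2 * π * (N * rlog ‖∑ i, κ i 0 * f (y i)‖))) / N =
        2 * π * (2 * rlog ‖∑ i, κ i 0 * f (y i)‖) := by field_simp
    have h5 : 2 * π * ((1 - rlog a) / N + k') =
        2 * π / N - 2 * π * (rlog a / N) + 2 * π * k' := by ring
    have h6 := mul_le_mul_of_nonneg_left h3 (by positivity : (0 : ℝ) ≤ 2 * π)
    rw [h5]
    push_cast
    linarith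
  refine (ofReal_le_ofReal hwI).trans ((ofReal_le_ofReal
    (integral_mono hwi hwi.pos_part fun θ => le_max_left _ _)).trans ?_)
  rw [ofReal_integral_eq_lintegral_ofReal hwi.pos_part (ae_of_all _ fun θ => le_max_right _ _)]
  refine lintegral_mono_ae ?_
  have hHne : ∀ᵐ θ ∂μ, H (circleMap 0 r θ) ≠ 0 := ae_restrict_of_ae (ae_ne_zero_circle hr0 hHa hH0')
  filter_upwards [hHne, ae_lt_top hgm hgT] with θ h1 h2
  have hpos : eofReal (max (w θ) 0) = eofReal (w θ) := by simp
  rw [hpos]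
  set t := circleMap 0 r θ with ht
  set K := bergmanSq {z | (z, t) ∈ D'} (fun z => φ (z, t)) fun h => ∑ i, κ i t * h (y i) with hK
  rcases eq_or_ne K ⊤ with hKT | hKT
  · rw [hKT, truncLog_top]; exact le_top
  refine ofReal_add_le_truncLog ?_
  have hKe0 : max K (eofReal (rexp (-k'))) ≠ 0 :=
    (lt_of_lt_of_le (by simpa using exp_pos _) (le_max_right _ _)).ne'
  have hKeT : max K (eofReal (rexp (-k'))) ≠ ⊤ := by simp [hKT]
  have hsec : Continuous fun z : ℂ^n => (z, t) := by fun_prop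
  have htb := tensor_bound (I := I) (D := {z | (z, t) ∈ D'}) (φ := fun z => φ (z, t))
    (hD'.preimage hsec) (hφ.comp hsec) (κ := fun i => κ i t) (fun i => hyD' i t (hnr θ))
    (fun h hh => ofReal_sq_le_mul_wL2 (le_max_left K _) hKe0 hKeT hh) N
    (F := fun Z => F (Z, t))
    (hFd.comp (Differentiable.differentiableOn (by fun_prop)) fun Z hZ => hZ)
  have hGt : ∫⁻ Z in {Z : Fin N → ℂ^n | ∀ i, Z i ∈ {z | (z, t) ∈ D'}},
      eofReal (rexp (-∑ i, φ (Z i, t)) * ‖F (Z, t)‖ ^ 2) = g θ := by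
    have ho : IsOpen {Z : Fin N → ℂ^n | ∀ i, Z i ∈ {z | (z, t) ∈ D'}} :=
      isOpen_forall_mem (hD'.preimage hsec)
    rw [← lintegral_indicator ho.measurableSet]
    rfl
  rw [hGt, ← ofReal_toReal h2.ne] at htb
  have := ofReal_exp_le_of_sq_le_pow_mul hN0 (by positivity) ENNReal.toReal_nonneg ha0 htb
  rwa [log_pow, Nat.cast_ofNat] at this

end BergmanFunctional

section Montel
variable [FiniteDimensional ℂ W]

/-- An ultrafilter version of Montel's theorem for functions defined on varying domains. -/
theorem exists_limit_of_locally_bounded {ι : Type*} (𝒰 : Ultrafilter ι) {D : Set W} (hD : IsOpen D)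
    {g : ι → W → ℂ} (hg : ∀ z ∈ D, ∃ r > 0, ∃ R : ℝ, ball z r ⊆ D ∧ ∀ᶠ j in (𝒰 : Filter ι),
      DifferentiableOn ℂ (g j) (ball z r) ∧ ∀ x ∈ ball z r, ‖g j x‖ ≤ R) :
    ∃ G : W → ℂ, DifferentiableOn ℂ G D ∧ TendstoLocallyUniformlyOn g G 𝒰 D := by
  have hlim : ∀ z, ∃ c : ℂ, z ∈ D → Tendsto (fun j => g j z) 𝒰 (𝓝 c) := by
    intro z
    by_cases hz : z ∈ D
    · obtain ⟨r, hr, R, -, hR⟩ := hg z hz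
      obtain ⟨c, -, hc⟩ := (isCompact_closedBall (0 : ℂ) R).ultrafilter_le_nhds
        (𝒰.map fun j => g j z) (by
          rw [le_principal_iff, Ultrafilter.mem_coe, Ultrafilter.mem_map]
          filter_upwards [hR] with j hj
          simpa using hj.2 z (mem_ball_self hr))
      exact ⟨c, fun _ => hc⟩
    · exact ⟨0, fun h => absurd h hz⟩
  choose G hG using hlim
  have htlu : TendstoLocallyUniformlyOn g G 𝒰 D := by
    rw [tendstoLocallyUniformlyOn_iff]
    intro ε hε z hz
    obtain ⟨r, hr, R, hrD, hR⟩ := hg z hz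
    set L := (2 * |R| + 1) / r with hL
    have hL0 : 0 < L := by positivity
    set s := min r (ε / (4 * L)) with hs
    have hs0 : 0 < s := lt_min hr (by positivity)
    have hLs : L * s ≤ ε / 4 := by
      calc L * s ≤ L * (ε / (4 * L)) := by gcongr; exact min_le_right _ _
        _ = ε / 4 := by field_simp
    have hlip : ∀ᶠ j in (𝒰 : Filter ι), ∀ y ∈ ball z s, dist (g j y) (g j z) ≤ ε / 4 := by
      filter_upwards [hR] with j hj y hy
      have hy' : y ∈ ball z r := ball_subset_ball (min_le_left _ _) hy
      have h1 := dist_le_div_mul_dist_of_mapsTo_ball (R₂ := 2 * |R| + 1) hj.1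
        (fun x hx => by
          rw [mem_closedBall]
          have h1 := hj.2 x hx
          have h2 := hj.2 z (mem_ball_self hr)
          have := le_abs_self R
          refine (dist_le_norm_add_norm _ _).trans ?_
          linarith) hy'
      refine h1.trans (le_trans ?_ hLs)
      exact mul_le_mul_of_nonneg_left (mem_ball.1 hy).le hL0.le
    refine ⟨ball z s, mem_nhdsWithin_of_mem_nhds (ball_mem_nhds z hs0), ?_⟩
    have h3 : ∀ᶠ j in (𝒰 : Filter ι), dist (g j z) (G z) < ε / 4 :=
      (hG z hz).eventually (ball_mem_nhds _ (by positivity))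
    filter_upwards [hlip, h3] with j hj hj3 y hy
    have hyD : y ∈ D := hrD (ball_subset_ball (min_le_left _ _) hy)
    have h4 : dist (G y) (G z) ≤ ε / 4 :=
      le_of_tendsto ((hG y hyD).dist (hG z hz)) (hlip.mono fun j hj => hj y hy)
    calc dist (G y) (g j y) ≤ dist (G y) (G z) + dist (G z) (g j z) + dist (g j z) (g j y) :=
          dist_triangle4 _ _ _ _
      _ < ε := by
          rw [dist_comm (G z), dist_comm (g j z) (g j y)]
          linarith [hj y hy]
  refine ⟨G, fun z hz => ?_, htlu⟩
  obtain ⟨r, hr, R, hrD, hR⟩ := hg z hz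
  have h1 : DifferentiableOn ℂ G (ball z r) :=
    differentiableOn_of_tendstoLocallyUniformlyOn isOpen_ball (hR.mono fun j hj => hj.1)
      (htlu.mono hrD)
  exact (h1.differentiableAt (ball_mem_nhds z hr)).differentiableWithinAt

end Montel

lemma exists_compact_exhaustion {X : Type*} [TopologicalSpace X] [LocallyCompactSpace X]
    [SecondCountableTopology X] {D : Set X} (hD : IsOpen D) :
    ∃ L : ℕ → Set X, (∀ m, IsCompact (L m)) ∧ (∀ m, L m ⊆ D) ∧
      ∀ C, IsCompact C → C ⊆ D → ∀ᶠ m in atTop, C ⊆ L m := by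
  have := hD.locallyCompactSpace
  let K := CompactExhaustion.choice D
  refine ⟨fun m => Subtype.val '' K m, fun m => (K.isCompact m).image continuous_subtype_val,
    fun m => by rintro _ ⟨x, -, rfl⟩; exact x.2, fun C hC hCD => ?_⟩
  have hc : IsCompact (Subtype.val ⁻¹' C : Set D) := by
    rw [Subtype.isCompact_iff, Subtype.image_preimage_coe, Set.inter_eq_right.2 hCD]
    exact hC
  obtain ⟨n, hn⟩ := K.exists_superset_of_isCompact hc
  filter_upwards [eventually_ge_atTop n] with m hm x hx
  exact ⟨⟨x, hCD hx⟩, K.subset hm (hn hx), rfl⟩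

section KernelLimit
variable {n : ℕ}

/-- Mean value estimate in a weighted Bergman space. -/
lemma exists_enorm_sq_le_wL2 {r : ℝ} (hr : 0 < r) : ∃ C : ℝ≥0∞, C ≠ ⊤ ∧
    ∀ (D : Set ℂ^n) (ψ : ℂ^n → ℝ) (g : ℂ^n → ℂ) (x : ℂ^n) (a : ℝ),
      IsOpen D → DifferentiableOn ℂ g D → closedBall x r ⊆ D →
      (∀ y ∈ closedBall x r, ψ y ≤ a) →
      ‖g x‖ₑ ^ 2 ≤ C * (eofReal (rexp a) * wL2 D ψ g) := by
  obtain ⟨C, hC, h⟩ := exists_enorm_sq_le_lintegral (W := ℂ^n) (μ := volume) hr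
  refine ⟨C, hC, fun D ψ g x a hD hg hx hψ => (h D g x hD hg hx).trans ?_⟩
  refine mul_le_mul_right ?_ _
  rw [wL2, ← lintegral_const_mul' _ _ ofReal_ne_top]
  refine le_trans (setLIntegral_mono' isClosed_closedBall.measurableSet fun y hy => ?_)
    (lintegral_mono_set hx)
  rw [← eofReal_mul (exp_nonneg _), ← ofReal_norm_eq_enorm,
    ← eofReal_pow (norm_nonneg _)]
  refine ofReal_le_ofReal ?_
  have : 1 ≤ rexp a * rexp (-ψ y) := by
    rw [← Real.exp_add]; exact Real.one_le_exp (by linarith [hψ y hy])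
  nlinarith [sq_nonneg ‖g y‖]

variable {D : Set ℂ^n} {ψ : ℂ^n → ℝ} {Dj : ℕ → Set ℂ^n}
  {ψj : ℕ → ℂ^n → ℝ} {l : (ℂ^n → ℂ) → ℂ} {lj : ℕ → (ℂ^n → ℂ) → ℂ}

/-- Domains and weights converging from inside, resp. from above. -/
structure WeightLimit (D : Set ℂ^n) (ψ : ℂ^n → ℝ) (Dj : ℕ → Set ℂ^n) (ψj : ℕ → ℂ^n → ℝ) :
    Prop where
  isOpen : IsOpen D
  isOpen' : ∀ j, IsOpen (Dj j)
  meas : ∀ j, AEMeasurable (ψj j) (volume.restrict (Dj j))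
  sub : ∀ C, IsCompact C → C ⊆ D → ∀ᶠ j in atTop, C ⊆ Dj j
  lim : ∀ z ∈ D, ∀ a, ψ z < a → ∃ V ∈ 𝓝 z, ∀ᶠ j in atTop, ∀ x ∈ V, x ∈ Dj j → ψj j x < a

/-- Normalized holomorphic functions with bounded weighted `L²` norms on converging domains have a
limit with the same bound. -/
theorem exists_bergman_limit (hW : WeightLimit D ψ Dj ψj) {ρ : ℝ} (hρD : closedBall 0 ρ ⊆ D)
    (hl : ∀ g, DifferentiableOn ℂ g D → ∀ ε > 0, ∃ δ > 0, ∀ᶠ j in atTop, ∀ h,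
      DifferentiableOn ℂ h (Dj j) → (∀ z ∈ closedBall (0 : ℂ^n) ρ, ‖h z - g z‖ ≤ δ) →
        ‖lj j h - l g‖ ≤ ε)
    {g : ℕ → ℂ^n → ℂ} (hg : ∀ j, DifferentiableOn ℂ (g j) (Dj j)) {M : ℝ≥0∞} (hM : M ≠ ⊤)
    (hgM : ∀ j, wL2 (Dj j) (ψj j) (g j) ≤ M) (hlg : ∀ j, lj j (g j) = 1) :
    ∃ G, DifferentiableOn ℂ G D ∧ wL2 D ψ G ≤ M ∧ l G = 1 := by
  obtain ⟨hD, hDj, hψm, hsub, hlim⟩ := hW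
  have hU : ((hyperfilter ℕ : Ultrafilter ℕ) : Filter ℕ) ≤ atTop := Nat.hyperfilter_le_atTop
  set 𝒰 : Ultrafilter ℕ := hyperfilter ℕ with h𝒰
  obtain ⟨G, hGd, hGl⟩ := exists_limit_of_locally_bounded 𝒰 hD (g := g) (by
    intro z hz
    obtain ⟨V, hV, hVj⟩ := hlim z hz (ψ z + 1) (by linarith)
    obtain ⟨r, hr, hrV⟩ := nhds_basis_closedBall.mem_iff.1
      (Filter.inter_mem hV (hD.mem_nhds hz))
    obtain ⟨C, hC, hCb⟩ := exists_enorm_sq_le_wL2 (n := n) (half_pos hr)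
    have hb : ∀ x ∈ ball z (r / 2), closedBall x (r / 2) ⊆ closedBall z r :=
      fun x hx => closedBall_subset_closedBall' (by linarith [mem_ball.1 hx])
    set B := C * (eofReal (rexp (ψ z + 1)) * M) with hB
    have hBT : B ≠ ⊤ := mul_ne_top hC (mul_ne_top ofReal_ne_top hM)
    refine ⟨r / 2, half_pos hr, B.toReal + 1, fun x hx => (hrV (hb x hx
      (mem_closedBall_self (half_pos hr).le))).2, ?_⟩
    filter_upwards [hU hVj, hU (hsub _ (isCompact_closedBall z r) fun x hx => (hrV hx).2)] with j h1 h2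
    refine ⟨(hg j).mono ((ball_subset_ball (by linarith)).trans
      (ball_subset_closedBall.trans h2)), fun x hx => ?_⟩
    have h3 := hCb (Dj j) (ψj j) (g j) x (ψ z + 1) (hDj j) (hg j) ((hb x hx).trans h2)
      fun y hy => (h1 y (hrV (hb x hx hy)).1 (h2 (hb x hx hy))).le
    have h4 : ‖g j x‖ₑ ^ 2 ≤ B := h3.trans (mul_le_mul_right (mul_le_mul_right (hgM j) _) _)
    have h5 : ‖g j x‖ ^ 2 ≤ B.toReal := by
      rw [← ofReal_norm_eq_enorm, ← eofReal_pow (norm_nonneg _)] at h4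
      exact (ENNReal.ofReal_le_iff_le_toReal hBT).1 h4
    nlinarith [norm_nonneg (g j x), sq_nonneg (‖g j x‖ - 1)])
  have hGu := (tendstoLocallyUniformlyOn_iff_forall_isCompact hD).1 hGl
  refine ⟨G, hGd, ?_, ?_⟩
  · obtain ⟨L, hLc, hLD, hLex⟩ := exists_compact_exhaustion hD
    have hch : ∀ m : ℕ, ∃ j, m ≤ j ∧ ∀ x ∈ L m, dist (G x) (g j x) < 1 / (m + 1) := fun m => by
      have h1 := tendstoUniformlyOn_iff.1 (hGu (L m) (hLD m) (hLc m)) (1 / (m + 1))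
        (by positivity)
      obtain ⟨j, hj⟩ := (h1.and (hU (eventually_ge_atTop m))).exists
      exact ⟨j, hj.2, hj.1⟩
    choose J hJm hJ using hch
    have hJt : Tendsto J atTop atTop := tendsto_atTop_mono hJm tendsto_id
    have hpt : ∀ z ∈ D, Tendsto (fun m => g (J m) z) atTop (𝓝 (G z)) := fun z hz => by
      rw [tendsto_iff_dist_tendsto_zero]
      refine squeeze_zero' (.of_forall fun _ => dist_nonneg) ?_
        tendsto_one_div_add_atTop_nhds_zero_nat
      filter_upwards [hLex {z} isCompact_singleton (by simpa using hz)] with m hm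
      rw [dist_comm]
      exact (hJ m z (hm rfl)).le
    set F : ℕ → ℂ^n → ℝ≥0∞ := fun m => (Dj (J m)).indicator fun z =>
      eofReal (‖g (J m) z‖ ^ 2 * rexp (-ψj (J m) z)) with hF
    have hFm : ∀ m, AEMeasurable (F m) := fun m => by
      rw [hF, aemeasurable_indicator_iff (hDj _).measurableSet]
      refine ENNReal.measurable_ofReal.comp_aemeasurable (AEMeasurable.mul ?_ ?_)
      · exact (((hg _).continuousOn.norm.pow 2).aemeasurable (hDj _).measurableSet)
      · exact Real.measurable_exp.comp_aemeasurable (hψm _).neg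
    have hFM : ∀ m, ∫⁻ z, F m z ≤ M := fun m => by
      rw [hF, lintegral_indicator (hDj _).measurableSet]; exact hgM _
    have key : ∀ z ∈ D, eofReal (‖G z‖ ^ 2 * rexp (-ψ z)) ≤
        liminf (fun m => F m z) atTop := by
      intro z hz
      have h1 : ∀ a, ψ z < a → eofReal (‖G z‖ ^ 2 * rexp (-a)) ≤
          liminf (fun m => F m z) atTop := by
        intro a ha
        have h2 : Tendsto (fun m => eofReal (‖g (J m) z‖ ^ 2 * rexp (-a))) atTop
            (𝓝 (eofReal (‖G z‖ ^ 2 * rexp (-a)))) :=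
          ENNReal.tendsto_ofReal (((hpt z hz).norm.pow 2).mul_const _)
        rw [← h2.liminf_eq]
        refine liminf_le_liminf ?_
        obtain ⟨V, hV, hVj⟩ := hlim z hz a ha
        filter_upwards [hJt.eventually hVj,
          hJt.eventually (hsub {z} isCompact_singleton (by simpa using hz))] with m hm1 hm2
        have hzm : z ∈ Dj (J m) := hm2 rfl
        simp only [hF, indicator_of_mem hzm]
        refine ofReal_le_ofReal ?_
        have := hm1 z (mem_of_mem_nhds hV) hzm
        gcongr
      have h3 : Tendsto (fun a => eofReal (‖G z‖ ^ 2 * rexp (-a))) (𝓝[>] (ψ z))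
          (𝓝 (eofReal (‖G z‖ ^ 2 * rexp (-ψ z)))) := by
        refine (ENNReal.tendsto_ofReal (Continuous.tendsto ?_ _)).mono_left nhdsWithin_le_nhds
        fun_prop
      exact le_of_tendsto h3 (eventually_mem_nhdsWithin.mono fun a ha => h1 a ha)
    calc wL2 D ψ G ≤ ∫⁻ z in D, liminf (fun m => F m z) atTop :=
          setLIntegral_mono' hD.measurableSet key
      _ ≤ liminf (fun m => ∫⁻ z in D, F m z) atTop :=
          lintegral_liminf_le' fun m => (hFm m).restrict
      _ ≤ liminf (fun _ => M) (atTop : Filter ℕ) :=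
          liminf_le_liminf (.of_forall fun m =>
            (lintegral_mono' Measure.restrict_le_self le_rfl).trans (hFM m))
      _ = M := by simp
  · have h1 : ∀ ε > 0, ‖1 - l G‖ ≤ ε := by
      intro ε hε
      obtain ⟨δ, hδ, h⟩ := hl G hGd ε hε
      have h2 := tendstoUniformlyOn_iff.1 (hGu _ hρD (isCompact_closedBall _ _)) δ hδ
      obtain ⟨j, hj1, hj2⟩ := ((h.filter_mono hU).and h2).exists
      have := hj1 (g j) (hg j) fun z hz => by
        rw [← dist_eq_norm, dist_comm]; exact (hj2 z hz).le
      rwa [hlg] at this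
    have := le_of_forall_pos_le_add (a := ‖1 - l G‖) (b := 0) fun ε hε => by
      simpa using h1 ε hε
    have h0 : ‖1 - l G‖ = 0 := le_antisymm this (norm_nonneg _)
    rw [norm_eq_zero, sub_eq_zero] at h0
    exact h0.symm

lemma wL2_const_smul (D : Set ℂ^n) (ψ : ℂ^n → ℝ) (c : ℂ) (f : ℂ^n → ℂ) :
    wL2 D ψ (c • f) = eofReal (‖c‖ ^ 2) * wL2 D ψ f := by
  rw [wL2, wL2, ← lintegral_const_mul' _ _ ofReal_ne_top]
  refine lintegral_congr fun z => ?_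
  rw [← eofReal_mul (by positivity), Pi.smul_apply, norm_smul]
  congr 1
  ring

/-- Upper semicontinuity of the norm of functionals on weighted Bergman spaces. -/
theorem eventually_bergmanSq_le (hW : WeightLimit D ψ Dj ψj) {ρ : ℝ} (hρD : closedBall 0 ρ ⊆ D)
    (hl : ∀ g, DifferentiableOn ℂ g D → ∀ ε > 0, ∃ δ > 0, ∀ᶠ j in atTop, ∀ h,
      DifferentiableOn ℂ h (Dj j) → (∀ z ∈ closedBall (0 : ℂ^n) ρ, ‖h z - g z‖ ≤ δ) →
        ‖lj j h - l g‖ ≤ ε)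
    (hhom : ∀ j (c : ℂ) h, lj j (c • h) = c * lj j h) {B : ℝ≥0∞} (hB : bergmanSq D ψ l < B) :
    ∀ᶠ j in atTop, bergmanSq (Dj j) (ψj j) (lj j) ≤ B := by
  obtain ⟨hD, hDj, hψm, hsub, hlim⟩ := hW
  by_contra hcon
  rw [not_eventually] at hcon
  obtain ⟨φ, hφ, hφB⟩ := extraction_of_frequently_atTop hcon
  have hφt := hφ.tendsto_atTop
  have hB0 : B ≠ 0 := (bot_le.trans_lt hB).ne'
  have hBT : B ≠ ⊤ := ne_top_of_lt (not_le.1 (hφB 0))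
  have hex : ∀ j, ∃ g, DifferentiableOn ℂ g (Dj (φ j)) ∧ wL2 (Dj (φ j)) (ψj (φ j)) g ≤ B⁻¹ ∧
      lj (φ j) g = 1 := by
    intro j
    obtain ⟨f, hf⟩ := lt_iSup_iff.1 (not_le.1 (hφB j))
    have h1 : B * wL2 (Dj (φ j)) (ψj (φ j)) f.1 ≤ eofReal (‖lj (φ j) f.1‖ ^ 2) :=
      ENNReal.mul_le_of_le_div hf.le
    have h0 : lj (φ j) f.1 ≠ 0 := by
      intro h0
      rw [h0] at hf
      simp at hf
    refine ⟨(lj (φ j) f.1)⁻¹ • f.1, f.2.1.const_smul _, ?_, ?_⟩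
    · rw [wL2_const_smul, ENNReal.le_inv_iff_mul_le, mul_assoc, mul_comm (wL2 _ _ _)]
      refine (mul_le_mul_right h1 _).trans (le_of_eq ?_)
      rw [← eofReal_mul (by positivity), norm_inv, ← mul_pow,
        inv_mul_cancel₀ (norm_ne_zero_iff.2 h0)]
      simp
    · rw [hhom, inv_mul_cancel₀ h0]
  choose g hg hgB hlg using hex
  obtain ⟨G, hGd, hGB, hGl⟩ := exists_bergman_limit (Dj := fun j => Dj (φ j))
    (ψj := fun j => ψj (φ j)) (lj := fun j => lj (φ j)) ⟨hD, fun j => hDj _, fun j => hψm _,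
    fun C hC hCD => hφt.eventually (hsub C hC hCD),
    fun z hz a ha => by
      obtain ⟨V, hV, h⟩ := hlim z hz a ha
      exact ⟨V, hV, hφt.eventually h⟩⟩ hρD
    (fun g hg ε hε => by
      obtain ⟨δ, hδ, h⟩ := hl g hg ε hε
      exact ⟨δ, hδ, hφt.eventually h⟩) hg (ENNReal.inv_ne_top.2 hB0) hgB hlg
  have h1 : eofReal (‖l G‖ ^ 2) / wL2 D ψ G ≤ bergmanSq D ψ l :=
    le_iSup (fun f : {f // MemA2 D ψ f} => eofReal (‖l f.1‖ ^ 2) / wL2 D ψ f.1)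
      ⟨G, hGd, hGB.trans_lt (ENNReal.inv_ne_top.2 hB0).lt_top⟩
  rw [hGl] at h1
  have h2 : B ≤ eofReal (‖(1 : ℂ)‖ ^ 2) / wL2 D ψ G := by
    rw [norm_one, one_pow, ENNReal.ofReal_one, one_div, ENNReal.le_inv_iff_mul_le, mul_comm,
      ← ENNReal.le_inv_iff_mul_le]
    exact hGB
  exact absurd (h2.trans h1) (not_le.2 hB)

end KernelLimit

section PartialDerivatives
variable {n : ℕ}

theorem differentiableOn_slice {U : Set ℂ^n} {f : ℂ^n → ℂ}
    (hf : DifferentiableOn ℂ f U) {z : ℂ^n} {i : Fin n} {s : Set ℂ}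
    (hs : ∀ t ∈ s, update z i t ∈ U) :
    DifferentiableOn ℂ (fun t => f (update z i t)) s :=
  hf.comp (fun t _ => (hasDerivAt_update z i t).differentiableAt.differentiableWithinAt) hs

theorem update_mem_ball {z : ℂ^n} {i : Fin n} {s : ℝ} {t : ℂ}
    (ht : t ∈ ball (z i) s) : update z i t ∈ ball z s := by
  have hs : 0 < s := pos_of_mem_ball ht
  rw [mem_ball, dist_pi_lt_iff hs]
  intro j
  rcases eq_or_ne j i with rfl | h
  · simpa using ht
  · simpa [update_of_ne h] using hs

theorem DifferentiableOn.pderivC {U : Set ℂ^n} (hU : IsOpen U) {f : ℂ^n → ℂ}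
    (hf : DifferentiableOn ℂ f U) (i : Fin n) : DifferentiableOn ℂ (pderivC i f) U := by
  refine (hf.fderiv_apply hU (Pi.single i 1)).congr fun z hz => ?_
  have h := hasDerivAt_update z i (z i)
  have hd : HasFDerivAt f (fderiv ℂ f z) (update z i (z i)) := by
    rw [update_eq_self]
    exact (hf.differentiableAt (hU.mem_nhds hz)).hasFDerivAt
  exact (hd.comp_hasDerivAt (z i) h).deriv

theorem DifferentiableOn.iterate_pderivC {U : Set ℂ^n} (hU : IsOpen U)
    {f : ℂ^n → ℂ} (hf : DifferentiableOn ℂ f U) (i : Fin n) (k : ℕ) :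
    DifferentiableOn ℂ ((_root_.pderivC i)^[k] f) U := by
  induction k with
  | zero => exact hf
  | succ k ih => rw [iterate_succ_apply']; exact ih.pderivC hU i

theorem iterate_pderivC_update (i : Fin n) (f : ℂ^n → ℂ) (k : ℕ) (z : ℂ^n) :
    (fun t => (pderivC i)^[k] f (update z i t))
      = iteratedDeriv k (fun t => f (update z i t)) := by
  induction k with
  | zero => simp
  | succ k ih =>
    rw [iteratedDeriv_succ, ← ih]
    funext t
    simp [iterate_succ_apply', pderivC]

theorem norm_iterate_pderivC_le {U : Set ℂ^n} {f : ℂ^n → ℂ}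
    (hf : DifferentiableOn ℂ f U) {z : ℂ^n} {d B : ℝ} (hd : 0 < d)
    (hz : closedBall z d ⊆ U) (hB : ∀ x ∈ U, ‖f x‖ ≤ B) (i : Fin n) (k : ℕ) :
    ‖(pderivC i)^[k] f z‖ ≤ k.factorial / d ^ k * B := by
  have hm : ∀ t ∈ closedBall (z i) d, update z i t ∈ U := fun t ht => by
    refine hz ?_
    rw [mem_closedBall, dist_pi_le_iff hd.le]
    intro j
    rcases eq_or_ne j i with rfl | h
    · simpa using ht
    · simpa [update_of_ne h] using hd.le
  have h := norm_iteratedDeriv_le_of_forall_mem_sphere_norm_le k hd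
    (f := fun t => f (update z i t)) (c := z i) (C := B) ?_
    (fun t ht => hB _ (hm t (sphere_subset_closedBall ht)))
  · rw [← iterate_pderivC_update] at h
    simp only [update_eq_self] at h
    rwa [div_mul_eq_mul_div]
  · refine DifferentiableOn.diffContOnCl ?_
    rw [closure_ball _ hd.ne']
    exact differentiableOn_slice hf hm

theorem norm_foldr_pderivC_le {ρ d B : ℝ} (hd : 0 < d) {g : ℂ^n → ℂ}
    (hg : DifferentiableOn ℂ g (ball 0 ρ)) (hB : ∀ x ∈ ball 0 ρ, ‖g x‖ ≤ B)
    (α : Fin n → ℕ) (l : List (Fin n)) :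
    DifferentiableOn ℂ (l.foldr (fun i g => (pderivC i)^[α i] g) g) (ball 0 ρ) ∧
    ∀ x ∈ ball 0 (ρ - l.length * d), ‖l.foldr (fun i g => (pderivC i)^[α i] g) g x‖ ≤
      (l.map fun i => ((α i).factorial / d ^ α i : ℝ)).prod * B := by
  induction l with
  | nil => exact ⟨hg, by simpa using hB⟩
  | cons i l ih =>
    refine ⟨ih.1.iterate_pderivC isOpen_ball i _, fun x hx => ?_⟩
    simp only [List.foldr_cons, List.map_cons, List.prod_cons, mul_assoc]
    refine norm_iterate_pderivC_le (U := ball 0 (ρ - l.length * d))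
      (ih.1.mono (ball_subset_ball (by nlinarith [l.length.cast_nonneg (α := ℝ)])))
      hd (fun y hy => ?_) ih.2 i _
    rw [mem_closedBall, dist_eq_norm] at hy
    rw [mem_ball_zero_iff] at hx ⊢
    have := norm_le_norm_add_norm_sub' y x
    push_cast [List.length_cons] at hx
    linarith

theorem norm_multiDeriv_div_le {ρ B : ℝ} (hρ : 0 < ρ) {g : ℂ^n → ℂ}
    (hg : DifferentiableOn ℂ g (ball 0 ρ)) (hB : ∀ x ∈ ball 0 ρ, ‖g x‖ ≤ B)
    (α : Fin n → ℕ) :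
    ‖multiDeriv α g 0 / (mfact α : ℂ)‖ ≤ ((n + 1) / ρ) ^ mdeg α * B := by
  have hn : (0 : ℝ) < n + 1 := by positivity
  have h := (norm_foldr_pderivC_le (d := ρ / (n + 1)) (by positivity) hg hB α
    (List.finRange n)).2 0 (by
      simp only [List.length_finRange, mem_ball_zero_iff, norm_zero]
      have : ρ - n * (ρ / (n + 1)) = ρ / (n + 1) := by field_simp; ring
      rw [this]; positivity)
  have hm : (0 : ℝ) < mfact α := by
    unfold mfact; exact_mod_cast Finset.prod_pos fun i _ => Nat.factorial_pos _
  rw [norm_div, norm_natCast, div_le_iff₀ hm]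
  refine h.trans (le_of_eq ?_)
  rw [← Fin.prod_univ_def, Finset.prod_div_distrib, Finset.prod_pow_eq_pow_sum, mfact, mdeg,
    div_pow, div_pow]
  push_cast
  field_simp

/-- Linear functionals `g ↦ T g z` which are limits of combinations of point evaluations,
uniformly on bounded families of holomorphic functions on a ball. -/
structure PointApproximable (ρ : ℝ) (T : (ℂ^n → ℂ) → ℂ^n → ℂ) : Prop where
  hol : ∀ g, DifferentiableOn ℂ g (ball 0 ρ) → DifferentiableOn ℂ (T g) (ball 0 ρ)
  bdd : ∀ z ∈ ball (0 : ℂ^n) ρ, ∃ s > 0, ∃ M ≥ 0,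
    ball z s ⊆ ball 0 ρ ∧ ∀ g B, DifferentiableOn ℂ g (ball 0 ρ) →
      (∀ x ∈ ball 0 ρ, ‖g x‖ ≤ B) → ∀ x ∈ ball z s, ‖T g x‖ ≤ M * B
  approx : ∀ z ∈ ball (0 : ℂ^n) ρ, ∀ ε > 0,
    ∃ c ∈ Finsupp.supported ℂ ℂ (ball (0 : ℂ^n) ρ), ∀ g B,
      DifferentiableOn ℂ g (ball 0 ρ) → (∀ x ∈ ball 0 ρ, ‖g x‖ ≤ B) →
        ‖T g z - Finsupp.linearCombination ℂ g c‖ ≤ ε * B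

theorem norm_deriv_sub_slope_le {φ : ℂ → ℂ} {c z : ℂ} {s M : ℝ}
    (hφ : DifferentiableOn ℂ φ (ball c s)) (hM : ∀ t ∈ ball c s, ‖φ t‖ ≤ M)
    (hz : z ∈ ball c s) (hzc : z ≠ c) :
    ‖deriv φ c - slope φ c z‖ ≤ 4 * M / s ^ 2 * ‖z - c‖ := by
  have hs : 0 < s := pos_of_mem_ball hz
  have hc := mem_ball_self (x := c) hs
  have hb : ∀ t ∈ ball c s, ‖dslope φ c t‖ ≤ 2 * M / s := fun t ht => by
    refine norm_dslope_le_div_of_mapsTo_ball hφ (fun x hx => ?_) ht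
    rw [mem_closedBall, dist_eq_norm]
    linarith [norm_sub_le (φ x) (φ c), hM x hx, hM c hc]
  have h := dist_le_div_mul_dist_of_mapsTo_ball (R₂ := 4 * M / s)
    ((differentiableOn_dslope (isOpen_ball.mem_nhds hc)).2 hφ) (fun x hx => ?_) hz
  · rw [dslope_of_ne _ hzc, dslope_same, dist_comm, dist_eq_norm, dist_eq_norm] at h
    rwa [div_div, ← sq] at h
  · rw [mem_closedBall, dist_eq_norm]
    have e : 4 * M / s = 2 * M / s + 2 * M / s := by ring
    linarith [norm_sub_le (dslope φ c x) (dslope φ c c), hb x hx, hb c hc]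

theorem PointApproximable.pderivC {ρ : ℝ} {T : (ℂ^n → ℂ) → ℂ^n → ℂ}
    (hT : PointApproximable ρ T) (i : Fin n) : PointApproximable ρ fun g => pderivC i (T g) where
  hol g hg := (hT.hol g hg).pderivC isOpen_ball i
  bdd z hz := by
    obtain ⟨s, hs, M, hM, hsub, h⟩ := hT.bdd z hz
    refine ⟨s / 2, by positivity, (Nat.factorial 1) / (s / 4) ^ 1 * M, by positivity,
      (ball_subset_ball (by linarith)).trans hsub, fun g B hg hB x hx => ?_⟩
    rw [mul_assoc]
    refine norm_iterate_pderivC_le ((hT.hol g hg).mono hsub) (by positivity) (fun y hy => ?_)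
      (h g B hg hB) i 1
    rw [mem_closedBall] at hy
    rw [mem_ball] at hx ⊢
    linarith [dist_triangle y x z]
  approx z hz ε hε := by
    obtain ⟨s, hs, M, hM, hsub, h⟩ := hT.bdd z hz
    obtain ⟨δ, hδ, hδs, hδε⟩ : ∃ δ : ℝ, 0 < δ ∧ δ < s ∧ 4 * M / s ^ 2 * δ ≤ ε / 2 := by
      refine ⟨min (s / 2) (ε * s ^ 2 / (8 * (M + 1))), by positivity,
        (min_le_left _ _).trans_lt (by linarith), ?_⟩
      refine (mul_le_mul_of_nonneg_left (min_le_right _ _) (by positivity)).trans ?_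
      rw [div_mul_div_comm, div_le_div_iff₀ (by positivity) (by positivity)]
      nlinarith [mul_pos hε (pow_pos hs 2)]
    have hzs : z i + δ ∈ ball (z i) s := by
      simpa [dist_eq_norm, abs_of_pos hδ] using hδs
    obtain ⟨c₀, hc₀, h₀⟩ := hT.approx z hz (ε * δ / 4) (by positivity)
    obtain ⟨c₁, hc₁, h₁⟩ := hT.approx (update z i (z i + δ)) (hsub (update_mem_ball hzs))
      (ε * δ / 4) (by positivity)
    refine ⟨(δ : ℂ)⁻¹ • (c₁ - c₀), Submodule.smul_mem _ _ (Submodule.sub_mem _ hc₁ hc₀),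
      fun g B hg hB => ?_⟩
    have hδ0 : (δ : ℂ) ≠ 0 := by exact_mod_cast hδ.ne'
    have hsl := norm_deriv_sub_slope_le (z := z i + δ)
      (differentiableOn_slice ((hT.hol g hg).mono hsub) fun t ht => update_mem_ball ht)
      (fun t ht => h g B hg hB _ (update_mem_ball ht)) hzs (by simpa using hδ0)
    have hB0 : 0 ≤ B := (norm_nonneg _).trans (hB z hz)
    have e1 := h₁ g B hg hB
    have e0 := h₀ g B hg hB
    set L := Finsupp.linearCombination ℂ g
    rw [slope_def_field, update_eq_self, add_sub_cancel_left, norm_real,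
      norm_of_nonneg hδ.le] at hsl
    have hd : ‖(T g (update z i (z i + δ)) - T g z) / δ - (δ : ℂ)⁻¹ * (L c₁ - L c₀)‖
        ≤ ε / 2 * B := by
      rw [div_eq_inv_mul, ← mul_sub, norm_mul, norm_inv, norm_real,
        norm_of_nonneg hδ.le, inv_mul_le_iff₀ hδ]
      have := norm_sub_le (T g (update z i (z i + δ)) - L c₁) (T g z - L c₀)
      rw [sub_sub_sub_comm] at this
      linarith
    have h4 : 4 * (M * B) / s ^ 2 * δ ≤ ε / 2 * B := by
      calc _ = 4 * M / s ^ 2 * δ * B := by ring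
        _ ≤ _ := mul_le_mul_of_nonneg_right hδε hB0
    rw [map_smul, map_sub, smul_eq_mul]
    refine (norm_sub_le_norm_sub_add_norm_sub _ _ _).trans
      ((add_le_add (hsl.trans h4) hd).trans (by linarith))

theorem PointApproximable.id {ρ : ℝ} : PointApproximable (n := n) ρ fun g => g where
  hol _ hg := hg
  bdd z hz := by
    obtain ⟨s, hs, h⟩ := isOpen_iff.1 isOpen_ball z hz
    exact ⟨s, hs, 1, zero_le_one, h, fun g B _ hB x hx => by simpa using hB x (h hx)⟩
  approx z hz ε hε := ⟨Finsupp.single z 1, Finsupp.single_mem_supported ℂ 1 hz, fun g B _ hB => by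
    have : 0 ≤ B := (norm_nonneg _).trans (hB z hz)
    simp; positivity⟩

theorem PointApproximable.multiDeriv (ρ : ℝ) (α : Fin n → ℕ) :
    PointApproximable ρ (multiDeriv α) := by
  unfold _root_.multiDeriv
  induction List.finRange n with
  | nil => exact .id
  | cons i l ih =>
    simp only [List.foldr_cons]
    induction α i with
    | zero => exact ih
    | succ k ih => simp only [iterate_succ_apply']; exact ih.pderivC i

theorem hasSum_le_of_tsum_ofReal_le {ι : Type*} {b : ι → ℝ} (hb : ∀ i, 0 ≤ b i) {C : ℝ}
    (hC : 0 ≤ C) (h : ∑' i, eofReal (b i) ≤ eofReal C) :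
    Summable b ∧ ∑' i, b i ≤ C := by
  have hs : Summable b := by
    simpa [ENNReal.toReal_ofReal, hb] using
      ENNReal.summable_toReal (h.trans_lt ENNReal.ofReal_lt_top).ne
  rw [← ENNReal.ofReal_tsum_of_nonneg hb hs] at h
  exact ⟨hs, (ofReal_le_ofReal_iff hC).1 h⟩

theorem norm_xiAct_sub_sum_le {ρ B C : ℝ} (hρ : 0 < ρ) (hC : 0 ≤ C) {ξ : (Fin n → ℕ) → ℂ}
    (hξ : ∑' α, eofReal (‖ξ α‖ * (2 * ((n + 1) / ρ)) ^ mdeg α) ≤ eofReal C)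
    {g : ℂ^n → ℂ} (hg : DifferentiableOn ℂ g (ball 0 ρ))
    (hB : ∀ x ∈ ball 0 ρ, ‖g x‖ ≤ B) {J : ℕ} {A : Finset (Fin n → ℕ)}
    (hA : ∀ α ∉ A, J ≤ mdeg α) :
    ‖xiAct ξ g 0 - ∑ α ∈ A, ξ α * (multiDeriv α g 0 / (mfact α : ℂ))‖ ≤ (1 / 2) ^ J * C * B := by
  have hB0 : 0 ≤ B := (norm_nonneg _).trans (hB 0 (by simpa using hρ))
  obtain ⟨hs, ht⟩ := hasSum_le_of_tsum_ofReal_le (fun α => by positivity) hC hξ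
  set b : (Fin n → ℕ) → ℝ := fun α => ‖ξ α‖ * (2 * ((n + 1) / ρ)) ^ mdeg α
  have hb : ∀ α, 0 ≤ b α := fun α => by positivity
  have ha : ∀ α, ‖ξ α * (multiDeriv α g 0 / (mfact α : ℂ))‖ ≤ (1 / 2) ^ mdeg α * b α * B := by
    intro α
    rw [norm_mul]
    refine (mul_le_mul_of_nonneg_left (norm_multiDeriv_div_le hρ hg hB α)
      (norm_nonneg _)).trans (le_of_eq ?_)
    simp only [b, mul_pow, one_div, inv_pow]
    field_simp
  have hle : ∀ α, (1 / 2 : ℝ) ^ mdeg α * b α * B ≤ B * b α := fun α => by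
    rw [mul_comm B]
    exact mul_le_mul_of_nonneg_right (mul_le_of_le_one_left (hb α)
      (pow_le_one₀ (by norm_num) (by norm_num))) hB0
  have hsum : Summable fun α => ‖ξ α * (multiDeriv α g 0 / (mfact α : ℂ))‖ :=
    (hs.mul_left B).of_nonneg_of_le (fun _ => norm_nonneg _) fun α => (ha α).trans (hle α)
  have hx : xiAct ξ g 0 = ∑' α, ξ α * (multiDeriv α g 0 / (mfact α : ℂ)) := by
    simp only [xiAct, mul_div_assoc]
  rw [hx, ← hsum.of_norm.sum_add_tsum_subtype_compl A, add_sub_cancel_left]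
  refine (norm_tsum_le_tsum_norm (hsum.subtype _)).trans ?_
  calc _ ≤ ∑' α : {α // α ∉ A}, (1 / 2) ^ J * B * b α := by
        refine Summable.tsum_le_tsum (fun α => (ha α).trans ?_) (hsum.subtype _)
          ((hs.subtype _).mul_left _)
        have := pow_le_pow_of_le_one (a := (1 / 2 : ℝ)) (by norm_num) (by norm_num) (hA α.1 α.2)
        nlinarith [mul_le_mul_of_nonneg_right this (mul_nonneg (hb α.1) hB0)]
    _ ≤ (1 / 2) ^ J * B * C := by
        rw [tsum_mul_left]
        exact mul_le_mul_of_nonneg_left ((Summable.tsum_subtype_le b _ hb hs).trans ht) (by positivity)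
    _ = _ := by ring

theorem norm_xiAct_le {ρ B C : ℝ} (hρ : 0 < ρ) (hC : 0 ≤ C) {ξ : (Fin n → ℕ) → ℂ}
    (hξ : ∑' α, eofReal (‖ξ α‖ * (2 * ((n + 1) / ρ)) ^ mdeg α) ≤ eofReal C)
    {g : ℂ^n → ℂ} (hg : DifferentiableOn ℂ g (ball 0 ρ))
    (hB : ∀ x ∈ ball 0 ρ, ‖g x‖ ≤ B) : ‖xiAct ξ g 0‖ ≤ C * B := by
  simpa using norm_xiAct_sub_sum_le hρ hC hξ hg hB (J := 0) (A := ∅) fun _ _ => Nat.zero_le _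

/-- Functionals in `ℓ₁` are approximated by combinations of point evaluations, uniformly on
bounded families of functionals and of holomorphic functions. -/
theorem exists_approx_xiAct {ρ C ε : ℝ} (hρ : 0 < ρ) (hC : 0 ≤ C) (hε : 0 < ε) :
    ∃ I : Finset (Σ _ : Fin n → ℕ, ℂ^n), ∃ c : I → ℂ, (∀ i : I, i.1.2 ∈ ball 0 ρ) ∧
      ∀ ξ : (Fin n → ℕ) → ℂ,
      ∑' α, eofReal (‖ξ α‖ * (2 * ((n + 1) / ρ)) ^ mdeg α) ≤ eofReal C →
      ∀ g B, DifferentiableOn ℂ g (ball 0 ρ) → (∀ x ∈ ball 0 ρ, ‖g x‖ ≤ B) →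
        ‖xiAct ξ g 0 - ∑ i : I, ξ i.1.1 * c i * g i.1.2‖ ≤ ε * B := by
  obtain ⟨J, hJ⟩ : ∃ J : ℕ, (1 / 2 : ℝ) ^ J * C ≤ ε / 2 := by
    have := (tendsto_pow_atTop_nhds_zero_of_lt_one (r := (1 / 2 : ℝ)) (by norm_num)
      (by norm_num)).mul_const C
    rw [zero_mul] at this
    exact ((this.eventually_le_const (by positivity : (0 : ℝ) < ε / 2))).exists
  set R : ℝ := 2 * ((n + 1) / ρ)
  set A : Finset (Fin n → ℕ) := Fintype.piFinset fun _ => Finset.range J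
  set S : ℝ := ∑ α ∈ A, C / R ^ mdeg α
  have hS : 0 ≤ S := sum_nonneg fun α _ => by positivity
  have hR : 0 < R := by positivity
  have h0 : (0 : ℂ^n) ∈ ball 0 ρ := by simpa using hρ
  have hm : ∀ α, ∃ c ∈ Finsupp.supported ℂ ℂ (ball (0 : ℂ^n) ρ), ∀ g B,
      DifferentiableOn ℂ g (ball 0 ρ) → (∀ x ∈ ball 0 ρ, ‖g x‖ ≤ B) →
        ‖multiDeriv α g 0 / (mfact α : ℂ) - Finsupp.linearCombination ℂ g c‖
          ≤ ε / (2 * (S + 1)) * B := by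
    intro α
    have hf : (0 : ℝ) < mfact α := by
      unfold mfact; exact_mod_cast Finset.prod_pos fun i _ => Nat.factorial_pos _
    obtain ⟨c, hc, h⟩ := (PointApproximable.multiDeriv ρ α).approx 0 h0
      (ε / (2 * (S + 1)) * mfact α) (by positivity)
    refine ⟨(mfact α : ℂ)⁻¹ • c, Submodule.smul_mem _ _ hc, fun g B hg hB => ?_⟩
    rw [map_smul, smul_eq_mul, div_eq_inv_mul, ← mul_sub, norm_mul, norm_inv,
      norm_natCast, inv_mul_le_iff₀ hf]
    exact (h g B hg hB).trans (le_of_eq (by ring))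
  choose c hc h using hm
  refine ⟨A.sigma fun α => (c α).support, fun i => c i.1.1 i.1.2, fun i => ?_,
    fun ξ hξ g B hg hB => ?_⟩
  · exact (Finsupp.mem_supported _ _).1 (hc i.1.1) (Finset.mem_sigma.1 i.2).2
  have hB0 : 0 ≤ B := (norm_nonneg _).trans (hB 0 h0)
  have e : ∑ i : (A.sigma fun α => (c α).support), ξ i.1.1 * c i.1.1 i.1.2 * g i.1.2
      = ∑ α ∈ A, ξ α * Finsupp.linearCombination ℂ g (c α) := by
    rw [Finset.sum_coe_sort (A.sigma fun α => (c α).support)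
      (fun i => ξ i.1 * c i.1 i.2 * g i.2), Finset.sum_sigma]
    refine sum_congr rfl fun α _ => ?_
    simp only [Finsupp.linearCombination_apply, Finsupp.sum, mul_sum, smul_eq_mul, mul_assoc]
  rw [e]
  obtain ⟨hs, ht⟩ := hasSum_le_of_tsum_ofReal_le (fun α => by positivity) hC hξ
  have hA : ‖∑ α ∈ A, ξ α * (multiDeriv α g 0 / (mfact α : ℂ))
      - ∑ α ∈ A, ξ α * Finsupp.linearCombination ℂ g (c α)‖ ≤ ε / 2 * B := by
    rw [← sum_sub_distrib]
    calc _ ≤ ∑ α ∈ A, C / R ^ mdeg α * (ε / (2 * (S + 1)) * B) := by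
          refine norm_sum_le_of_le _ fun α _ => ?_
          rw [← mul_sub, norm_mul]
          refine mul_le_mul ?_ (h α g B hg hB) (norm_nonneg _) (by positivity)
          rw [le_div_iff₀ (by positivity)]
          exact (hs.le_tsum α fun _ _ => by positivity).trans ht
      _ = S / (S + 1) * (ε / 2 * B) := by
        rw [← sum_mul, show ∑ α ∈ A, C / R ^ mdeg α = S from rfl]
        field_simp
      _ ≤ _ := mul_le_of_le_one_left (by positivity)
          ((div_le_one (by positivity)).2 (by linarith))
  have h1 := norm_xiAct_sub_sum_le hρ hC hξ hg hB (J := J) (A := A) fun α hα => by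
    obtain ⟨i, hi⟩ : ∃ i, J ≤ α i := by
      by_contra! h
      exact hα (Fintype.mem_piFinset.2 fun i => Finset.mem_range.2 (h i))
    exact hi.trans (single_le_sum (f := α) (fun _ _ => Nat.zero_le _) (mem_univ i))
  refine (norm_sub_le_norm_sub_add_norm_sub _ _ _).trans ((add_le_add h1 hA).trans ?_)
  nlinarith [mul_le_mul_of_nonneg_right hJ hB0]

theorem multiDeriv_smul (α : Fin n → ℕ) (c : ℂ) (f : ℂ^n → ℂ) :
    multiDeriv α (c • f) = c • multiDeriv α f := by
  have h1 : ∀ (i : Fin n) (f : ℂ^n → ℂ), pderivC i (c • f) = c • pderivC i f :=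
    fun i f => by funext z; simp [pderivC, deriv_const_mul_field]
  have h2 : ∀ (i : Fin n) (k : ℕ) (f : ℂ^n → ℂ),
      (pderivC i)^[k] (c • f) = c • (pderivC i)^[k] f := fun i k f => by
    induction k with
    | zero => rfl
    | succ k ih => rw [iterate_succ_apply', ih, h1, iterate_succ_apply']
  unfold multiDeriv
  induction List.finRange n with
  | nil => rfl
  | cons i l ih => rw [List.foldr_cons, ih, h2, List.foldr_cons]

theorem multiDeriv_comp_add (α : Fin n → ℕ) (a : ℂ^n) (f : ℂ^n → ℂ) :
    multiDeriv α (fun x => f (a + x)) = fun x => multiDeriv α f (a + x) := by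
  have h1 : ∀ (i : Fin n) (f : ℂ^n → ℂ),
      pderivC i (fun x => f (a + x)) = fun x => pderivC i f (a + x) := fun i f => by
    funext z
    have : ∀ t, a + update z i t = update (a + z) i (a i + t) := fun t => by
      ext j
      rcases eq_or_ne j i with rfl | h
      · simp
      · simp [update_of_ne h]
    simp only [pderivC, this, Pi.add_apply]
    exact deriv_comp_const_add (f := fun t => f (update (a + z) i t)) (a i) (z i)
  have h2 : ∀ (i : Fin n) (k : ℕ) (f : ℂ^n → ℂ),
      (pderivC i)^[k] (fun x => f (a + x)) = fun x => (pderivC i)^[k] f (a + x) := fun i k f => by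
    induction k with
    | zero => rfl
    | succ k ih => rw [iterate_succ_apply', ih, h1, iterate_succ_apply']
  unfold multiDeriv
  induction List.finRange n with
  | nil => rfl
  | cons i l ih => rw [List.foldr_cons, ih, h2, List.foldr_cons]

theorem xiAct_smul (ξ : (Fin n → ℕ) → ℂ) (c : ℂ) (f : ℂ^n → ℂ) (z : ℂ^n) :
    xiAct ξ (c • f) z = c * xiAct ξ f z := by
  simp only [xiAct, multiDeriv_smul, ← tsum_mul_left]
  exact tsum_congr fun α => by simp; ring

theorem xiAct_comp_add (ξ : (Fin n → ℕ) → ℂ) (a : ℂ^n) (f : ℂ^n → ℂ)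
    (z : ℂ^n) : xiAct ξ (fun x => f (a + x)) z = xiAct ξ f (a + z) := by
  simp only [xiAct, multiDeriv_comp_add]

end PartialDerivatives

section FiberKernel
variable {n m : ℕ}

theorem fiberKernel_eq_bergmanSq (ξ : ℂ^m → (Fin n → ℕ) → ℂ)
    (Ω : Set (ℂ^n × ℂ^m)) (ψ : ℂ^n × ℂ^m → ℝ)
    (z : ℂ^n) (w : ℂ^m) :
    fiberKernel ξ Ω ψ (z, w) = bergmanSq {x | (z + x, w) ∈ Ω} (fun x => ψ (z + x, w))
      (fun f => xiAct (ξ w) f 0) := by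
  have hw : ∀ f : ℂ^n → ℂ, wL2 {x | (z + x, w) ∈ Ω} (fun x => ψ (z + x, w))
      (fun x => f (z + x)) = wL2 {x | (x, w) ∈ Ω} (fun x => ψ (x, w)) f := fun f =>
    (measurePreserving_add_left volume z).setLIntegral_comp_preimage_emb
      (measurableEmbedding_addLeft z)
      (fun x => eofReal (‖f x‖ ^ 2 * rexp (-ψ (x, w)))) {x | (x, w) ∈ Ω}
  refine Function.Surjective.iSup_congr (fun f => ⟨fun x => f.1 (z + x), ?_, ?_⟩) (fun f => ?_)
    fun f => ?_
  · exact f.2.1.comp (by fun_prop) fun x hx => hx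
  · rw [hw]; exact f.2.2
  · have hf : (fun x => f.1 (-z + (z + x))) = f.1 := by simp
    refine ⟨⟨fun x => f.1 (-z + x), f.2.1.comp (by fun_prop) fun x hx => ?_, ?_⟩, Subtype.ext hf⟩
    · simpa using hx
    · rw [← hw, hf]; exact f.2.2
  · simp only [hw, xiAct_comp_add, add_zero]

theorem exists_bergmanSq_le {ρ r M a : ℝ} (hr : 0 < r) (hM : 0 ≤ M) :
    ∃ K : ℝ≥0∞, K ≠ ⊤ ∧ ∀ (D : Set ℂ^n) (ψ : ℂ^n → ℝ)
      (l : (ℂ^n → ℂ) → ℂ), IsOpen D → closedBall 0 (ρ + r) ⊆ D →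
      (∀ y ∈ closedBall 0 (ρ + r), ψ y ≤ a) →
      (∀ h B, DifferentiableOn ℂ h (ball 0 ρ) →
        (∀ x ∈ ball 0 ρ, ‖h x‖ ≤ B) → ‖l h‖ ≤ M * B) → bergmanSq D ψ l ≤ K := by
  obtain ⟨C, hC, h⟩ := exists_enorm_sq_le_wL2 (n := n) hr
  refine ⟨eofReal (M ^ 2) * (C * eofReal (rexp a)), by finiteness,
    fun D ψ l hD hsub hψ hl => iSup_le fun f => ?_⟩
  set X := C * (eofReal (rexp a) * wL2 D ψ f.1)
  have hX : X ≠ ⊤ := mul_ne_top hC (mul_ne_top ofReal_ne_top f.2.2.ne)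
  have hcb : ∀ x ∈ ball (0 : ℂ^n) ρ,
      closedBall x r ⊆ closedBall 0 (ρ + r) := fun x hx =>
    closedBall_subset_closedBall' (by rw [mem_ball] at hx; linarith)
  have hb : ∀ x ∈ ball (0 : ℂ^n) ρ, ‖f.1 x‖ ≤ √X.toReal := fun x hx => by
    have h1 := h D ψ f.1 x a hD f.2.1 ((hcb x hx).trans hsub) fun y hy => hψ y (hcb x hx hy)
    refine Real.le_sqrt_of_sq_le ?_
    have := ENNReal.toReal_mono hX h1
    simpa using this
  have hsub' : ball 0 ρ ⊆ D := (ball_subset_closedBall.trans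
    (closedBall_subset_closedBall (by linarith))).trans hsub
  have h2 := hl f.1 _ (f.2.1.mono hsub') hb
  refine ENNReal.div_le_of_le_mul ?_
  calc eofReal (‖l f.1‖ ^ 2) ≤ eofReal ((M * √X.toReal) ^ 2) :=
        ofReal_le_ofReal (by gcongr)
    _ = eofReal (M ^ 2) * X := by
        rw [mul_pow, sq_sqrt ENNReal.toReal_nonneg, eofReal_mul (by positivity),
          ofReal_toReal hX]
    _ = _ := by simp only [X]; ring

theorem eventually_bergmanSq_le_of_xiAct {D : Set ℂ^n} {ψ : ℂ^n → ℝ}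
    {Dj : ℕ → Set ℂ^n} {ψj : ℕ → ℂ^n → ℝ} (hW : WeightLimit D ψ Dj ψj)
    {ρ : ℝ} (hρ : 0 < ρ) (hρD : closedBall 0 ρ ⊆ D) {ξj : ℕ → (Fin n → ℕ) → ℂ}
    {ξ : (Fin n → ℕ) → ℂ} {C : ℝ} (hC : 0 ≤ C)
    (hξj : ∀ᶠ j in atTop, ∑' α, eofReal (‖ξj j α‖ * (2 * ((n + 1) / ρ)) ^ mdeg α)
      ≤ eofReal C)
    (hξ : ∑' α, eofReal (‖ξ α‖ * (2 * ((n + 1) / ρ)) ^ mdeg α) ≤ eofReal C)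
    (hlimξ : ∀ α, Tendsto (fun j => ξj j α) atTop (𝓝 (ξ α))) {ε : ℕ → ℝ}
    (hε : Tendsto ε atTop (𝓝 0)) {l : ℕ → (ℂ^n → ℂ) → ℂ}
    (hl : ∀ j h B, DifferentiableOn ℂ h (ball 0 ρ) → (∀ x ∈ ball 0 ρ, ‖h x‖ ≤ B) →
      ‖l j h - xiAct (ξj j) h 0‖ ≤ ε j * B)
    (hhom : ∀ j (c : ℂ) h, l j (c • h) = c * l j h) {B : ℝ≥0∞}
    (hB : bergmanSq D ψ (fun f => xiAct ξ f 0) < B) :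
    ∀ᶠ j in atTop, bergmanSq (Dj j) (ψj j) (l j) ≤ B := by
  refine eventually_bergmanSq_le hW hρD (fun g hg ε' hε' => ?_) hhom hB
  have hbc : ball (0 : ℂ^n) ρ ⊆ closedBall 0 ρ := ball_subset_closedBall
  have hcpt := isCompact_closedBall (0 : ℂ^n) ρ
  obtain ⟨G, hG⟩ := hcpt.exists_bound_of_continuousOn (hg.continuousOn.mono hρD)
  have hG0 : 0 ≤ G := (norm_nonneg _).trans (hG 0 (by simpa using hρ.le))
  obtain ⟨I, c, hI, hap⟩ := exists_approx_xiAct (n := n) (ρ := ρ) (C := C)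
    (ε := ε' / (5 * (G + 1))) hρ hC (by positivity)
  have hlimS : Tendsto (fun j => ∑ i : I, (ξj j i.1.1 * c i * g i.1.2)) atTop
      (𝓝 (∑ i : I, ξ i.1.1 * c i * g i.1.2)) :=
    tendsto_finsetSum _ fun i _ => ((hlimξ i.1.1).mul_const _).mul_const _
  have hlimN : Tendsto (fun j => ∑ i : I, ‖ξj j i.1.1 * c i‖) atTop
      (𝓝 (∑ i : I, ‖ξ i.1.1 * c i‖)) :=
    tendsto_finsetSum _ fun i _ => ((hlimξ i.1.1).mul_const _).norm
  set S := ∑ i : I, ‖ξ i.1.1 * c i‖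
  have hS : 0 ≤ S := sum_nonneg fun _ _ => norm_nonneg _
  refine ⟨min 1 (ε' / (5 * (S + 1))), by positivity, ?_⟩
  filter_upwards [hξj, hW.sub _ hcpt hρD, hlimN.eventually_le_const (show S < S + 1 by linarith),
    tendsto_nhds.1 hlimS (ε' / 5) (by positivity),
    (hε.mul_const (G + 1)).eventually_le_const
      (show 0 * (G + 1) < ε' / 5 by rw [zero_mul]; positivity)]
    with j h1 h2 h3 h4 h5 h hh hhg
  have hh' := hh.mono (hbc.trans h2)
  have hgb : ∀ x ∈ ball (0 : ℂ^n) ρ, ‖g x‖ ≤ G + 1 := fun x hx =>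
    (hG x (hbc hx)).trans (by linarith)
  have hhb : ∀ x ∈ ball (0 : ℂ^n) ρ, ‖h x‖ ≤ G + 1 := fun x hx => by
    have := (hhg x (hbc hx)).trans (min_le_left _ _)
    linarith [norm_le_norm_add_norm_sub' (h x) (g x), hG x (hbc hx)]
  have e1 := hl j h _ hh' hhb
  have e2 := hap _ h1 h _ hh' hhb
  have e3 := hap _ hξ g _ (hg.mono (hbc.trans hρD)) hgb
  have e4 : ‖∑ i : I, ξj j i.1.1 * c i * h i.1.2 - ∑ i : I, ξj j i.1.1 * c i * g i.1.2‖
      ≤ ε' / 5 := by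
    rw [← sum_sub_distrib]
    calc _ ≤ ∑ i : I, ‖ξj j i.1.1 * c i‖ * (ε' / (5 * (S + 1))) := by
          refine norm_sum_le_of_le _ fun i _ => ?_
          rw [← mul_sub, norm_mul]
          exact mul_le_mul_of_nonneg_left ((hhg _ (hbc (hI i))).trans (min_le_right _ _))
            (norm_nonneg _)
      _ ≤ (S + 1) * (ε' / (5 * (S + 1))) := by
          rw [← sum_mul]
          exact mul_le_mul_of_nonneg_right h3 (by positivity)
      _ = ε' / 5 := by field_simp
  have hGe : ε' / (5 * (G + 1)) * (G + 1) = ε' / 5 := by field_simp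
  rw [hGe] at e2 e3
  rw [dist_eq_norm] at h4
  rw [norm_sub_rev] at e3
  change ‖l j h - xiAct ξ g 0‖ ≤ ε'
  have s0 := norm_sub_le_norm_sub_add_norm_sub (l j h) (xiAct (ξj j) h 0) (xiAct ξ g 0)
  have s1 := norm_sub_le_norm_sub_add_norm_sub (xiAct (ξj j) h 0)
    (∑ i : I, ξj j i.1.1 * c i * h i.1.2) (xiAct ξ g 0)
  have s2 := norm_sub_le_norm_sub_add_norm_sub (∑ i : I, ξj j i.1.1 * c i * h i.1.2)
    (∑ i : I, ξj j i.1.1 * c i * g i.1.2) (xiAct ξ g 0)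
  have s3 := norm_sub_le_norm_sub_add_norm_sub (∑ i : I, ξj j i.1.1 * c i * g i.1.2)
    (∑ i : I, ξ i.1.1 * c i * g i.1.2) (xiAct ξ g 0)
  linarith

theorem upperSemicontinuousOn_log_fiberKernel {ξ : ℂ^m → (Fin n → ℕ) → ℂ}
    {Ω : Set (ℂ^n × ℂ^m)} {ψ : ℂ^n × ℂ^m → ℝ} (hΩ : IsOpen Ω)
    (hψ : UpperSemicontinuousOn ψ Ω)
    (hξ : ∀ α, ContinuousOn (fun w => ξ w α) (Prod.snd '' Ω)) (hlub : LocUnifBdd ξ (Prod.snd '' Ω)) :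
    UpperSemicontinuousOn (fun p => ENNReal.log (fiberKernel ξ Ω ψ p)) Ω := by
  rintro ⟨z, w⟩ hp y hy
  change ENNReal.log (fiberKernel ξ Ω ψ (z, w)) < y at hy
  obtain ⟨c, hc, hcy⟩ := exists_between hy
  have hB : fiberKernel ξ Ω ψ (z, w) < c.exp := by
    rw [← ENNReal.log_lt_log_iff, EReal.log_exp]; exact hc
  suffices h : ∀ᶠ p in 𝓝[Ω] (z, w), fiberKernel ξ Ω ψ p ≤ c.exp by
    filter_upwards [h] with p hp
    refine lt_of_le_of_lt (ENNReal.log_monotone hp) ?_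
    rwa [EReal.log_exp]
  by_contra hcon
  rw [not_eventually] at hcon
  obtain ⟨q, hq, hqB⟩ := exists_seq_forall_of_frequently
    (hcon.and_eventually (self_mem_nhdsWithin (a := (z, w)) (s := Ω)))
  have hqt := tendsto_nhdsWithin_iff.1 hq
  have hmap : Continuous fun x : (ℂ^n × ℂ^m) × ℂ^n =>
      (x.1.1 + x.2, x.1.2) := by fun_prop
  have hslice : ∀ p : ℂ^n × ℂ^m, IsOpen {x | (p.1 + x, p.2) ∈ Ω} := fun p =>
    hΩ.preimage (by fun_prop)
  have hw : w ∈ Prod.snd '' Ω := ⟨_, hp, rfl⟩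
  obtain ⟨ρ, hρ, hρΩ⟩ := nhds_basis_closedBall.mem_iff.1
    ((hslice (z, w)).mem_nhds (show (0 : ℂ^n) ∈ _ by simpa using hp))
  obtain ⟨V, hV, C, hC⟩ := hlub w hw (2 * ((n + 1) / ρ)) (by positivity)
  have hC' : ∀ w' ∈ V ∩ Prod.snd '' Ω, ∑' α, eofReal
      (‖ξ w' α‖ * (2 * ((n + 1) / ρ)) ^ mdeg α) ≤ eofReal (max C 0) := fun w' hw' =>
    (hC w' hw').trans (ofReal_le_ofReal (le_max_left _ _))
  have hq2 : Tendsto (fun j => (q j).2) atTop (𝓝[Prod.snd '' Ω] w) :=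
    tendsto_nhdsWithin_iff.2 ⟨(continuous_snd.tendsto _).comp hqt.1,
      .of_forall fun j => ⟨_, (hqB j).2, rfl⟩⟩
  rw [fiberKernel_eq_bergmanSq] at hB
  have hev := eventually_bergmanSq_le_of_xiAct (ψj := fun j x => ψ ((q j).1 + x, (q j).2))
    ⟨hslice (z, w), fun j => hslice (q j), fun j => ?_, fun K hK hKs => ?_,
      fun x hx a ha => ?_⟩ hρ hρΩ (ξj := fun j => ξ (q j).2) (le_max_right C 0) ?_
    (hC' _ ⟨mem_of_mem_nhds hV, hw⟩) (fun α => (hξ α w hw).tendsto.comp hq2) tendsto_const_nhds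
    (l := fun j f => xiAct (ξ (q j).2) f 0) (fun j h B _ _ => by simp)
    (fun j c h => xiAct_smul _ _ _ _) hB
  · obtain ⟨j, hj⟩ := hev.exists
    exact (hqB j).1 (by rwa [← Prod.mk.eta (p := q j), fiberKernel_eq_bergmanSq])
  · refine (aemeasurable_indicator_iff (hslice (q j)).measurableSet).1
      (UpperSemicontinuousOn.measurable_indicator (hslice (q j)).measurableSet ?_).aemeasurable
    exact hψ.comp (g := fun x => ((q j).1 + x, (q j).2)) (by fun_prop) fun x hx => hx
  · exact hqt.1 (hK.eventually_forall_of_forall_eventually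
      (P := fun (p : ℂ^n × ℂ^m) x => (p.1 + x, p.2) ∈ Ω) fun x hx =>
        (hΩ.preimage hmap).mem_nhds (hKs hx))
  · have h1 : ∀ᶠ y in 𝓝 (((z, w), x) : (ℂ^n × ℂ^m) × ℂ^n),
        ψ (y.1.1 + y.2, y.1.2) < a := by
      have h2 := hψ _ hx a ha
      rw [hΩ.nhdsWithin_eq hx] at h2
      exact (hmap.tendsto ((z, w), x)).eventually h2
    rw [nhds_prod_eq, eventually_prod_iff] at h1
    obtain ⟨pa, hpa, pb, hpb, h⟩ := h1
    exact ⟨{x | pb x}, hpb, (hqt.1.eventually hpa).mono fun j hj x hx _ => h hj hx⟩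
  · filter_upwards [(tendsto_nhdsWithin_iff.1 hq2).1.eventually hV] with j hj
    exact hC' _ ⟨hj, _, (hqB j).2, rfl⟩

end FiberKernel

section DiscInequality

theorem le_average_of_forall_le_lintegral {G : ℝ → ℝ} {c : ℝ}
    (hG : IntervalIntegrable G volume 0 (2 * π))
    (h : ∀ k : ℝ, eofReal (2 * π * (c + k)) ≤
      ∫⁻ θ in Ioc 0 (2 * π), eofReal (G θ + k)) :
    c ≤ (2 * π)⁻¹ * ∫ θ in (0 : ℝ)..(2 * π), G θ := by
  have hπ := two_pi_pos
  rw [intervalIntegrable_iff_integrableOn_Ioc_of_le hπ.le] at hG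
  rw [integral_of_le hπ.le]
  have hmi : ∀ k : ℝ, IntegrableOn (fun θ => max (G θ) (-k)) (Ioc 0 (2 * π)) := fun k =>
    hG.sup (integrable_const (-k))
  have hlim : Tendsto (fun k : ℝ => ∫ θ in Ioc 0 (2 * π), max (G θ) (-k)) atTop
      (𝓝 (∫ θ in Ioc 0 (2 * π), G θ)) := by
    refine tendsto_integral_filter_of_dominated_convergence (fun θ => |G θ|)
      (.of_forall fun k => (hmi k).aestronglyMeasurable) ?_ hG.abs ?_
    · filter_upwards [eventually_ge_atTop 0] with k hk
      refine .of_forall fun θ => ?_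
      rw [norm_eq_abs, abs_le]
      exact ⟨(neg_abs_le _).trans (le_max_left _ _),
        max_le (le_abs_self _) ((neg_nonpos.2 hk).trans (abs_nonneg _))⟩
    · refine .of_forall fun θ => tendsto_const_nhds.congr' ?_
      filter_upwards [eventually_ge_atTop (-G θ)] with k hk
      rw [max_eq_left (by linarith)]
  have hle : ∀ᶠ k : ℝ in atTop, 2 * π * c ≤
      ∫ θ in Ioc 0 (2 * π), max (G θ) (-k) := by
    filter_upwards [eventually_gt_atTop (-c)] with k hk
    have h1 := h k
    have hi : Integrable (fun θ => max (G θ) (-k) + k)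
        (volume.restrict (Ioc 0 (2 * π))) := (hmi k).add (integrable_const k)
    have h2 : ∫⁻ θ in Ioc 0 (2 * π), eofReal (G θ + k)
        = eofReal (∫ θ in Ioc 0 (2 * π), (max (G θ) (-k) + k)) := by
      rw [ofReal_integral_eq_lintegral_ofReal hi
        (.of_forall fun θ => by
          change 0 ≤ max (G θ) (-k) + k
          linarith [le_max_right (G θ) (-k)])]
      refine lintegral_congr fun θ => ?_
      rw [max_add, neg_add_cancel]
      simp [ENNReal.ofReal_max]
    rw [h2, integral_add (hmi k) (integrable_const k)] at h1
    have h3 := (ENNReal.ofReal_le_ofReal_iff' .. ).1 h1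
    have h4 : 0 < 2 * π * (c + k) := by nlinarith
    rcases h3 with h3 | h3
    · simp [hπ.le] at h3
      nlinarith
    · linarith
  rw [inv_mul_eq_div, le_div_iff₀ hπ, mul_comm]
  exact ge_of_tendsto hlim hle

variable {n : ℕ} {D : Set (ℂ^n × ℂ)} (hE : HasPshExhaustion D)
  {ψ : ℂ^n × ℂ → ℝ} (hψ : RealPsh ψ D) {ρ : ℝ} (hρ : 0 < ρ)
  (hρD : closedBall 0 (ρ + ρ) ×ˢ closedBall 0 1 ⊆ D)
  {ζ : ℂ → (Fin n → ℕ) → ℂ} {T : Set ℂ} (hT : IsOpen T) (hT1 : closedBall 0 1 ⊆ T)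
  (hζ : ∀ α, DifferentiableOn ℂ (fun t => ζ t α) T) {C : ℝ} (hC : 0 ≤ C)
  (hζC : ∀ t ∈ closedBall (0 : ℂ) 1, ∑' α, eofReal
    (‖ζ t α‖ * (2 * ((n + 1) / ρ)) ^ mdeg α) ≤ eofReal C)
include hE hψ hρ hρD hT hT1 hζ hC hζC

theorem log_norm_xiAct_le {f : ℂ^n → ℂ} (hf : DifferentiableOn ℂ f {z | (z, (0 : ℂ)) ∈ D})
    (hfψ : wL2₀ D ψ f ≠ ⊤)
    (hf0 : wL2₀ D ψ f ≠ 0)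
    (hl : xiAct (ζ 0) f 0 ≠ 0) {G : ℝ → ℝ} (hG : IntervalIntegrable G volume 0 (2 * π))
    (hGK : ∀ θ, bergmanSq {z | (z, circleMap 0 1 θ) ∈ D} (fun z => ψ (z, circleMap 0 1 θ))
      (fun h => xiAct (ζ (circleMap 0 1 θ)) h 0) < eofReal (rexp (G θ))) :
    rlog (‖xiAct (ζ 0) f 0‖ ^ 2) -
      rlog (wL2₀ D ψ f).toReal ≤
        (2 * π)⁻¹ * ∫ θ in (0 : ℝ)..(2 * π), G θ := by
  have hD := hE.1
  refine le_average_of_forall_le_lintegral hG fun k' => ?_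
  have h01 : (0 : ℂ) ∈ closedBall (0 : ℂ) 1 := by simp
  set Q : Set (ℂ^n × ℂ) := closedBall 0 (ρ + ρ) ×ˢ closedBall 0 1 with hQ
  have hQc : IsCompact Q := (isCompact_closedBall _ _).prod (isCompact_closedBall _ _)
  have hbQ : ∀ z ∈ closedBall (0 : ℂ^n) (ρ + ρ), ∀ t ∈ closedBall (0 : ℂ) 1,
      (z, t) ∈ Q := fun z hz t ht => ⟨hz, ht⟩
  have hbb : ball (0 : ℂ^n) ρ ⊆ closedBall 0 (ρ + ρ) :=
    ball_subset_closedBall.trans (closedBall_subset_closedBall (by linarith))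
  obtain ⟨δ, hδ, hδD⟩ := hQc.exists_cthickening_subset_open hD hρD
  obtain ⟨a, ha0, ha⟩ : ∃ a : ℝ, 0 ≤ a ∧ ∀ y ∈ cthickening δ Q, ψ y ≤ a := by
    obtain ⟨a, ha⟩ := UpperSemicontinuousOn.bddAbove_of_isCompact hQc.cthickening
      (hψ.usc.mono hδD)
    exact ⟨max a 0, le_max_right _ _, fun y hy =>
      (ha (mem_image_of_mem _ hy)).trans (le_max_left _ _)⟩
  have hfb : DifferentiableOn ℂ f (ball 0 ρ) :=
    hf.mono fun z hz => hρD (hbQ z (hbb hz) 0 h01)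
  obtain ⟨F, hF⟩ := (isCompact_closedBall (0 : ℂ^n) (ρ + ρ)).exists_bound_of_continuousOn
    (hf.continuousOn.mono fun z hz => hρD (hbQ z hz 0 h01))
  have hF0 : 0 ≤ F := (norm_nonneg _).trans (hF 0 (by simp; positivity))
  have hl' := norm_pos_iff.2 hl
  have hj1 : Tendsto (fun j : ℕ => 1 / ((j : ℝ) + 1)) atTop (𝓝 0) :=
    tendsto_one_div_add_atTop_nhds_zero_nat
  have hj2 : ∀ j : ℕ, 1 / ((j : ℝ) + 1) ≤ 1 := fun j =>
    (div_le_one (by positivity)).2 (by linarith [j.cast_nonneg (α := ℝ)])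
  set e₀ : ℝ := ‖xiAct (ζ 0) f 0‖ / (2 * (F + 1)) with he₀
  have he₀p : 0 < e₀ := by positivity
  set s₀ : ℝ := min (1 / 2) δ
  have hs₀ : 0 < s₀ := by positivity
  set ε : ℕ → ℝ := fun j => e₀ * (1 / ((j : ℝ) + 1))
  set η : ℕ → ℝ := fun j => s₀ * (1 / ((j : ℝ) + 1))
  have hε : Tendsto ε atTop (𝓝 0) := by
    have h := hj1.const_mul e₀
    rwa [mul_zero] at h
  have hη : Tendsto η atTop (𝓝 0) := by
    have h := hj1.const_mul s₀
    rwa [mul_zero] at h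
  have hεp : ∀ j, 0 < ε j := fun j => by positivity
  have hηp : ∀ j, 0 < η j := fun j => by positivity
  have hεe : ∀ j, ε j ≤ e₀ := fun j => mul_le_of_le_one_right he₀p.le (hj2 j)
  have hηs : ∀ j, η j ≤ s₀ := fun j => mul_le_of_le_one_right hs₀.le (hj2 j)
  have hη1 : ∀ j, η j ≤ 1 / 2 := fun j => (hηs j).trans (min_le_left _ _)
  choose I c hI hap using fun j => exists_approx_xiAct (n := n) (ρ := ρ) (C := C) hρ hC (hεp j)
  set Λ : ℕ → ℂ → (ℂ^n → ℂ) → ℂ := fun j t h =>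
    ∑ i : I j, ζ t i.1.1 * c j i * h i.1.2 with hΛ
  have hΛl : ∀ j, ‖xiAct (ζ 0) f 0 - Λ j 0 f‖ ≤ ε j * F := fun j =>
    hap j _ (hζC 0 h01) f F hfb fun x hx => hF x (hbb hx)
  have hne : ∀ j, Λ j 0 f ≠ 0 := fun j h0 => by
    have h := hΛl j
    rw [h0, sub_zero] at h
    have h1 : e₀ * F < ‖xiAct (ζ 0) f 0‖ := by
      rw [he₀, div_mul_eq_mul_div, div_lt_iff₀ (by positivity)]
      nlinarith
    exact absurd (h.trans (mul_le_mul_of_nonneg_right (hεe j) hF0)) (not_le.2 h1)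
  obtain ⟨L, hLc, hLD, hLex⟩ := exists_compact_exhaustion hD
  choose D' φ r hD' hLD' hD'D hφ hφb hr hIg using fun j : ℕ => exists_circle_bound hE
    hψ hf hfψ hf0 (y := fun i : I j => i.1.2) (κ := fun i t => ζ t i.1.1 * c j i) hT hT1
    (fun i => (hζ _).mul_const _) (fun i t ht => hρD (hbQ _ (hbb (hI j i)) t (by simpa using ht)))
    (hne j) ((hLc j).union hQc) (union_subset (hLD j) hρD) j k' (hηp j) (hη1 j)
  have hQD' : ∀ j, Q ⊆ D' j := fun j => Set.subset_union_right.trans (hLD' j)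
  have ht1 : ∀ j θ, circleMap 0 (r j) θ ∈ closedBall (0 : ℂ) 1 := fun j θ => by
    have := (hr j).1
    rw [mem_closedBall_zero_iff, norm_circleMap_zero, abs_of_nonneg (by linarith [hη1 j])]
    exact (hr j).2
  have hr1 : Tendsto r atTop (𝓝 1) :=
    tendsto_of_tendsto_of_tendsto_of_le_of_le (by simpa using hη.const_sub 1) tendsto_const_nhds
      (fun j => (hr j).1) fun j => (hr j).2
  have htθ : ∀ θ, Tendsto (fun j => circleMap 0 (r j) θ) atTop (𝓝 (circleMap 0 1 θ)) := fun θ => by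
    have : Continuous fun R : ℝ => circleMap 0 R θ := by unfold circleMap; fun_prop
    exact (this.tendsto 1).comp hr1
  set K : ℕ → ℝ → ℝ≥0∞ := fun j θ => bergmanSq {z | (z, circleMap 0 (r j) θ) ∈ D' j}
    (fun z => φ j (z, circleMap 0 (r j) θ)) (Λ j (circleMap 0 (r j) θ))
  have hslice : ∀ (S : Set (ℂ^n × ℂ)) (t : ℂ), IsOpen S → IsOpen {z | (z, t) ∈ S} :=
    fun S t hS => hS.preimage (by fun_prop)
  obtain ⟨K₀, hK₀, hK⟩ : ∃ K₀ : ℝ≥0∞, K₀ ≠ ⊤ ∧ ∀ j θ, K j θ ≤ K₀ := by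
    obtain ⟨K₀, hK₀, h⟩ := exists_bergmanSq_le (n := n) (ρ := ρ) (M := C + e₀) (a := a + 1 / 2) hρ
      (by positivity)
    refine ⟨K₀, hK₀, fun j θ => h _ _ _ (hslice _ _ (hD' j))
      (fun z hz => hQD' j (hbQ z hz _ (ht1 j θ))) (fun z hz => ?_) fun h B hh hB => ?_⟩
    · have hz' := hbQ z hz _ (ht1 j θ)
      refine (hφb j _ (hQD' j hz') a fun y hy _ => max_le (ha y ?_) ?_).trans
        (by linarith [hη1 j])
      · exact mem_cthickening_of_dist_le y _ δ Q hz'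
          ((mem_ball.1 hy).le.trans ((hηs j).trans (min_le_right _ _)))
      · linarith [j.cast_nonneg (α := ℝ)]
    · have hB0 : 0 ≤ B := (norm_nonneg _).trans (hB 0 (by simpa using hρ))
      have h1 := hap j _ (hζC _ (ht1 j θ)) h B hh hB
      have h2 := norm_xiAct_le hρ hC (hζC _ (ht1 j θ)) hh hB
      have h3 := norm_le_norm_add_norm_sub (xiAct (ζ (circleMap 0 (r j) θ)) h 0)
        (Λ j (circleMap 0 (r j) θ) h)
      nlinarith [mul_le_mul_of_nonneg_right (hεe j) hB0]
  have hev : ∀ θ, ∀ᶠ j in atTop, K j θ ≤ eofReal (rexp (G θ)) := fun θ => by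
    have hθ1 : circleMap 0 1 θ ∈ closedBall (0 : ℂ) 1 := by simp
    refine eventually_bergmanSq_le_of_xiAct ⟨hslice D _ hD, fun j => hslice _ _ (hD' j),
      fun j => ?_, fun M hM hMD => ?_, fun z hz b hb => ?_⟩ hρ (fun z hz => hρD
        (hbQ z (closedBall_subset_closedBall (by linarith) hz) _ hθ1))
      (ξj := fun j => ζ (circleMap 0 (r j) θ)) hC
      (.of_forall fun j => hζC _ (ht1 j θ)) (hζC _ hθ1)
      (fun α => ?_) hε (fun j h B hh hB => ?_) (fun j c h => ?_) (hGK θ)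
    · exact ((hφ j).comp (by fun_prop)).measurable.aemeasurable
    · obtain ⟨s, hs, hsD⟩ := (hM.prod isCompact_singleton).exists_cthickening_subset_open hD
        (s := M ×ˢ {circleMap 0 1 θ}) (by rintro ⟨z, t⟩ ⟨hz, rfl⟩; exact hMD hz)
      filter_upwards [hLex _ ((hM.prod isCompact_singleton).cthickening) hsD,
        tendsto_nhds.1 (htθ θ) s hs] with j hj hj' z hz
      refine hLD' j (Or.inl (hj (mem_cthickening_of_dist_le _ (z, circleMap 0 1 θ) s _
        ⟨hz, rfl⟩ ?_)))
      rw [Prod.dist_eq, dist_self]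
      exact max_le hs.le hj'.le
    · obtain ⟨b', hb', hbb'⟩ := exists_between hb
      have h2 := hψ.usc _ hz b' hb'
      rw [hD.nhdsWithin_eq hz] at h2
      obtain ⟨s, hs, hsψ⟩ := Metric.eventually_nhds_iff.1 h2
      refine ⟨ball z (s / 2), ball_mem_nhds _ (by positivity), ?_⟩
      filter_upwards [tendsto_nhds.1 (htθ θ) (s / 2) (by positivity),
        hη.eventually_lt_const (show 0 < s / 2 by positivity),
        hη.eventually_lt_const (show 0 < b - b' by linarith),
        tendsto_natCast_atTop_atTop.eventually_ge_atTop (-b')] with j h3 h4 h5 h6 x hx hxD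
      refine (hφb j _ hxD b' fun y hy _ => max_le (hsψ ?_).le (by linarith)).trans_lt (by linarith)
      have h7 : dist (x, circleMap 0 (r j) θ) (z, circleMap 0 1 θ) < s / 2 := by
        rw [Prod.dist_eq]; exact max_lt hx h3
      linarith [dist_triangle y (x, circleMap 0 (r j) θ) (z, circleMap 0 1 θ), mem_ball.1 hy]
    · exact ((hζ α).continuousOn.continuousAt (hT.mem_nhds (hT1 hθ1))).tendsto.comp (htθ θ)
    · rw [norm_sub_rev]; exact hap j _ (hζC _ (ht1 j θ)) h B hh hB
    · simp only [hΛ, mul_sum, Pi.smul_apply, smul_eq_mul]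
      exact sum_congr rfl fun i _ => by ring
  choose M hMm hMle hMint using fun j => exists_measurable_le_lintegral_eq
    (volume.restrict (Ioc 0 (2 * π))) fun θ => truncLog k' (K j θ)
  have hlimf : Tendsto (fun j => Λ j 0 f) atTop (𝓝 (xiAct (ζ 0) f 0)) := by
    rw [tendsto_iff_norm_sub_tendsto_zero]
    refine squeeze_zero (fun _ => norm_nonneg _) (fun j => ?_) (by simpa using hε.mul_const F)
    rw [norm_sub_rev]; exact hΛl j
  have hleft : Tendsto (fun j => eofReal (2 * π * (rlog (‖Λ j 0 f‖ ^ 2) -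
      rlog (wL2₀ D ψ f).toReal - 2 * η j + k'))) atTop
      (𝓝 (eofReal (2 * π * (rlog (‖xiAct (ζ 0) f 0‖ ^ 2) -
      rlog (wL2₀ D ψ f).toReal + k')))) := by
    refine ENNReal.tendsto_ofReal (Tendsto.const_mul _ (Tendsto.add_const _ ?_))
    have := (((hlimf.norm.pow 2).log (by positivity)).sub_const
      (rlog (wL2₀ D ψ f).toReal)).sub (hη.const_mul 2)
    simpa using this
  obtain ⟨x₀, hx₀⟩ : ∃ x₀ : ℝ, K₀ ≤ eofReal (rexp x₀) :=
    ⟨K₀.toReal, ENNReal.le_ofReal_iff_toReal_le hK₀ (exp_nonneg _) |>.2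
      (by linarith [Real.add_one_le_exp K₀.toReal])⟩
  calc _ = limsup (fun j => eofReal (2 * π * (rlog (‖Λ j 0 f‖ ^ 2) -
      rlog (wL2₀ D ψ f).toReal - 2 * η j + k'))) atTop :=
        hleft.limsup_eq.symm
    _ ≤ limsup (fun j => ∫⁻ θ in Ioc 0 (2 * π), M j θ) atTop :=
        limsup_le_limsup (.of_forall fun j => (hIg j).trans (hMint j).le)
    _ ≤ ∫⁻ θ in Ioc 0 (2 * π), limsup (fun j => M j θ) atTop := by
        refine limsup_lintegral_le (fun _ => eofReal (x₀ + k')) hMm (fun j =>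
          .of_forall fun θ => ?_) ?_
        · rw [← truncLog_ofReal_exp]
          exact (hMle j θ).trans (truncLog_mono k' ((hK j θ).trans hx₀))
        · rw [setLIntegral_const, Real.volume_Ioc]; finiteness
    _ ≤ _ := by
        refine lintegral_mono fun θ => limsup_le_of_le (by isBoundedDefault) ?_
        filter_upwards [hev θ] with j hj
        rw [← truncLog_ofReal_exp]
        exact (hMle j θ).trans (truncLog_mono k' hj)

theorem log_bergmanSq_le_average {G : ℝ → ℝ} (hG : IntervalIntegrable G volume 0 (2 * π))
    (hGK : ∀ θ, ENNReal.log (bergmanSq {z | (z, circleMap 0 1 θ) ∈ D}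
      (fun z => ψ (z, circleMap 0 1 θ)) (fun h => xiAct (ζ (circleMap 0 1 θ)) h 0)) ≤ (G θ : EReal)) :
    ENNReal.log (bergmanSq {z | (z, (0 : ℂ)) ∈ D} (fun z => ψ (z, 0)) (fun h => xiAct (ζ 0) h 0)) ≤
      (((2 * π)⁻¹ * ∫ θ in (0 : ℝ)..(2 * π), G θ : ℝ) : EReal) := by
  set S := (2 * π)⁻¹ * ∫ θ in (0 : ℝ)..(2 * π), G θ with hS
  have hlog : ∀ x : ℝ, ENNReal.log (eofReal (rexp x)) = x := fun x => by
    rw [ENNReal.log_ofReal_of_pos (exp_pos _), Real.log_exp]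
  have h01 : (0 : ℂ) ∈ closedBall (0 : ℂ) 1 := by simp
  have hsl : closedBall (0 : ℂ^n) (ρ + ρ) ⊆ {z | (z, (0 : ℂ)) ∈ D} :=
    fun z hz => hρD ⟨hz, h01⟩
  have hDo : IsOpen {z : ℂ^n | (z, (0 : ℂ)) ∈ D} := hE.1.preimage (by fun_prop)
  rw [← hlog]
  refine ENNReal.log_monotone (iSup_le fun f => ?_)
  obtain ⟨f, hf, hfψ⟩ := f
  change eofReal (‖xiAct (ζ 0) f 0‖ ^ 2) / wL2₀ D ψ f ≤ _
  by_cases hl : xiAct (ζ 0) f 0 = 0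
  · simp [hl]
  have hf0 : wL2₀ D ψ f ≠ 0 := fun h0 => hl <| by
    obtain ⟨a, ha⟩ := UpperSemicontinuousOn.bddAbove_of_isCompact
      ((isCompact_closedBall (0 : ℂ^n) (ρ + ρ)).prod (isCompact_closedBall (0 : ℂ) 1))
      (hψ.usc.mono hρD)
    obtain ⟨K, hK, h⟩ := exists_bergmanSq_le (n := n) (ρ := ρ) (a := a) hρ hC
    have h1 := h _ (fun z => ψ (z, 0)) (fun h => xiAct (ζ 0) h 0) hDo hsl
      (fun y hy => ha (mem_image_of_mem ψ (Set.mk_mem_prod hy h01)))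
      fun h B hh hB => norm_xiAct_le hρ hC (hζC 0 h01) hh hB
    have h2 := ofReal_sq_le_mul_wL2 (h1.trans (le_add_of_nonneg_right bot_le : K ≤ K + 1))
      (by simp) (by finiteness) hf
    rw [h0, mul_zero] at h2
    simpa using h2
  have hkey : rlog (‖xiAct (ζ 0) f 0‖ ^ 2) -
      rlog (wL2₀ D ψ f).toReal ≤ S := by
    refine le_of_forall_pos_le_add fun δ hδ => ?_
    have h := log_norm_xiAct_le hE hψ hρ hρD hT hT1 hζ hC hζC hf hfψ.ne hf0 hl
      (G := fun θ => G θ + δ) (hG.add (by simp)) fun θ => by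
        rw [← ENNReal.log_lt_log_iff, hlog]
        exact (hGK θ).trans_lt (EReal.coe_lt_coe_iff.2 (by linarith))
    rw [intervalIntegral.integral_add hG (by simp), intervalIntegral.integral_const, sub_zero,
      smul_eq_mul, mul_add, inv_mul_cancel_left₀ two_pi_pos.ne'] at h
    exact h
  refine ENNReal.div_le_of_le_mul ?_
  have hp := ENNReal.toReal_pos hf0 hfψ.ne
  rw [← ofReal_toReal hfψ.ne, ← eofReal_mul (exp_pos _).le]
  refine ofReal_le_ofReal ?_
  have hl' : 0 < ‖xiAct (ζ 0) f 0‖ ^ 2 := by positivity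
  calc ‖xiAct (ζ 0) f 0‖ ^ 2 = rexp (rlog (‖xiAct (ζ 0) f 0‖ ^ 2)) :=
        (exp_log hl').symm
    _ ≤ rexp (S + rlog (wL2₀ D ψ f).toReal) :=
        exp_le_exp.2 (by linarith)
    _ = _ := by rw [Real.exp_add, exp_log hp]

end DiscInequality

section Conclusion

variable {n m : ℕ}

lemma RealPsh.comp_affine {V W : Type*} [NormedAddCommGroup V] [NormedSpace ℂ V]
    [NormedAddCommGroup W] [NormedSpace ℂ W] {f : W → ℝ} {Ω : Set W} (hf : RealPsh f Ω)
    {A : V → W} (L : V →ₗ[ℂ] W) (hA : Continuous A) (hAL : ∀ x v, A (x + v) = A x + L v) :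
    RealPsh (fun x => f (A x)) (A ⁻¹' Ω) where
  usc x hx a ha := by
    have h := hf.usc (A x) hx a ha
    exact (hA.continuousWithinAt.tendsto_nhdsWithin (Set.mapsTo_preimage A Ω)).eventually h
  submean z hz v hv g hg hfg := by
    refine hf.submean (A z) hz (L v) (fun t ht => ?_) g hg fun θ => ?_
    · simpa [hAL] using hv t ht
    · simpa [hAL] using hfg θ

lemma sq_norm_le_circle_average (a b : ℂ) : ‖a‖ ^ 2 ≤ (2 * π)⁻¹ *
    ∫ θ in (0 : ℝ)..(2 * π), ‖a + exp (θ * I) * b‖ ^ 2 := by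
  set c := conj a * b
  have h : ∀ θ : ℝ, ‖a‖ ^ 2 + 2 * (c.re * Real.cos θ - c.im * Real.sin θ) ≤
      ‖a + exp (θ * I) * b‖ ^ 2 := fun θ => by
    rw [← normSq_eq_norm_sq, ← normSq_eq_norm_sq, normSq_add]
    have h1 : (a * conj (exp (θ * I) * b)).re
        = c.re * Real.cos θ - c.im * Real.sin θ := by
      simp [c, exp_mul_I,
        ← ofReal_cos, ← ofReal_sin]
      ring
    rw [h1]
    linarith [normSq_nonneg (exp (θ * I) * b)]
  have h2 := intervalIntegral.integral_mono (μ := volume) two_pi_pos.le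
    (Continuous.intervalIntegrable (by fun_prop) _ _)
    (Continuous.intervalIntegrable (by fun_prop) _ _) h
  rw [intervalIntegral.integral_add (by simp) (Continuous.intervalIntegrable (by fun_prop) _ _),
    intervalIntegral.integral_const_mul, intervalIntegral.integral_sub
      (Continuous.intervalIntegrable (by fun_prop) _ _)
      (Continuous.intervalIntegrable (by fun_prop) _ _)] at h2
  simp only [intervalIntegral.integral_const_mul, integral_cos, integral_sin,
    intervalIntegral.integral_const, Real.sin_two_pi, Real.cos_two_pi, Real.sin_zero,
    Real.cos_zero, sub_self, mul_zero, add_zero, sub_zero, smul_eq_mul] at h2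
  rw [inv_mul_eq_div, le_div_iff₀ two_pi_pos]
  linarith

lemma RealPsh.add_sq_norm_snd {V : Type*} [NormedAddCommGroup V] [NormedSpace ℂ V]
    {f : V × ℂ → ℝ} {Ω : Set (V × ℂ)} (hf : RealPsh f Ω) :
    RealPsh (fun x => f x + ‖x.2‖ ^ 2) Ω where
  usc := hf.usc.add (ContinuousOn.upperSemicontinuousOn (by fun_prop))
  submean z hz v hv g hg hfg := by
    have hi : IntervalIntegrable (fun θ : ℝ => ‖z.2 + exp (θ * I) * v.2‖ ^ 2)
        volume 0 (2 * π) := Continuous.intervalIntegrable (by fun_prop) _ _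
    have h := hf.submean z hz v hv _ (hg.sub hi) fun θ => by
      simpa [le_sub_iff_add_le] using hfg θ
    rw [intervalIntegral.integral_sub hg hi, mul_sub] at h
    linarith [sq_norm_le_circle_average z.2 v.2]

theorem exists_uniform_bound_of_locUnifBdd {ξ : ℂ^m → (Fin n → ℕ) → ℂ}
    {D K : Set ℂ^m} (hlub : LocUnifBdd ξ D) (hK : IsCompact K) (hKD : K ⊆ D) {ρ : ℝ}
    (hρ : 0 < ρ) : ∃ C : ℝ, 0 ≤ C ∧ ∀ w ∈ K,
      ∑' α, eofReal (‖ξ w α‖ * ρ ^ mdeg α) ≤ eofReal C := by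
  refine hK.induction_on (p := fun S => ∃ C : ℝ, 0 ≤ C ∧ ∀ w ∈ S,
      ∑' α, eofReal (‖ξ w α‖ * ρ ^ mdeg α) ≤ eofReal C) ⟨0, le_rfl, by simp⟩
    ?_ ?_ fun w hw => ?_
  · rintro s t hst ⟨C, hC, h⟩
    exact ⟨C, hC, fun w hw => h w (hst hw)⟩
  · rintro s t ⟨C, hC, h⟩ ⟨C', hC', h'⟩
    refine ⟨max C C', hC.trans (le_max_left _ _), ?_⟩
    rintro w (hw | hw)
    · exact (h w hw).trans (ofReal_le_ofReal (le_max_left _ _))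
    · exact (h' w hw).trans (ofReal_le_ofReal (le_max_right _ _))
  · obtain ⟨V, hV, C, h⟩ := hlub w (hKD hw) ρ hρ
    refine ⟨V ∩ K, inter_mem (mem_nhdsWithin_of_mem_nhds hV) self_mem_nhdsWithin, max C 0,
      le_max_right _ _, fun w' hw' => ?_⟩
    exact (h w' ⟨hw'.1, hKD hw'.2⟩).trans (ofReal_le_ofReal (le_max_left _ _))

theorem log_fiberKernel_le_average {Ω : Set (ℂ^n × ℂ^m)} (hΩ : Pseudoconvex Ω)
    {ψ : ℂ^n × ℂ^m → ℝ} (hψ : RealPsh ψ Ω)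
    {ξ : ℂ^m → (Fin n → ℕ) → ℂ}
    (hhol : ∀ α, DifferentiableOn ℂ (fun w => ξ w α) (Prod.snd '' Ω))
    (hlub : LocUnifBdd ξ (Prod.snd '' Ω)) {p v : ℂ^n × ℂ^m}
    (hpv : ∀ t : ℂ, ‖t‖ ≤ 1 → p + t • v ∈ Ω) {g : ℝ → ℝ}
    (hg : IntervalIntegrable g volume 0 (2 * π))
    (hKg : ∀ θ : ℝ, ENNReal.log (fiberKernel ξ Ω ψ (p + exp (θ * I) • v)) ≤
      (g θ : EReal)) :
    ENNReal.log (fiberKernel ξ Ω ψ p) ≤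
      (((2 * π)⁻¹ * ∫ θ in (0 : ℝ)..(2 * π), g θ : ℝ) : EReal) := by
  obtain ⟨z, w⟩ := p
  obtain ⟨a, b⟩ := v
  obtain ⟨hΩo, u, hu, hup, hex⟩ := hΩ
  set A : ℂ^n × ℂ → ℂ^n × ℂ^m :=
    fun x => (z + x.2 • a + x.1, w + x.2 • b) with hA
  set L : ℂ^n × ℂ →ₗ[ℂ] ℂ^n × ℂ^m :=
    { toFun := fun x => (x.2 • a + x.1, x.2 • b)
      map_add' := fun x y => by ext <;> simp <;> ring
      map_smul' := fun c x => by ext <;> simp <;> ring }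
  have hAc : Continuous A := by fun_prop
  have hAL : ∀ x y, A (x + y) = A x + L y := fun x y => by
    ext <;> simp [A, L] <;> ring
  have hker : ∀ t : ℂ, fiberKernel ξ Ω ψ (z + t • a, w + t • b) =
      bergmanSq {x | (x, t) ∈ A ⁻¹' Ω} (fun x => ψ (A (x, t))) (fun f => xiAct (ξ (w + t • b)) f 0) :=
    fun t => fiberKernel_eq_bergmanSq _ _ _ _ _
  have h0 : fiberKernel ξ Ω ψ (z, w) = bergmanSq {x | (x, (0 : ℂ)) ∈ A ⁻¹' Ω}
      (fun x => ψ (A (x, 0))) (fun f => xiAct (ξ (w + (0 : ℂ) • b)) f 0) := by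
    rw [← hker]; simp
  have hdisc : ∀ t ∈ closedBall (0 : ℂ) 1, A (0, t) ∈ Ω := fun t ht => by
    simpa [A] using hpv t (by simpa using ht)
  have hDo : IsOpen (A ⁻¹' Ω) := hΩo.preimage hAc
  obtain ⟨δ, hδ, hδD⟩ := ((isCompact_singleton (x := (0 : ℂ^n))).prod
    (isCompact_closedBall (0 : ℂ) 1)).exists_cthickening_subset_open hDo (by
      rintro ⟨x, t⟩ ⟨hx, ht⟩
      rw [Set.mem_singleton_iff] at hx
      change x = 0 at hx
      rw [hx]
      exact hdisc t ht)
  have hρD : closedBall 0 (δ / 2 + δ / 2) ×ˢ closedBall 0 1 ⊆ A ⁻¹' Ω := by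
    rintro ⟨x, t⟩ ⟨hx, ht⟩
    refine hδD (mem_cthickening_of_dist_le (x, t) (0, t) δ _ ⟨rfl, ht⟩ ?_)
    rw [Prod.dist_eq, dist_self, max_le_iff]
    exact ⟨by simpa using hx, hδ.le⟩
  set T : Set ℂ := {t | A (0, t) ∈ Ω}
  have hTo : IsOpen T := hDo.preimage (by fun_prop)
  have hTm : Set.MapsTo (fun t : ℂ => w + t • b) T (Prod.snd '' Ω) := fun t ht => ⟨_, ht, rfl⟩
  obtain ⟨C, hC, hCb⟩ := exists_uniform_bound_of_locUnifBdd hlub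
    ((isCompact_closedBall (0 : ℂ) 1).image (f := fun t : ℂ => w + t • b) (by fun_prop))
    (Set.image_subset_iff.2 fun t ht => hTm (hdisc t ht))
    (ρ := 2 * ((n + 1) / (δ / 2))) (by positivity)
  obtain ⟨M, hM⟩ : ∃ M : ℝ, ∀ x ∈ Ω, -M ≤ u x := by
    obtain ⟨K, hK, hKΩ, hsub⟩ := hex 0
    obtain ⟨M, hM⟩ := hK.exists_bound_of_continuousOn (hu.mono hKΩ)
    refine ⟨max M 0, fun x hx => ?_⟩
    rcases le_or_gt (u x) 0 with h | h
    · have := (abs_le.1 (hM x (hsub ⟨hx, h⟩))).1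
      linarith [le_max_left M 0]
    · linarith [le_max_right M 0]
  have hexA : ∀ c : ℝ, ∃ K, IsCompact K ∧ K ⊆ A ⁻¹' Ω ∧
      {x ∈ A ⁻¹' Ω | u (A x) + ‖x.2‖ ^ 2 ≤ c} ⊆ K := fun c => by
    obtain ⟨K, hK, hKΩ, hsub⟩ := hex c
    refine ⟨A ⁻¹' K ∩ Prod.snd ⁻¹' closedBall 0 (c + M + 1), ?_,
      inter_subset_left.trans (Set.preimage_mono hKΩ), fun x hx => ?_⟩
    · refine ((hK.prod (isCompact_closedBall (0 : ℂ) (c + M + 1))).image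
        (f := fun y => (y.1.1 - z - y.2 • a, y.2)) (by fun_prop)).of_isClosed_subset
        ((hK.isClosed.preimage hAc).inter (isClosed_closedBall.preimage continuous_snd))
        fun x hx => ⟨(A x, x.2), ⟨hx.1, hx.2⟩, ?_⟩
      ext <;> simp [A]
      ring
    · obtain ⟨hx1, hx2⟩ := hx
      refine ⟨hsub ⟨hx1, by nlinarith [sq_nonneg ‖x.2‖]⟩, ?_⟩
      have := hM _ hx1
      simp only [Set.mem_preimage, mem_closedBall_zero_iff]
      nlinarith [sq_nonneg (‖x.2‖ - 1)]
  rw [h0]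
  refine log_bergmanSq_le_average ⟨hDo, fun x => u (A x) + ‖x.2‖ ^ 2,
    (hu.comp hAc.continuousOn (Set.mapsTo_preimage A Ω)).add (by fun_prop),
    (hup.realPsh.comp_affine L hAc hAL).add_sq_norm_snd, hexA⟩ (ψ := fun x => ψ (A x))
    (hψ.comp_affine L hAc hAL) (half_pos hδ) hρD (ζ := fun t => ξ (w + t • b)) hTo
    hdisc (fun α => (hhol α).comp (by fun_prop) hTm) hC
    (fun t ht => hCb _ (mem_image_of_mem _ ht)) hg fun θ => ?_
  rw [← hker]
  simpa [circleMap] using hKg θ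

end Conclusion

end Background

/-- Log-plurisubharmonicity of the fiberwise `ξ(w)`-Bergman kernels for a family of variant
functionals (main theorem): on a pseudoconvex domain `Ω ⊆ ℂ^{n+m}` with plurisubharmonic
weight `ψ` and a holomorphic, locally uniformly bounded functional-valued function `ξ(·)`,
the function `log K^{ψ_w}_{ξ(w),Ω_w}(z)` is plurisubharmonic in `(z,w)` on `Ω`. -/
theorem statement18 {n m : ℕ} (Ω : Set ((Fin n → ℂ) × (Fin m → ℂ)))
    (hΩ : Pseudoconvex Ω)
    (ψ : (Fin n → ℂ) × (Fin m → ℂ) → ℝ)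
    (hψ : PlurisubharmonicOn (fun p => (ψ p : EReal)) Ω)
    (ξ : (Fin m → ℂ) → (Fin n → ℕ) → ℂ)
    (hmem : ∀ w ∈ Prod.snd '' Ω, MemL1 (ξ w))
    (hhol : ∀ α : Fin n → ℕ, DifferentiableOn ℂ (fun w => ξ w α) (Prod.snd '' Ω))
    (hlub : LocUnifBdd ξ (Prod.snd '' Ω)) :
    PlurisubharmonicOn (fun p => ENNReal.log (fiberKernel ξ Ω ψ p)) Ω :=
  ⟨upperSemicontinuousOn_log_fiberKernel hΩ.1 hψ.realPsh.usc
    (fun α => (hhol α).continuousOn) hlub,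
    fun _ _ _ hv _ hg h => log_fiberKernel_le_average hΩ hψ.realPsh hhol hlub hv hg h⟩
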